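/- Let d ∈ ℕ, α ∈ (0, min(2,d)) and δ ∈ (0, d-α). The function p̃ (the Schrödinger perturbation of the relativistic heat kernel p by V_δ) satisfies: for every T > 0 there is a constant c ≥ 1 such that c^{-1} p(t,x,y) H⁰(t,x) H⁰(t,y) ≤ p̃(t,x,y) ≤ c p(t,x,y) H⁰(t,x) H⁰(t,y) for all t ∈ (0,T] and x, y ∈ ℝ^d \ {0}. -/

import Mathlib

open MeasureTheory Real Set Filter RealInnerProductSpace

noncomputable section

/-- Euclidean space `ℝ^d`. -/
abbrev Ed (d : ℕ) := EuclideanSpace ℝ (Fin d)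

/-- Modified Bessel function of the second kind `K_ν(r)`. -/
def besselK (ν r : ℝ) : ℝ :=
  (1 / 2) * (r / 2) ^ ν * ∫ u in Ioi (0 : ℝ), u ^ (-ν - 1) * Real.exp (-u - r ^ 2 / (4 * u))

/-- Relativistic `α`-stable heat kernel with mass parameter `m`:
`p^m(t,x,y) = (2π)^{-d} ∫ exp(-i⟨y-x,z⟩) exp(-t(|z|²+m^{2/α})^{α/2}) dz`
(the integral is real, and equals the cosine integral below). -/
def relKernel (d : ℕ) (α m t : ℝ) (x y : Ed d) : ℝ :=
  (2 * π) ^ (-(d : ℝ)) *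
    ∫ z : Ed d, Real.cos ⟪y - x, z⟫ * Real.exp (-t * (‖z‖ ^ 2 + m ^ (2 / α)) ^ (α / 2))

/-- Fractional (`α`-stable) heat kernel `p⁰(t,x,y)`. -/
def fracKernel (d : ℕ) (α t : ℝ) (x y : Ed d) : ℝ :=
  (2 * π) ^ (-(d : ℝ)) * ∫ z : Ed d, Real.cos ⟪y - x, z⟫ * Real.exp (-t * ‖z‖ ^ α)

/-- The summands of the perturbation series. -/
def pertN (d : ℕ) (k : ℝ → Ed d → Ed d → ℝ) (q : Ed d → ℝ) : ℕ → ℝ → Ed d → Ed d → ℝ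
  | 0 => k
  | n + 1 => fun t x y =>
      ∫ s in Ioo (0 : ℝ) t, ∫ z : Ed d, pertN d k q n s x z * q z * k (t - s) z y

/-- Schrödinger perturbation of a transition density `k` by a potential `q`. -/
def pert (d : ℕ) (k : ℝ → Ed d → Ed d → ℝ) (q : Ed d → ℝ) (t : ℝ) (x y : Ed d) : ℝ :=
  ∑' n : ℕ, pertN d k q n t x y

/-- Radial profile of the potential `V_β`. -/
def VProf (d : ℕ) (α β r : ℝ) : ℝ :=
  2 ^ (α / 2) * Real.Gamma (((d : ℝ) - β) / 2) / Real.Gamma (((d : ℝ) - β - α) / 2) *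
    (besselK ((β + α) / 2) r / besselK (β / 2) r) * r ^ (-(α / 2))

/-- The potential `V_β(x)`. -/
def Vbeta (d : ℕ) (α β : ℝ) (x : Ed d) : ℝ := VProf d α β ‖x‖

/-- The Hardy constant `κ_β` for the fractional Laplacian. -/
def kappa (d : ℕ) (α β : ℝ) : ℝ :=
  2 ^ α * Real.Gamma ((β + α) / 2) * Real.Gamma (((d : ℝ) - β) / 2) /
    (Real.Gamma (β / 2) * Real.Gamma (((d : ℝ) - β - α) / 2))

/-- `h^m_β(x) = ∫_0^∞ t^{(d-α-β)/α} p^m(t,x,0) dt`. -/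
def hBetaM (d : ℕ) (α m β : ℝ) (x : Ed d) : ℝ :=
  ∫ t in Ioi (0 : ℝ), t ^ (((d : ℝ) - α - β) / α) * relKernel d α m t x 0

/-- `h_β = h^1_β`. -/
def hBeta (d : ℕ) (α β : ℝ) (x : Ed d) : ℝ := hBetaM d α 1 β x

/-- `V^m_β(x) = ((d-α-β)/α) h^m_{β+α}(x)/h^m_β(x)`. -/
def VbetaM (d : ℕ) (α m β : ℝ) (x : Ed d) : ℝ :=
  (((d : ℝ) - α - β) / α) * hBetaM d α m (β + α) x / hBetaM d α m β x

/-- The function `H⁰(t,x)`. -/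
def Hzero (d : ℕ) (α δ t : ℝ) (x : Ed d) : ℝ :=
  if δ ≤ ((d : ℝ) - α) / 2 then 1 + t ^ (δ / α) * ‖x‖ ^ (-δ)
  else 1 + t ^ (((d : ℝ) - α - δ) / α) * ‖x‖ ^ (-((d : ℝ) - α - δ))

/-- Density of the Lévy measure of the relativistic `α`-stable operator (mass 1). -/
def levyNu (d : ℕ) (α : ℝ) (x : Ed d) : ℝ :=
  2 ^ ((α - (d : ℝ)) / 2 + 1) * π ^ (-(d : ℝ) / 2) * |Real.Gamma (-α / 2)|⁻¹ *
    besselK (((d : ℝ) + α) / 2) ‖x‖ / ‖x‖ ^ (((d : ℝ) + α) / 2)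

open scoped ENNReal NNReal
section P1
set_option linter.unusedSectionVars false

variable {E X Y Z : Type*} [MeasureSpace E] [SFinite (volume : Measure E)]
  [MeasurableSpace X] [MeasurableSpace Y] [MeasurableSpace Z]

/-- joint measurability of a space-time kernel -/
def KMeas (A : ℝ → X → Y → ℝ≥0∞) : Prop := Measurable fun p : ℝ × X × Y => A p.1 p.2.1 p.2.2

def cnv (A : ℝ → X → E → ℝ≥0∞) (B : ℝ → E → Y → ℝ≥0∞) : ℝ → X → Y → ℝ≥0∞ :=
  fun t x y => ∫⁻ a : ℝ × E, A a.1 x a.2 * B (t - a.1) a.2 y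

def mq (A : ℝ → X → E → ℝ≥0∞) (q : E → ℝ≥0∞) : ℝ → X → E → ℝ≥0∞ := fun t x y => A t x y * q y

lemma KMeas.comp {A : ℝ → X → Y → ℝ≥0∞} (hA : KMeas A) {W : Type*} [MeasurableSpace W]
    {f : W → ℝ} {g : W → X} {h : W → Y} (hf : Measurable f) (hg : Measurable g) (hh : Measurable h) :
    Measurable fun w => A (f w) (g w) (h w) :=
  Measurable.comp hA (hf.prodMk (hg.prodMk hh))

lemma KMeas.mq {A : ℝ → X → E → ℝ≥0∞} (hA : KMeas A) {q : E → ℝ≥0∞} (hq : Measurable q) :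
    KMeas (mq A q) := by
  unfold KMeas _root_.mq
  exact Measurable.mul hA (hq.comp measurable_snd.snd)

lemma KMeas.cnv {A : ℝ → X → E → ℝ≥0∞} {B : ℝ → E → Y → ℝ≥0∞} (hA : KMeas A) (hB : KMeas B) :
    KMeas (cnv A B) := by
  unfold KMeas _root_.cnv
  refine Measurable.lintegral_prod_right' (f := fun p : (ℝ × X × Y) × (ℝ × E) =>
    A p.2.1 p.1.2.1 p.2.2 * B (p.1.1 - p.2.1) p.2.2 p.1.2.2) ?_
  exact (hA.comp (by fun_prop) (by fun_prop) (by fun_prop)).mul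
    (hB.comp (by fun_prop) (by fun_prop) (by fun_prop))

lemma lint_shift (c : ℝ) (f : ℝ × E → ℝ≥0∞) :
    ∫⁻ a : ℝ × E, f (a.1 + c, a.2) = ∫⁻ a : ℝ × E, f a := by
  have h : MeasurePreserving (Prod.map (MeasurableEquiv.addRight c) (MeasurableEquiv.refl E))
      (volume : Measure (ℝ × E)) volume := by
    have h1 : MeasurePreserving (MeasurableEquiv.addRight c) (volume : Measure ℝ) volume :=
      measurePreserving_add_right volume c
    exact h1.prod (MeasurePreserving.id (volume : Measure E))
  have := h.lintegral_comp_emb (MeasurableEquiv.measurableEmbedding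
    (MeasurableEquiv.prodCongr (MeasurableEquiv.addRight c) (MeasurableEquiv.refl E))) f
  exact this

lemma lint_refl (c : ℝ) (f : ℝ × E → ℝ≥0∞) :
    ∫⁻ a : ℝ × E, f (c - a.1, a.2) = ∫⁻ a : ℝ × E, f a := by
  have h : MeasurePreserving (Prod.map (MeasurableEquiv.subLeft c) (MeasurableEquiv.refl E))
      (volume : Measure (ℝ × E)) volume := by
    have h1 : MeasurePreserving (MeasurableEquiv.subLeft c) (volume : Measure ℝ) volume :=
      Measure.measurePreserving_sub_left volume c
    exact h1.prod (MeasurePreserving.id (volume : Measure E))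
  have := h.lintegral_comp_emb (MeasurableEquiv.measurableEmbedding
    (MeasurableEquiv.prodCongr (MeasurableEquiv.subLeft c) (MeasurableEquiv.refl E))) f
  exact this

lemma cnv_assoc {A : ℝ → X → E → ℝ≥0∞} {B : ℝ → E → E → ℝ≥0∞} {C : ℝ → E → Y → ℝ≥0∞}
    (hA : KMeas A) (hB : KMeas B) (hC : KMeas C) : cnv (cnv A B) C = cnv A (cnv B C) := by
  funext t x y
  have e1 : cnv (cnv A B) C t x y = ∫⁻ b : ℝ × E, ∫⁻ a : ℝ × E,
      A a.1 x a.2 * B (b.1 - a.1) a.2 b.2 * C (t - b.1) b.2 y := by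
    refine lintegral_congr fun b => ?_
    rw [cnv, lintegral_mul_const]
    exact (hA.comp (by fun_prop) (by fun_prop) (by fun_prop)).mul
      (hB.comp (by fun_prop) (by fun_prop) (by fun_prop))
  have e2 : cnv A (cnv B C) t x y = ∫⁻ a : ℝ × E, ∫⁻ b : ℝ × E,
      A a.1 x a.2 * B (b.1 - a.1) a.2 b.2 * C (t - b.1) b.2 y := by
    refine lintegral_congr fun a => ?_
    rw [cnv, ← lint_shift (-a.1), ← lintegral_const_mul]
    · refine lintegral_congr fun b => ?_
      simp only [mul_assoc]
      rw [show t - a.1 - (b.1 + -a.1) = t - b.1 by ring, ← sub_eq_add_neg]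
    · exact (hB.comp (by fun_prop) (by fun_prop) (by fun_prop)).mul
        (hC.comp (by fun_prop) (by fun_prop) (by fun_prop))
  rw [e1, e2, lintegral_lintegral_swap]
  exact (((hA.comp (by fun_prop) (by fun_prop) (by fun_prop)).mul
    (hB.comp (by fun_prop) (by fun_prop) (by fun_prop))).mul
    (hC.comp (by fun_prop) (by fun_prop) (by fun_prop))).aemeasurable

lemma mq_cnv {A : ℝ → X → E → ℝ≥0∞} {B : ℝ → E → E → ℝ≥0∞} (q : E → ℝ≥0∞)
    (hA : KMeas A) (hB : KMeas B) : mq (cnv A B) q = cnv A (mq B q) := by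
  funext t x y
  simp only [mq, cnv]
  rw [← lintegral_mul_const]
  · simp only [mul_assoc]
  · exact (hA.comp (by fun_prop) (by fun_prop) (by fun_prop)).mul
      (hB.comp (by fun_prop) (by fun_prop) (by fun_prop))

structure HK (K : ℝ → E → E → ℝ≥0∞) : Prop where
  meas : KMeas K
  zero : ∀ t ≤ 0, ∀ x y, K t x y = 0
  ck : ∀ s t, 0 < s → 0 < t → ∀ x y, ∫⁻ z, K s x z * K t z y = K (s + t) x y
  symm : ∀ t x y, K t x y = K t y x

def PN (K : ℝ → E → E → ℝ≥0∞) (q : E → ℝ≥0∞) : ℕ → ℝ → E → E → ℝ≥0∞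
  | 0 => K
  | n + 1 => cnv (mq (PN K q n) q) K

def PT (K : ℝ → E → E → ℝ≥0∞) (q : E → ℝ≥0∞) : ℝ → E → E → ℝ≥0∞ :=
  fun t x y => ∑' n, PN K q n t x y

variable {K : ℝ → E → E → ℝ≥0∞} {q : E → ℝ≥0∞}

lemma PN_meas (hK : HK K) (hq : Measurable q) (n : ℕ) : KMeas (PN K q n) := by
  induction n with
  | zero => exact hK.meas
  | succ n ih => exact (ih.mq hq).cnv hK.meas

lemma PT_meas (hK : HK K) (hq : Measurable q) : KMeas (PT K q) :=
  Measurable.tsum fun n => PN_meas hK hq n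

lemma PN_zero (hK : HK K) (n : ℕ) : ∀ t ≤ 0, ∀ x y, PN K q n t x y = 0 := by
  induction n with
  | zero => exact hK.zero
  | succ n ih =>
    intro t ht x y
    simp only [PN, cnv, mq]
    rw [lintegral_eq_zero_of_ae_eq_zero]
    refine Eventually.of_forall fun a => ?_
    rcases le_or_gt a.1 0 with h | h
    · simp [ih a.1 h]
    · simp [hK.zero (t - a.1) (by linarith)]

lemma PT_zero (hK : HK K) : ∀ t ≤ 0, ∀ x y, PT K q t x y = 0 := by
  intro t ht x y
  simp [PT, PN_zero hK _ t ht]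

lemma PN_left (hK : HK K) (hq : Measurable q) (n : ℕ) :
    PN K q (n + 1) = cnv (mq K q) (PN K q n) := by
  induction n with
  | zero => rfl
  | succ n ih =>
    have hm := PN_meas hK hq n
    calc PN K q (n + 2) = cnv (mq (PN K q (n + 1)) q) K := rfl
      _ = cnv (cnv (mq K q) (mq (PN K q n) q)) K := by
        rw [ih, mq_cnv q (hK.meas.mq hq) hm]
      _ = cnv (mq K q) (cnv (mq (PN K q n) q) K) :=
        cnv_assoc (hK.meas.mq hq) (hm.mq hq) hK.meas

lemma PN_symm (hK : HK K) (hq : Measurable q) (n : ℕ) : ∀ t x y, PN K q n t x y = PN K q n t y x := by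
  induction n with
  | zero => exact hK.symm
  | succ n ih =>
    intro t x y
    have hl : PN K q (n + 1) t x y = cnv (mq K q) (PN K q n) t x y := by rw [PN_left hK hq]
    rw [hl]
    change (∫⁻ a : ℝ × E, K a.1 x a.2 * q a.2 * PN K q n (t - a.1) a.2 y) = ∫⁻ a : ℝ × E, PN K q n a.1 y a.2 * q a.2 * K (t - a.1) a.2 x
    rw [← lint_refl t]
    refine lintegral_congr fun a => ?_
    simp only [sub_sub_cancel]
    rw [hK.symm, ih]; ring

lemma PT_symm (hK : HK K) (hq : Measurable q) (t : ℝ) (x y : E) : PT K q t x y = PT K q t y x :=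
  tsum_congr fun n => PN_symm hK hq n t x y

lemma K_le_PT (t : ℝ) (x y : E) : K t x y ≤ PT K q t x y :=
  ENNReal.le_tsum (f := fun n => PN K q n t x y) 0

lemma cnv_tsum_left {A : ℕ → ℝ → X → E → ℝ≥0∞} {B : ℝ → E → Y → ℝ≥0∞} (hA : ∀ n, KMeas (A n))
    (hB : KMeas B) (t : ℝ) (x : X) (y : Y) :
    cnv (fun t x y => ∑' n, A n t x y) B t x y = ∑' n, cnv (A n) B t x y := by
  simp only [cnv]
  rw [← lintegral_tsum]
  · simp only [ENNReal.tsum_mul_right]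
  · intro n
    exact (((hA n).comp (by fun_prop) (by fun_prop) (by fun_prop)).mul
      (hB.comp (by fun_prop) (by fun_prop) (by fun_prop))).aemeasurable

/-- Duhamel -/
lemma PT_duhamel (hK : HK K) (hq : Measurable q) (t : ℝ) (x y : E) :
    PT K q t x y = K t x y + cnv (mq (PT K q) q) K t x y := by
  have : mq (PT K q) q = fun t x y => ∑' n, mq (PN K q n) q t x y := by
    funext t x y
    simp only [mq, PT, ENNReal.tsum_mul_right]
  rw [this, cnv_tsum_left (fun n => (PN_meas hK hq n).mq hq) hK.meas]
  rw [PT, tsum_eq_zero_add' ENNReal.summable]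
  rfl

lemma split_time (f : ℝ × E → ℝ≥0∞) (s : ℝ) :
    ∫⁻ a : ℝ × E, f a = (∫⁻ a in {a : ℝ × E | a.1 < s}, f a) + ∫⁻ a in {a : ℝ × E | s < a.1}, f a := by
  have hm : MeasurableSet {a : ℝ × E | a.1 < s} := measurableSet_lt measurable_fst measurable_const
  rw [← lintegral_add_compl f hm]
  congr 1
  refine setLIntegral_congr ?_
  have h0 : (volume : Measure (ℝ × E)) {a : ℝ × E | a.1 = s} = 0 := by
    have : {a : ℝ × E | a.1 = s} = ({s} : Set ℝ) ×ˢ univ := by ext; simp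
    rw [this, Measure.volume_eq_prod, Measure.prod_prod]; simp
  have : ∀ᵐ a : ℝ × E, a.1 ≠ s := by
    rw [ae_iff]; simpa using h0
  filter_upwards [this] with a ha
  simp only [eq_iff_iff]
  change ¬ (a.1 < s) ↔ s < a.1
  rw [not_lt, lt_iff_le_and_ne]
  exact ⟨fun h => ⟨h, ha.symm⟩, fun h => h.1⟩

lemma PN_K_lt (hK : HK K) (hq : Measurable q) (n : ℕ) {s t : ℝ} (ht : 0 < t) (x y : E) :
    ∫⁻ w, PN K q (n + 1) s x w * K t w y =
      ∫⁻ a in {a : ℝ × E | a.1 < s}, PN K q n a.1 x a.2 * q a.2 * K (s + t - a.1) a.2 y := by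
  have hm := (PN_meas hK hq n).mq hq
  have e1 : ∀ w, PN K q (n + 1) s x w * K t w y =
      ∫⁻ a in {a : ℝ × E | a.1 < s}, mq (PN K q n) q a.1 x a.2 * (K (s - a.1) a.2 w * K t w y) := by
    intro w
    have hset : MeasurableSet {a : ℝ × E | a.1 < s} := measurableSet_lt measurable_fst measurable_const
    change (∫⁻ a : ℝ × E, mq (PN K q n) q a.1 x a.2 * K (s - a.1) a.2 w) * _ = _
    rw [← setLIntegral_eq_of_support_subset (s := {a : ℝ × E | a.1 < s}), ← lintegral_mul_const]
    · simp only [mul_assoc]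
    · exact (hm.comp (by fun_prop) (by fun_prop) (by fun_prop)).mul
        (hK.meas.comp (by fun_prop) (by fun_prop) (by fun_prop))
    · intro a ha
      by_contra h
      apply ha
      simp only [mem_ofPred_eq, not_lt] at h
      simp [hK.zero (s - a.1) (by linarith)]
  simp_rw [e1]
  rw [lintegral_lintegral_swap]
  · refine setLIntegral_congr_fun (measurableSet_lt measurable_fst measurable_const) fun a ha => ?_
    rw [lintegral_const_mul, hK.ck (s - a.1) t (sub_pos.2 ha) ht]
    · simp only [mq]; congr 2; ring
    · exact (hK.meas.comp (by fun_prop) (by fun_prop) (by fun_prop)).mul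
        (hK.meas.comp (by fun_prop) (by fun_prop) (by fun_prop))
  · exact ((hm.comp (by fun_prop) (by fun_prop) (by fun_prop)).mul
      ((hK.meas.comp (by fun_prop) (by fun_prop) (by fun_prop)).mul
        (hK.meas.comp (by fun_prop) (by fun_prop) (by fun_prop)))).aemeasurable

end P1

section P1b
set_option linter.unusedSectionVars false

variable {E X : Type*} [MeasureSpace E] [SFinite (volume : Measure E)]
  [MeasurableSpace X]

variable {K : ℝ → E → E → ℝ≥0∞} {q : E → ℝ≥0∞}

lemma PN_K_le (hK : HK K) (hq : Measurable q) (n : ℕ) {s t : ℝ} (hs : 0 < s) (ht : 0 < t) (x y : E) :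
    ∫⁻ w, PN K q n s x w * K t w y ≤ PN K q n (s + t) x y := by
  cases n with
  | zero => exact (hK.ck s t hs ht x y).le
  | succ n =>
    rw [PN_K_lt hK hq n ht]
    exact setLIntegral_le_lintegral _ _

lemma PN_ck (hK : HK K) (hq : Measurable q) (n : ℕ) : ∀ {s t : ℝ} (_ : 0 < s) (_ : 0 < t) (x y : E),
    ∑ p ∈ Finset.HasAntidiagonal.antidiagonal n, ∫⁻ w, PN K q p.1 s x w * PN K q p.2 t w y = PN K q n (s + t) x y := by
  induction n with
  | zero =>
    intro s t hs ht x y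
    simp only [Finset.Nat.antidiagonal_zero, Finset.sum_singleton]
    exact hK.ck s t hs ht x y
  | succ n ih =>
    intro s t hs ht x y
    have hm := PN_meas hK hq
    have hset : MeasurableSet {a : ℝ × E | s < a.1} := measurableSet_lt measurable_const measurable_fst
    rw [Finset.Nat.sum_antidiagonal_succ']
    have e0 : PN K q (n + 1) (s + t) x y =
      ∫⁻ a : ℝ × E, PN K q n a.1 x a.2 * q a.2 * K (s + t - a.1) a.2 y := rfl
    rw [e0, split_time _ s, ← PN_K_lt hK hq n ht]
    refine congrArg₂ (· + ·) rfl ?_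
    have e1 : ∫⁻ a in {a : ℝ × E | s < a.1}, PN K q n a.1 x a.2 * q a.2 * K (s + t - a.1) a.2 y
       = ∫⁻ a in {a : ℝ × E | s < a.1}, ∑ p ∈ Finset.HasAntidiagonal.antidiagonal n,
        ∫⁻ w, PN K q p.1 s x w * (PN K q p.2 (a.1 - s) w a.2 * q a.2 * K (s + t - a.1) a.2 y) := by
      refine setLIntegral_congr_fun hset fun a ha => ?_
      have := ih hs (sub_pos.2 ha) x a.2
      rw [add_sub_cancel] at this
      rw [← this, mul_assoc, Finset.sum_mul]
      refine Finset.sum_congr rfl fun p _ => ?_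
      rw [← lintegral_mul_const]
      · simp only [mul_assoc]
      · exact ((hm _).comp (by fun_prop) (by fun_prop) (by fun_prop)).mul
          ((hm _).comp (by fun_prop) (by fun_prop) (by fun_prop))
    have hmm : ∀ p : ℕ × ℕ, Measurable fun b : (ℝ × E) × E =>
        PN K q p.1 s x b.2 * (PN K q p.2 (b.1.1 - s) b.2 b.1.2 * q b.1.2 * K (s + t - b.1.1) b.1.2 y) := by
      intro p
      exact ((hm _).comp (by fun_prop) (by fun_prop) (by fun_prop)).mul
          ((((hm _).comp (by fun_prop) (by fun_prop) (by fun_prop)).mul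
            (hq.comp (by fun_prop))).mul (hK.meas.comp (by fun_prop) (by fun_prop) (by fun_prop)))
    rw [e1, lintegral_finsetSum]
    · refine Finset.sum_congr rfl fun p _ => ?_
      rw [lintegral_lintegral_swap]
      · refine lintegral_congr fun w => ?_
        rw [lintegral_const_mul]
        · congr 1
          change (∫⁻ a : ℝ × E, PN K q p.2 a.1 w a.2 * q a.2 * K (t - a.1) a.2 y) = _
          rw [setLIntegral_eq_of_support_subset, ← lint_shift (-s)]
          · refine lintegral_congr fun a => ?_
            rw [show t - (a.1 + -s) = s + t - a.1 by ring, ← sub_eq_add_neg]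
          · intro a ha
            by_contra h
            simp only [mem_ofPred_eq, not_lt] at h
            apply ha
            simp [PN_zero hK p.2 (a.1 - s) (by linarith)]
        · exact Measurable.mul (((hm _).comp (by fun_prop) (by fun_prop) (by fun_prop)).mul
            (hq.comp (by fun_prop))) (hK.meas.comp (by fun_prop) (by fun_prop) (by fun_prop))
      · exact (hmm p).aemeasurable
    · intro p _
      exact Measurable.lintegral_prod_right' (hmm p)

lemma PT_ck (hK : HK K) (hq : Measurable q) {s t : ℝ} (hs : 0 < s) (ht : 0 < t) (x y : E) :
    ∫⁻ w, PT K q s x w * PT K q t w y = PT K q (s + t) x y := by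
  have hm := PN_meas hK hq
  have e1 : ∀ w, PT K q s x w * PT K q t w y =
      ∑' p : ℕ × ℕ, PN K q p.1 s x w * PN K q p.2 t w y := by
    intro w
    rw [ENNReal.tsum_prod (f := fun k l => PN K q k s x w * PN K q l t w y)]
    simp only [ENNReal.tsum_mul_left, ENNReal.tsum_mul_right, PT]
  simp_rw [e1]
  rw [lintegral_tsum]
  · rw [← Finset.HasAntidiagonal.sigmaAntidiagonalEquivProd.tsum_eq, ENNReal.tsum_sigma']
    refine tsum_congr fun n => ?_
    rw [← PN_ck hK hq n hs ht, ← Finset.tsum_subtype]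
    rfl
  · intro p
    exact (((hm _).comp (by fun_prop) (by fun_prop) (by fun_prop)).mul
          ((hm _).comp (by fun_prop) (by fun_prop) (by fun_prop))).aemeasurable

def act (A : ℝ → X → E → ℝ≥0∞) (φ : E → ℝ≥0∞) : ℝ → X → ℝ≥0∞ :=
  fun t x => ∫⁻ z, A t x z * φ z

def pot (A : ℝ → X → E → ℝ≥0∞) (g : E → ℝ≥0∞) : ℝ → X → ℝ≥0∞ :=
  fun t x => ∫⁻ s in Ioo 0 t, act A g s x

def cact (A : ℝ → X → E → ℝ≥0∞) (u : ℝ → E → ℝ≥0∞) : ℝ → X → ℝ≥0∞ :=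
  fun t x => ∫⁻ a : ℝ × E, A a.1 x a.2 * u (t - a.1) a.2

def onp (g : E → ℝ≥0∞) : ℝ → E → ℝ≥0∞ := fun t x => if 0 < t then g x else 0

def UMeas (u : ℝ → E → ℝ≥0∞) : Prop := Measurable fun p : ℝ × E => u p.1 p.2

lemma UMeas.comp {u : ℝ → E → ℝ≥0∞} (hu : UMeas u) {W : Type*} [MeasurableSpace W]
    {f : W → ℝ} {g : W → E} (hf : Measurable f) (hg : Measurable g) :
    Measurable fun w => u (f w) (g w) :=
  Measurable.comp (g := fun p : ℝ × E => u p.1 p.2) hu (hf.prodMk hg)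

lemma UMeas.k {u : ℝ → E → ℝ≥0∞} (hu : UMeas u) : KMeas (fun t x (_ : Unit) => u t x) :=
  hu.comp measurable_fst measurable_snd.fst

lemma onp_meas {g : E → ℝ≥0∞} (hg : Measurable g) : UMeas (onp g) := by
  unfold UMeas onp
  exact Measurable.ite (measurableSet_lt measurable_const measurable_fst) (hg.comp measurable_snd)
    measurable_const

lemma act_meas {A : ℝ → E → E → ℝ≥0∞} (hA : KMeas A) {φ : E → ℝ≥0∞} (hφ : Measurable φ) :
    UMeas (act A φ) := by
  unfold UMeas act
  refine Measurable.lintegral_prod_right' (f := fun p : (ℝ × E) × E =>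
    A p.1.1 p.1.2 p.2 * φ p.2) ?_
  exact (hA.comp (by fun_prop) (by fun_prop) (by fun_prop)).mul (hφ.comp (by fun_prop))

lemma cact_meas {A : ℝ → E → E → ℝ≥0∞} (hA : KMeas A) {u : ℝ → E → ℝ≥0∞} (hu : UMeas u) :
    UMeas (cact A u) :=
  (hA.cnv hu.k).comp (f := fun p : ℝ × E => p.1) (g := fun p => p.2) (h := fun _ => ()) (by fun_prop) (by fun_prop) (by fun_prop)

lemma cact_cnv {A B : ℝ → E → E → ℝ≥0∞} (hA : KMeas A) (hB : KMeas B)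
    {u : ℝ → E → ℝ≥0∞} (hu : UMeas u) : cact (cnv A B) u = cact A (cact B u) := by
  funext t x
  exact congrFun (congrFun (congrFun (cnv_assoc hA hB hu.k) t) x) ()

lemma act_cnv {A B : ℝ → E → E → ℝ≥0∞} (hA : KMeas A) (hB : KMeas B)
    {φ : E → ℝ≥0∞} (hφ : Measurable φ) : act (cnv A B) φ = cact A (act B φ) := by
  funext t x
  simp only [act, cact, cnv]
  have e1 : ∀ z, (∫⁻ a : ℝ × E, A a.1 x a.2 * B (t - a.1) a.2 z) * φ z =
      ∫⁻ a : ℝ × E, A a.1 x a.2 * (B (t - a.1) a.2 z * φ z) := by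
    intro z
    rw [← lintegral_mul_const]
    · simp only [mul_assoc]
    · exact (hA.comp (by fun_prop) (by fun_prop) (by fun_prop)).mul
        (hB.comp (by fun_prop) (by fun_prop) (by fun_prop))
  simp_rw [e1]
  rw [lintegral_lintegral_swap]
  · refine lintegral_congr fun a => ?_
    rw [lintegral_const_mul]
    exact (hB.comp (by fun_prop) (by fun_prop) (by fun_prop)).mul (hφ.comp (by fun_prop))
  · exact ((hA.comp (by fun_prop) (by fun_prop) (by fun_prop)).mul
        ((hB.comp (by fun_prop) (by fun_prop) (by fun_prop)).mul (hφ.comp (by fun_prop)))).aemeasurable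

lemma cact_onp {A : ℝ → E → E → ℝ≥0∞} (hA : KMeas A) (h0 : ∀ t ≤ 0, ∀ x y, A t x y = 0)
    {g : E → ℝ≥0∞} (hg : Measurable g) : cact A (onp g) = pot A g := by
  funext t x
  simp only [cact, pot]
  rw [Measure.volume_eq_prod, lintegral_prod]
  · rw [← setLIntegral_eq_of_support_subset (s := Ioo 0 t)]
    · refine setLIntegral_congr_fun measurableSet_Ioo fun s hs => ?_
      simp [act, onp, hs.2]
    · intro s hs
      by_contra h
      apply hs
      simp only [mem_Ioo, not_and_or, not_lt] at h
      rcases h with h | h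
      · simp [h0 s h]
      · simp [onp, not_lt.2 h]
  · exact ((hA.comp (by fun_prop) (by fun_prop) (by fun_prop)).mul
        ((onp_meas hg).comp (by fun_prop) (by fun_prop))).aemeasurable

lemma cact_mq (A : ℝ → E → E → ℝ≥0∞) (q : E → ℝ≥0∞) (u : ℝ → E → ℝ≥0∞) :
    cact (mq A q) u = cact A (fun t x => q x * u t x) := by
  funext t x
  simp only [cact, mq, mul_assoc]

lemma mul_onp (q g : E → ℝ≥0∞) : (fun t x => q x * onp g t x) = onp (fun x => q x * g x) := by
  funext t x
  simp [onp]

lemma cact_add {A : ℝ → E → E → ℝ≥0∞} (hA : KMeas A) {u v : ℝ → E → ℝ≥0∞} (hu : UMeas u) (t x) :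
    cact A (fun t x => u t x + v t x) t x = cact A u t x + cact A v t x := by
  simp only [cact, mul_add]
  rw [lintegral_add_left]
  exact ((hA.comp (by fun_prop) (by fun_prop) (by fun_prop)).mul
        (hu.comp (by fun_prop) (by fun_prop)))

lemma act_add {A : ℝ → E → E → ℝ≥0∞} (hA : KMeas A) {u v : E → ℝ≥0∞} (hu : Measurable u) (t x) :
    act A (fun x => u x + v x) t x = act A u t x + act A v t x := by
  simp only [act, mul_add]
  rw [lintegral_add_left]
  exact ((hA.comp (by fun_prop) (by fun_prop) (by fun_prop)).mul hu)

lemma pot_add {A : ℝ → E → E → ℝ≥0∞} (hA : KMeas A) {u v : E → ℝ≥0∞} (hu : Measurable u) (t x) :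
    pot A (fun x => u x + v x) t x = pot A u t x + pot A v t x := by
  simp only [pot, act_add hA hu]
  rw [lintegral_add_left]
  exact (act_meas hA hu).comp (by fun_prop) (by fun_prop)

lemma act_cmul {A : ℝ → E → E → ℝ≥0∞} (hA : KMeas A) {u : E → ℝ≥0∞} (hu : Measurable u) (c t x) :
    act A (fun x => c * u x) t x = c * act A u t x := by
  simp only [act, mul_left_comm _ c]
  rw [lintegral_const_mul]
  exact ((hA.comp (by fun_prop) (by fun_prop) (by fun_prop)).mul hu)

lemma pot_cmul {A : ℝ → E → E → ℝ≥0∞} (hA : KMeas A) {u : E → ℝ≥0∞} (hu : Measurable u) (c t x) :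
    pot A (fun x => c * u x) t x = c * pot A u t x := by
  simp only [pot, act_cmul hA hu]
  rw [lintegral_const_mul]
  exact (act_meas hA hu).comp (by fun_prop) (by fun_prop)

lemma act_mono {A : ℝ → E → E → ℝ≥0∞} {u v : E → ℝ≥0∞} (h : ∀ᵐ z, u z ≤ v z) (t x) :
    act A u t x ≤ act A v t x :=
  lintegral_mono_ae (h.mono fun _ hz => by gcongr)

lemma pot_mono {A : ℝ → E → E → ℝ≥0∞} {u v : E → ℝ≥0∞} (h : ∀ᵐ z, u z ≤ v z) (t x) :
    pot A u t x ≤ pot A v t x :=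
  lintegral_mono fun _ => act_mono h _ _

lemma ae_prod_snd {p : E → Prop} (h : ∀ᵐ z, p z) : ∀ᵐ a : ℝ × E, p a.2 :=
  Measure.quasiMeasurePreserving_snd.ae h

lemma cact_mono_ae {A : ℝ → E → E → ℝ≥0∞} {u v : ℝ → E → ℝ≥0∞} {S : E → Prop} (hS : ∀ᵐ z, S z)
    (h : ∀ t z, S z → u t z ≤ v t z) (t x) : cact A u t x ≤ cact A v t x := by
  refine lintegral_mono_ae ((ae_prod_snd hS).mono fun a ha => ?_)
  gcongr
  exact h _ _ ha

/-- F6 -/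
lemma supersol (hK : HK K) (hq : Measurable q) {φ g : E → ℝ≥0∞} (hφ : Measurable φ)
    (hg : Measurable g) {S : E → Prop} (hS : ∀ᵐ z, S z)
    (H : ∀ t, 0 < t → ∀ x, S x → act K φ t x + pot K (fun z => q z * φ z + g z) t x ≤ φ x) :
    ∀ t, 0 < t → ∀ x, S x → act (PT K q) φ t x + pot (PT K q) g t x ≤ φ x := by
  have hm := PN_meas hK hq
  set U : ℕ → ℝ → E → ℝ≥0∞ := fun n t x => act (PN K q n) φ t x + cact (PN K q n) (onp g) t x with hU
  have hUm : ∀ n, UMeas (U n) := fun n =>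
    Measurable.add (act_meas (hm n) hφ) (cact_meas (hm n) (onp_meas hg))
  have hU1 : ∀ n t x, U (n + 1) t x = cact (mq K q) (U n) t x := by
    intro n t x
    simp only [hU]
    rw [PN_left hK hq, act_cnv (hK.meas.mq hq) (hm n) hφ, cact_cnv (hK.meas.mq hq) (hm n) (onp_meas hg),
      ← cact_add (hK.meas.mq hq) (act_meas (hm n) hφ)]
  have hU0 : ∀ n t x, t ≤ 0 → U n t x = 0 := by
    intro n t x ht
    simp only [hU, act]
    rw [cact_onp (hm n) (PN_zero hK n) hg]
    simp [PN_zero hK n t ht, pot, not_lt.2 ht]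
  have hsum : ∀ N t x, S x → ∑ n ∈ Finset.range N, U n t x ≤ onp φ t x := by
    intro N
    induction N with
    | zero => intro t x _; simp
    | succ N ih =>
      intro t x hx
      rcases le_or_gt t 0 with ht | ht
      · simp [hU0 _ t x ht]
      rw [Finset.sum_range_succ']
      simp only [hU1]
      have e1 : ∑ n ∈ Finset.range N, cact (mq K q) (U n) t x =
          cact (mq K q) (fun t x => ∑ n ∈ Finset.range N, U n t x) t x := by
        simp only [cact, Finset.mul_sum]
        rw [lintegral_finsetSum]
        intro n _
        exact (((hK.meas.mq hq).comp (by fun_prop) (by fun_prop) (by fun_prop)).mul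
          ((hUm n).comp (by fun_prop) (by fun_prop)))
      rw [e1]
      calc _ ≤ cact (mq K q) (onp φ) t x + U 0 t x := by
            gcongr
            exact cact_mono_ae hS ih t x
        _ = act K φ t x + pot K (fun z => q z * φ z + g z) t x := by
            rw [cact_mq, mul_onp, cact_onp hK.meas hK.zero (g := fun z => q z * φ z) (hq.mul hφ), pot_add hK.meas (u := fun z => q z * φ z) (hq.mul hφ)]
            simp only [hU]
            rw [show PN K q 0 = K from rfl, cact_onp hK.meas hK.zero hg]
            ring
        _ ≤ φ x := H t ht x hx
        _ = onp φ t x := by simp [onp, ht]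
  intro t ht x hx
  have e2 : act (PT K q) φ t x + pot (PT K q) g t x = ∑' n, U n t x := by
    simp only [hU]
    rw [ENNReal.tsum_add, ← cact_onp (PT_meas hK hq) (PT_zero hK) hg]
    congr 1
    · simp only [act, PT, ← ENNReal.tsum_mul_right]
      rw [lintegral_tsum]
      intro n
      exact (((hm n).comp (by fun_prop) (by fun_prop) (by fun_prop)).mul hφ).aemeasurable
    · simp only [cact, PT, ← ENNReal.tsum_mul_right]
      rw [lintegral_tsum]
      intro n
      exact (((hm n).comp (by fun_prop) (by fun_prop) (by fun_prop)).mul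
        ((onp_meas hg).comp (by fun_prop) (by fun_prop))).aemeasurable
  rw [e2]
  refine ENNReal.tsum_le_of_sum_range_le fun N => ?_
  have := hsum N t x hx
  simpa [onp, ht] using this

/-- (I) -/
lemma duhamel_fun (hK : HK K) (hq : Measurable q) {h f : E → ℝ≥0∞} (hh : Measurable h)
    (hf : Measurable f) {S : E → Prop} (hS : ∀ᵐ z, S z)
    (H : ∀ t, 0 < t → ∀ x, S x → act K h t x + pot K f t x = h x) :
    ∀ t, 0 < t → ∀ x, S x → act (PT K q) h t x + pot (PT K q) f t x =
      h x + pot (PT K q) (fun z => q z * h z) t x := by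
  intro t ht x hx
  have hP := PT_meas hK hq
  have e : PT K q = fun t x y => K t x y + cnv (mq (PT K q) q) K t x y := by
    funext t x y; exact PT_duhamel hK hq t x y
  have e1 : act (PT K q) h t x = act K h t x + cact (mq (PT K q) q) (act K h) t x := by
    rw [← act_cnv (hP.mq hq) hK.meas hh]
    conv_lhs => rw [e]
    simp only [act, add_mul]
    rw [lintegral_add_left]
    exact (hK.meas.comp (by fun_prop) (by fun_prop) (by fun_prop)).mul hh
  have e2 : cact (PT K q) (onp f) t x = cact K (onp f) t x + cact (mq (PT K q) q) (cact K (onp f)) t x := by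
    rw [← cact_cnv (hP.mq hq) hK.meas (onp_meas hf)]
    conv_lhs => rw [e]
    simp only [cact, add_mul]
    rw [lintegral_add_left]
    exact (hK.meas.comp (by fun_prop) (by fun_prop) (by fun_prop)).mul
      ((onp_meas hf).comp (by fun_prop) (by fun_prop))
  rw [← cact_onp hP (PT_zero hK) hf, e1, e2, ← cact_onp hP (PT_zero hK) (g := fun z => q z * h z) (hq.mul hh), ← mul_onp, ← cact_mq]
  rw [show ∀ a b c d : ℝ≥0∞, a + b + (c + d) = (a + c) + (b + d) by intros; ring]
  rw [← cact_add (hP.mq hq) (act_meas hK.meas hh), cact_onp hK.meas hK.zero hf, H t ht x hx]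
  congr 1
  have hE : ∀ t z, S z → act K h t z + pot K f t z = onp h t z := by
    intro t z hz
    rcases le_or_gt t 0 with h0 | h0
    · simp [act, pot, hK.zero t h0, not_lt.2 h0, onp]
    · simp [H t h0 z hz, onp, h0]
  apply le_antisymm
  · exact cact_mono_ae hS (fun t z hz => (hE t z hz).le) t x
  · exact cact_mono_ae hS (fun t z hz => (hE t z hz).ge) t x

/-- (*) -/
lemma absorb (hK : HK K) (hq : Measurable q) {A : Set E} (hA : MeasurableSet A) {c : ℝ≥0∞} {t : ℝ} (hc : c * ENNReal.ofReal t ≤ 1 / 2) (hqc : ∀ᵐ z, z ∉ A → q z ≤ c) (x y : E) :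
    PT K q t x y ≤ 2 * (K t x y + cnv (mq (PT K q) (A.indicator q)) K t x y) := by
  set B := K t x y + cnv (mq (PT K q) (A.indicator q)) K t x y with hB
  have hm := PN_meas hK hq
  have hqA : Measurable (A.indicator q) := hq.indicator hA
  have hstep : ∀ n, PN K q (n + 1) t x y ≤
      cnv (mq (PN K q n) (A.indicator q)) K t x y + 1 / 2 * PN K q n t x y := by
    intro n
    have e1 : PN K q (n + 1) t x y ≤
      cnv (mq (PN K q n) (A.indicator q)) K t x y + c * cnv (PN K q n) K t x y := by
      change (∫⁻ a : ℝ × E, PN K q n a.1 x a.2 * q a.2 * K (t - a.1) a.2 y) ≤ _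
      simp only [cnv, mq]
      rw [← lintegral_const_mul, ← lintegral_add_left]
      · refine lintegral_mono_ae ((ae_prod_snd hqc).mono fun a ha => ?_)
        by_cases h : a.2 ∈ A
        · simp [h]
        · simp only [h, not_false_eq_true, indicator_of_notMem, mul_zero, zero_mul, zero_add]
          have := ha h
          calc _ ≤ PN K q n a.1 x a.2 * c * K (t - a.1) a.2 y := by gcongr
            _ = _ := by ring
      · exact (((hm n).mq hqA).comp (by fun_prop) (by fun_prop) (by fun_prop)).mul
          (hK.meas.comp (by fun_prop) (by fun_prop) (by fun_prop))
      · exact ((hm n).comp (by fun_prop) (by fun_prop) (by fun_prop)).mul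
          (hK.meas.comp (by fun_prop) (by fun_prop) (by fun_prop))
    have e2 : cnv (PN K q n) K t x y ≤ ENNReal.ofReal t * PN K q n t x y := by
      simp only [cnv]
      rw [Measure.volume_eq_prod, lintegral_prod]
      · rw [← setLIntegral_eq_of_support_subset (s := Ioo 0 t)]
        · calc _ ≤ ∫⁻ s in Ioo 0 t, PN K q n t x y := by
                refine setLIntegral_mono measurable_const fun s hs => ?_
                have := PN_K_le hK hq n hs.1 (sub_pos.2 hs.2) x y
                rwa [add_sub_cancel] at this
            _ = _ := by simp [mul_comm]
        · intro s hs
          by_contra h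
          apply hs
          simp only [mem_Ioo, not_and_or, not_lt] at h
          rcases h with h | h
          · simp [PN_zero hK n s h]
          · simp [hK.zero (t - s) (by linarith)]
      · exact (((hm n).comp (by fun_prop) (by fun_prop) (by fun_prop)).mul
          (hK.meas.comp (by fun_prop) (by fun_prop) (by fun_prop))).aemeasurable
    refine e1.trans (add_le_add le_rfl ?_)
    calc c * cnv (PN K q n) K t x y ≤ c * (ENNReal.ofReal t * PN K q n t x y) := by gcongr
      _ = (c * ENNReal.ofReal t) * PN K q n t x y := by ring
      _ ≤ _ := by gcongr
  have hsumB : ∀ N, K t x y + ∑ n ∈ Finset.range N, cnv (mq (PN K q n) (A.indicator q)) K t x y ≤ B := by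
    intro N
    rw [hB]
    gcongr
    have : mq (PT K q) (A.indicator q) = fun t x y => ∑' n, mq (PN K q n) (A.indicator q) t x y := by
      funext t x y
      simp only [mq, PT, ENNReal.tsum_mul_right]
    rw [this, cnv_tsum_left (fun n => (hm n).mq hqA) hK.meas]
    exact ENNReal.sum_le_tsum _
  refine ENNReal.tsum_le_of_sum_range_le fun N => ?_
  induction N with
  | zero => simp
  | succ N ih =>
    rw [Finset.sum_range_succ']
    calc _ ≤ (∑ n ∈ Finset.range N, (cnv (mq (PN K q n) (A.indicator q)) K t x y + 1 / 2 * PN K q n t x y))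
          + K t x y := by
          gcongr with n _
          · exact hstep n
          · exact le_rfl
      _ = (K t x y + ∑ n ∈ Finset.range N, cnv (mq (PN K q n) (A.indicator q)) K t x y)
          + 1 / 2 * ∑ n ∈ Finset.range N, PN K q n t x y := by
          rw [Finset.sum_add_distrib, Finset.mul_sum]; ring
      _ ≤ B + 1 / 2 * (2 * B) := by
          gcongr
          exact hsumB N
      _ = 2 * B := by
          rw [← mul_assoc, one_div, ENNReal.inv_mul_cancel (by simp) (by simp)]; ring

end P1b

section P1c
set_option linter.unusedSectionVars false

lemma lint_exp (lam : ℝ) (hl : 0 ≤ lam) {r t : ℝ} (hrt : r ≤ t) :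
    ∫⁻ s in Ioo r t, ENNReal.ofReal (lam * exp (-lam * s)) = ENNReal.ofReal (exp (-lam * r) - exp (-lam * t)) := by
  have hIntg : IntervalIntegrable (fun s => lam * exp (-lam * s)) volume r t :=
    (by fun_prop : Continuous fun s => lam * exp (-lam * s)).intervalIntegrable _ _
  have h1 : ∫ s in r..t, lam * exp (-lam * s) = (-exp (-lam * t)) - (-exp (-lam * r)) := by
    apply intervalIntegral.integral_eq_sub_of_hasDerivAt (f := fun s => -exp (-lam * s)) _ hIntg
    intro s _
    have := (((hasDerivAt_id s).const_mul (-lam)).exp).neg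
    refine this.congr_deriv ?_
    simp only [id]; ring
  rw [Measure.restrict_congr_set Ioo_ae_eq_Ioc, ← ofReal_integral_eq_lintegral_ofReal,
    ← intervalIntegral.integral_of_le hrt, h1]
  · congr 1; ring
  · exact (intervalIntegrable_iff_integrableOn_Ioc_of_le hrt).1 hIntg
  · exact Eventually.of_forall fun s => by positivity

lemma lam_pure {A F : ℝ → ℝ≥0∞} (hA : Measurable A) (hF : Measurable F) {u : ℝ≥0∞}
    (H : ∀ s, 0 < s → A s + ∫⁻ r in Ioo 0 s, F r = u) {lam : ℝ} (hl : 0 ≤ lam) {t : ℝ} (ht : 0 < t) :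
    ENNReal.ofReal (exp (-lam * t)) * A t +
      ∫⁻ s in Ioo 0 t, ENNReal.ofReal (exp (-lam * s)) * (F s + ENNReal.ofReal lam * A s) = u := by
  set e : ℝ → ℝ≥0∞ := fun s => ENNReal.ofReal (exp (-lam * s)) with he
  have hem : Measurable e := by fun_prop
  have hle : ∀ s, ENNReal.ofReal lam * e s = ENNReal.ofReal (lam * exp (-lam * s)) := by
    intro s; rw [ENNReal.ofReal_mul hl]
  have hmF : Measurable fun s => ∫⁻ r in Ioo 0 s, F r := by
    have : (fun s => ∫⁻ r in Ioo 0 s, F r) = fun s => ∫⁻ r, (Ioo 0 s).indicator F r := by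
      funext s; rw [lintegral_indicator measurableSet_Ioo]
    rw [this]
    refine Measurable.lintegral_prod_right' (f := fun p : ℝ × ℝ => (Ioo 0 p.1).indicator F p.2) ?_
    have h2 : (fun p : ℝ × ℝ => (Ioo 0 p.1).indicator F p.2) =
      {p : ℝ × ℝ | 0 < p.2 ∧ p.2 < p.1}.indicator fun p => F p.2 := by
      funext p
      by_cases h : 0 < p.2 ∧ p.2 < p.1
      · rw [indicator_of_mem (show p.2 ∈ Ioo 0 p.1 from h), indicator_of_mem (show p ∈ {p : ℝ × ℝ | 0 < p.2 ∧ p.2 < p.1} from h)]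
      · rw [indicator_of_notMem (show p.2 ∉ Ioo 0 p.1 from h), indicator_of_notMem (show p ∉ {p : ℝ × ℝ | 0 < p.2 ∧ p.2 < p.1} from h)]
    rw [h2]
    exact (hF.comp measurable_snd).indicator ((measurableSet_lt measurable_const measurable_snd).inter
      (measurableSet_lt measurable_snd measurable_fst))
  -- Tonelli
  have T1 : ∫⁻ s in Ioo 0 t, (ENNReal.ofReal lam * e s) * ∫⁻ r in Ioo 0 s, F r =
      ∫⁻ r in Ioo 0 t, F r * ENNReal.ofReal (exp (-lam * r) - exp (-lam * t)) := by
    have a1 : ∫⁻ s in Ioo 0 t, (ENNReal.ofReal lam * e s) * ∫⁻ r in Ioo 0 s, F r =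
        ∫⁻ s in Ioo 0 t, ∫⁻ r in Ioo 0 t, {p : ℝ × ℝ | p.2 < p.1}.indicator (fun p => (ENNReal.ofReal lam * e p.1) * F p.2) (s, r) := by
      refine setLIntegral_congr_fun measurableSet_Ioo fun s hs => ?_
      rw [← lintegral_const_mul _ hF, ← lintegral_indicator measurableSet_Ioo, ← lintegral_indicator measurableSet_Ioo]
      refine lintegral_congr fun r => ?_
      simp only [indicator, mem_Ioo, mem_ofPred_eq]
      have h3 := hs.2
      by_cases h1 : 0 < r <;> by_cases h2 : r < s
      · have : r < t := h2.trans h3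
        simp [h1, h2, this]
      all_goals simp [h1, h2]
    have hmeas : Measurable fun p : ℝ × ℝ => {p : ℝ × ℝ | p.2 < p.1}.indicator (fun p => (ENNReal.ofReal lam * e p.1) * F p.2) p := by
      refine Measurable.indicator ?_ (measurableSet_lt measurable_snd measurable_fst)
      exact ((hem.comp measurable_fst).const_mul _).mul (hF.comp measurable_snd)
    rw [a1, lintegral_lintegral_swap]
    · refine setLIntegral_congr_fun measurableSet_Ioo fun r hr => ?_
      rw [← lint_exp lam hl hr.2.le, ← lintegral_const_mul _ (by fun_prop), ← lintegral_indicator measurableSet_Ioo, ← lintegral_indicator measurableSet_Ioo]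
      refine lintegral_congr fun s => ?_
      simp only [indicator, mem_Ioo, mem_ofPred_eq, hle]
      have h3 := hr.1
      by_cases h1 : s < t <;> by_cases h2 : r < s
      · have : 0 < s := h3.trans h2
        simp [h1, h2, this, mul_comm]
      all_goals simp [h1, h2]
    · exact hmeas.aemeasurable
  have T2 : ∫⁻ s in Ioo 0 t, (ENNReal.ofReal lam * e s) * u = ENNReal.ofReal (1 - exp (-lam * t)) * u := by
    rw [lintegral_mul_const _ (by fun_prop)]
    simp only [hle]
    rw [lint_exp lam hl ht.le]; simp
  have T3 : ∫⁻ s in Ioo 0 t, (ENNReal.ofReal lam * e s) * u =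
      (∫⁻ s in Ioo 0 t, (ENNReal.ofReal lam * e s) * A s) +
        ∫⁻ r in Ioo 0 t, F r * ENNReal.ofReal (exp (-lam * r) - exp (-lam * t)) := by
    rw [← T1, ← lintegral_add_left (by fun_prop)]
    refine setLIntegral_congr_fun measurableSet_Ioo fun s hs => ?_
    rw [← mul_add, H s hs.1]
  have hF2 : ∫⁻ s in Ioo 0 t, e s * F s = (∫⁻ r in Ioo 0 t, F r * ENNReal.ofReal (exp (-lam * r) - exp (-lam * t)))
      + e t * ∫⁻ r in Ioo 0 t, F r := by
    rw [← lintegral_const_mul _ hF, ← lintegral_add_left (by fun_prop)]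
    refine setLIntegral_congr_fun measurableSet_Ioo fun s hs => ?_
    rw [mul_comm (F s), ← add_mul, he]
    simp only
    rw [← ENNReal.ofReal_add _ (by positivity)]
    · congr 2; ring
    · rw [sub_nonneg]; apply exp_le_exp.2
      have := hs.2.le; nlinarith
  have hsplit : ∫⁻ s in Ioo 0 t, e s * (F s + ENNReal.ofReal lam * A s) =
      (∫⁻ s in Ioo 0 t, e s * F s) + ∫⁻ s in Ioo 0 t, (ENNReal.ofReal lam * e s) * A s := by
    rw [← lintegral_add_left (by fun_prop)]
    refine lintegral_congr fun s => by ring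
  rw [hsplit, hF2]
  calc _ = ((∫⁻ s in Ioo 0 t, (ENNReal.ofReal lam * e s) * A s) +
        ∫⁻ r in Ioo 0 t, F r * ENNReal.ofReal (exp (-lam * r) - exp (-lam * t))) +
          e t * (A t + ∫⁻ r in Ioo 0 t, F r) := by
        simp only [he]; ring
    _ = ENNReal.ofReal (1 - exp (-lam * t)) * u + e t * u := by rw [← T3, T2, H t ht]
    _ = u := by
      rw [← add_mul, he]
      simp only
      rw [← ENNReal.ofReal_add _ (by positivity)]
      · simp
      · rw [sub_nonneg, exp_le_one_iff]; nlinarith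

variable {E : Type*} [MeasureSpace E] [SFinite (volume : Measure E)]
variable {K : ℝ → E → E → ℝ≥0∞} {q : E → ℝ≥0∞}

def eK (lam : ℝ) (K : ℝ → E → E → ℝ≥0∞) : ℝ → E → E → ℝ≥0∞ :=
  fun t x y => ENNReal.ofReal (exp (-lam * t)) * K t x y

lemma eK_HK (lam : ℝ) (hK : HK K) : HK (eK lam K) where
  meas := Measurable.mul (by fun_prop) hK.meas
  zero t ht x y := by simp [eK, hK.zero t ht]
  ck s t hs ht x y := by
    simp only [eK]
    rw [← hK.ck s t hs ht, ← lintegral_const_mul]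
    · refine lintegral_congr fun z => ?_
      rw [show -lam * (s + t) = -lam * s + -lam * t by ring, exp_add, ENNReal.ofReal_mul (by positivity)]
      ring
    · exact (hK.meas.comp (by fun_prop) (by fun_prop) (by fun_prop)).mul
        (hK.meas.comp (by fun_prop) (by fun_prop) (by fun_prop))
  symm t x y := by simp only [eK]; rw [hK.symm]

lemma eK_PN (lam : ℝ) (hK : HK K) (hq : Measurable q) (n : ℕ) :
    PN (eK lam K) q n = eK lam (PN K q n) := by
  induction n with
  | zero => rfl
  | succ n ih =>
    funext t x y
    simp only [PN, ih]
    simp only [eK, cnv, mq]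
    rw [← lintegral_const_mul]
    · refine lintegral_congr fun a => ?_
      rw [show -lam * t = -lam * a.1 + -lam * (t - a.1) by ring, exp_add, ENNReal.ofReal_mul (by positivity)]
      ring
    · exact Measurable.mul (((PN_meas hK hq n).comp (by fun_prop) (by fun_prop) (by fun_prop)).mul
            (hq.comp (by fun_prop))) (hK.meas.comp (by fun_prop) (by fun_prop) (by fun_prop))

lemma eK_PT (lam : ℝ) (hK : HK K) (hq : Measurable q) :
    PT (eK lam K) q = eK lam (PT K q) := by
  funext t x y
  simp only [PT, eK_PN lam hK hq]
  simp only [eK, ENNReal.tsum_mul_left, PT]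

lemma act_eK {lam : ℝ} {A : ℝ → E → E → ℝ≥0∞} (hA : KMeas A) {φ : E → ℝ≥0∞} (hφ : Measurable φ) (t x) :
    act (eK lam A) φ t x = ENNReal.ofReal (exp (-lam * t)) * act A φ t x := by
  simp only [act, eK, mul_assoc]
  rw [lintegral_const_mul]
  exact (hA.comp (by fun_prop) (by fun_prop) (by fun_prop)).mul hφ

lemma lam_ident (hK : KMeas K) {u f : E → ℝ≥0∞} (hu : Measurable u) (hf : Measurable f) {x : E}
    (H : ∀ t, 0 < t → act K u t x + pot K f t x = u x) {lam : ℝ} (hl : 0 ≤ lam) {t : ℝ} (ht : 0 < t) :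
    act (eK lam K) u t x + pot (eK lam K) (fun z => f z + ENNReal.ofReal lam * u z) t x = u x := by
  have := lam_pure (A := fun s => act K u s x) (F := fun s => act K f s x)
    ((act_meas hK hu).comp (by fun_prop) (by fun_prop)) ((act_meas hK hf).comp (by fun_prop) (by fun_prop))
    H hl ht
  rw [act_eK hK hu]
  convert this using 2
  simp only [pot]
  refine lintegral_congr fun s => ?_
  rw [act_eK hK (φ := fun z => f z + ENNReal.ofReal lam * u z) (hf.add (hu.const_mul _)), act_add hK hf, act_cmul hK hu]

lemma supersol_lam (hK : HK K) (hq : Measurable q) {φ g u1 u2 f1 f2 : E → ℝ≥0∞} (hφ : Measurable φ)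
    (hg : Measurable g) (hu1 : Measurable u1) (hu2 : Measurable u2) (hf1 : Measurable f1)
    (hf2 : Measurable f2) {S : E → Prop} (hS : ∀ᵐ z, S z)
    (h1 : ∀ t, 0 < t → ∀ x, S x → act K u1 t x + pot K f1 t x = u1 x)
    (h2 : ∀ t, 0 < t → ∀ x, S x → act K u2 t x + pot K f2 t x = u2 x)
    (hfin : ∀ x, S x → u2 x ≠ ∞) (h12 : ∀ x, S x → φ x + u2 x = u1 x)
    {lam : ℝ} (hl : 0 ≤ lam)
    (hineq : ∀ x, S x → q x * φ x + g x + f2 x ≤ f1 x + ENNReal.ofReal lam * φ x) :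
    ∀ t, 0 < t → ∀ x, S x → act (PT K q) φ t x + pot (PT K q) g t x ≤
      ENNReal.ofReal (exp (lam * t)) * φ x := by
  have hE := eK_HK lam hK
  have hEm := hE.meas
  have key := supersol hE hq hφ hg hS (fun t ht x hx => by
    have i1 := lam_ident hK.meas hu1 hf1 (fun t ht => h1 t ht x hx) hl ht
    have i2 := lam_ident hK.meas hu2 hf2 (fun t ht => h2 t ht x hx) hl ht
    have hle : pot (eK lam K) (fun z => (q z * φ z + g z) + (f2 z + ENNReal.ofReal lam * u2 z)) t x ≤
        pot (eK lam K) (fun z => f1 z + ENNReal.ofReal lam * u1 z) t x := by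
      refine pot_mono (hS.mono fun z hz => ?_) t x
      rw [← h12 z hz]
      calc _ = (q z * φ z + g z + f2 z) + ENNReal.ofReal lam * u2 z := by ring
        _ ≤ (f1 z + ENNReal.ofReal lam * φ z) + ENNReal.ofReal lam * u2 z := by
          exact add_le_add (hineq z hz) le_rfl
        _ = _ := by ring
    rw [pot_add hEm (u := fun z => q z * φ z + g z) ((hq.mul hφ).add hg)] at hle
    have hac : act (eK lam K) φ t x + act (eK lam K) u2 t x = act (eK lam K) u1 t x := by
      rw [← act_add hEm hφ]
      apply le_antisymm
      · exact act_mono (hS.mono fun z hz => (h12 z hz).le) t x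
      · exact act_mono (hS.mono fun z hz => (h12 z hz).ge) t x
    have : act (eK lam K) φ t x + pot (eK lam K) (fun z => q z * φ z + g z) t x + u2 x ≤ φ x + u2 x := by
      rw [h12 x hx, ← i1, ← hac]
      conv_lhs => rw [← i2]
      calc _ = act (eK lam K) φ t x + act (eK lam K) u2 t x + (pot (eK lam K) (fun z => q z * φ z + g z) t x + pot (eK lam K) (fun z => f2 z + ENNReal.ofReal lam * u2 z) t x) := by ring
        _ ≤ _ := by gcongr
    exact (ENNReal.add_le_add_iff_right (hfin x hx)).1 this)
  intro t ht x hx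
  have k := key t ht x hx
  have hPm := PT_meas hK hq
  rw [eK_PT lam hK hq, act_eK hPm hφ] at k
  have k2 : ENNReal.ofReal (exp (-lam * t)) * pot (PT K q) g t x ≤ pot (eK lam (PT K q)) g t x := by
    simp only [pot]
    rw [← lintegral_const_mul _ ((act_meas hPm hg).comp (by fun_prop) (by fun_prop))]
    refine setLIntegral_mono ?_ fun s hs => ?_
    · exact (act_meas (KMeas.comp (A := eK lam (PT K q)) (Measurable.mul (by fun_prop) hPm) (by fun_prop) (by fun_prop) (by fun_prop)) hg).comp (by fun_prop) (by fun_prop)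
    · rw [act_eK hPm hg]
      gcongr ?_ * _
      apply ENNReal.ofReal_le_ofReal
      apply exp_le_exp.2
      have := hs.2.le; nlinarith
  have k3 : ENNReal.ofReal (exp (-lam * t)) * (act (PT K q) φ t x + pot (PT K q) g t x) ≤ φ x := by
    rw [mul_add]; exact (add_le_add le_rfl k2).trans k
  calc act (PT K q) φ t x + pot (PT K q) g t x
      = ENNReal.ofReal (exp (lam * t)) * (ENNReal.ofReal (exp (-lam * t)) * (act (PT K q) φ t x + pot (PT K q) g t x)) := by
        rw [← mul_assoc, ← ENNReal.ofReal_mul (by positivity), ← exp_add]; simp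
    _ ≤ _ := by gcongr
end P1c

section P2a
set_option linter.unusedSectionVars false

lemma ball_int (d : ℕ) (hd : 0 < d) {e : ℝ} (he : e < d) :
    ∃ C : ℝ≥0, ∀ a : ℝ, 0 < a → ∫⁻ z in Metric.ball (0 : Ed d) a, ENNReal.ofReal (‖z‖ ^ (-e)) ≤
      C * ENNReal.ofReal (a ^ ((d : ℝ) - e)) := by
  haveI : NeZero d := ⟨hd.ne'⟩
  haveI : Nontrivial (Ed d) := by
    haveI : Nonempty (Fin d) := ⟨⟨0, hd⟩⟩
    exact inferInstance
  have hI : IntegrableOn (fun z : Ed d => ‖z‖ ^ (-e)) (Metric.ball 0 1) := by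
    rw [integrableOn_fun_norm_addHaar volume (f := fun y => y ^ (-e))]
    simp only [finrank_euclideanSpace, Fintype.card_fin, smul_eq_mul]
    have h1 : IntegrableOn (fun y : ℝ => y ^ ((d : ℝ) - 1 - e)) (Ioo 0 1) :=
      ((intervalIntegral.intervalIntegrable_rpow' (a := 0) (b := 1) (by linarith)).1).mono_set Ioo_subset_Ioc_self
    refine h1.congr_fun (fun y hy => ?_) measurableSet_Ioo
    simp only
    rw [sub_eq_add_neg ((d : ℝ) - 1), rpow_add hy.1, ← rpow_natCast, Nat.cast_sub hd]
    simp
  have hfin : ∫⁻ z in Metric.ball (0 : Ed d) 1, ENNReal.ofReal (‖z‖ ^ (-e)) ≠ ∞ := by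
    have := hI.2
    rw [hasFiniteIntegral_iff_ofReal (Eventually.of_forall fun z => by positivity)] at this
    exact this.ne
  refine ⟨(∫⁻ z in Metric.ball (0 : Ed d) 1, ENNReal.ofReal (‖z‖ ^ (-e))).toNNReal, fun a ha => ?_⟩
  rw [ENNReal.coe_toNNReal hfin]
  have hmap := Measure.map_addHaar_smul (volume : Measure (Ed d)) ha.ne'
  simp only [finrank_euclideanSpace, Fintype.card_fin] at hmap
  have hemb : MeasurableEmbedding (fun x : Ed d => a • x) := (Homeomorph.smulOfNeZero a ha.ne').measurableEmbedding
  have e1 : ∫⁻ z in Metric.ball (0 : Ed d) a, ENNReal.ofReal (‖z‖ ^ (-e)) =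
      ENNReal.ofReal (a ^ d) * ∫⁻ z in Metric.ball (0 : Ed d) a, ENNReal.ofReal (‖z‖ ^ (-e)) ∂(Measure.map (fun x : Ed d => a • x) volume) := by
    rw [hmap, Measure.restrict_smul, lintegral_smul_measure, smul_eq_mul, ← mul_assoc, ← ENNReal.ofReal_mul (by positivity),
      abs_of_pos (by positivity), mul_inv_cancel₀ (by positivity)]
    simp
  rw [e1, hemb.restrict_map, hemb.lintegral_map]
  have hpre : (fun x : Ed d => a • x) ⁻¹' Metric.ball 0 a = Metric.ball 0 1 := by
    ext x
    simp only [mem_preimage, Metric.mem_ball, dist_zero_right, norm_smul, Real.norm_eq_abs, abs_of_pos ha]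
    exact mul_lt_iff_lt_one_right ha
  rw [hpre]
  have e2 : ∀ x : Ed d, ENNReal.ofReal (‖a • x‖ ^ (-e)) = ENNReal.ofReal (a ^ (-e)) * ENNReal.ofReal (‖x‖ ^ (-e)) := by
    intro x
    rw [← ENNReal.ofReal_mul (by positivity), norm_smul, Real.norm_eq_abs, abs_of_pos ha, mul_rpow ha.le (norm_nonneg _)]
  simp_rw [e2]
  rw [lintegral_const_mul _ (by fun_prop), ← mul_assoc, ← ENNReal.ofReal_mul (by positivity), mul_comm]
  gcongr
  rw [← rpow_natCast, ← rpow_add ha]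
  exact le_rfl

/-- parabolic length scale -/
def rd (α t : ℝ) : ℝ := t ^ (1 / α)

lemma rd_pos {α t : ℝ} (ht : 0 < t) : 0 < rd α t := rpow_pos_of_pos ht _

lemma rd_pow {α t : ℝ} (hα : 0 < α) (ht : 0 < t) : rd α t ^ α = t := by
  rw [rd, ← rpow_mul ht.le, one_div_mul_cancel hα.ne', rpow_one]

lemma rd_mono {α s t : ℝ} (hα : 0 < α) (hs : 0 < s) (hst : s ≤ t) : rd α s ≤ rd α t :=
  rpow_le_rpow hs.le hst (by positivity)

lemma rd_mul {α s t : ℝ} (hs : 0 ≤ s) (ht : 0 ≤ t) : rd α (s * t) = rd α s * rd α t :=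
  mul_rpow hs ht

def Wt {d : ℕ} (α t : ℝ) (x : Ed d) (e : ℝ) : ℝ≥0∞ := ENNReal.ofReal ((1 + rd α t / ‖x‖) ^ e)

def Dt (d : ℕ) (α t : ℝ) : ℝ≥0∞ := ENNReal.ofReal ((rd α t ^ d)⁻¹)

structure HKB (d : ℕ) (α : ℝ) (K : ℝ → Ed d → Ed d → ℝ≥0∞) : Prop extends HK K where
  mass : ∀ t, 0 < t → ∀ x, ∫⁻ z, K t x z = ENNReal.ofReal (exp (-t))
  k2 : ∀ T : ℝ, 0 < T → ∃ C : ℝ≥0, ∀ t, 0 < t → t ≤ T → ∀ x y, K t x y ≤ C * Dt d α t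
  k3 : ∀ T : ℝ, 0 < T → ∀ k : ℝ, 0 < k → ∃ C : ℝ≥0, ∀ t, 0 < t → t ≤ T → ∀ x y : Ed d,
    ‖x‖ ≤ k * rd α t → ‖y‖ ≤ k * rd α t → Dt d α t ≤ C * K t x y
  k4 : ∀ T : ℝ, 0 < T → ∀ k : ℝ, 0 < k → ∃ C : ℝ≥0, ∀ s t, 0 < s → s ≤ 2 * t → t ≤ T → ∀ x y z : Ed d,
    ‖x‖ ≤ k * rd α t → ‖z‖ ≤ k * rd α t → 2 * (k * rd α t) ≤ ‖y‖ → K s z y ≤ C * K t x y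

structure POT (d : ℕ) (α β b₀ ε : ℝ) (K : ℝ → Ed d → Ed d → ℝ≥0∞) (q : ℝ → ℝ) (h V : ℝ → ℝ → ℝ) : Prop where
  hα : 0 < α
  hb₀ : 0 < b₀
  hbβ : b₀ < β
  hβd : 2 * β + α ≤ d
  hbε : β - b₀ < ε
  hbα : β - b₀ < α
  hεα : ε ≤ α
  qm : Measurable q
  hm : ∀ b, Measurable (h b)
  Vm : ∀ b, Measurable (V b)
  q0 : ∀ r, 0 < r → 0 ≤ q r
  V0 : ∀ b ∈ Icc b₀ β, ∀ r, 0 < r → 0 ≤ V b r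
  ident : ∀ b ∈ Icc b₀ β, ∀ t, 0 < t → ∀ x : Ed d, x ≠ 0 →
    act K (fun z => ENNReal.ofReal (h b ‖z‖)) t x +
      pot K (fun z => ENNReal.ofReal (V b ‖z‖ * h b ‖z‖)) t x = ENNReal.ofReal (h b ‖x‖)
  qle : ∃ C : ℝ, 0 < C ∧ ∀ r, 0 < r → q r ≤ C * (r ^ (-α) + r ^ (-(α / 2)))
  Vle : ∃ C : ℝ, 0 < C ∧ ∀ b ∈ Icc b₀ β, ∀ r, 0 < r → V b r ≤ C * (r ^ (-α) + 1)
  hpos : ∀ b ∈ Icc b₀ β, ∀ r, 0 < r → 0 < h b r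
  hle : ∀ b ∈ Icc b₀ β, ∀ r, 0 < r → h b r ≤ r ^ (-b)
  hge : ∀ R : ℝ, 0 < R → ∃ c : ℝ, 0 < c ∧ ∀ b ∈ Icc b₀ β, ∀ r, 0 < r → r ≤ R → c * r ^ (-b) ≤ h b r
  gap : ∀ b ∈ Ico b₀ β, ∃ c r₁ : ℝ, 0 < c ∧ 0 < r₁ ∧ ∀ r, 0 < r → r ≤ r₁ → c * r ^ (-α) ≤ q r - V b r
  near : ∃ C r₁ : ℝ, 0 < C ∧ 0 < r₁ ∧ ∀ r, 0 < r → r ≤ r₁ → q r - V β r ≤ C * r ^ (-α + ε) ∧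
    ∀ b ∈ Icc b₀ β, V b r - q r ≤ C * r ^ (-α + ε)

end P2a

section P2b
set_option linter.unusedSectionVars false

lemma one_add_rpow_le {w e : ℝ} (hw : 0 ≤ w) (he : 0 ≤ e) : (1 + w) ^ e ≤ 2 ^ e * (1 + w ^ e) := by
  rcases le_total w 1 with h | h
  · calc (1 + w) ^ e ≤ 2 ^ e := rpow_le_rpow (by linarith) (by linarith) he
      _ ≤ 2 ^ e * (1 + w ^ e) := le_mul_of_one_le_right (by positivity) (by have := rpow_nonneg hw e; linarith)
  · calc (1 + w) ^ e ≤ (2 * w) ^ e := rpow_le_rpow (by linarith) (by linarith) he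
      _ = 2 ^ e * w ^ e := mul_rpow (by norm_num) hw
      _ ≤ 2 ^ e * (1 + w ^ e) := by gcongr; linarith

variable {d : ℕ} {α β b₀ ε : ℝ} {K : ℝ → Ed d → Ed d → ℝ≥0∞} {q : ℝ → ℝ} {h V : ℝ → ℝ → ℝ}

lemma scale_facts (hα : 0 < α) {T τ r : ℝ} (hτ : 0 < τ) (hτT : τ ≤ T) (hr : 0 < r) :
    τ * r ^ (-α) = (rd α τ / r) ^ α ∧ τ * r ^ (-(α / 2)) ≤ T ^ (1 / 2 : ℝ) * (rd α τ / r) ^ (α / 2) ∧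
    (∀ ε : ℝ, 0 ≤ ε → τ * r ^ (-α + ε) ≤ rd α T ^ ε * (rd α τ / r) ^ (α - ε)) ∧
    (∀ b : ℝ, rd α τ ^ b * r ^ (-b) = (rd α τ / r) ^ b) := by
  have hρ := rd_pos (α := α) hτ
  have h4 : ∀ b : ℝ, rd α τ ^ b * r ^ (-b) = (rd α τ / r) ^ b := by
    intro b
    rw [div_rpow hρ.le hr.le, rpow_neg hr.le]; rfl
  have h1 : τ * r ^ (-α) = (rd α τ / r) ^ α := by rw [← h4 α, rd_pow hα hτ]
  refine ⟨h1, ?_, ?_, h4⟩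
  · rw [← h4 (α / 2), ← mul_assoc]
    gcongr
    have : rd α τ ^ (α / 2) = τ ^ (1 / 2 : ℝ) := by
      rw [rd, ← rpow_mul hτ.le]; congr 1; field_simp
    rw [this]
    calc τ = τ ^ (1 / 2 : ℝ) * τ ^ (1 / 2 : ℝ) := by rw [← rpow_add hτ]; norm_num
      _ ≤ _ := by gcongr
  · intro ε hε
    rw [rpow_add hr, ← mul_assoc, h1]
    have : (rd α τ / r) ^ α * r ^ ε = rd α τ ^ ε * (rd α τ / r) ^ (α - ε) := by
      rw [rpow_sub (by positivity), div_rpow hρ.le hr.le ε]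
      field_simp
    rw [this]
    gcongr
    exact rd_mono hα hτ hτT

set_option maxHeartbeats 1000000 in
lemma mass_real (hP : POT d α β b₀ ε K q h V) {T : ℝ} (hT : 0 < T) {b : ℝ} (hb : b ∈ Ico b₀ β) :
    ∃ A L c C : ℝ, 0 < A ∧ 0 < L ∧ 0 < c ∧ 0 < C ∧ ∀ τ, 0 < τ → τ ≤ T → ∀ r, 0 < r → ∀ φ : ℝ,
      φ = 1 + A * (rd α τ ^ β * h β r) - rd α τ ^ b * h b r →
      c * (1 + rd α τ / r) ^ β ≤ φ ∧ φ ≤ C * (1 + rd α τ / r) ^ β ∧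
      τ * (q r * φ) + c * (1 + rd α τ / r) ^ (α + b) + τ * (rd α τ ^ b * (V b r * h b r)) ≤
        τ + τ * (A * (rd α τ ^ β * (V β r * h β r))) + L * φ := by
  obtain ⟨hα, hb₀, hbβ, hβd, hbε, hbα, hεα, -, -, -, hq0, hV0, -, ⟨C1, hC1, hq⟩, ⟨C2, hC2, hV⟩, hpos, hle, hge, hgap, ⟨C3, r2, hC3, hr2, hnear⟩⟩ := hP
  have hbI : b ∈ Icc b₀ β := ⟨hb.1, hb.2.le⟩
  have hβI : β ∈ Icc b₀ β := ⟨hbβ.le, le_rfl⟩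
  obtain ⟨c1, r3, hc1, hr3, hgap⟩ := hgap b hb
  have hb0 : 0 < b := hb₀.trans_le hb.1
  have hβ0 : 0 < β := hb0.trans hb.2
  have hε : 0 < ε := by linarith [hb.1]
  set r1 := min r2 r3 with hr1d
  have hr1 : 0 < r1 := lt_min hr2 hr3
  set ρT := rd α T with hρT
  have hρT0 : 0 < ρT := rd_pos hT
  set R := max r1 (ρT * 2 ^ (1 / b)) with hR
  have hR0 : 0 < R := lt_max_of_lt_left hr1
  obtain ⟨ch, hch, hge⟩ := hge R hR0
  set A := (2 ^ (β / b) + 1) / ch with hA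
  have hA0 : 0 < A := by positivity
  set g := c1 * ch with hg
  have hg0 : 0 < g := by positivity
  set c := min (2 ^ (-β - 1) : ℝ) (g / (4 * 2 ^ (α + b))) with hc
  have hc0 : 0 < c := lt_min (by positivity) (by positivity)
  obtain ⟨W, hW1, hWr, hWa, hWb⟩ : ∃ W : ℝ, 1 ≤ W ∧ ρT / r1 ≤ W ∧
      (∀ w, W ≤ w → 4 * C1 * (1 + T ^ (1 / 2 : ℝ)) / g ≤ w ^ b) ∧
      (∀ w, W ≤ w → 4 * A * C3 * ρT ^ ε / g ≤ w ^ (ε + b - β)) := by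
    have e1 := (tendsto_rpow_atTop hb0).eventually_ge_atTop (4 * C1 * (1 + T ^ (1 / 2 : ℝ)) / g)
    have e2 := (tendsto_rpow_atTop (y := ε + b - β) (by linarith [hb.1])).eventually_ge_atTop (4 * A * C3 * ρT ^ ε / g)
    obtain ⟨W1, h1⟩ := eventually_atTop.1 e1
    obtain ⟨W2, h2⟩ := eventually_atTop.1 e2
    exact ⟨max (max 1 (ρT / r1)) (max W1 W2), (le_max_left _ _).trans (le_max_left _ _),
      (le_max_right _ _).trans (le_max_left _ _),
      fun w hw => h1 w ((le_max_left _ _).trans ((le_max_right _ _).trans hw)),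
      fun w hw => h2 w ((le_max_right _ _).trans ((le_max_right _ _).trans hw))⟩
  have hW0 : 0 < W := by linarith
  set L := C1 * (W ^ α + T ^ (1 / 2 : ℝ) * W ^ (α / 2)) + (1 + W) ^ (α + b) + W ^ b * (C2 * (W ^ α + T)) / c with hL
  have hL0 : 0 < L := by positivity
  refine ⟨A, L, c, 1 + A, hA0, hL0, hc0, by positivity, ?_⟩
  intro τ hτ hτT r hr φ hφ
  obtain ⟨s1, s2, s3, s4⟩ := scale_facts hα hτ hτT hr
  have hρ := rd_pos (α := α) hτ
  have hρle : rd α τ ≤ ρT := rd_mono hα hτ hτT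
  set ρ := rd α τ with hρd
  set w := ρ / r with hw
  have hw0 : 0 < w := by positivity
  set a := ρ ^ β * h β r with ha
  set e := ρ ^ b * h b r with he
  have ha0 : 0 < a := mul_pos (by positivity) (hpos β hβI r hr)
  have he0 : 0 < e := mul_pos (by positivity) (hpos b hbI r hr)
  have ha1 : a ≤ w ^ β := by rw [ha, ← s4]; gcongr; exact hle β hβI r hr
  have he1 : e ≤ w ^ b := by rw [he, ← s4]; gcongr; exact hle b hbI r hr
  have ha2 : r ≤ R → ch * w ^ β ≤ a := by
    intro h1
    rw [ha, ← s4, mul_left_comm]; gcongr; exact hge β hβI r hr h1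
  have he2 : r ≤ R → ch * w ^ b ≤ e := by
    intro h1
    rw [he, ← s4, mul_left_comm]; gcongr; exact hge b hbI r hr h1
  have hX1 : 1 ≤ (1 + w) ^ β := one_le_rpow (by linarith) hβ0.le
  have hlow : c * (1 + w) ^ β ≤ φ := by
    rcases le_or_gt (w ^ b) (1 / 2) with h1 | h1
    · have hw1 : w ≤ 1 := by
        by_contra hcon
        have := one_le_rpow (not_le.1 hcon).le hb0.le
        linarith
      have : (1 + w) ^ β ≤ 2 ^ β := rpow_le_rpow (by linarith) (by linarith) hβ0.le
      have h3 : c * (1 + w) ^ β ≤ 2 ^ (-β - 1) * (2 : ℝ) ^ β := by gcongr; exact min_le_left _ _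
      have h4 : (2 : ℝ) ^ (-β - 1) * (2 : ℝ) ^ β = 1 / 2 := by
        rw [← rpow_add (by norm_num)]; ring_nf; rw [rpow_neg_one]; norm_num
      have := mul_pos hA0 ha0
      linarith
    · have hrR : r ≤ R := by
        have h2 : (1 / 2 : ℝ) ^ (1 / b) < w := by
          have := rpow_lt_rpow (by norm_num) h1 (show 0 < 1 / b by positivity)
          rwa [← rpow_mul hw0.le, mul_one_div_cancel hb0.ne', rpow_one] at this
        have h3 : r * w = ρ := by rw [hw]; field_simp
        have h5 : (1 / 2 : ℝ) ^ (1 / b) * 2 ^ (1 / b) = 1 := by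
          rw [← mul_rpow (by norm_num) (by norm_num)]; norm_num
        have : r ≤ ρ * 2 ^ (1 / b) := by
          rw [← h3, mul_assoc]
          refine le_mul_of_one_le_right hr.le ?_
          exact h5.symm.le.trans (mul_le_mul_of_nonneg_right h2.le (rpow_nonneg (by norm_num) _))
        exact this.trans ((by gcongr : ρ * 2 ^ (1 / b) ≤ ρT * 2 ^ (1 / b)).trans (le_max_right _ _))
      have h2 : w ^ b ≤ 2 ^ (β / b) * w ^ β := by
        have h3 : w ^ β = (w ^ b) ^ (β / b) := by
          rw [← rpow_mul hw0.le]; congr 1; field_simp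
        rw [h3, ← mul_rpow (by norm_num) (by positivity)]
        have h4 : 1 ≤ 2 * w ^ b := by linarith
        have h5 : 1 ≤ β / b := by rw [one_le_div hb0]; exact hb.2.le
        calc w ^ b ≤ 2 * w ^ b := by linarith
          _ = (2 * w ^ b) ^ (1 : ℝ) := (rpow_one _).symm
          _ ≤ _ := rpow_le_rpow_of_exponent_le h4 h5
      have h3 : A * a ≥ (2 ^ (β / b) + 1) * w ^ β := by
        calc A * a ≥ A * (ch * w ^ β) := by gcongr; exact ha2 hrR
          _ = _ := by rw [hA]; field_simp
      have h4 : c * (1 + w) ^ β ≤ 2 ^ (-β - 1) * (2 ^ β * (1 + w ^ β)) := by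
        gcongr
        · exact min_le_left _ _
        · exact one_add_rpow_le hw0.le hβ0.le
      have h6 : (2 : ℝ) ^ (-β - 1) * (2 : ℝ) ^ β = 1 / 2 := by
        rw [← rpow_add (by norm_num)]; ring_nf; rw [rpow_neg_one]; norm_num
      rw [← mul_assoc, h6] at h4
      have := rpow_pos_of_pos hw0 β
      rw [add_mul] at h3
      linarith
  have hφ0 : 0 < φ := (mul_pos hc0 (by linarith)).trans_le hlow
  have hcφ : c ≤ φ := (le_mul_of_one_le_right hc0.le hX1).trans hlow
  refine ⟨hlow, ?_, ?_⟩
  · have h1 : w ^ β ≤ (1 + w) ^ β := rpow_le_rpow hw0.le (by linarith) hβ0.le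
    have : A * a ≤ A * (1 + w) ^ β := by gcongr; exact ha1.trans h1
    rw [add_mul]
    linarith
  have hτq : τ * q r ≤ C1 * (w ^ α + T ^ (1 / 2 : ℝ) * w ^ (α / 2)) := by
    calc τ * q r ≤ τ * (C1 * (r ^ (-α) + r ^ (-(α / 2)))) := by gcongr; exact hq r hr
      _ = C1 * (τ * r ^ (-α) + τ * r ^ (-(α / 2))) := by ring
      _ ≤ _ := by rw [s1]; gcongr
  rcases le_or_gt W w with hWw | hWw
  · -- near
    have hw1 : 1 ≤ w := hW1.trans hWw
    have hrr1 : r ≤ r1 := by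
      have h1 : ρT / r1 ≤ w := hWr.trans hWw
      rw [hw, div_le_div_iff₀ hr1 hr] at h1
      by_contra hcon
      have : ρ * r1 < ρT * r := by
        calc ρ * r1 ≤ ρT * r1 := by gcongr
          _ < ρT * r := by gcongr; exact not_le.1 hcon
      linarith
    have hrR : r ≤ R := hrr1.trans (le_max_left _ _)
    have hn := (hnear r hr (hrr1.trans (min_le_left _ _))).1
    have hgp := hgap r hr (hrr1.trans (min_le_right _ _))
    have n1 : τ * q r ≤ g / 4 * w ^ (α + b) := by
      have h1 : w ^ (α / 2) ≤ w ^ α := rpow_le_rpow_of_exponent_le hw1 (by linarith)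
      calc τ * q r ≤ C1 * (w ^ α + T ^ (1 / 2 : ℝ) * w ^ (α / 2)) := hτq
        _ ≤ C1 * (w ^ α + T ^ (1 / 2 : ℝ) * w ^ α) := by gcongr
        _ = g / 4 * w ^ α * (4 * C1 * (1 + T ^ (1 / 2 : ℝ)) / g) := by field_simp
        _ ≤ g / 4 * w ^ α * w ^ b := by gcongr; exact hWa w hWw
        _ = _ := by rw [rpow_add hw0]; ring
    have n2 : A * (τ * a * (q r - V β r)) ≤ g / 4 * w ^ (α + b) := by
      calc A * (τ * a * (q r - V β r)) ≤ A * (τ * a * (C3 * r ^ (-α + ε))) := by gcongr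
        _ = A * C3 * a * (τ * r ^ (-α + ε)) := by ring
        _ ≤ A * C3 * w ^ β * (ρT ^ ε * w ^ (α - ε)) := mul_le_mul (mul_le_mul_of_nonneg_left ha1 (by positivity)) (s3 ε hε.le) (by positivity) (by positivity)
        _ = g / 4 * (w ^ β * w ^ (α - ε)) * (4 * A * C3 * ρT ^ ε / g) := by field_simp
        _ ≤ g / 4 * (w ^ β * w ^ (α - ε)) * w ^ (ε + b - β) := by gcongr; exact hWb w hWw
        _ = g / 4 * w ^ (α + b) := by
          rw [mul_assoc, ← rpow_add hw0, ← rpow_add hw0]; congr 2; ring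
    have n3 : c * (1 + w) ^ (α + b) ≤ g / 4 * w ^ (α + b) := by
      calc c * (1 + w) ^ (α + b) ≤ g / (4 * 2 ^ (α + b)) * (2 * w) ^ (α + b) := by
            gcongr
            · exact min_le_right _ _
            · linarith
        _ = _ := by rw [mul_rpow (by norm_num) hw0.le]; field_simp
    have n4 : g * w ^ (α + b) ≤ τ * e * (q r - V b r) := by
      calc g * w ^ (α + b) = (ch * w ^ b) * (c1 * w ^ α) := by rw [rpow_add hw0, hg]; ring
        _ ≤ e * (c1 * (τ * r ^ (-α))) := by rw [s1]; gcongr; exact he2 hrR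
        _ = τ * e * (c1 * r ^ (-α)) := by ring
        _ ≤ _ := by gcongr
    have hid : τ * (q r * φ) + c * (1 + w) ^ (α + b) + τ * (ρ ^ b * (V b r * h b r)) - τ * (A * (ρ ^ β * (V β r * h β r)))
      = τ * q r + A * (τ * a * (q r - V β r)) - τ * e * (q r - V b r) + c * (1 + w) ^ (α + b) := by
      rw [hφ, ha, he]; ring
    have hp1 := mul_pos hL0 hφ0
    have hp2 : 0 < g * w ^ (α + b) := by positivity
    linarith
  · -- far
    have f1 : τ * (q r * φ) ≤ C1 * (W ^ α + T ^ (1 / 2 : ℝ) * W ^ (α / 2)) * φ := by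
      rw [← mul_assoc]
      refine mul_le_mul_of_nonneg_right (hτq.trans ?_) hφ0.le
      gcongr
    have f2 : c * (1 + w) ^ (α + b) ≤ (1 + W) ^ (α + b) * φ := by
      have : c ≤ φ := hcφ
      calc c * (1 + w) ^ (α + b) ≤ φ * (1 + W) ^ (α + b) := by gcongr
        _ = _ := mul_comm _ _
    have f3 : τ * (ρ ^ b * (V b r * h b r)) ≤ W ^ b * (C2 * (W ^ α + T)) / c * φ := by
      have h1 : τ * V b r ≤ C2 * (W ^ α + T) := by
        calc τ * V b r ≤ τ * (C2 * (r ^ (-α) + 1)) := by gcongr; exact hV b hbI r hr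
          _ = C2 * (τ * r ^ (-α) + τ) := by ring
          _ ≤ _ := by rw [s1]; gcongr
      have h2 : c ≤ φ := hcφ
      calc τ * (ρ ^ b * (V b r * h b r)) = e * (τ * V b r) := by rw [he]; ring
        _ ≤ W ^ b * (C2 * (W ^ α + T)) := by
          have := hV0 b hbI r hr
          gcongr
          exact he1.trans (by gcongr)
        _ = W ^ b * (C2 * (W ^ α + T)) / c * c := by field_simp
        _ ≤ _ := by gcongr
    have f4 : 0 ≤ τ * (A * (ρ ^ β * (V β r * h β r))) := by
      have := hV0 β hβI r hr
      have := (hpos β hβI r hr).le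
      positivity
    rw [hL, add_mul, add_mul]
    linarith
end P2b

section P2c
set_option linter.unusedSectionVars false

variable {d : ℕ} {α β b₀ ε : ℝ} {K : ℝ → Ed d → Ed d → ℝ≥0∞} {q : ℝ → ℝ} {h V : ℝ → ℝ → ℝ}

def qE (d : ℕ) (q : ℝ → ℝ) : Ed d → ℝ≥0∞ := fun z => ENNReal.ofReal (q ‖z‖)

abbrev PP (K : ℝ → Ed d → Ed d → ℝ≥0∞) (q : ℝ → ℝ) := PT K (qE d q)

lemma qE_meas (hq : Measurable q) : Measurable (qE d q) := by unfold qE; fun_prop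

lemma Wt_meas (α τ e : ℝ) : Measurable (fun z : Ed d => Wt α τ z e) := by unfold Wt; fun_prop

lemma POT.hd (hP : POT d α β b₀ ε K q h V) : 0 < d := by
  have h1 := hP.hα; have h2 := hP.hb₀; have h3 := hP.hbβ; have h4 := hP.hβd
  have : (0 : ℝ) < d := by linarith
  exact_mod_cast this

lemma ae_ne (hd : 0 < d) : ∀ᵐ z : Ed d, z ≠ 0 := by
  haveI : Nonempty (Fin d) := ⟨⟨0, hd⟩⟩
  have : Nontrivial (Ed d) := inferInstance
  have := (measure_singleton (μ := (volume : Measure (Ed d))) 0)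
  rw [ae_iff]
  simpa using this

lemma mass_ident (hK : HKB d α K) (t : ℝ) (ht : 0 < t) (x : Ed d) :
    act K (fun _ => 1) t x + pot K (fun _ => 1) t x = 1 := by
  have e1 : ∀ s, 0 < s → act K (fun _ => 1) s x = ENNReal.ofReal (exp (-s)) := by
    intro s hs
    simp only [act, mul_one]
    exact hK.mass s hs x
  unfold pot
  rw [setLIntegral_congr_fun measurableSet_Ioo (fun s hs => e1 s hs.1), e1 t ht]
  rw [← ofReal_integral_eq_lintegral_ofReal, ← integral_Ioc_eq_integral_Ioo, ← intervalIntegral.integral_of_le ht.le, ← ENNReal.ofReal_add]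
  · simp
  · positivity
  · simp [ht.le]
  · exact (Continuous.integrableOn_Ioc (by fun_prop)).mono_set Ioo_subset_Ioc_self
  · exact Eventually.of_forall fun s => (exp_pos _).le

set_option maxHeartbeats 1000000 in
lemma MQ (hK : HKB d α K) (hP : POT d α β b₀ ε K q h V) {T : ℝ} (hT : 0 < T) {b : ℝ} (hb : b ∈ Ico b₀ β) :
    ∃ C : ℝ≥0, ∀ τ, 0 < τ → τ ≤ T → ∀ x : Ed d, x ≠ 0 →
      (∀ s, 0 < s → s ≤ τ → act (PP K q) (fun z => Wt α τ z β) s x ≤ C * Wt α τ x β) ∧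
      pot (PP K q) (fun z => Wt α τ z (α + b)) τ x ≤ C * ENNReal.ofReal τ * Wt α τ x β := by
  obtain ⟨A, L, c, C, hA, hL, hc, hC, H⟩ := mass_real hP hT hb
  have hS := ae_ne hP.hd
  have hbI : b ∈ Icc b₀ β := ⟨hb.1, hb.2.le⟩
  have hβI : β ∈ Icc b₀ β := ⟨hP.hbβ.le, le_rfl⟩
  refine ⟨(c⁻¹ * (exp L * C)).toNNReal, fun τ hτ hτT x hx => ?_⟩
  have hρ := rd_pos (α := α) hτ
  set ρ := rd α τ with hρd
  have hm1 := hP.hm b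
  have hm2 := hP.hm β
  have hm3 := hP.Vm b
  have hm4 := hP.Vm β
  have hqm := hP.qm
  have hn : Measurable (fun z : Ed d => ‖z‖) := measurable_norm
  have sol := supersol_lam hK.toHK (qE_meas hP.qm)
    (φ := fun z : Ed d => ENNReal.ofReal (1 + A * (ρ ^ β * h β ‖z‖) - ρ ^ b * h b ‖z‖))
    (g := fun z : Ed d => ENNReal.ofReal (c / τ) * Wt α τ z (α + b))
    (u1 := fun z : Ed d => 1 + ENNReal.ofReal (A * ρ ^ β) * ENNReal.ofReal (h β ‖z‖))
    (u2 := fun z : Ed d => ENNReal.ofReal (ρ ^ b) * ENNReal.ofReal (h b ‖z‖))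
    (f1 := fun z : Ed d => 1 + ENNReal.ofReal (A * ρ ^ β) * ENNReal.ofReal (V β ‖z‖ * h β ‖z‖))
    (f2 := fun z : Ed d => ENNReal.ofReal (ρ ^ b) * ENNReal.ofReal (V b ‖z‖ * h b ‖z‖))
    (by fun_prop) ((Wt_meas _ _ _).const_mul _) (by fun_prop) (by fun_prop) (by fun_prop) (by fun_prop) hS
    ?_ ?_ ?_ ?_ (lam := L / τ) (by positivity) ?_
  · have key : ∀ s, 0 < s → s ≤ τ → act (PP K q) (fun z => ENNReal.ofReal (1 + A * (ρ ^ β * h β ‖z‖) - ρ ^ b * h b ‖z‖)) s x + pot (PP K q) (fun z => ENNReal.ofReal (c / τ) * Wt α τ z (α + b)) s x ≤ ENNReal.ofReal (exp L * C) * Wt α τ x β := by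
      intro s hs hsτ
      refine (sol s hs x hx).trans ?_
      rw [ENNReal.ofReal_mul (by positivity), mul_assoc, Wt, ← ENNReal.ofReal_mul hC.le]
      gcongr
      · calc L / τ * s ≤ L / τ * τ := by gcongr
          _ = L := by field_simp
      · exact (H τ hτ hτT _ (norm_pos_iff.2 hx) _ rfl).2.1
    have hCC : (((c⁻¹ * (exp L * C)).toNNReal : ℝ≥0) : ℝ≥0∞) = ENNReal.ofReal c⁻¹ * ENNReal.ofReal (exp L * C) := by
      rw [← ENNReal.ofReal_mul (by positivity)]; rfl
    rw [hCC]
    constructor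
    · intro s hs hsτ
      have h1 : act (PP K q) (fun z => Wt α τ z β) s x ≤ act (PP K q) (fun z => ENNReal.ofReal c⁻¹ * ENNReal.ofReal (1 + A * (ρ ^ β * h β ‖z‖) - ρ ^ b * h b ‖z‖)) s x := by
        refine act_mono (hS.mono fun z hz => ?_) _ _
        rw [Wt, ← ENNReal.ofReal_mul (by positivity)]
        refine ENNReal.ofReal_le_ofReal ?_
        have := (H τ hτ hτT _ (norm_pos_iff.2 hz) _ rfl).1
        rw [inv_mul_eq_div, le_div_iff₀ hc, mul_comm]
        exact this
      rw [act_cmul (PT_meas hK.toHK (qE_meas hP.qm)) (by fun_prop)] at h1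
      refine h1.trans ?_
      rw [mul_assoc]
      gcongr
      exact le_self_add.trans (key s hs hsτ)
    · have h1 := le_add_self.trans (key τ hτ le_rfl)
      rw [pot_cmul (PT_meas hK.toHK (qE_meas hP.qm)) (Wt_meas _ _ _)] at h1
      have h2 : ENNReal.ofReal (c⁻¹ * τ) * ENNReal.ofReal (c / τ) = 1 := by
        rw [← ENNReal.ofReal_mul (by positivity)]
        have : c⁻¹ * τ * (c / τ) = 1 := by field_simp
        rw [this, ENNReal.ofReal_one]
      calc pot (PP K q) (fun z => Wt α τ z (α + b)) τ x
          = ENNReal.ofReal (c⁻¹ * τ) * (ENNReal.ofReal (c / τ) * pot (PP K q) (fun z => Wt α τ z (α + b)) τ x) := by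
            rw [← mul_assoc, h2, one_mul]
        _ ≤ ENNReal.ofReal (c⁻¹ * τ) * (ENNReal.ofReal (exp L * C) * Wt α τ x β) := by gcongr
        _ = _ := by rw [ENNReal.ofReal_mul (by positivity)]; ring
  · intro t ht x hx
    rw [act_add hK.meas (by fun_prop), pot_add hK.meas (by fun_prop), act_cmul hK.meas (by fun_prop), pot_cmul hK.meas (by fun_prop),
      ← hP.ident β hβI t ht x hx, mul_add]
    have m := mass_ident hK t ht x
    rw [add_add_add_comm, m]
  · intro t ht x hx
    rw [act_cmul hK.meas (by fun_prop), pot_cmul hK.meas (by fun_prop),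
      ← hP.ident b hbI t ht x hx, mul_add]
  · intro x hx
    exact ENNReal.mul_ne_top ENNReal.ofReal_ne_top ENNReal.ofReal_ne_top
  · intro x hx
    have hp := (H τ hτ hτT _ (norm_pos_iff.2 hx) _ rfl).1
    have h1 := hP.hpos b hbI _ (norm_pos_iff.2 hx)
    have h2 := hP.hpos β hβI _ (norm_pos_iff.2 hx)
    rw [← ENNReal.ofReal_mul (by positivity), ← ENNReal.ofReal_mul (by positivity), ← ENNReal.ofReal_add (le_trans (by positivity) hp) (by positivity),
      ← ENNReal.ofReal_one, ← ENNReal.ofReal_add (by positivity) (by positivity)]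
    congr 1; ring
  · intro x hx
    have hx0 := norm_pos_iff.2 hx
    obtain ⟨hp, -, h3⟩ := H τ hτ hτT _ (norm_pos_iff.2 hx) _ rfl
    have h1 := hP.hpos b hbI _ hx0
    have h2 := hP.hpos β hβI _ hx0
    have v1 := hP.V0 b hbI _ hx0
    have v2 := hP.V0 β hβI _ hx0
    have q1 := hP.q0 _ hx0
    have hp0 := le_trans (by positivity) hp
    simp only [qE, Wt]
    rw [← ENNReal.ofReal_mul q1, ← ENNReal.ofReal_mul (by positivity), ← ENNReal.ofReal_mul (by positivity), ← ENNReal.ofReal_mul (by positivity), ← ENNReal.ofReal_mul (by positivity),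
      ← ENNReal.ofReal_one, ← ENNReal.ofReal_add (mul_nonneg q1 hp0) (by positivity), ← ENNReal.ofReal_add (add_nonneg (mul_nonneg q1 hp0) (by positivity)) (by positivity), ← ENNReal.ofReal_add (by positivity) (by positivity), ← ENNReal.ofReal_add (by positivity) (mul_nonneg (by positivity) hp0)]
    refine ENNReal.ofReal_le_ofReal ?_
    refine le_of_mul_le_mul_left ?_ hτ
    rw [← hρd] at h3 ⊢
    generalize (1 + ρ / ‖x‖) ^ (α + b) = X at *
    generalize ρ ^ b = Y at *
    generalize ρ ^ β = Z at *
    refine le_trans (le_of_eq ?_) (h3.trans (le_of_eq ?_))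
    · rw [mul_add, mul_add, ← mul_assoc τ (c / τ), mul_div_cancel₀ _ hτ.ne']
    · rw [mul_add, mul_add, ← mul_assoc τ (L / τ), mul_div_cancel₀ _ hτ.ne']; ring
end P2c

section P2d
set_option linter.unusedSectionVars false

variable {d : ℕ} {α β b₀ ε : ℝ} {K : ℝ → Ed d → Ed d → ℝ≥0∞} {q : ℝ → ℝ} {h V : ℝ → ℝ → ℝ}

lemma Wb_one {t : ℝ} (ht : 0 < t) (x : Ed d) : 1 ≤ 1 + rd α t / ‖x‖ := by
  have := (rd_pos (α := α) ht).le
  have : 0 ≤ rd α t / ‖x‖ := by positivity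
  linarith

lemma Wt_mul {t : ℝ} (ht : 0 < t) (x : Ed d) (e f : ℝ) : Wt α t x e * Wt α t x f = Wt α t x (e + f) := by
  have := Wb_one (α := α) ht x
  rw [Wt, Wt, Wt, ← ENNReal.ofReal_mul (by positivity), rpow_add (by linarith)]

lemma Wt_le_e {t : ℝ} (ht : 0 < t) (x : Ed d) {e f : ℝ} (hef : e ≤ f) : Wt α t x e ≤ Wt α t x f :=
  ENNReal.ofReal_le_ofReal (rpow_le_rpow_of_exponent_le (Wb_one ht x) hef)

lemma one_le_Wt {t : ℝ} (ht : 0 < t) (x : Ed d) {e : ℝ} (he : 0 ≤ e) : 1 ≤ Wt α t x e := by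
  have := Wt_le_e (α := α) ht x he
  simpa [Wt] using this

lemma Wt_mono (hα : 0 < α) {s t : ℝ} (hs : 0 < s) (hst : s ≤ t) (x : Ed d) {e : ℝ} (he : 0 ≤ e) :
    Wt α s x e ≤ Wt α t x e := by
  have := Wb_one (α := α) hs x
  have := rd_mono hα hs hst
  exact ENNReal.ofReal_le_ofReal (rpow_le_rpow (by linarith) (by gcongr) he)

lemma Wt_ne_top (t : ℝ) (x : Ed d) (e : ℝ) : Wt α t x e ≠ ∞ := ENNReal.ofReal_ne_top

lemma Wt_scale (hα : 0 < α) {s t k : ℝ} (hs : 0 < s) (ht : 0 < t) (hk : 1 ≤ k) (hst : t ≤ k * s) (x : Ed d) {e : ℝ} (he : 0 ≤ e) :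
    Wt α t x e ≤ ENNReal.ofReal (rd α k ^ e) * Wt α s x e := by
  have h1 := Wb_one (α := α) hs x
  have h1' := Wb_one (α := α) ht x
  have h2 : rd α t ≤ rd α k * rd α s := by
    rw [← rd_mul (by linarith) hs.le]; exact rd_mono hα ht hst
  have h3 : 1 ≤ rd α k := one_le_rpow hk (by positivity)
  rw [Wt, Wt, ← ENNReal.ofReal_mul (by positivity), ← mul_rpow (by linarith) (by linarith)]
  refine ENNReal.ofReal_le_ofReal (rpow_le_rpow (by linarith) ?_ he)
  rw [mul_add, ← mul_div_assoc]
  gcongr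
  linarith

lemma Dt_anti (hα : 0 < α) {s t : ℝ} (hs : 0 < s) (hst : s ≤ t) : Dt d α t ≤ Dt d α s := by
  have := rd_pos (α := α) hs
  have h2 := rd_mono hα hs hst
  exact ENNReal.ofReal_le_ofReal (by gcongr)

lemma Dt_scale (hα : 0 < α) {s t k : ℝ} (hs : 0 < s) (ht : 0 < t) (hk : 1 ≤ k) (hst : t ≤ k * s) :
    Dt d α s ≤ ENNReal.ofReal (rd α k ^ d) * Dt d α t := by
  have h2 : rd α t ≤ rd α k * rd α s := by
    rw [← rd_mul (by linarith) hs.le]; exact rd_mono hα ht hst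
  have h0 := rd_pos (α := α) hs
  have h0' := rd_pos (α := α) ht
  have h3 : 0 < rd α k := rd_pos (by linarith)
  rw [Dt, Dt, ← ENNReal.ofReal_mul (by positivity)]
  refine ENNReal.ofReal_le_ofReal ?_
  rw [inv_eq_one_div, ← div_eq_mul_inv, div_le_div_iff₀ (by positivity) (by positivity), one_mul, ← mul_pow]
  gcongr

lemma PP_symm (hK : HKB d α K) (hP : POT d α β b₀ ε K q h V) (t : ℝ) (x y : Ed d) : PP K q t x y = PP K q t y x :=
  PT_symm hK.toHK (qE_meas hP.qm) t x y

lemma PP_ck (hK : HKB d α K) (hP : POT d α β b₀ ε K q h V) {s t : ℝ} (hs : 0 < s) (ht : 0 < t) (x y : Ed d) :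
    ∫⁻ w, PP K q s x w * PP K q t w y = PP K q (s + t) x y := PT_ck hK.toHK (qE_meas hP.qm) hs ht x y

lemma PP_meas (hK : HKB d α K) (hP : POT d α β b₀ ε K q h V) : KMeas (PP K q) :=
  PT_meas hK.toHK (qE_meas hP.qm)

lemma mass_le (hK : HKB d α K) (hP : POT d α β b₀ ε K q h V) {T : ℝ} (hT : 0 < T) :
    ∃ C : ℝ≥0, ∀ s τ, 0 < s → s ≤ τ → τ ≤ T → ∀ x : Ed d, x ≠ 0 →
      act (PP K q) (fun z => Wt α τ z β) s x ≤ C * Wt α τ x β := by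
  obtain ⟨C, hC⟩ := MQ hK hP hT (b := b₀) ⟨le_rfl, hP.hbβ⟩
  exact ⟨C, fun s τ hs hsτ hτ x hx => (hC τ (hs.trans_le hsτ) hτ x hx).1 s hs hsτ⟩

/-- `t q ≤ C W^α`. -/
lemma tq_le (hP : POT d α β b₀ ε K q h V) {T : ℝ} (hT : 0 < T) :
    ∃ C : ℝ≥0, ∀ t, 0 < t → t ≤ T → ∀ x : Ed d, x ≠ 0 → ENNReal.ofReal t * qE d q x ≤ C * Wt α t x α := by
  obtain ⟨C1, hC1, hq⟩ := hP.qle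
  have hα := hP.hα
  refine ⟨(C1 * (1 + T ^ (1 / 2 : ℝ))).toNNReal, fun t ht htT x hx => ?_⟩
  have hr := norm_pos_iff.2 hx
  obtain ⟨s1, s2, -, -⟩ := scale_facts hP.hα ht htT hr
  have h1 := Wb_one (α := α) ht x
  have hρ := rd_pos (α := α) ht
  rw [qE, Wt, ← ENNReal.ofReal_mul ht.le]
  have : (((C1 * (1 + T ^ (1 / 2 : ℝ))).toNNReal : ℝ≥0) : ℝ≥0∞) = ENNReal.ofReal (C1 * (1 + T ^ (1 / 2 : ℝ))) := rfl
  rw [this, ← ENNReal.ofReal_mul (by positivity)]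
  refine ENNReal.ofReal_le_ofReal ?_
  have a1 : (rd α t / ‖x‖) ^ α ≤ (1 + rd α t / ‖x‖) ^ α := rpow_le_rpow (by positivity) (by linarith) hα.le
  have a2 : (rd α t / ‖x‖) ^ (α / 2) ≤ (1 + rd α t / ‖x‖) ^ α :=
    (rpow_le_rpow (by positivity) (by linarith) (by positivity)).trans (rpow_le_rpow_of_exponent_le h1 (by linarith))
  calc t * q ‖x‖ ≤ t * (C1 * (‖x‖ ^ (-α) + ‖x‖ ^ (-(α / 2)))) := by gcongr; exact hq _ hr
    _ = C1 * (t * ‖x‖ ^ (-α) + t * ‖x‖ ^ (-(α / 2))) := by ring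
    _ ≤ C1 * ((1 + rd α t / ‖x‖) ^ α + T ^ (1 / 2 : ℝ) * (1 + rd α t / ‖x‖) ^ α) := by
      refine mul_le_mul_of_nonneg_left (add_le_add (by rw [s1]; exact a1) (s2.trans ?_)) hC1.le
      gcongr
    _ = _ := by ring

lemma potq_le (hK : HKB d α K) (hP : POT d α β b₀ ε K q h V) {T : ℝ} (hT : 0 < T) :
    ∃ C : ℝ≥0, ∀ t, 0 < t → t ≤ T → ∀ x : Ed d, x ≠ 0 → pot (PP K q) (qE d q) t x ≤ C * Wt α t x β := by
  obtain ⟨C, hC⟩ := MQ hK hP hT (b := b₀) ⟨le_rfl, hP.hbβ⟩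
  obtain ⟨C2, hC2⟩ := tq_le hP hT
  refine ⟨C2 * C, fun t ht htT x hx => ?_⟩
  have h1 := (hC t ht htT x hx).2
  have ht0 : ENNReal.ofReal t ≠ 0 := by simp [ht]
  rw [← ENNReal.mul_le_mul_iff_right ht0 ENNReal.ofReal_ne_top, ← pot_cmul (PT_meas hK.toHK (qE_meas hP.qm)) (qE_meas hP.qm)]
  calc pot (PP K q) (fun z => ENNReal.ofReal t * qE d q z) t x
      ≤ pot (PP K q) (fun z => C2 * Wt α t z (α + b₀)) t x := by
        refine pot_mono ((ae_ne hP.hd).mono fun z hz => (hC2 t ht htT z hz).trans ?_) _ _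
        gcongr
        exact Wt_le_e ht z (by linarith [hP.hb₀])
    _ = C2 * pot (PP K q) (fun z => Wt α t z (α + b₀)) t x := pot_cmul (PT_meas hK.toHK (qE_meas hP.qm)) (Wt_meas _ _ _) _ _ _
    _ ≤ C2 * (C * ENNReal.ofReal t * Wt α t x β) := by gcongr
    _ = _ := by push_cast; ring

lemma R_exists (hP : POT d α β b₀ ε K q h V) {T : ℝ} (hT : 0 < T) :
    ∃ R : ℝ, 1 ≤ R ∧ ∀ t, 0 < t → t ≤ T → ∀ x : Ed d, R * rd α t ≤ ‖x‖ → qE d q x ≤ ENNReal.ofReal (1 / (2 * t)) := by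
  obtain ⟨C1, hC1, hq⟩ := hP.qle
  have hα := hP.hα
  have l1 : Tendsto (fun w : ℝ => C1 * (w ^ α + T ^ (1 / 2 : ℝ) * w ^ (α / 2))) (nhds 0) (nhds (C1 * ((0:ℝ) ^ α + T ^ (1 / 2 : ℝ) * (0:ℝ) ^ (α / 2)))) := by
    have := (continuousAt_rpow_const 0 α (Or.inr hα.le)).tendsto
    have h2 := (continuousAt_rpow_const 0 (α / 2) (Or.inr (by positivity))).tendsto
    exact ((this.add (h2.const_mul _)).const_mul _)
  rw [zero_rpow hα.ne', zero_rpow (by positivity)] at l1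
  have := l1.eventually (Iio_mem_nhds (show C1 * (0 + T ^ (1 / 2 : ℝ) * 0) < 1 / 2 by norm_num))
  obtain ⟨e, he, hball⟩ := Metric.eventually_nhds_iff.1 this
  refine ⟨max 1 (2 / e), le_max_left _ _, fun t ht htT x hx => ?_⟩
  have hρ := rd_pos (α := α) ht
  have hR : 0 < max 1 (2 / e) := lt_of_lt_of_le one_pos (le_max_left _ _)
  have hr : 0 < ‖x‖ := lt_of_lt_of_le (by positivity) hx
  obtain ⟨s1, s2, -, -⟩ := scale_facts hP.hα ht htT hr
  refine ENNReal.ofReal_le_ofReal ?_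
  rw [le_div_iff₀ (by positivity)]
  have hw : rd α t / ‖x‖ ≤ e / 2 := by
    rw [div_le_iff₀ hr]
    calc rd α t = e / 2 * (2 / e * rd α t) := by field_simp
      _ ≤ e / 2 * ‖x‖ := by gcongr; exact le_trans (by gcongr; exact le_max_right _ _) hx
  have := hball (y := rd α t / ‖x‖) (by rw [dist_zero_right, Real.norm_eq_abs, abs_of_pos (by positivity)]; linarith)
  have h5 : t * q ‖x‖ ≤ C1 * ((rd α t / ‖x‖) ^ α + T ^ (1 / 2 : ℝ) * (rd α t / ‖x‖) ^ (α / 2)) := by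
    calc t * q ‖x‖ ≤ t * (C1 * (‖x‖ ^ (-α) + ‖x‖ ^ (-(α / 2)))) := by gcongr; exact hq _ hr
      _ = C1 * (t * ‖x‖ ^ (-α) + t * ‖x‖ ^ (-(α / 2))) := by ring
      _ ≤ _ := by rw [s1]; gcongr
  linarith

lemma absorbR (hK : HKB d α K) (hP : POT d α β b₀ ε K q h V) {T R : ℝ} 
    (hR : ∀ t, 0 < t → t ≤ T → ∀ x : Ed d, R * rd α t ≤ ‖x‖ → qE d q x ≤ ENNReal.ofReal (1 / (2 * t)))
    {t : ℝ} (ht : 0 < t) (htT : t ≤ T) (x y : Ed d) :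
    PP K q t x y ≤ 2 * (K t x y + cnv (mq (PP K q) ((Metric.ball (0 : Ed d) (R * rd α t)).indicator (qE d q))) K t x y) := by
  refine absorb hK.toHK (qE_meas hP.qm) measurableSet_ball (c := ENNReal.ofReal (1 / (2 * t))) ?_ ?_ x y
  · rw [← ENNReal.ofReal_mul (by positivity)]
    have : 1 / (2 * t) * t = 1 / 2 := by field_simp
    rw [this, ENNReal.ofReal_div_of_pos (by norm_num)]
    simp
  · refine Eventually.of_forall fun z hz => hR t ht htT z ?_
    simpa using hz

/-- bound for the absorbed term -/
lemma cnv_ball_le (hK : HKB d α K) (hP : POT d α β b₀ ε K q h V) {A : Set (Ed d)} {t : ℝ} {x y : Ed d} {B : ℝ≥0∞}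
    (hB : ∀ s, 0 < s → s < t → ∀ z ∈ A, K (t - s) z y ≤ B) :
    cnv (mq (PP K q) (A.indicator (qE d q))) K t x y ≤ B * pot (PP K q) (qE d q) t x := by
  have hm := PT_meas hK.toHK (qE_meas (d := d) hP.qm)
  have hqm := qE_meas (d := d) hP.qm
  have e1 : B * pot (PP K q) (qE d q) t x = ∫⁻ s in Ioo 0 t, ∫⁻ z, B * (PP K q s x z * qE d q z) := by
    unfold pot act
    rw [← lintegral_const_mul]
    · refine lintegral_congr fun s => ?_
      rw [lintegral_const_mul]
      exact (hm.comp measurable_const measurable_const measurable_id).mul hqm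
    · exact (act_meas hm hqm).comp (by fun_prop) (by fun_prop)
  rw [e1, ← lintegral_indicator measurableSet_Ioo]
  unfold cnv
  refine (lintegral_prod_le _).trans ?_
  refine lintegral_mono fun s => ?_
  by_cases hs : s ∈ Ioo 0 t
  · rw [indicator_of_mem hs]
    refine lintegral_mono fun z => ?_
    simp only [mq]
    by_cases hz : z ∈ A
    · rw [indicator_of_mem hz, mul_comm]
      gcongr
      exact hB s hs.1 hs.2 z hz
    · simp [hz]
  · rw [indicator_of_notMem hs]
    simp only [mem_Ioo, not_and_or, not_lt] at hs
    refine le_of_eq ?_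
    have : ∀ z : Ed d, mq (PP K q) (A.indicator (qE d q)) s x z * K (t - s) z y = 0 := by
      intro z
      rcases hs with hs | hs
      · simp [mq, PT_zero hK.toHK s hs]
      · simp [hK.zero (t - s) (by linarith)]
    simp [this]

/-- the estimate away from the origin -/
lemma far_est (hK : HKB d α K) (hP : POT d α β b₀ ε K q h V) {T R : ℝ} (hT : 0 < T) (hR1 : 1 ≤ R)
    (hR : ∀ t, 0 < t → t ≤ T → ∀ x : Ed d, R * rd α t ≤ ‖x‖ → qE d q x ≤ ENNReal.ofReal (1 / (2 * t))) :
    ∃ C : ℝ≥0, ∀ t, 0 < t → t ≤ T → ∀ x y : Ed d, x ≠ 0 → 2 * (R * rd α t) ≤ ‖y‖ →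
      PP K q t x y ≤ C * (K t x y + K t 0 y * Wt α t x β) := by
  obtain ⟨C1, h1⟩ := potq_le hK hP hT
  obtain ⟨C2, h2⟩ := hK.k4 T hT R (by linarith)
  refine ⟨2 * (1 + C2 * C1), fun t ht htT x y hx hy => ?_⟩
  have hρ := rd_pos (α := α) ht
  have h3 := cnv_ball_le hK hP (A := Metric.ball (0 : Ed d) (R * rd α t)) (t := t) (x := x) (y := y) (B := C2 * K t 0 y) (by
    intro s hs hst z hz
    refine h2 (t - s) t (by linarith) (by linarith) htT 0 y z ?_ ?_ hy
    · rw [norm_zero]; positivity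
    · simpa using (Metric.mem_ball.1 hz).le)
  calc PP K q t x y ≤ 2 * (K t x y + C2 * K t 0 y * (C1 * Wt α t x β)) := by
        refine (absorbR hK hP hR ht htT x y).trans ?_
        gcongr
        refine h3.trans ?_
        gcongr
        exact h1 t ht htT x hx
    _ = 2 * (1 * K t x y + C2 * C1 * (K t 0 y * Wt α t x β)) := by ring
    _ ≤ 2 * ((1 + C2 * C1) * K t x y + (1 + C2 * C1) * (K t 0 y * Wt α t x β)) := by
        gcongr
        · exact le_self_add
        · exact le_add_self
    _ = _ := by push_cast; ring

lemma base_est (hK : HKB d α K) (hP : POT d α β b₀ ε K q h V) {T : ℝ} (hT : 0 < T) :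
    ∃ C : ℝ≥0, ∀ t, 0 < t → t ≤ T → ∀ x y : Ed d, x ≠ 0 → y ≠ 0 →
      PP K q t x y ≤ C * (Dt d α t * Wt α t x β * Wt α t y d) := by
  obtain ⟨R, hR1, hR⟩ := R_exists hP hT
  obtain ⟨C1, h1⟩ := far_est hK hP hT hR1 hR
  obtain ⟨C2, h2⟩ := hK.k2 T hT
  obtain ⟨C3, h3⟩ := mass_le hK hP hT
  have hα := hP.hα
  have hβ : 0 < β := hP.hb₀.trans hP.hbβ
  have F : ∀ t, 0 < t → t ≤ T → ∀ x y : Ed d, x ≠ 0 → 2 * (R * rd α t) ≤ ‖y‖ → PP K q t x y ≤ C1 * (2 * C2) * (Dt d α t * Wt α t x β) := by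
    intro t ht htT x y hx hy
    calc PP K q t x y ≤ C1 * (K t x y + K t 0 y * Wt α t x β) := h1 t ht htT x y hx hy
      _ ≤ C1 * (C2 * Dt d α t * Wt α t x β + C2 * Dt d α t * Wt α t x β) := by
        gcongr
        · exact (h2 t ht htT x y).trans (le_mul_of_one_le_right' (one_le_Wt ht x hβ.le))
        · exact h2 t ht htT 0 y
      _ = _ := by ring
  refine ⟨C1 * (2 * C2) * (1 + C3 * ((2 * R) ^ d).toNNReal), fun t ht htT x y hx hy => ?_⟩
  have hρ := rd_pos (α := α) ht
  have hy0 := norm_pos_iff.2 hy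
  rcases le_or_gt (2 * (R * rd α t)) ‖y‖ with hyy | hyy
  · refine (F t ht htT x y hx hyy).trans ?_
    push_cast
    rw [mul_assoc _ (1 + _ : ℝ≥0∞)]
    refine mul_le_mul_right ?_ _
    calc Dt d α t * Wt α t x β = 1 * (Dt d α t * Wt α t x β * 1) := by ring
      _ ≤ _ := by
        gcongr
        · exact le_self_add
        · exact one_le_Wt ht y (by positivity)
  · set s := (‖y‖ / (2 * R)) ^ α with hs
    have hs0 : 0 < s := by positivity
    have hrs : rd α s = ‖y‖ / (2 * R) := by
      rw [rd, hs, ← rpow_mul (by positivity), mul_one_div_cancel hα.ne', rpow_one]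
    have hst : s < t := by
      rw [← rd_pow hα ht, hs]
      refine rpow_lt_rpow (by positivity) ?_ hα
      rw [div_lt_iff₀ (by positivity)]; linarith
    have e := PT_ck hK.toHK (qE_meas hP.qm) (s := t - s) (t := s) (by linarith) hs0 x y
    rw [sub_add_cancel] at e
    have hD : Dt d α s ≤ ((2 * R) ^ d).toNNReal * (Dt d α t * Wt α t y d) := by
      have : ((((2 * R) ^ d).toNNReal : ℝ≥0) : ℝ≥0∞) = ENNReal.ofReal ((2 * R) ^ d) := rfl
      rw [this, Dt, Dt, Wt, ← ENNReal.ofReal_mul (by positivity), ← ENNReal.ofReal_mul (by positivity)]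
      refine ENNReal.ofReal_le_ofReal ?_
      rw [hrs, rpow_natCast]
      calc ((‖y‖ / (2 * R)) ^ d)⁻¹ = (2 * R) ^ d * ((rd α t ^ d)⁻¹ * (rd α t / ‖y‖) ^ d) := by
            rw [div_pow, div_pow]; field_simp
        _ ≤ _ := by gcongr; linarith
    calc PP K q t x y = ∫⁻ w, PP K q (t - s) x w * PP K q s w y := e.symm
      _ ≤ ∫⁻ w, (C1 * (2 * C2) * Dt d α s) * (PP K q (t - s) x w * Wt α t w β) := by
        refine lintegral_mono_ae ((ae_ne hP.hd).mono fun w hw => ?_)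
        calc PP K q (t - s) x w * PP K q s w y ≤ PP K q (t - s) x w * (C1 * (2 * C2) * (Dt d α s * Wt α t w β)) := by
              gcongr
              refine (F s hs0 (hst.le.trans htT) w y hw ?_).trans ?_
              · rw [hrs]; refine le_of_eq ?_; field_simp
              · gcongr
                exact Wt_mono hα hs0 hst.le w hβ.le
          _ = _ := by ring
      _ = C1 * (2 * C2) * Dt d α s * act (PP K q) (fun w => Wt α t w β) (t - s) x := by
        rw [lintegral_const_mul]; rfl
        exact ((PT_meas hK.toHK (qE_meas hP.qm)).comp measurable_const measurable_const measurable_id).mul (Wt_meas _ _ _)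
      _ ≤ C1 * (2 * C2) * (((2 * R) ^ d).toNNReal * (Dt d α t * Wt α t y d)) * (C3 * Wt α t x β) := by
        gcongr
        exact h3 (t - s) t (by linarith) (by linarith) htT x hx
      _ = C1 * (2 * C2) * (C3 * ((2 * R) ^ d).toNNReal) * (Dt d α t * Wt α t x β * Wt α t y d) := by ring
      _ ≤ _ := by
        push_cast
        gcongr
        exact le_add_self

def ODG (d : ℕ) (α β : ℝ) (P : ℝ → Ed d → Ed d → ℝ≥0∞) (T γ : ℝ) : Prop :=
  ∃ C : ℝ≥0, ∀ t, 0 < t → t ≤ T → ∀ x y : Ed d, x ≠ 0 → y ≠ 0 →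
      P t x y ≤ C * (Dt d α t * Wt α t x β * Wt α t y γ)

lemma W_interp {t : ℝ} (ht : 0 < t) (z y : Ed d) {γ ω β : ℝ} (hω : 0 ≤ ω) (hωγ : β ≤ γ - ω) {P D : ℝ≥0∞}
    (h1 : P ≤ D * (Wt α t z β * Wt α t y γ)) (h2 : P ≤ D * (Wt α t y β * Wt α t z γ)) :
    P ≤ D * (Wt α t z (β + ω) * Wt α t y (γ - ω)) := by
  have hz := Wb_one (α := α) ht z
  have hy := Wb_one (α := α) ht y
  have mono : ∀ (u v : Ed d) (e : ℝ), 0 ≤ e → 1 + rd α t / ‖u‖ ≤ 1 + rd α t / ‖v‖ → Wt α t u e ≤ Wt α t v e := by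
    intro u v e he huv
    have := Wb_one (α := α) ht u
    exact ENNReal.ofReal_le_ofReal (rpow_le_rpow (by linarith) huv he)
  rcases le_total (1 + rd α t / ‖z‖) (1 + rd α t / ‖y‖) with hc | hc
  · refine h2.trans ?_
    have e1 : Wt α t z γ = Wt α t z (β + ω) * Wt α t z (γ - ω - β) := by rw [Wt_mul ht]; congr 1; ring
    have e2 : Wt α t y (γ - ω) = Wt α t y β * Wt α t y (γ - ω - β) := by rw [Wt_mul ht]; congr 1; ring
    rw [e1, e2]
    calc D * (Wt α t y β * (Wt α t z (β + ω) * Wt α t z (γ - ω - β)))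
        ≤ D * (Wt α t y β * (Wt α t z (β + ω) * Wt α t y (γ - ω - β))) := by
          gcongr; exact mono _ _ _ (by linarith) hc
      _ = _ := by ring
  · refine h1.trans ?_
    have e1 : Wt α t y γ = Wt α t y (γ - ω) * Wt α t y ω := by rw [Wt_mul ht]; congr 1; ring
    rw [e1, ← Wt_mul ht z]
    calc D * (Wt α t z β * (Wt α t y (γ - ω) * Wt α t y ω))
        ≤ D * (Wt α t z β * (Wt α t y (γ - ω) * Wt α t z ω)) := by
          gcongr; exact mono _ _ _ hω hc
      _ = _ := by ring

lemma ODG_step (hK : HKB d α K) (hP : POT d α β b₀ ε K q h V) {T : ℝ} (hT : 0 < T) {γ ω : ℝ}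
    (hω : 0 ≤ ω) (hω2 : β + ω ≤ α + b₀) (hωγ : β ≤ γ - ω) (H : ODG d α β (PP K q) T γ) :
    ODG d α β (PP K q) T (γ - ω) := by
  obtain ⟨C, hC⟩ := H
  obtain ⟨C1, h1⟩ := MQ hK hP hT (b := b₀) ⟨le_rfl, hP.hbβ⟩
  have hα := hP.hα
  have hβ : 0 < β := hP.hb₀.trans hP.hbβ
  have hm := PT_meas hK.toHK (qE_meas (d := d) hP.qm)
  refine ⟨2 * C * (rd α 2 ^ d).toNNReal * C1, fun t ht htT x y hx hy => ?_⟩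
  have step : ∀ s, 0 < s → s < t / 2 → PP K q t x y ≤
      (C * (rd α 2 ^ d).toNNReal * Dt d α t * Wt α t y (γ - ω)) * act (PP K q) (fun z => Wt α t z (α + b₀)) s x := by
    intro s hs hst
    have e := PT_ck hK.toHK (qE_meas hP.qm) (s := s) (t := t - s) hs (by linarith) x y
    rw [add_sub_cancel] at e
    refine e.symm.le.trans ?_
    rw [act, ← lintegral_const_mul]
    swap
    · exact (hm.comp measurable_const measurable_const measurable_id).mul (Wt_meas _ _ _)
    refine lintegral_mono_ae ((ae_ne hP.hd).mono fun z hz => ?_)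
    have hts : 0 < t - s := by linarith
    have a1 := hC (t - s) hts (by linarith) z y hz hy
    have a2 := hC (t - s) hts (by linarith) y z hy hz
    rw [PP_symm hK hP] at a2
    rw [mul_assoc, ← mul_assoc] at a1 a2
    have a3 := W_interp hts z y hω hωγ (D := C * Dt d α (t - s)) a1 a2
    have a4 : Dt d α (t - s) ≤ (rd α 2 ^ d).toNNReal * Dt d α t := Dt_scale hα hts ht (by norm_num) (by linarith)
    calc PP K q s x z * PP K q (t - s) z y
        ≤ PP K q s x z * (C * ((rd α 2 ^ d).toNNReal * Dt d α t) * (Wt α t z (α + b₀) * Wt α t y (γ - ω))) := by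
          gcongr
          refine a3.trans ?_
          gcongr
          · exact (Wt_mono hα hts (by linarith) z (by linarith)).trans (Wt_le_e ht z hω2)
          · exact Wt_mono hα hts (by linarith) y (by linarith)
      _ = _ := by ring
  set B := (C * (rd α 2 ^ d).toNNReal * Dt d α t * Wt α t y (γ - ω)) with hB
  have avg : ENNReal.ofReal (t / 2) * PP K q t x y ≤ B * (C1 * ENNReal.ofReal t * Wt α t x β) := by
    calc ENNReal.ofReal (t / 2) * PP K q t x y = ∫⁻ s in Ioo 0 (t / 2), PP K q t x y := by
          rw [setLIntegral_const, Real.volume_Ioo, sub_zero, mul_comm]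
      _ ≤ ∫⁻ s in Ioo 0 (t / 2), B * act (PP K q) (fun z => Wt α t z (α + b₀)) s x :=
          setLIntegral_mono' measurableSet_Ioo fun s hs => step s hs.1 hs.2
      _ = B * ∫⁻ s in Ioo 0 (t / 2), act (PP K q) (fun z => Wt α t z (α + b₀)) s x := by
          rw [lintegral_const_mul]
          exact (act_meas hm (Wt_meas _ _ _)).comp (by fun_prop) (by fun_prop)
      _ ≤ B * pot (PP K q) (fun z => Wt α t z (α + b₀)) t x := by
          unfold pot
          gcongr
          linarith
      _ ≤ _ := by gcongr; exact (h1 t ht htT x hx).2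
  have ht0 : ENNReal.ofReal (t / 2) ≠ 0 := by simp [ht]
  rw [← ENNReal.mul_le_mul_iff_right ht0 ENNReal.ofReal_ne_top]
  refine avg.trans (le_of_eq ?_)
  have : ENNReal.ofReal t = 2 * ENNReal.ofReal (t / 2) := by
    rw [show (2 : ℝ≥0∞) = ENNReal.ofReal 2 by simp, ← ENNReal.ofReal_mul (by norm_num)]; congr 1; ring
  rw [this, hB]
  push_cast
  ring

lemma ondiag (hK : HKB d α K) (hP : POT d α β b₀ ε K q h V) {T : ℝ} (hT : 0 < T) :
    ODG d α β (PP K q) T β := by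
  set ω₀ := α + b₀ - β with hω₀
  have h0 : 0 < ω₀ := by linarith [hP.hbα]
  have hdβ : β ≤ d := by linarith [hP.hβd, hP.hα, hP.hb₀, hP.hbβ]
  have : ∀ n : ℕ, ODG d α β (PP K q) T (max β (d - n * ω₀)) := by
    intro n
    induction n with
    | zero =>
      obtain ⟨C, hC⟩ := base_est hK hP hT
      simp only [Nat.cast_zero, zero_mul, sub_zero, max_eq_right hdβ]
      exact ⟨C, hC⟩
    | succ n ih =>
      have h1 : (max β ((d : ℝ) - n * ω₀)) - max β (d - n * ω₀) + max β (d - (n + 1 : ℕ) * ω₀) = max β (d - (n + 1 : ℕ) * ω₀) := by ring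
      have h2 := ODG_step hK hP hT (γ := max β (d - n * ω₀)) (ω := max β (d - n * ω₀) - max β (d - (n + 1 : ℕ) * ω₀)) ?_ ?_ ?_ ih
      · simpa using h2
      · rw [sub_nonneg]; push_cast
        exact max_le_max le_rfl (by nlinarith)
      · have : max β ((d : ℝ) - n * ω₀) ≤ max β (d - (n + 1 : ℕ) * ω₀) + ω₀ := by
          refine max_le ?_ ?_
          · linarith [le_max_left β ((d : ℝ) - (n + 1 : ℕ) * ω₀)]
          · have := le_max_right β ((d : ℝ) - (n + 1 : ℕ) * ω₀)
            push_cast at this ⊢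
            linarith
        linarith
      · linarith [le_max_left β ((d : ℝ) - (n + 1 : ℕ) * ω₀)]
  obtain ⟨n, hn⟩ := exists_nat_gt (((d : ℝ) - β) / ω₀)
  have h3 := this n
  rw [div_lt_iff₀ h0] at hn
  rwa [max_eq_left (by linarith)] at h3
end P2d

section P2e
set_option linter.unusedSectionVars false

variable {d : ℕ} {α β b₀ ε : ℝ} {K : ℝ → Ed d → Ed d → ℝ≥0∞} {q : ℝ → ℝ} {h V : ℝ → ℝ → ℝ}

lemma Dt_mul {t : ℝ} (ht : 0 < t) : Dt d α t * ENNReal.ofReal (rd α t ^ d) = 1 := by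
  have := rd_pos (α := α) ht
  rw [Dt, ← ENNReal.ofReal_mul (by positivity), inv_mul_cancel₀ (by positivity), ENNReal.ofReal_one]

lemma ball_W (hd : 0 < d) {e R : ℝ} (he0 : 0 ≤ e) (he : e < d) (hR : 1 ≤ R) :
    ∃ C : ℝ≥0, ∀ t, 0 < t → ∫⁻ z in Metric.ball (0 : Ed d) (R * rd α t), Wt α t z e ≤ C * ENNReal.ofReal (rd α t ^ d) := by
  obtain ⟨C, hC⟩ := ball_int d hd he
  refine ⟨((R + 1) ^ e).toNNReal * (C * (R ^ (d - e)).toNNReal), fun t ht => ?_⟩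
  have hρ := rd_pos (α := α) ht
  have c1 : ((((R + 1) ^ e).toNNReal : ℝ≥0) : ℝ≥0∞) = ENNReal.ofReal ((R + 1) ^ e) := rfl
  have c2 : (((R ^ (d - e)).toNNReal : ℝ≥0) : ℝ≥0∞) = ENNReal.ofReal (R ^ (d - e)) := rfl
  calc ∫⁻ z in Metric.ball (0 : Ed d) (R * rd α t), Wt α t z e
      ≤ ∫⁻ z in Metric.ball (0 : Ed d) (R * rd α t), ENNReal.ofReal ((R + 1) ^ e * rd α t ^ e) * ENNReal.ofReal (‖z‖ ^ (-e)) := by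
        refine lintegral_mono_ae ?_
        refine (ae_restrict_iff' measurableSet_ball).2 ?_
        refine (ae_ne hd).mono fun z hz hzb => ?_
        have hz0 := norm_pos_iff.2 hz
        rw [mem_ball_zero_iff] at hzb
        rw [Wt, ← ENNReal.ofReal_mul (by positivity)]
        refine ENNReal.ofReal_le_ofReal ?_
        rw [rpow_neg hz0.le, ← div_eq_mul_inv, ← mul_rpow (by positivity) hρ.le, ← div_rpow (by positivity) hz0.le]
        refine rpow_le_rpow (by positivity) ?_ he0
        rw [le_div_iff₀ hz0, add_mul, div_mul_cancel₀ _ hz0.ne']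
        linarith
    _ = ENNReal.ofReal ((R + 1) ^ e * rd α t ^ e) * ∫⁻ z in Metric.ball (0 : Ed d) (R * rd α t), ENNReal.ofReal (‖z‖ ^ (-e)) :=
        lintegral_const_mul _ (by fun_prop)
    _ ≤ ENNReal.ofReal ((R + 1) ^ e * rd α t ^ e) * (C * ENNReal.ofReal ((R * rd α t) ^ (d - e))) := by
        gcongr; exact hC _ (by positivity)
    _ = _ := by
        push_cast
        rw [c1, c2, mul_rpow (by linarith) hρ.le, ENNReal.ofReal_mul (by positivity), ENNReal.ofReal_mul (by positivity)]
        have : ENNReal.ofReal (rd α t ^ d) = ENNReal.ofReal (rd α t ^ e) * ENNReal.ofReal (rd α t ^ (d - e)) := by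
          rw [← ENNReal.ofReal_mul (by positivity), ← rpow_add hρ, add_sub_cancel, rpow_natCast]
        rw [this]; ring

/-- volume of balls -/
lemma vol_ball (hd : 0 < d) {a : ℝ} (ha : 0 ≤ a) :
    volume (Metric.ball (0 : Ed d) a) = ENNReal.ofReal (a ^ d) * volume (Metric.ball (0 : Ed d) 1) := by
  have : Nonempty (Fin d) := ⟨⟨0, hd⟩⟩
  have : Nontrivial (Ed d) := inferInstance
  have := Measure.addHaar_ball (volume : Measure (Ed d)) 0 ha
  simpa using this

lemma vol_ball1 : volume (Metric.ball (0 : Ed d) 1) ≠ 0 ∧ volume (Metric.ball (0 : Ed d) 1) ≠ ∞ :=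
  ⟨(Metric.measure_ball_pos _ _ one_pos).ne', measure_ball_lt_top.ne⟩

lemma KK_le (hK : HKB d α K) (hd : 0 < d) {T R : ℝ} (hT : 0 < T) (hR : 1 ≤ R) :
    ∃ C : ℝ≥0, ∀ t, 0 < t → t ≤ T → ∀ x y : Ed d, 2 * (R * rd α t) ≤ ‖x‖ → 2 * (R * rd α t) ≤ ‖y‖ →
      ENNReal.ofReal (rd α t ^ d) * (K t 0 x * K t 0 y) ≤ C * K t x y := by
  have h2 : 0 < rd α 2 := rd_pos (by norm_num)
  obtain ⟨C4, h4⟩ := hK.k4 T hT (R * rd α 2) (by positivity)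
  obtain ⟨w0, w1⟩ := vol_ball1 (d := d)
  set ω := volume (Metric.ball (0 : Ed d) 1) with hω
  refine ⟨(ω⁻¹).toNNReal * (C4 * C4), fun t ht htT x y hx hy => ?_⟩
  have hρ := rd_pos (α := α) ht
  have hk : R * rd α 2 * rd α (t / 2) = R * rd α t := by
    rw [mul_assoc, ← rd_mul (by norm_num) (by positivity)]; congr 2; ring
  have hb : ∀ x, 2 * (R * rd α t) ≤ ‖x‖ → ∀ w ∈ Metric.ball (0 : Ed d) (R * rd α t), K t 0 x ≤ C4 * K (t / 2) w x := by
    intro x hx w hw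
    refine h4 t (t / 2) ht (by linarith) (by linarith) w x 0 ?_ ?_ ?_
    · rw [hk]; exact (mem_ball_zero_iff.1 hw).le
    · rw [hk, norm_zero]; positivity
    · rw [hk]; exact hx
  have e := hK.ck (t / 2) (t / 2) (by linarith) (by linarith) x y
  rw [add_halves] at e
  have key : ENNReal.ofReal (rd α t ^ d) * ω * (K t 0 x * K t 0 y) ≤ C4 * C4 * K t x y := by
    calc ENNReal.ofReal (rd α t ^ d) * ω * (K t 0 x * K t 0 y)
        ≤ volume (Metric.ball (0 : Ed d) (R * rd α t)) * (K t 0 x * K t 0 y) := by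
          rw [vol_ball hd (by positivity)]
          gcongr
          exact le_mul_of_one_le_left hρ.le hR
      _ = ∫⁻ w in Metric.ball (0 : Ed d) (R * rd α t), K t 0 x * K t 0 y := by
          rw [setLIntegral_const, mul_comm]
      _ ≤ ∫⁻ w in Metric.ball (0 : Ed d) (R * rd α t), C4 * C4 * (K (t / 2) x w * K (t / 2) w y) := by
          refine setLIntegral_mono' measurableSet_ball fun w hw => ?_
          calc K t 0 x * K t 0 y ≤ (C4 * K (t / 2) w x) * (C4 * K (t / 2) w y) := by
                gcongr
                · exact hb x hx w hw
                · exact hb y hy w hw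
            _ = _ := by rw [hK.symm _ w x]; ring
      _ ≤ ∫⁻ w, C4 * C4 * (K (t / 2) x w * K (t / 2) w y) := setLIntegral_le_lintegral _ _
      _ = C4 * C4 * K t x y := by
          rw [lintegral_const_mul, e]
          exact (hK.meas.comp measurable_const measurable_const measurable_id).mul (hK.meas.comp measurable_const measurable_id measurable_const)
  push_cast
  rw [ENNReal.coe_toNNReal (by simpa using w0)]
  calc ENNReal.ofReal (rd α t ^ d) * (K t 0 x * K t 0 y)
      = ω⁻¹ * (ENNReal.ofReal (rd α t ^ d) * ω * (K t 0 x * K t 0 y)) := by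
        rw [mul_comm (ENNReal.ofReal _) ω, mul_assoc ω, ← mul_assoc ω⁻¹, ENNReal.inv_mul_cancel w0 w1, one_mul]
    _ ≤ ω⁻¹ * (C4 * C4 * K t x y) := by gcongr
    _ = _ := by ring

lemma cnv_ball_le2 (hK : HKB d α K) (hP : POT d α β b₀ ε K q h V) {A : Set (Ed d)} (hA : MeasurableSet A) {t : ℝ} {x y : Ed d} {B : Ed d → ℝ≥0∞}
    (hB : ∀ s, 0 < s → s < t → ∀ z ∈ A, z ≠ 0 → PP K q s x z * K (t - s) z y ≤ B z) :
    cnv (mq (PP K q) (A.indicator (qE d q))) K t x y ≤ ENNReal.ofReal t * ∫⁻ z in A, B z * qE d q z := by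
  have e1 : ENNReal.ofReal t * ∫⁻ z in A, B z * qE d q z = ∫⁻ s in Ioo 0 t, ∫⁻ z in A, B z * qE d q z := by
    rw [setLIntegral_const, Real.volume_Ioo, sub_zero, mul_comm]
  rw [e1, ← lintegral_indicator measurableSet_Ioo]
  unfold cnv
  refine (lintegral_prod_le _).trans ?_
  refine lintegral_mono fun s => ?_
  by_cases hs : s ∈ Ioo 0 t
  · rw [indicator_of_mem hs, ← lintegral_indicator hA]
    refine lintegral_mono_ae ((ae_ne hP.hd).mono fun z hz0 => ?_)
    simp only [mq]
    by_cases hz : z ∈ A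
    · rw [indicator_of_mem hz, indicator_of_mem hz, mul_right_comm]
      gcongr
      exact hB s hs.1 hs.2 z hz hz0
    · simp [hz]
  · rw [indicator_of_notMem hs]
    simp only [mem_Ioo, not_and_or, not_lt] at hs
    refine le_of_eq ?_
    have : ∀ z : Ed d, mq (PP K q) (A.indicator (qE d q)) s x z * K (t - s) z y = 0 := by
      intro z
      rcases hs with hs | hs
      · simp [mq, PT_zero hK.toHK s hs]
      · simp [hK.zero (t - s) (by linarith)]
    simp [this]

lemma far_far (hK : HKB d α K) (hP : POT d α β b₀ ε K q h V) {T R : ℝ} (hT : 0 < T) (hR1 : 1 ≤ R)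
    (hR : ∀ t, 0 < t → t ≤ T → ∀ x : Ed d, R * rd α t ≤ ‖x‖ → qE d q x ≤ ENNReal.ofReal (1 / (2 * t))) :
    ∃ C : ℝ≥0, ∀ t, 0 < t → t ≤ T → ∀ x y : Ed d, 4 * (R * rd α t) ≤ ‖x‖ → 4 * (R * rd α t) ≤ ‖y‖ →
      PP K q t x y ≤ C * K t x y := by
  have hα := hP.hα
  have hβ : 0 < β := hP.hb₀.trans hP.hbβ
  obtain ⟨C1, h1⟩ := far_est hK hP hT hR1 hR
  obtain ⟨C2, h2⟩ := hK.k4 T hT R (by linarith)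
  obtain ⟨C3, h3⟩ := tq_le hP hT
  obtain ⟨C4, h4⟩ := ball_W (α := α) hP.hd (e := β + α) (R := R) (by positivity) (by linarith [hP.hβd]) hR1
  obtain ⟨C5, h5⟩ := KK_le hK hP.hd hT hR1
  refine ⟨2 * (1 + C1 * (2 * C2) * C2 * C3 * C4 * C5), fun t ht htT x y hx hy => ?_⟩
  have hρ := rd_pos (α := α) ht
  have hRρ : 0 < R * rd α t := by positivity
  set A := Metric.ball (0 : Ed d) (R * rd α t) with hA
  set M := C1 * (2 * C2) * C2 * (K t 0 x * K t 0 y) with hM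
  have hB := cnv_ball_le2 hK hP (A := A) measurableSet_ball (t := t) (x := x) (y := y) (B := fun z => M * Wt α t z β) (by
    intro s hs hst z hz hz0
    have hz' := (mem_ball_zero_iff.1 hz).le
    have a1 : K (t - s) z y ≤ C2 * K t 0 y :=
      h2 (t - s) t (by linarith) (by linarith) htT 0 y z (by rw [norm_zero]; positivity) hz' (by linarith)
    have hrs := rd_mono hα hs hst.le
    have a2 : PP K q s x z ≤ C1 * (C2 * K t 0 x * Wt α t z β + C2 * K t 0 x * Wt α t z β) := by
      rw [PP_symm hK hP]
      refine (h1 s hs (by linarith) z x hz0 ?_).trans ?_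
      · have : R * rd α s ≤ R * rd α t := by gcongr
        linarith
      · gcongr
        · refine (h2 s t hs (by linarith) htT 0 x z (by rw [norm_zero]; positivity) hz' (by linarith)).trans ?_
          exact le_mul_of_one_le_right' (one_le_Wt ht z hβ.le)
        · exact h2 s t hs (by linarith) htT 0 x 0 (by rw [norm_zero]; positivity) (by rw [norm_zero]; positivity) (by linarith)
        · exact Wt_mono hα hs hst.le z hβ.le
    calc _ ≤ C1 * (C2 * K t 0 x * Wt α t z β + C2 * K t 0 x * Wt α t z β) * (C2 * K t 0 y) := by gcongr
      _ = _ := by rw [hM]; ring)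
  have hc : ENNReal.ofReal t * ∫⁻ z in A, M * Wt α t z β * qE d q z ≤ C1 * (2 * C2) * C2 * C3 * C4 * C5 * K t x y := by
    have hm : Measurable (fun z => M * Wt α t z β * qE d q z) := ((Wt_meas _ _ _).const_mul _).mul (qE_meas hP.qm)
    rw [← lintegral_const_mul (f := fun z => M * Wt α t z β * qE d q z) _ hm]
    calc ∫⁻ z in A, ENNReal.ofReal t * (M * Wt α t z β * qE d q z)
        ≤ ∫⁻ z in A, M * C3 * Wt α t z (β + α) := by
          refine lintegral_mono_ae ((ae_restrict_of_ae (ae_ne hP.hd)).mono fun z hz => ?_)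
          calc ENNReal.ofReal t * (M * Wt α t z β * qE d q z) = M * Wt α t z β * (ENNReal.ofReal t * qE d q z) := by ring
            _ ≤ M * Wt α t z β * (C3 * Wt α t z α) := mul_le_mul_right (h3 t ht htT z hz) _
            _ = _ := by rw [← Wt_mul ht]; ring
      _ = M * C3 * ∫⁻ z in A, Wt α t z (β + α) := lintegral_const_mul _ (Wt_meas _ _ _)
      _ ≤ M * C3 * (C4 * ENNReal.ofReal (rd α t ^ d)) := by gcongr; exact h4 t ht
      _ = C1 * (2 * C2) * C2 * C3 * C4 * (ENNReal.ofReal (rd α t ^ d) * (K t 0 x * K t 0 y)) := by rw [hM]; ring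
      _ ≤ C1 * (2 * C2) * C2 * C3 * C4 * (C5 * K t x y) := 
          mul_le_mul_right (h5 t ht htT x y (by linarith) (by linarith)) _
      _ = _ := by ring
  refine (absorbR hK hP hR ht htT x y).trans ?_
  calc 2 * (K t x y + _) ≤ 2 * (K t x y + C1 * (2 * C2) * C2 * C3 * C4 * C5 * K t x y) := by
        gcongr; exact hB.trans hc
    _ = _ := by push_cast; ring

lemma upper_full (hK : HKB d α K) (hP : POT d α β b₀ ε K q h V) {T : ℝ} (hT : 0 < T) :
    ∃ C : ℝ≥0, ∀ t, 0 < t → t ≤ T → ∀ x y : Ed d, x ≠ 0 → y ≠ 0 →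
      PP K q t x y ≤ C * (K t x y * Wt α t x β * Wt α t y β) := by
  have hα := hP.hα
  have hβ : 0 < β := hP.hb₀.trans hP.hbβ
  obtain ⟨R, hR1, hR⟩ := R_exists hP hT
  obtain ⟨C1, h1⟩ := far_est hK hP hT hR1 hR
  obtain ⟨C2, h2⟩ := far_far hK hP hT hR1 hR
  obtain ⟨C3, h3⟩ := ondiag hK hP hT
  obtain ⟨C4, h4⟩ := hK.k3 T hT (8 * R) (by linarith)
  obtain ⟨C5, h5⟩ := hK.k4 T hT (4 * R) (by linarith)
  set C := C2 + C3 * C4 + C1 * (1 + C5) with hC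
  have nf : ∀ t, 0 < t → t ≤ T → ∀ x y : Ed d, x ≠ 0 → y ≠ 0 → ‖x‖ < 4 * (R * rd α t) → 8 * (R * rd α t) ≤ ‖y‖ →
      PP K q t x y ≤ C * (K t x y * Wt α t x β * Wt α t y β) := by
    intro t ht htT x y hx hy hxx hyy
    have hρ := rd_pos (α := α) ht
    have hRρ : 0 < R * rd α t := by positivity
    have a1 : K t 0 y ≤ C5 * K t x y := by
      refine h5 t t ht (by linarith) htT x y 0 ?_ ?_ ?_
      · linarith
      · rw [norm_zero]; positivity
      · linarith
    calc PP K q t x y ≤ C1 * (K t x y + K t 0 y * Wt α t x β) := h1 t ht htT x y hx (by linarith)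
      _ ≤ C1 * (K t x y * Wt α t x β + C5 * K t x y * Wt α t x β) := by
        gcongr
        exact le_mul_of_one_le_right' (one_le_Wt ht x hβ.le)
      _ = C1 * (1 + C5) * (K t x y * Wt α t x β * 1) := by ring
      _ ≤ _ := by
        gcongr
        · rw [hC]; push_cast; exact le_add_self
        · exact one_le_Wt ht y hβ.le
  refine ⟨C, fun t ht htT x y hx hy => ?_⟩
  have hρ := rd_pos (α := α) ht
  have hRρ : 0 < R * rd α t := by positivity
  by_cases c1 : ‖x‖ < 4 * (R * rd α t) ∧ 8 * (R * rd α t) ≤ ‖y‖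
  · exact nf t ht htT x y hx hy c1.1 c1.2
  by_cases c2 : ‖y‖ < 4 * (R * rd α t) ∧ 8 * (R * rd α t) ≤ ‖x‖
  · have := nf t ht htT y x hy hx c2.1 c2.2
    rw [PP_symm hK hP, hK.symm, mul_right_comm] at this
    exact this
  by_cases c3 : 4 * (R * rd α t) ≤ ‖x‖ ∧ 4 * (R * rd α t) ≤ ‖y‖
  · calc PP K q t x y ≤ C2 * (K t x y * 1 * 1) := by rw [mul_one, mul_one]; exact h2 t ht htT x y c3.1 c3.2
      _ ≤ _ := by
        gcongr
        · rw [hC, add_assoc]; exact le_self_add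
        · exact one_le_Wt ht x hβ.le
        · exact one_le_Wt ht y hβ.le
  have hx8 : ‖x‖ ≤ 8 * (R * rd α t) := by
    by_contra hcon
    rw [not_le] at hcon
    rcases lt_or_ge ‖y‖ (4 * (R * rd α t)) with hh | hh
    · exact c2 ⟨hh, hcon.le⟩
    · exact c3 ⟨by linarith, hh⟩
  have hy8 : ‖y‖ ≤ 8 * (R * rd α t) := by
    by_contra hcon
    rw [not_le] at hcon
    rcases lt_or_ge ‖x‖ (4 * (R * rd α t)) with hh | hh
    · exact c1 ⟨hh, hcon.le⟩
    · exact c3 ⟨hh, by linarith⟩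
  calc PP K q t x y ≤ C3 * (Dt d α t * Wt α t x β * Wt α t y β) := h3 t ht htT x y hx hy
    _ ≤ C3 * (C4 * K t x y * Wt α t x β * Wt α t y β) := by
      gcongr
      exact h4 t ht htT x y (by rw [mul_assoc]; exact hx8) (by rw [mul_assoc]; exact hy8)
    _ = C3 * C4 * (K t x y * Wt α t x β * Wt α t y β) := by ring
    _ ≤ _ := by
      gcongr
      rw [hC]; push_cast
      exact le_add_self.trans le_self_add
end P2e

section P2f
set_option linter.unusedSectionVars false

variable {d : ℕ} {α β b₀ ε : ℝ} {K : ℝ → Ed d → Ed d → ℝ≥0∞} {q : ℝ → ℝ} {h V : ℝ → ℝ → ℝ}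

lemma r_le_W {t : ℝ} (ht : 0 < t) {z : Ed d} {e : ℝ} (he : 0 ≤ e) :
    (rd α t / ‖z‖) ^ e ≤ (1 + rd α t / ‖z‖) ^ e := by
  have := rd_pos (α := α) ht
  exact rpow_le_rpow (by positivity) (by linarith) he

/-- error bound -/
lemma err_le (hP : POT d α β b₀ ε K q h V) :
    ∃ C : ℝ, 0 < C ∧ ∀ t, 0 < t → t ≤ 1 → ∀ b ∈ Icc b₀ β, ∀ z : Ed d, z ≠ 0 →
      t * (max (V b ‖z‖ - q ‖z‖) 0 * (rd α t ^ b * h b ‖z‖)) ≤ C * rd α t ^ ε * (1 + rd α t / ‖z‖) ^ (α + b₀) := by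
  obtain ⟨hα, hb₀, hbβ, hβd, hbε, hbα, hεα, -, -, -, hq0, hV0, -, -, ⟨C2, hC2, hV⟩, hpos, hle, -, -, ⟨C3, r1, hC3, hr1, hnear⟩⟩ := hP
  refine ⟨C3 + C2 * (r1 ^ (-α) + 1), by positivity, fun t ht ht1 b hb z hz => ?_⟩
  have hr := norm_pos_iff.2 hz
  set r := ‖z‖ with hrdef
  have hρ := rd_pos (α := α) ht
  obtain ⟨f1, -, f3, f4⟩ := scale_facts hα ht le_rfl hr
  have hW1 := Wb_one (α := α) ht z
  rw [← hrdef] at hW1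
  have hbpos : 0 < b := hb₀.trans_le hb.1
  have hρ1 : rd α t ≤ 1 := rpow_le_one ht.le ht1 (by positivity)
  have hh : rd α t ^ b * h b r ≤ (rd α t / r) ^ b := by
    rw [← f4]; exact mul_le_mul_of_nonneg_left (hle b hb r hr) (by positivity)
  have hh0 : 0 ≤ rd α t ^ b * h b r := mul_nonneg (by positivity) (hpos b hb r hr).le
  have hεp : 0 < ε := by linarith
  have hX : 0 ≤ rd α t ^ ε * (1 + rd α t / r) ^ (α + b₀) := by positivity
  rcases le_or_gt r r1 with h1 | h1
  · have n := (hnear r hr h1).2 b hb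
    have n' : max (V b r - q r) 0 ≤ C3 * r ^ (-α + ε) := max_le n (by positivity)
    calc t * (max (V b r - q r) 0 * (rd α t ^ b * h b r)) ≤ t * (C3 * r ^ (-α + ε) * (rd α t / r) ^ b) := by
          refine mul_le_mul_of_nonneg_left (mul_le_mul n' hh hh0 (by positivity)) ht.le
      _ = C3 * (t * r ^ (-α + ε)) * (rd α t / r) ^ b := by ring
      _ ≤ C3 * (rd α t ^ ε * (rd α t / r) ^ (α - ε)) * (rd α t / r) ^ b := by
          have := f3 ε hεp.le
          gcongr
      _ = C3 * (rd α t ^ ε * (rd α t / r) ^ (α - ε + b)) := by rw [rpow_add (by positivity)]; ring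
      _ ≤ C3 * (rd α t ^ ε * (1 + rd α t / r) ^ (α + b₀)) := by
          have e1 : (rd α t / r) ^ (α - ε + b) ≤ (1 + rd α t / r) ^ (α - ε + b) := r_le_W ht (by linarith)
          have e2 : (1 + rd α t / r) ^ (α - ε + b) ≤ (1 + rd α t / r) ^ (α + b₀) :=
            rpow_le_rpow_of_exponent_le hW1 (by linarith [hb.2])
          have := e1.trans e2
          gcongr
      _ ≤ (C3 + C2 * (r1 ^ (-α) + 1)) * (rd α t ^ ε * (1 + rd α t / r) ^ (α + b₀)) := by
          refine mul_le_mul_of_nonneg_right ?_ hX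
          have : 0 ≤ C2 * (r1 ^ (-α) + 1) := by positivity
          linarith
      _ = _ := by ring
  · have n' : max (V b r - q r) 0 ≤ C2 * (r1 ^ (-α) + 1) := by
      refine max_le ?_ (by positivity)
      have a1 := hV b hb r hr
      have a2 := hq0 r hr
      have a3 : r ^ (-α) ≤ r1 ^ (-α) := rpow_le_rpow_of_nonpos hr1 h1.le (by linarith)
      have : C2 * (r ^ (-α) + 1) ≤ C2 * (r1 ^ (-α) + 1) := by gcongr
      linarith
    calc t * (max (V b r - q r) 0 * (rd α t ^ b * h b r)) ≤ t * (C2 * (r1 ^ (-α) + 1) * (rd α t / r) ^ b) := by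
          refine mul_le_mul_of_nonneg_left (mul_le_mul n' hh hh0 (by positivity)) ht.le
      _ = C2 * (r1 ^ (-α) + 1) * (t * (rd α t / r) ^ b) := by ring
      _ ≤ C2 * (r1 ^ (-α) + 1) * (rd α t ^ ε * (1 + rd α t / r) ^ (α + b₀)) := by
          refine mul_le_mul_of_nonneg_left (mul_le_mul ?_ ?_ (by positivity) (by positivity)) (by positivity)
          · rw [← rd_pow hα ht]
            conv_rhs => rw [rd_pow hα ht]
            exact rpow_le_rpow_of_exponent_ge hρ hρ1 hεα
          · exact (r_le_W ht hbpos.le).trans (rpow_le_rpow_of_exponent_le hW1 (by linarith [hb.2]))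
      _ ≤ (C3 + C2 * (r1 ^ (-α) + 1)) * (rd α t ^ ε * (1 + rd α t / r) ^ (α + b₀)) := by
          refine mul_le_mul_of_nonneg_right ?_ hX
          linarith
      _ = _ := by ring

/-- basic lower inequality from Duhamel -/
lemma lower_duh (hK : HKB d α K) (hP : POT d α β b₀ ε K q h V) :
    ∃ C : ℝ≥0, ∀ t, 0 < t → t ≤ 1 → ∀ b ∈ Ico b₀ β, ∀ x : Ed d, x ≠ 0 →
      ENNReal.ofReal (rd α t ^ b * h b ‖x‖) ≤ act (PP K q) (fun z => ENNReal.ofReal ((rd α t / ‖z‖) ^ b)) t x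
        + C * ENNReal.ofReal (rd α t ^ ε) * Wt α t x β := by
  obtain ⟨C1, hC1, hE⟩ := err_le hP
  obtain ⟨C0, hC0⟩ := MQ hK hP one_pos (b := b₀) ⟨le_rfl, hP.hbβ⟩
  obtain ⟨C3, h3⟩ := tq_le hP one_pos
  refine ⟨C1.toNNReal * C0, fun t ht ht1 b hb x hx => ?_⟩
  have hbI : b ∈ Icc b₀ β := ⟨hb.1, hb.2.le⟩
  have hρ := rd_pos (α := α) ht
  have hS := ae_ne hP.hd
  have hα := hP.hα
  have hbpos : 0 < b := hP.hb₀.trans_le hb.1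
  have hm1 := hP.hm b
  have hm3 := hP.Vm b
  have hqm := hP.qm
  have hPm := PP_meas hK hP
  have hn : Measurable (fun z : Ed d => ‖z‖) := measurable_norm
  have ht0 : ENNReal.ofReal t ≠ 0 := by simpa using ht
  have hqh : Measurable (fun z : Ed d => qE d q z * (ENNReal.ofReal (rd α t ^ b) * ENNReal.ofReal (h b ‖z‖))) :=
    (qE_meas hqm).mul (by fun_prop)
  have D := duhamel_fun hK.toHK (qE_meas hP.qm)
    (h := fun z : Ed d => ENNReal.ofReal (rd α t ^ b) * ENNReal.ofReal (h b ‖z‖))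
    (f := fun z : Ed d => ENNReal.ofReal (rd α t ^ b) * ENNReal.ofReal (V b ‖z‖ * h b ‖z‖))
    (by fun_prop) (by fun_prop) hS (by
      intro t ht x hx
      rw [act_cmul hK.meas (by fun_prop), pot_cmul hK.meas (by fun_prop),
        ← hP.ident b hbI t ht x hx, mul_add]) t ht x hx
  have hu : ∀ z : Ed d, z ≠ 0 → ENNReal.ofReal (rd α t ^ b) * ENNReal.ofReal (h b ‖z‖) ≤ ENNReal.ofReal ((rd α t / ‖z‖) ^ b) := by
    intro z hz
    rw [← ENNReal.ofReal_mul (by positivity), ← (scale_facts hα ht le_rfl (norm_pos_iff.2 hz)).2.2.2 b]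
    exact ENNReal.ofReal_le_ofReal (mul_le_mul_of_nonneg_left (hP.hle b hbI _ (norm_pos_iff.2 hz)) (by positivity))
  set Q := pot (PP K q) (fun z => qE d q z * (ENNReal.ofReal (rd α t ^ b) * ENNReal.ofReal (h b ‖z‖))) t x with hQ
  have hQfin : Q ≠ ∞ := by
    obtain ⟨Cb, hCb⟩ := MQ hK hP one_pos hb
    have : ENNReal.ofReal t * Q ≤ C3 * (Cb * ENNReal.ofReal t * Wt α t x β) := by
      rw [hQ, ← pot_cmul hPm hqh]
      refine le_trans ?_ (mul_le_mul_right (hCb t ht ht1 x hx).2 _)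
      rw [← pot_cmul hPm (Wt_meas _ _ _)]
      refine pot_mono (hS.mono fun z hz => ?_) _ _
      rw [← Wt_mul ht]
      simp only [← mul_assoc]
      rw [mul_assoc _ (ENNReal.ofReal (rd α t ^ b))]
      exact mul_le_mul' (h3 t ht ht1 z hz) ((hu z hz).trans (ENNReal.ofReal_le_ofReal (r_le_W ht hbpos.le)))
    intro hq
    rw [hq, ENNReal.mul_top ht0] at this
    refine absurd (top_le_iff.1 this) ?_
    exact ENNReal.mul_ne_top ENNReal.coe_ne_top (ENNReal.mul_ne_top (ENNReal.mul_ne_top ENNReal.coe_ne_top ENNReal.ofReal_ne_top) (Wt_ne_top _ _ _))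
  set er : Ed d → ℝ≥0∞ := fun z => ENNReal.ofReal (max (V b ‖z‖ - q ‖z‖) 0 * (rd α t ^ b * h b ‖z‖)) with her
  have hEr : pot (PP K q) er t x ≤ C1.toNNReal * C0 * ENNReal.ofReal (rd α t ^ ε) * Wt α t x β := by
    have hc : ((C1.toNNReal : ℝ≥0) : ℝ≥0∞) = ENNReal.ofReal C1 := rfl
    refine (ENNReal.mul_le_mul_iff_right ht0 ENNReal.ofReal_ne_top).1 ?_
    rw [← pot_cmul hPm (by rw [her]; fun_prop)]
    calc pot (PP K q) (fun z => ENNReal.ofReal t * er z) t x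
        ≤ pot (PP K q) (fun z => ENNReal.ofReal (C1 * rd α t ^ ε) * Wt α t z (α + b₀)) t x := by
          refine pot_mono (hS.mono fun z hz => ?_) _ _
          rw [her, Wt, ← ENNReal.ofReal_mul ht.le, ← ENNReal.ofReal_mul (by positivity)]
          exact ENNReal.ofReal_le_ofReal (hE t ht ht1 b hbI z hz)
      _ = ENNReal.ofReal (C1 * rd α t ^ ε) * pot (PP K q) (fun z => Wt α t z (α + b₀)) t x := pot_cmul hPm (Wt_meas _ _ _) _ _ _
      _ ≤ ENNReal.ofReal (C1 * rd α t ^ ε) * (C0 * ENNReal.ofReal t * Wt α t x β) := mul_le_mul_right (hC0 t ht ht1 x hx).2 _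
      _ = _ := by rw [ENNReal.ofReal_mul hC1.le, hc]; ring
  have hV : pot (PP K q) (fun z : Ed d => ENNReal.ofReal (rd α t ^ b) * ENNReal.ofReal (V b ‖z‖ * h b ‖z‖)) t x ≤ Q + pot (PP K q) er t x := by
    rw [hQ, ← pot_add hPm hqh]
    refine pot_mono (hS.mono fun z hz => ?_) _ _
    have hz0 := norm_pos_iff.2 hz
    have q0 := hP.q0 _ hz0
    have p0 := (hP.hpos b hbI _ hz0).le
    have v0 := hP.V0 b hbI _ hz0
    simp only [qE, her]
    rw [← ENNReal.ofReal_mul (by positivity), ← ENNReal.ofReal_mul (by positivity), ← ENNReal.ofReal_mul (by positivity),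
      ← ENNReal.ofReal_add (by positivity) (by positivity)]
    refine ENNReal.ofReal_le_ofReal ?_
    rw [← add_mul]
    calc rd α t ^ b * (V b ‖z‖ * h b ‖z‖) = V b ‖z‖ * (rd α t ^ b * h b ‖z‖) := by ring
      _ ≤ _ := by
        refine mul_le_mul_of_nonneg_right ?_ (by positivity)
        linarith [le_max_left (V b ‖z‖ - q ‖z‖) 0]
  have fin : ENNReal.ofReal (rd α t ^ b) * ENNReal.ofReal (h b ‖x‖) + Q ≤
      act (PP K q) (fun z => ENNReal.ofReal ((rd α t / ‖z‖) ^ b)) t x + C1.toNNReal * C0 * ENNReal.ofReal (rd α t ^ ε) * Wt α t x β + Q := by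
    rw [← D]
    calc _ ≤ act (PP K q) (fun z => ENNReal.ofReal ((rd α t / ‖z‖) ^ b)) t x + (Q + C1.toNNReal * C0 * ENNReal.ofReal (rd α t ^ ε) * Wt α t x β) := by
          refine add_le_add (act_mono (hS.mono fun z hz => hu z hz) _ _) (hV.trans (add_le_add le_rfl hEr))
      _ = _ := by ring
  rw [ENNReal.add_le_add_iff_right hQfin] at fin
  rw [ENNReal.ofReal_mul (by positivity)]
  push_cast
  exact fin

lemma split_act (hK : HKB d α K) (hP : POT d α β b₀ ε K q h V) :
    ∃ C : ℝ≥0, ∀ η R : ℝ, 0 < η → η ≤ 1 → 1 ≤ R → ∀ t, 0 < t → t ≤ 1 → ∀ b ∈ Ico b₀ β, ∀ x : Ed d, x ≠ 0 →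
      act (PP K q) (fun z => ENNReal.ofReal ((rd α t / ‖z‖) ^ b)) t x ≤
        C * ENNReal.ofReal (η ^ (d - 2 * β)) * Wt α t x β + C * ENNReal.ofReal (R ^ (-b₀)) * Wt α t x β
        + ENNReal.ofReal (η ^ (-β)) * ∫⁻ z in Metric.ball (0 : Ed d) (R * rd α t), PP K q t x z := by
  have hα := hP.hα
  have hb0 := hP.hb₀
  have hbβ := hP.hbβ
  have hβd := hP.hβd
  obtain ⟨C1, h1⟩ := ondiag hK hP one_pos
  obtain ⟨C2, h2⟩ := ball_int d hP.hd (e := 2 * β) (by linarith)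
  obtain ⟨C3, h3⟩ := mass_le hK hP one_pos
  refine ⟨C1 * (2 ^ β : ℝ).toNNReal * C2 + C3, fun η R hη hη1 hR t ht ht1 b hb x hx => ?_⟩
  have hρ := rd_pos (α := α) ht
  have hbp : 0 < b := hb0.trans_le hb.1
  have hS := ae_ne hP.hd
  have hPm := PP_meas hK hP
  set B1 := Metric.ball (0 : Ed d) (η * rd α t) with hB1
  set B2 := Metric.ball (0 : Ed d) (R * rd α t) with hB2
  have c2 : (((2 ^ β : ℝ).toNNReal : ℝ≥0) : ℝ≥0∞) = ENNReal.ofReal (2 ^ β) := rfl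
  have hle : ∀ᵐ z : Ed d, PP K q t x z * ENNReal.ofReal ((rd α t / ‖z‖) ^ b) ≤
      B1.indicator (fun z => (C1 * Dt d α t * Wt α t x β * ENNReal.ofReal (2 ^ β * rd α t ^ (2 * β))) * ENNReal.ofReal (‖z‖ ^ (-(2 * β)))) z
      + (ENNReal.ofReal (R ^ (-b₀)) * (PP K q t x z * Wt α t z β) + B2.indicator (fun z => ENNReal.ofReal (η ^ (-β)) * PP K q t x z) z) := by
    refine hS.mono fun z hz => ?_
    have hz0 := norm_pos_iff.2 hz
    by_cases hz1 : z ∈ B1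
    · refine le_trans ?_ le_self_add
      rw [indicator_of_mem hz1]
      rw [hB1, mem_ball_zero_iff] at hz1
      have hzr : 1 ≤ rd α t / ‖z‖ := by
        rw [one_le_div hz0]; nlinarith
      calc PP K q t x z * ENNReal.ofReal ((rd α t / ‖z‖) ^ b)
          ≤ (C1 * (Dt d α t * Wt α t x β * Wt α t z β)) * ENNReal.ofReal ((rd α t / ‖z‖) ^ b) :=
            mul_le_mul_left (h1 t ht ht1 x z hx hz) _
        _ = C1 * Dt d α t * Wt α t x β * (ENNReal.ofReal ((1 + rd α t / ‖z‖) ^ β) * ENNReal.ofReal ((rd α t / ‖z‖) ^ b)) := by rw [Wt, Wt]; ring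
        _ ≤ C1 * Dt d α t * Wt α t x β * (ENNReal.ofReal (2 ^ β * rd α t ^ (2 * β)) * ENNReal.ofReal (‖z‖ ^ (-(2 * β)))) := by
            refine mul_le_mul_right ?_ _
            rw [← ENNReal.ofReal_mul (by positivity), ← ENNReal.ofReal_mul (by positivity)]
            refine ENNReal.ofReal_le_ofReal ?_
            rw [mul_assoc, (scale_facts hα ht le_rfl hz0).2.2.2 (2 * β), two_mul β, rpow_add (by positivity), ← mul_assoc,
              ← mul_rpow (by norm_num) (by positivity)]
            refine mul_le_mul (rpow_le_rpow (by positivity) (by linarith) (by linarith)) (rpow_le_rpow_of_exponent_le hzr hb.2.le) (by positivity) (by positivity)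
        _ = _ := by ring
    · rw [indicator_of_notMem hz1, zero_add]
      rw [hB1, mem_ball_zero_iff, not_lt] at hz1
      by_cases hz2 : z ∈ B2
      · refine le_trans ?_ le_add_self
        rw [indicator_of_mem hz2, mul_comm]
        refine mul_le_mul_left (ENNReal.ofReal_le_ofReal ?_) _
        calc (rd α t / ‖z‖) ^ b ≤ (η⁻¹) ^ b := by
              refine rpow_le_rpow (by positivity) ?_ hbp.le
              rw [div_le_iff₀ hz0, ← div_eq_inv_mul, le_div_iff₀ hη]; linarith
          _ ≤ η⁻¹ ^ β := rpow_le_rpow_of_exponent_le ((one_le_inv₀ hη).2 hη1) hb.2.le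
          _ = _ := by rw [rpow_neg hη.le, inv_rpow hη.le]
      · refine le_trans ?_ le_self_add
        rw [hB2, mem_ball_zero_iff, not_lt] at hz2
        rw [mul_left_comm]
        refine mul_le_mul_right ?_ _
        refine le_trans ?_ (le_mul_of_one_le_right' (one_le_Wt ht z (by linarith)))
        refine ENNReal.ofReal_le_ofReal ?_
        have hR0 : 0 < R := by linarith
        calc (rd α t / ‖z‖) ^ b ≤ (R⁻¹) ^ b := by
              refine rpow_le_rpow (by positivity) ?_ hbp.le
              rw [div_le_iff₀ hz0, ← div_eq_inv_mul, le_div_iff₀ hR0]; linarith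
          _ ≤ R⁻¹ ^ b₀ := rpow_le_rpow_of_exponent_ge (by positivity) (inv_le_one_of_one_le₀ hR) hb.1
          _ = _ := by rw [rpow_neg hR0.le, inv_rpow hR0.le]
  have mP : Measurable (fun z => PP K q t x z) := hPm.comp measurable_const measurable_const measurable_id
  have m1 : Measurable (fun z => PP K q t x z * Wt α t z β) := mP.mul (Wt_meas _ _ _)
  refine (lintegral_mono_ae hle).trans ?_
  rw [lintegral_add_left ((by fun_prop : Measurable _).indicator measurableSet_ball), lintegral_add_left (m1.const_mul _),
    lintegral_indicator measurableSet_ball, lintegral_indicator measurableSet_ball,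
    lintegral_const_mul _ (by fun_prop), lintegral_const_mul _ m1, lintegral_const_mul _ mP, ← add_assoc]
  gcongr ?_ + ?_ + _
  · have hη0 : (0:ℝ) ≤ d - 2 * β := by linarith
    calc _ ≤ C1 * Dt d α t * Wt α t x β * ENNReal.ofReal (2 ^ β * rd α t ^ (2 * β)) * (C2 * ENNReal.ofReal ((η * rd α t) ^ (d - 2 * β))) :=
          mul_le_mul_right (h2 _ (by positivity)) _
      _ = C1 * ENNReal.ofReal (2 ^ β) * C2 * ENNReal.ofReal (η ^ (d - 2 * β)) * Wt α t x β * (Dt d α t * (ENNReal.ofReal (rd α t ^ (2 * β)) * ENNReal.ofReal (rd α t ^ (d - 2 * β)))) := by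
          rw [ENNReal.ofReal_mul (by positivity), mul_rpow hη.le hρ.le, ENNReal.ofReal_mul (by positivity)]; ring
      _ = C1 * ENNReal.ofReal (2 ^ β) * C2 * ENNReal.ofReal (η ^ (d - 2 * β)) * Wt α t x β := by
          rw [← ENNReal.ofReal_mul (by positivity), ← rpow_add hρ, add_sub_cancel, rpow_natCast, Dt_mul ht, mul_one]
      _ ≤ _ := by
          push_cast
          rw [c2]
          refine mul_le_mul_left (mul_le_mul_left le_self_add _) _
  · calc _ ≤ ENNReal.ofReal (R ^ (-b₀)) * (C3 * Wt α t x β) := mul_le_mul_right (h3 t t ht le_rfl ht1 x hx) _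
      _ = C3 * ENNReal.ofReal (R ^ (-b₀)) * Wt α t x β := by ring
      _ ≤ _ := by
          push_cast
          refine mul_le_mul_left (mul_le_mul_left le_add_self _) _

lemma lower_mass (hK : HKB d α K) (hP : POT d α β b₀ ε K q h V) :
    ∃ (t0 R : ℝ) (C : ℝ≥0), 0 < t0 ∧ 1 ≤ R ∧ ∀ t, 0 < t → t ≤ t0 → ∀ x : Ed d, x ≠ 0 → ‖x‖ ≤ rd α t →
      Wt α t x β ≤ C * ∫⁻ z in Metric.ball (0 : Ed d) (R * rd α t), PP K q t x z := by
  have hα := hP.hα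
  have hb0 := hP.hb₀
  have hbβ := hP.hbβ
  have hβd := hP.hβd
  have hε : 0 < ε := by linarith [hP.hbε]
  obtain ⟨C1, h1⟩ := split_act hK hP
  obtain ⟨C2, h2⟩ := lower_duh hK hP
  obtain ⟨c, hc, h3⟩ := hP.hge 1 one_pos
  set c4 : ℝ := c / 2 ^ β / 4 with hc4
  have hc4p : 0 < c4 := by positivity
  -- choices
  have lim0 : ∀ (C : ℝ≥0) (e : ℝ), 0 < e → ∃ η : ℝ, 0 < η ∧ η ≤ 1 ∧ (C : ℝ) * η ^ e ≤ c4 := by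
    intro C e he
    have : Tendsto (fun η : ℝ => (C : ℝ) * η ^ e) (nhdsWithin 0 (Ioi 0)) (nhds (C * 0)) := by
      refine Tendsto.const_mul _ ?_
      have := (continuousAt_rpow_const (0 : ℝ) e (Or.inr he.le)).tendsto
      rw [zero_rpow he.ne'] at this
      exact this.mono_left nhdsWithin_le_nhds
    rw [mul_zero] at this
    have ev := (this.eventually (eventually_le_nhds hc4p)).and (Ioc_mem_nhdsGT (zero_lt_one' ℝ))
    obtain ⟨η, h1, h2⟩ := ev.exists
    exact ⟨η, h2.1, h2.2, h1⟩
  obtain ⟨η, hη, hη1, hηc⟩ := lim0 C1 (d - 2 * β) (by linarith)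
  obtain ⟨R', hR', hR1', hRc⟩ := lim0 C1 b₀ hb0
  obtain ⟨t0, ht0, ht1, htc⟩ := lim0 C2 (1 / α * ε) (by positivity)
  refine ⟨t0, R'⁻¹, ((c4)⁻¹ * η ^ (-β)).toNNReal, ht0, (one_le_inv₀ hR').2 hR1', fun t ht htt x hx hxρ => ?_⟩
  have hρ := rd_pos (α := α) ht
  have hx0 := norm_pos_iff.2 hx
  have htone := htt.trans ht1
  have hρ1 : rd α t ≤ 1 := rpow_le_one ht.le htone (by positivity)
  set I := ∫⁻ z in Metric.ball (0 : Ed d) (R'⁻¹ * rd α t), PP K q t x z with hI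
  set W := Wt α t x β with hW
  have step : ∀ b ∈ Ico b₀ β, ENNReal.ofReal (c * (rd α t / ‖x‖) ^ b) ≤ ENNReal.ofReal (3 * c4) * W + ENNReal.ofReal (η ^ (-β)) * I := by
    intro b hb
    have a1 := h2 t ht htone b hb x hx
    have a2 := h1 η R'⁻¹ hη hη1 ((one_le_inv₀ hR').2 hR1') t ht htone b hb x hx
    have a3 : ENNReal.ofReal (c * (rd α t / ‖x‖) ^ b) ≤ ENNReal.ofReal (rd α t ^ b * h b ‖x‖) := by
      refine ENNReal.ofReal_le_ofReal ?_
      rw [← (scale_facts hα ht le_rfl hx0).2.2.2 b, mul_left_comm]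
      exact mul_le_mul_of_nonneg_left (h3 b ⟨hb.1, hb.2.le⟩ _ hx0 (hxρ.trans hρ1)) (by positivity)
    have o : ∀ (C : ℝ≥0) (a : ℝ), (C : ℝ≥0∞) * ENNReal.ofReal a = ENNReal.ofReal (C * a) := fun C a => by
      rw [ENNReal.ofReal_mul C.coe_nonneg]; simp
    refine a3.trans (a1.trans ((add_le_add a2 le_rfl).trans ?_))
    have e1 : C1 * ENNReal.ofReal (η ^ (d - 2 * β)) ≤ ENNReal.ofReal c4 := by rw [o]; exact ENNReal.ofReal_le_ofReal hηc
    have e2 : C1 * ENNReal.ofReal (R'⁻¹ ^ (-b₀)) ≤ ENNReal.ofReal c4 := by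
      rw [o, inv_rpow hR'.le, rpow_neg hR'.le, inv_inv]; exact ENNReal.ofReal_le_ofReal hRc
    have e3 : C2 * ENNReal.ofReal (rd α t ^ ε) ≤ ENNReal.ofReal c4 := by
      rw [o, rd, ← rpow_mul ht.le]; refine ENNReal.ofReal_le_ofReal (le_trans ?_ htc)
      exact mul_le_mul_of_nonneg_left (rpow_le_rpow ht.le htt (by positivity)) C2.2
    calc _ ≤ ENNReal.ofReal c4 * W + ENNReal.ofReal c4 * W + ENNReal.ofReal (η ^ (-β)) * I + ENNReal.ofReal c4 * W := by
          gcongr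
      _ = _ := by
          rw [ENNReal.ofReal_mul (by norm_num)]
          simp only [ENNReal.ofReal_ofNat]; ring
  have lim : ENNReal.ofReal (c * (rd α t / ‖x‖) ^ β) ≤ ENNReal.ofReal (3 * c4) * W + ENNReal.ofReal (η ^ (-β)) * I := by
    have hcont : Continuous (fun b : ℝ => ENNReal.ofReal (c * (rd α t / ‖x‖) ^ b)) := by
      refine ENNReal.continuous_ofReal.comp (continuous_const.mul (continuous_const.rpow continuous_id (fun _ => Or.inl (by positivity))))
    refine le_of_tendsto ((hcont.tendsto β).mono_left (nhdsWithin_le_nhds (s := Iio β))) ?_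
    filter_upwards [Ico_mem_nhdsLT hbβ] with b hb using step b hb
  have hWle : ENNReal.ofReal (4 * c4) * W ≤ ENNReal.ofReal (c * (rd α t / ‖x‖) ^ β) := by
    rw [hW, Wt, ← ENNReal.ofReal_mul (by positivity)]
    refine ENNReal.ofReal_le_ofReal ?_
    have : (1 + rd α t / ‖x‖) ^ β ≤ 2 ^ β * (rd α t / ‖x‖) ^ β := by
      rw [← mul_rpow (by norm_num) (by positivity)]
      have : 1 ≤ rd α t / ‖x‖ := (one_le_div hx0).2 hxρ
      exact rpow_le_rpow (by positivity) (by linarith) (by linarith)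
    calc 4 * c4 * (1 + rd α t / ‖x‖) ^ β ≤ 4 * c4 * (2 ^ β * (rd α t / ‖x‖) ^ β) := by gcongr
      _ = _ := by rw [hc4]; field_simp
  have fin := hWle.trans lim
  have e4 : ENNReal.ofReal (4 * c4) * W = ENNReal.ofReal (3 * c4) * W + ENNReal.ofReal c4 * W := by
    rw [← add_mul, ← ENNReal.ofReal_add (by positivity) hc4p.le]; congr 2; ring
  rw [e4, ENNReal.add_le_add_iff_left (ENNReal.mul_ne_top ENNReal.ofReal_ne_top (Wt_ne_top _ _ _))] at fin
  have c5 : ((((c4)⁻¹ * η ^ (-β)).toNNReal : ℝ≥0) : ℝ≥0∞) = ENNReal.ofReal c4⁻¹ * ENNReal.ofReal (η ^ (-β)) := by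
    rw [← ENNReal.ofReal_mul (by positivity)]; rfl
  rw [c5, mul_assoc]
  refine le_trans (le_of_eq ?_) (mul_le_mul_right fin _)
  rw [← mul_assoc, ← ENNReal.ofReal_mul (by positivity), inv_mul_cancel₀ hc4p.ne', ENNReal.ofReal_one, one_mul]

lemma lower_full (hK : HKB d α K) (hP : POT d α β b₀ ε K q h V) {T : ℝ} (hT : 0 < T) :
    ∃ C : ℝ≥0, ∀ t, 0 < t → t ≤ T → ∀ x y : Ed d, x ≠ 0 → y ≠ 0 →
      K t x y * Wt α t x β * Wt α t y β ≤ C * PP K q t x y := by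
  have hα := hP.hα
  have hβ : 0 < β := hP.hb₀.trans hP.hbβ
  obtain ⟨t0, R, C1, ht0, hR, h1⟩ := lower_mass hK hP
  obtain ⟨C2, h2⟩ := hK.k2 T hT
  obtain ⟨C3, h3⟩ := hK.k3 T hT (2 * R) (by positivity)
  obtain ⟨C4, h4⟩ := hK.k4 T hT R (by positivity)
  have hPm := PP_meas hK hP
  have mP1 : ∀ s x, Measurable (fun z => PP K q s x z) := fun s x => hPm.comp measurable_const measurable_const measurable_id
  have mP2 : ∀ s x u y, Measurable (fun z => PP K q s x z * PP K q u z y) := fun s x u y =>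
    (mP1 s x).mul (hPm.comp measurable_const measurable_id measurable_const)
  set k : ℝ := 3 * max 1 (T / t0) with hk
  have hk1 : 1 ≤ k := by have := le_max_left 1 (T / t0); linarith
  have hk0 : 0 < k := by linarith
  set Ck : ℝ≥0∞ := ENNReal.ofReal (rd α k ^ β) with hCk
  set Dk : ℝ≥0∞ := ENNReal.ofReal (rd α k ^ d) with hDk
  set F : ℝ≥0∞ := ENNReal.ofReal ((1 + rd α k) ^ β) with hF
  -- time splitting
  have hs : ∀ t, 0 < t → t ≤ T → ∃ s, 0 < s ∧ s ≤ t0 ∧ 3 * s ≤ t ∧ t ≤ k * s := by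
    intro t ht htT
    refine ⟨min t t0 / 3, by positivity, ?_, ?_, ?_⟩
    · have := min_le_right t t0; have : 0 < min t t0 := by positivity
      linarith
    · have := min_le_left t t0; linarith
    · rw [hk]
      rcases le_total t t0 with h | h
      · rw [min_eq_left h]; have := le_max_left 1 (T / t0); nlinarith
      · rw [min_eq_right h]; have : T / t0 * t0 ≤ max 1 (T / t0) * t0 := by gcongr; exact le_max_right _ _
        rw [div_mul_cancel₀ _ ht0.ne'] at this
        linarith
  have hfar : ∀ s t, 0 < s → 0 < t → t ≤ k * s → ∀ x : Ed d, rd α s ≤ ‖x‖ → Wt α t x β ≤ F := by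
    intro s t hs ht hts x hx
    have hρ := rd_pos (α := α) hs
    refine ENNReal.ofReal_le_ofReal (rpow_le_rpow (by have := rd_pos (α := α) ht; positivity) ?_ hβ.le)
    have : rd α t ≤ rd α k * rd α s := by rw [← rd_mul hk0.le hs.le]; exact rd_mono hα ht hts
    have h2 : rd α t / ‖x‖ ≤ rd α k := by
      rw [div_le_iff₀ (hρ.trans_le hx)]
      exact this.trans (mul_le_mul_of_nonneg_left hx (rd_pos hk0).le)
    linarith
  -- comparison of kernel near the origin
  have hcomp : ∀ s t, 0 < s → 3 * s ≤ t → t ≤ T → ∀ u, s ≤ u → u ≤ t → t ≤ 2 * u → ∀ x z y : Ed d, ‖x‖ ≤ R * rd α s → ‖z‖ ≤ R * rd α s →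
      K t x y ≤ (C4 + C2 * C3) * K u z y := by
    intro s t hs hst htT u hsu hut htu x z y hx hz
    have hu : 0 < u := by linarith
    have e : R * rd α s ≤ R * rd α u := by have := rd_mono hα hs hsu; gcongr
    rcases le_or_gt (2 * (R * rd α u)) ‖y‖ with hy | hy
    · refine (h4 t u (by linarith) htu (by linarith) z y x (hz.trans e) (hx.trans e) hy).trans ?_
      exact mul_le_mul_left le_self_add _
    · have hρ := rd_pos (α := α) hu
      have e2 : R * rd α u ≤ 2 * R * rd α u := by nlinarith
      calc K t x y ≤ C2 * Dt d α t := h2 t (by linarith) htT x y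
        _ ≤ C2 * Dt d α u := mul_le_mul_right (Dt_anti hα hu hut) _
        _ ≤ C2 * (C3 * K u z y) := mul_le_mul_right (h3 u hu (by linarith) z y ((hz.trans e).trans e2) (by linarith)) _
        _ = C2 * C3 * K u z y := by ring
        _ ≤ _ := mul_le_mul_left le_add_self _
  -- near x, arbitrary y
  have hnear : ∃ C : ℝ≥0∞, C ≠ ∞ ∧ ∀ t, 0 < t → t ≤ T → ∀ s, 0 < s → s ≤ t0 → 3 * s ≤ t → t ≤ k * s → ∀ x y : Ed d, x ≠ 0 → y ≠ 0 →
      ‖x‖ ≤ rd α s → K t x y * Wt α t x β * Wt α t y β ≤ C * PP K q t x y := by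
    have key : ∀ (A : ℝ≥0∞) t, 0 < t → t ≤ T → ∀ s, 0 < s → s ≤ t0 → 3 * s ≤ t → t ≤ k * s → ∀ x y : Ed d, x ≠ 0 → 
      ‖x‖ ≤ rd α s → ∀ M : ℝ≥0∞, (∀ z, ‖z‖ ≤ R * rd α s → M ≤ A * PP K q (t - s) z y) → M * Wt α t x β ≤ A * Ck * C1 * PP K q t x y := by
      intro A t ht htT s hs hst0 hst htk x y hx hxs M hM
      calc M * Wt α t x β ≤ M * (Ck * (C1 * ∫⁻ z in Metric.ball (0 : Ed d) (R * rd α s), PP K q s x z)) :=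
            mul_le_mul_right ((Wt_scale hα hs ht hk1 htk x hβ.le).trans (mul_le_mul_right (h1 s hs hst0 x hx hxs) _)) _
        _ = Ck * C1 * ∫⁻ z in Metric.ball (0 : Ed d) (R * rd α s), M * PP K q s x z := by
            rw [lintegral_const_mul _ (mP1 _ _)]; ring
        _ ≤ Ck * C1 * ∫⁻ z in Metric.ball (0 : Ed d) (R * rd α s), A * (PP K q s x z * PP K q (t - s) z y) := by
            refine mul_le_mul_right (setLIntegral_mono' measurableSet_ball fun z hz => ?_) _
            refine (mul_le_mul_left (hM z (mem_ball_zero_iff.1 hz).le) _).trans (le_of_eq ?_)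
            ring
        _ ≤ Ck * C1 * ∫⁻ z, A * (PP K q s x z * PP K q (t - s) z y) := mul_le_mul_right (setLIntegral_le_lintegral _ _) _
        _ = A * Ck * C1 * PP K q t x y := by
            rw [lintegral_const_mul _ (mP2 _ _ _ _),
              PP_ck hK hP hs (by linarith)]
            rw [add_sub_cancel]; ring
    refine ⟨(C4 + C2 * C3) * Ck * C1 * Ck * C1 + (C4 + C2 * C3) * F * Ck * C1 + C2 * C3 * Ck * C1 * Ck * C1 , ?_, ?_⟩
    · simp [ENNReal.add_eq_top, ENNReal.mul_eq_top, hCk, hF]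
    intro t ht htT s hs hst0 hst htk x y hx hy hxs
    have hρ := rd_pos (α := α) hs
    have hxR : ‖x‖ ≤ R * rd α s := by nlinarith
    rcases le_total ‖y‖ (rd α s) with hys | hys
    · have hyR : ‖y‖ ≤ R * rd α s := by nlinarith
      have := key ((C2 * C3) * Ck * C1) t ht htT s hs hst0 hst htk x y hx hxs (K t x y * Wt α t y β) (by
        intro z hz
        have hts : s ≤ t - 2 * s := by linarith
        have hu : 0 < t - 2 * s := by linarith
        calc K t x y * Wt α t y β ≤ K t x y * (Ck * (C1 * ∫⁻ w in Metric.ball (0 : Ed d) (R * rd α s), PP K q s y w)) :=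
              mul_le_mul_right ((Wt_scale hα hs ht hk1 htk y hβ.le).trans (mul_le_mul_right (h1 s hs hst0 y hy hys) _)) _
          _ = Ck * C1 * ∫⁻ w in Metric.ball (0 : Ed d) (R * rd α s), K t x y * PP K q s y w := by
              rw [lintegral_const_mul _ (mP1 _ _)]; ring
          _ ≤ Ck * C1 * ∫⁻ w in Metric.ball (0 : Ed d) (R * rd α s), C2 * C3 * (PP K q (t - 2 * s) z w * PP K q s w y) := by
              refine mul_le_mul_right (setLIntegral_mono' measurableSet_ball fun w hw => ?_) _
              have hw' := (mem_ball_zero_iff.1 hw).le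
              have e : R * rd α s ≤ 2 * R * rd α (t - 2 * s) := by have := rd_mono hα hs hts; nlinarith
              have e1 : K t x y ≤ C2 * C3 * PP K q (t - 2 * s) z w := by
                calc K t x y ≤ C2 * Dt d α t := h2 t (by linarith) htT x y
                  _ ≤ C2 * Dt d α (t - 2 * s) := mul_le_mul_right (Dt_anti hα hu (by linarith)) _
                  _ ≤ C2 * (C3 * K (t - 2 * s) z w) := mul_le_mul_right (h3 _ hu (by linarith) z w (hz.trans e) (hw'.trans e)) _
                  _ ≤ C2 * (C3 * PP K q (t - 2 * s) z w) := mul_le_mul_right (mul_le_mul_right (K_le_PT _ _ _) _) _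
                  _ = _ := by ring
              rw [PP_symm hK hP s y w]
              refine (mul_le_mul_left e1 _).trans (le_of_eq (by ring))
          _ ≤ Ck * C1 * ∫⁻ w, C2 * C3 * (PP K q (t - 2 * s) z w * PP K q s w y) := mul_le_mul_right (setLIntegral_le_lintegral _ _) _
          _ = _ := by
              rw [lintegral_const_mul _ (mP2 _ _ _ _),
                PP_ck hK hP hu hs, (by ring : t - 2 * s + s = t - s)]
              ring)
      calc _ = K t x y * Wt α t y β * Wt α t x β := by ring
        _ ≤ _ := this
        _ ≤ _ := mul_le_mul_left le_add_self _
    · have := key ((C4 + C2 * C3) * F) t ht htT s hs hst0 hst htk x y hx hxs (K t x y * Wt α t y β) (by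
        intro z hz
        have e1 := hcomp s t hs hst htT (t - s) (by linarith) (by linarith) (by linarith) x z y hxR hz
        calc K t x y * Wt α t y β ≤ ((C4 + C2 * C3) * K (t - s) z y) * F := mul_le_mul' e1 (hfar s t hs ht htk y hys)
          _ ≤ ((C4 + C2 * C3) * PP K q (t - s) z y) * F := mul_le_mul_left (mul_le_mul_right (K_le_PT _ _ _) _) _
          _ = _ := by ring)
      calc _ = K t x y * Wt α t y β * Wt α t x β := by ring
        _ ≤ _ := this
        _ ≤ _ := mul_le_mul_left (le_add_self.trans le_self_add) _
  obtain ⟨C5, hC5, h5⟩ := hnear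
  have hC : C5 + F * F ≠ ∞ := by simp [hC5, hF, ENNReal.mul_eq_top]
  refine ⟨(C5 + F * F).toNNReal, fun t ht htT x y hx hy => ?_⟩
  rw [ENNReal.coe_toNNReal hC]
  obtain ⟨s, hs0, hst0, hst, htk⟩ := hs t ht htT
  rcases le_total ‖x‖ (rd α s) with hxs | hxs
  · exact (h5 t ht htT s hs0 hst0 hst htk x y hx hy hxs).trans (mul_le_mul_left le_self_add _)
  rcases le_total ‖y‖ (rd α s) with hys | hys
  · have := h5 t ht htT s hs0 hst0 hst htk y x hy hx hys
    rw [hK.symm t y x, PP_symm hK hP t y x] at this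
    calc _ = K t x y * Wt α t y β * Wt α t x β := by ring
      _ ≤ _ := this
      _ ≤ _ := mul_le_mul_left le_self_add _
  · calc K t x y * Wt α t x β * Wt α t y β ≤ PP K q t x y * F * F := by
          gcongr
          · exact K_le_PT _ _ _
          · exact hfar s t hs0 ht htk x hxs
          · exact hfar s t hs0 ht htk y hys
      _ = F * F * PP K q t x y := by ring
      _ ≤ _ := mul_le_mul_left le_add_self _
end P2f

section P3a
set_option linter.unusedSectionVars false

lemma lint_of_int {s : Set ℝ} (hs : MeasurableSet s) {f : ℝ → ℝ} {v : ℝ} (hf : ∀ u ∈ s, 0 ≤ f u) (hv : ∫ u in s, f u = v) (h0 : v ≠ 0) :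
    ∫⁻ u in s, ENNReal.ofReal (f u) = ENNReal.ofReal v := by
  have hi : Integrable f (volume.restrict s) := by
    by_contra h
    rw [integral_undef h] at hv
    exact h0 hv.symm
  rw [← hv, ofReal_integral_eq_lintegral_ofReal hi]
  exact (ae_restrict_iff' hs).2 (Eventually.of_forall hf)

lemma lap_rpow {a r : ℝ} (ha : 0 < a) (hr : 0 < r) :
    ∫⁻ u in Ioi (0:ℝ), ENNReal.ofReal (u ^ (a - 1) * exp (-(r * u))) = ENNReal.ofReal ((1 / r) ^ a * Gamma a) := by
  refine lint_of_int measurableSet_Ioi (fun u hu => ?_) (integral_rpow_mul_exp_neg_mul_Ioi ha hr) ?_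
  · have : (0:ℝ) < u := hu
    positivity
  · have := Gamma_pos_of_pos ha
    positivity

lemma lint_rpow {p l : ℝ} (hp : 0 < p) (hl : 0 < l) :
    ∫⁻ x in Ioo (0:ℝ) l, ENNReal.ofReal (x ^ (p - 1)) = ENNReal.ofReal (l ^ p / p) := by
  refine lint_of_int measurableSet_Ioo (fun u hu => ?_) ?_ ?_
  · have : (0:ℝ) < u := hu.1
    positivity
  · rw [← integral_Ioc_eq_integral_Ioo, ← intervalIntegral.integral_of_le hl.le, integral_rpow (Or.inl (by linarith))]
    simp [hp.ne']
  · positivity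

lemma lap_one_sub {p l : ℝ} (hp : 0 < p) (hp1 : p < 1) (hl : 0 < l) :
    ∫⁻ u in Ioi (0:ℝ), ENNReal.ofReal ((1 - exp (-(l * u))) * u ^ (-1 - p)) = ENNReal.ofReal (Gamma (1 - p) / p * l ^ p) := by
  have e1 : ∀ u ∈ Ioi (0:ℝ), ENNReal.ofReal ((1 - exp (-(l * u))) * u ^ (-1 - p)) =
      ∫⁻ x in Ioo (0:ℝ) l, ENNReal.ofReal (u ^ ((1 - p) - 1) * exp (-(x * u))) := by
    intro u hu
    have hu' : (0:ℝ) < u := hu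
    have hpos : 0 < 1 - exp (-(l * u)) := by
      have : exp (-(l * u)) < 1 := by rw [exp_lt_one_iff]; have := mul_pos hl hu'; linarith
      linarith
    symm
    refine lint_of_int measurableSet_Ioo (fun x hx => by positivity) ?_ (by positivity)
    rw [integral_const_mul, ← integral_Ioc_eq_integral_Ioo, ← intervalIntegral.integral_of_le hl.le]
    have : ∫ x in (0:ℝ)..l, exp (-(x * u)) = (1 - exp (-(l * u))) / u := by
      rw [intervalIntegral.integral_eq_sub_of_hasDerivAt (f := fun x => - exp (-(x * u)) / u)]
      · simp; ring
      · intro x _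
        have h1 : HasDerivAt (fun x : ℝ => -(x * u)) (-u) x := by
          have := ((hasDerivAt_id' x).mul_const u).fun_neg
          simpa using this
        have := (h1.exp.fun_neg).div_const u
        refine this.congr_deriv ?_
        field_simp
      · exact Continuous.intervalIntegrable (by fun_prop) _ _
    have h3 : u ^ (-1 - p) = u ^ ((1 - p) - 1) / u := by
      rw [← rpow_sub_one hu'.ne']; congr 1; ring
    rw [this, h3]
    ring
  rw [setLIntegral_congr_fun measurableSet_Ioi e1, lintegral_lintegral_swap (by fun_prop)]
  have e2 : ∀ x ∈ Ioo (0:ℝ) l, ∫⁻ u in Ioi (0:ℝ), ENNReal.ofReal (u ^ ((1 - p) - 1) * exp (-(x * u))) =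
      ENNReal.ofReal (Gamma (1 - p)) * ENNReal.ofReal (x ^ (p - 1)) := by
    intro x hx
    have hG := Gamma_pos_of_pos (by linarith : 0 < 1 - p)
    rw [lap_rpow (by linarith) hx.1, ← ENNReal.ofReal_mul hG.le, mul_comm, one_div, inv_rpow hx.1.le, ← rpow_neg hx.1.le, neg_sub]
  rw [setLIntegral_congr_fun measurableSet_Ioo e2, lintegral_const_mul _ (by fun_prop), lint_rpow hp hl,
    ← ENNReal.ofReal_mul (Gamma_pos_of_pos (by linarith : 0 < 1 - p)).le]
  congr 1; ring

/-- truncated Levy measure: Pareto probability -/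
lemma pareto_exists {p : ℝ} (hp : 0 < p) (hp1 : p < 1) :
    ∃ P : ℕ → Measure ℝ, (∀ n, 0 < n → IsProbabilityMeasure (P n) ∧ P n (Iic 0) = 0) ∧
      ∀ l : ℝ, 0 < l → ∃ g : ℕ → ℝ, Tendsto g atTop (nhds (l ^ p)) ∧ ∀ n, 0 < n → ∫⁻ u, ENNReal.ofReal (exp (-(l * u))) ∂(P n) = ENNReal.ofReal (1 - g n / n) := by
  set κ : ℝ := p / Gamma (1 - p) with hκ
  have hG := Gamma_pos_of_pos (by linarith : 0 < 1 - p)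
  have hκ0 : 0 < κ := by positivity
  set a : ℕ → ℝ := fun n => (κ / (p * n)) ^ (1 / p) with ha
  have ha0 : ∀ n, 0 < n → 0 < a n := fun n hn => by simp only [ha]; positivity
  have hap : ∀ n, 0 < n → a n ^ (-p) = p * n / κ := by
    intro n hn
    simp only [ha]
    rw [← rpow_mul (by positivity), show 1 / p * -p = -1 by field_simp, rpow_neg_one, inv_div]
  have hmass : ∀ n, 0 < n → ∫⁻ u in Ioi (a n), ENNReal.ofReal (κ / n * u ^ (-1 - p)) = 1 := by
    intro n hn
    rw [lint_of_int (v := 1) measurableSet_Ioi (fun u hu => ?_) ?_ one_ne_zero, ENNReal.ofReal_one]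
    · rw [integral_const_mul, integral_Ioi_rpow_of_lt (by linarith) (ha0 n hn), show (-1 - p + 1) = -p by ring, hap n hn]
      field_simp
    · have : 0 < u := (ha0 n hn).trans hu
      positivity
  refine ⟨fun n => (volume.restrict (Ioi (a n))).withDensity (fun u => ENNReal.ofReal (κ / n * u ^ (-1 - p))), ?_, ?_⟩
  · intro n hn
    refine ⟨⟨?_⟩, ?_⟩
    · rw [withDensity_apply _ MeasurableSet.univ, Measure.restrict_univ]; exact hmass n hn
    · refine withDensity_absolutelyContinuous _ _ ?_
      rw [Measure.restrict_apply measurableSet_Iic]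
      have : Iic 0 ∩ Ioi (a n) = ∅ := by
        ext u; simp only [mem_inter_iff, mem_Iic, mem_Ioi, mem_empty_iff_false, iff_false, not_and, not_lt]
        intro h; exact h.trans (ha0 n hn).le
      rw [this, measure_empty]
  · intro l hl
    -- g n = ∫_{a n}^∞ κ (1-e^{-lu}) u^{-1-p}
    have hF : ∫⁻ u in Ioi (0:ℝ), ENNReal.ofReal ((1 - exp (-(l * u))) * u ^ (-1 - p)) ≠ ∞ := by
      rw [lap_one_sub hp hp1 hl]; exact ENNReal.ofReal_ne_top
    set F : ℝ → ℝ := fun u => (1 - exp (-(l * u))) * u ^ (-1 - p) with hFd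
    have hF0 : ∀ u ∈ Ioi (0:ℝ), 0 ≤ F u := by
      intro u hu
      have hu' : (0:ℝ) < u := hu
      have : exp (-(l * u)) ≤ 1 := by rw [exp_le_one_iff]; have := mul_pos hl hu'; linarith
      exact mul_nonneg (by linarith) (by positivity)
    have hFm : Measurable F := by rw [hFd]; fun_prop
    have hFi : IntegrableOn F (Ioi 0) := by
      refine ⟨hFm.aestronglyMeasurable, ?_⟩
      rw [hasFiniteIntegral_iff_ofReal ((ae_restrict_iff' measurableSet_Ioi).2 (Eventually.of_forall hF0))]
      exact lt_top_iff_ne_top.2 hF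
    have hFv : ∫ u in Ioi (0:ℝ), F u = Gamma (1 - p) / p * l ^ p := by
      rw [integral_eq_lintegral_of_nonneg_ae ((ae_restrict_iff' measurableSet_Ioi).2 (Eventually.of_forall hF0)) hFm.aestronglyMeasurable]
      rw [lap_one_sub hp hp1 hl, ENNReal.toReal_ofReal (by positivity)]
    refine ⟨fun n => κ * ∫ u in Ioi (a n), F u, ?_, ?_⟩
    · have : l ^ p = κ * ∫ u in Ioi (0:ℝ), F u := by rw [hFv, hκ]; field_simp
      rw [this]
      refine Tendsto.const_mul _ ?_
      have e : ∀ n, 0 < n → ∫ u in Ioi (a n), F u = ∫ u in Ioi (0:ℝ), (Ioi (a n)).indicator F u := by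
        intro n hn
        rw [setIntegral_indicator measurableSet_Ioi, inter_eq_right.2 (Ioi_subset_Ioi (ha0 n hn).le)]
      have hta : Tendsto a atTop (nhds 0) := by
        have h1 : Tendsto (fun n : ℕ => κ / (p * n)) atTop (nhds 0) := by
          have := (tendsto_const_div_atTop_nhds_zero_nat (κ / p))
          refine this.congr fun n => ?_
          rw [div_div]
        have h2 := (continuousAt_rpow_const (0:ℝ) (1 / p) (Or.inr (by positivity))).tendsto
        rw [zero_rpow (by positivity)] at h2
        exact h2.comp h1
      have lim : Tendsto (fun n => ∫ u in Ioi (0:ℝ), (Ioi (a n)).indicator F u) atTop (nhds (∫ u in Ioi (0:ℝ), F u)) := by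
        refine tendsto_integral_of_dominated_convergence (fun u => ‖F u‖) (fun n => (hFm.indicator measurableSet_Ioi).aestronglyMeasurable) hFi.norm
          (fun n => Eventually.of_forall fun u => norm_indicator_le_norm_self _ _) ?_
        refine (ae_restrict_iff' measurableSet_Ioi).2 (Eventually.of_forall fun u hu => ?_)
        refine tendsto_const_nhds.congr' ?_
        filter_upwards [hta.eventually (gt_mem_nhds hu)] with n hn
        rw [indicator_of_mem]; exact hn
      refine lim.congr' ?_
      filter_upwards [eventually_gt_atTop 0] with n hn using (e n hn).symm
    · intro n hn
      have hn' : (0:ℝ) < n := by exact_mod_cast hn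
      rw [lintegral_withDensity_eq_lintegral_mul _ (by fun_prop) (by fun_prop)]
      have hsub : Ioi (a n) ⊆ Ioi 0 := Ioi_subset_Ioi (ha0 n hn).le
      have i1 : IntegrableOn (fun u : ℝ => κ / n * u ^ (-1 - p)) (Ioi (a n)) :=
        (integrableOn_Ioi_rpow_of_lt (by linarith) (ha0 n hn)).const_mul _
      have i2 : IntegrableOn (fun u : ℝ => κ / n * F u) (Ioi (a n)) := (hFi.mono_set hsub).const_mul _
      have e : ∀ u, ((fun u : ℝ => ENNReal.ofReal (κ / n * u ^ (-1 - p))) * fun u : ℝ => ENNReal.ofReal (exp (-(l * u)))) u =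
          ENNReal.ofReal (κ / n * u ^ (-1 - p) * exp (-(l * u))) := by
        intro u; simp only [Pi.mul_apply]; rw [ENNReal.ofReal_mul' (exp_pos _).le]
      simp_rw [e]
      have e3 : ∀ u, κ / n * u ^ (-1 - p) * exp (-(l * u)) = κ / n * u ^ (-1 - p) - κ / n * F u := by
        intro u; simp only [hFd]; ring
      have i3 : IntegrableOn (fun u : ℝ => κ / n * u ^ (-1 - p) * exp (-(l * u))) (Ioi (a n)) := by
        simp_rw [e3]; exact i1.sub i2
      rw [← ofReal_integral_eq_lintegral_ofReal i3]
      · congr 1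
        simp_rw [e3]
        rw [integral_sub i1 i2, integral_const_mul, integral_const_mul, integral_Ioi_rpow_of_lt (by linarith) (ha0 n hn), show (-1 - p + 1) = -p by ring, hap n hn]
        field_simp
      · refine (ae_restrict_iff' measurableSet_Ioi).2 (Eventually.of_forall fun u hu => ?_)
        have : 0 < u := (ha0 n hn).trans hu
        positivity
end P3a

section P3b
set_option linter.unusedSectionVars false

def eI (u : ℝ) : unitInterval := ⟨exp (-max u 0), by
  constructor
  · positivity
  · rw [exp_le_one_iff]; have := le_max_right u 0; linarith⟩

lemma eI_cont : Continuous eI := by unfold eI; fun_prop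

lemma eI_coe {u : ℝ} (hu : 0 ≤ u) : (eI u : ℝ) = exp (-u) := by simp [eI, max_eq_left hu]

lemma poly_meas_ext {μ ν : Measure unitInterval} [IsFiniteMeasure μ] [IsFiniteMeasure ν]
    (h : ∀ n : ℕ, ∫ y, (y : ℝ) ^ n ∂μ = ∫ y, (y : ℝ) ^ n ∂ν) : μ = ν := by
  have hI : ∀ (m : Measure unitInterval) [IsFiniteMeasure m] (f : C(unitInterval, ℝ)), Integrable f m := by
    intro m _ f
    exact (BoundedContinuousFunction.mkOfCompact f).integrable m
  have hp : ∀ p : Polynomial ℝ, ∫ y, p.eval (y : ℝ) ∂μ = ∫ y, p.eval (y : ℝ) ∂ν := by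
    intro p
    induction p using Polynomial.induction_on' with
    | add p q hp hq =>
      simp only [Polynomial.eval_add]
      have a1 : ∀ (m : Measure unitInterval) [IsFiniteMeasure m] (p : Polynomial ℝ), Integrable (fun y : unitInterval => p.eval (y : ℝ)) m :=
        fun m _ p => hI m ⟨fun y : unitInterval => p.eval (y : ℝ), by fun_prop⟩
      rw [integral_add (a1 μ p) (a1 μ q), integral_add (a1 ν p) (a1 ν q), hp, hq]
    | monomial n a => simp only [Polynomial.eval_monomial, integral_const_mul, h n]
  have hc : ∀ f : C(unitInterval, ℝ), ∫ y, f y ∂μ = ∫ y, f y ∂ν := by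
    have hcl : ∀ (m : Measure unitInterval) [IsFiniteMeasure m], Continuous fun f : C(unitInterval, ℝ) => ∫ y, f y ∂m := by
      intro m _
      refine continuous_iff_continuousAt.2 fun f => ?_
      have := (BoundedContinuousFunction.toLp 1 m ℝ (E := ℝ) (α := unitInterval)).continuous
      have h2 : Continuous fun f : C(unitInterval, ℝ) => ∫ y, (BoundedContinuousFunction.toLp 1 m ℝ (E := ℝ) (BoundedContinuousFunction.mkOfCompact f)) y ∂m := by
        refine (continuous_integral.comp this).comp ?_
        exact (ContinuousMap.isometryEquivBoundedOfCompact unitInterval ℝ).continuous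
      have h3 : (fun f : C(unitInterval, ℝ) => ∫ y, (BoundedContinuousFunction.toLp 1 m ℝ (E := ℝ) (BoundedContinuousFunction.mkOfCompact f)) y ∂m) =
          fun f : C(unitInterval, ℝ) => ∫ y, f y ∂m := by
        ext f
        refine integral_congr_ae ?_
        exact BoundedContinuousFunction.coeFn_toLp (p := 1) (μ := m) (𝕜 := ℝ) (BoundedContinuousFunction.mkOfCompact f)
      rw [h3] at h2
      exact h2.continuousAt
    intro f
    have hf := continuousMap_mem_polynomialFunctions_closure 0 1 f
    refine closure_minimal (s := (polynomialFunctions unitInterval : Set C(unitInterval, ℝ))) (t := {f | ∫ y, f y ∂μ = ∫ y, f y ∂ν}) ?_ (isClosed_eq (hcl μ) (hcl ν)) hf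
    rintro g ⟨p, -, rfl⟩
    exact hp p
  refine ext_of_forall_integral_eq_of_IsFiniteMeasure fun f => hc f.toContinuousMap

lemma laplace_ext {μ ν : Measure ℝ} [IsFiniteMeasure μ] [IsFiniteMeasure ν] (hμ : μ (Iio 0) = 0) (hν : ν (Iio 0) = 0)
    (h : ∀ n : ℕ, ∫⁻ u, ENNReal.ofReal (exp (-(n * u))) ∂μ = ∫⁻ u, ENNReal.ofReal (exp (-(n * u))) ∂ν) : μ = ν := by
  have hm : Measurable eI := eI_cont.measurable
  have key : ∀ (m : Measure ℝ) [IsFiniteMeasure m], m (Iio 0) = 0 → ∀ n : ℕ,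
      ∫ y, (y : ℝ) ^ n ∂(m.map eI) = (∫⁻ u, ENNReal.ofReal (exp (-(n * u))) ∂m).toReal := by
    intro m _ hm0 n
    rw [integral_map hm.aemeasurable (by fun_prop), integral_eq_lintegral_of_nonneg_ae (Eventually.of_forall fun u => pow_nonneg (eI u).2.1 _)
      (by have := eI_cont; fun_prop)]
    congr 1
    refine lintegral_congr_ae ?_
    have : ∀ᵐ u ∂m, u ∉ Iio (0:ℝ) := measure_eq_zero_iff_ae_notMem.1 hm0
    filter_upwards [this] with u hu
    rw [eI_coe (not_lt.1 hu), ← exp_nat_mul]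
    congr 2; ring
  have h1 : μ.map eI = ν.map eI := by
    refine poly_meas_ext fun n => ?_
    rw [key μ hμ, key ν hν, h]
  have back : ∀ (m : Measure ℝ) [IsFiniteMeasure m], m (Iio 0) = 0 → (m.map eI).map (fun y : unitInterval => -log (y : ℝ)) = m := by
    intro m _ hm0
    rw [Measure.map_map (by fun_prop) hm]
    refine (Measure.map_congr ?_).trans Measure.map_id
    have : ∀ᵐ u ∂m, u ∉ Iio (0:ℝ) := measure_eq_zero_iff_ae_notMem.1 hm0
    filter_upwards [this] with u hu
    simp [eI_coe (not_lt.1 hu)]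
  rw [← back μ hμ, ← back ν hν, h1]

def mcp (μ : Measure unitInterval) : ℕ → Measure unitInterval
  | 0 => Measure.dirac 1
  | n + 1 => (mcp μ n).mconv μ

instance mcp_prob (μ : Measure unitInterval) [IsProbabilityMeasure μ] (n : ℕ) : IsProbabilityMeasure (mcp μ n) := by
  induction n with
  | zero => unfold mcp; infer_instance
  | succ n ih =>
    unfold mcp
    infer_instance

lemma mcp_lint (μ : Measure unitInterval) [IsProbabilityMeasure μ] {l : ℝ} (n : ℕ) :
    ∫⁻ y, ENNReal.ofReal ((y : ℝ) ^ l) ∂(mcp μ n) = (∫⁻ y, ENNReal.ofReal ((y : ℝ) ^ l) ∂μ) ^ n := by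
  have hmeas : Measurable fun y : unitInterval => ENNReal.ofReal ((y : ℝ) ^ l) := by fun_prop
  induction n with
  | zero =>
    unfold mcp
    rw [lintegral_dirac' _ hmeas]; simp
  | succ n ih =>
    have e : mcp μ (n + 1) = (mcp μ n).mconv μ := rfl
    rw [e, Measure.lintegral_mconv hmeas]
    have : ∀ x y : unitInterval, ENNReal.ofReal (((x * y : unitInterval) : ℝ) ^ l) = ENNReal.ofReal ((x:ℝ) ^ l) * ENNReal.ofReal ((y:ℝ) ^ l) := by
      intro x y
      rw [← ENNReal.ofReal_mul (rpow_nonneg x.2.1 _), ← mul_rpow x.2.1 y.2.1]; rfl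
    simp_rw [this]
    simp_rw [lintegral_const_mul _ hmeas]
    rw [lintegral_mul_const _ hmeas, ih, pow_succ]

lemma stable_exists {p : ℝ} (hp : 0 < p) (hp1 : p < 1) :
    ∃ η : Measure ℝ, IsProbabilityMeasure η ∧ η (Iic 0) = 0 ∧
      ∀ l : ℝ, 0 < l → ∫⁻ u, ENNReal.ofReal (exp (-(l * u))) ∂η = ENNReal.ofReal (exp (-(l ^ p))) := by
  obtain ⟨P, hP, hL⟩ := pareto_exists hp hp1
  have hm : Measurable eI := eI_cont.measurable
  have hPI : ∀ n, 0 < n → IsProbabilityMeasure ((P n).map eI) := fun n hn => by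
    haveI := (hP n hn).1
    exact Measure.isProbabilityMeasure_map hm.aemeasurable
  let ν : ℕ → ProbabilityMeasure unitInterval := fun n =>
    ⟨mcp ((P (n + 1)).map eI) (n + 1), by
      haveI := hPI (n + 1) (Nat.succ_pos n)
      exact mcp_prob _ _⟩
  have hνL : ∀ l, 0 < l → Tendsto (fun n => ∫ y, (y : ℝ) ^ l ∂(ν n : Measure unitInterval)) atTop (nhds (exp (-(l ^ p)))) := by
    intro l hl
    obtain ⟨g, hg, hgn⟩ := hL l hl
    have hlim : Tendsto (fun n : ℕ => (1 + (-(g n / n))) ^ n) atTop (nhds (exp (-(l ^ p)))) := by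
      refine Real.tendsto_one_add_pow_exp_of_tendsto ?_
      refine (hg.neg).congr' ?_
      filter_upwards [eventually_gt_atTop 0] with n hn
      have : (n : ℝ) ≠ 0 := by positivity
      field_simp
    refine ((tendsto_add_atTop_iff_nat 1).2 hlim).congr fun n => ?_
    haveI := hPI (n + 1) (Nat.succ_pos n)
    haveI := (hP (n + 1) (Nat.succ_pos n)).1
    rw [integral_eq_lintegral_of_nonneg_ae (Eventually.of_forall fun y => rpow_nonneg y.2.1 _) (Measurable.aestronglyMeasurable (by fun_prop))]
    have e1 : ∫⁻ y, ENNReal.ofReal ((y : ℝ) ^ l) ∂((P (n + 1)).map eI) = ENNReal.ofReal (1 - g (n + 1) / (n + 1 : ℕ)) := by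
      rw [← hgn (n + 1) (Nat.succ_pos n), lintegral_map (by fun_prop) hm]
      refine lintegral_congr_ae ?_
      have : ∀ᵐ u ∂(P (n + 1)), u ∉ Iic (0:ℝ) := measure_eq_zero_iff_ae_notMem.1 (hP (n + 1) (Nat.succ_pos n)).2
      filter_upwards [this] with u hu
      rw [eI_coe (not_le.1 hu).le, ← exp_mul]
      congr 2; ring
    have e2 : ∫⁻ y, ENNReal.ofReal ((y : ℝ) ^ l) ∂(ν n : Measure unitInterval) = _ := mcp_lint _ (n + 1)
    rw [e2, e1]
    have hge : 0 ≤ 1 - g (n + 1) / (n + 1 : ℕ) := by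
      by_contra hneg
      have h0 : ENNReal.ofReal (1 - g (n + 1) / (n + 1 : ℕ)) = 0 := ENNReal.ofReal_of_nonpos (not_le.1 hneg).le
      rw [← hgn (n + 1) (Nat.succ_pos n), lintegral_eq_zero_iff (by fun_prop)] at h0
      have : ∀ᵐ u ∂(P (n + 1)), False := by
        filter_upwards [h0] with u hu
        have : ENNReal.ofReal (exp (-(l * u))) ≠ 0 := by simp [exp_pos]
        exact this hu
      rw [eventually_false_iff_eq_bot, ae_eq_bot] at this
      exact IsProbabilityMeasure.ne_zero _ this
    rw [← ENNReal.ofReal_pow hge, ENNReal.toReal_ofReal (by positivity), sub_eq_add_neg]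
  -- limit along an ultrafilter
  obtain ⟨m, -, hm'⟩ := isCompact_univ.ultrafilter_le_nhds ((hyperfilter ℕ : Ultrafilter ℕ).map ν) (by simp)
  have hlim : Tendsto ν (hyperfilter ℕ : Filter ℕ) (nhds m) := hm'
  have hmL : ∀ l, 0 < l → ∫ y, (y : ℝ) ^ l ∂(m : Measure unitInterval) = exp (-(l ^ p)) := by
    intro l hl
    have hc : Continuous fun y : unitInterval => (y : ℝ) ^ l := continuous_subtype_val.rpow_const fun y => Or.inr hl.le
    have := (ProbabilityMeasure.tendsto_iff_forall_integral_tendsto.1 hlim) (BoundedContinuousFunction.mkOfCompact ⟨_, hc⟩)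
    refine tendsto_nhds_unique this ?_
    exact (hνL l hl).mono_left Nat.hyperfilter_le_atTop
  set M : Measure unitInterval := (m : Measure unitInterval) with hM
  have hmL' : ∀ l, 0 < l → ∫⁻ y, ENNReal.ofReal ((y : ℝ) ^ l) ∂M = ENNReal.ofReal (exp (-(l ^ p))) := by
    intro l hl
    rw [← hmL l hl, ofReal_integral_eq_lintegral_ofReal]
    · have hc : Continuous fun y : unitInterval => (y : ℝ) ^ l := continuous_subtype_val.rpow_const fun y => Or.inr hl.le
      exact (BoundedContinuousFunction.mkOfCompact ⟨_, hc⟩).integrable M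
    · exact Eventually.of_forall fun y => rpow_nonneg y.2.1 _
  have h0 : M {0} = 0 := by
    have h1 : ∀ l, 0 < l → ENNReal.ofReal (exp (-(l ^ p))) ≤ M {0}ᶜ := by
      intro l hl
      rw [← hmL' l hl, ← lintegral_indicator_one (measurableSet_singleton _).compl]
      refine lintegral_mono fun y => ?_
      by_cases hy : y = 0
      · simp [hy, hl.ne']
      · rw [indicator_of_mem (by simpa using hy)]
        simp only [Pi.one_apply, ENNReal.ofReal_le_one]
        exact rpow_le_one y.2.1 y.2.2 hl.le
    have h2 : Tendsto (fun l : ℝ => ENNReal.ofReal (exp (-(l ^ p)))) (nhdsWithin 0 (Ioi 0)) (nhds 1) := by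
      have c : ContinuousAt (fun l : ℝ => ENNReal.ofReal (exp (-(l ^ p)))) 0 := by
        have := continuousAt_rpow_const (0:ℝ) p (Or.inr hp.le)
        exact ENNReal.continuous_ofReal.continuousAt.comp (continuous_exp.continuousAt.comp this.neg)
      have := c.tendsto.mono_left (nhdsWithin_le_nhds (s := Ioi 0))
      simpa [zero_rpow hp.ne'] using this
    have h3 : 1 ≤ M {0}ᶜ := le_of_tendsto h2 (by filter_upwards [self_mem_nhdsWithin] with l hl using h1 l hl)
    have h4 := prob_compl_eq_one_sub (μ := M) (measurableSet_singleton (0 : unitInterval)).compl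
    rw [compl_compl] at h4
    rw [h4]; exact tsub_eq_zero_of_le h3
  have h1 : M {1} = 0 := by
    have h1 : ∀ l, 0 < l → M {1} ≤ ENNReal.ofReal (exp (-(l ^ p))) := by
      intro l hl
      rw [← hmL' l hl, ← lintegral_indicator_one (measurableSet_singleton _)]
      refine lintegral_mono fun y => ?_
      by_cases hy : y = 1
      · simp [hy]
      · rw [indicator_of_notMem (by simpa using hy)]
        exact zero_le
    have h2 : Tendsto (fun l : ℝ => ENNReal.ofReal (exp (-(l ^ p)))) atTop (nhds 0) := by
      rw [← ENNReal.ofReal_zero]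
      refine ENNReal.tendsto_ofReal ?_
      exact tendsto_exp_neg_atTop_nhds_zero.comp (tendsto_rpow_atTop hp)
    refine le_antisymm (ge_of_tendsto h2 ?_) zero_le
    filter_upwards [eventually_gt_atTop 0] with l hl using h1 l hl
  have hlm : Measurable fun y : unitInterval => -log (y : ℝ) := by fun_prop
  have hae : ∀ᵐ y : unitInterval ∂M, 0 < (y : ℝ) ∧ (y : ℝ) < 1 := by
    filter_upwards [measure_eq_zero_iff_ae_notMem.1 h0, measure_eq_zero_iff_ae_notMem.1 h1] with y hy0 hy1
    exact ⟨lt_of_le_of_ne y.2.1 fun h => hy0 (Subtype.ext h.symm), lt_of_le_of_ne y.2.2 fun h => hy1 (Subtype.ext h)⟩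
  refine ⟨M.map fun y : unitInterval => -log (y : ℝ), Measure.isProbabilityMeasure_map hlm.aemeasurable, ?_, ?_⟩
  · rw [Measure.map_apply hlm measurableSet_Iic]
    refine measure_eq_zero_iff_ae_notMem.2 ?_
    filter_upwards [hae] with y hy
    simp only [mem_preimage, mem_Iic, not_le]
    have := log_neg hy.1 hy.2
    linarith
  · intro l hl
    rw [lintegral_map (by fun_prop) hlm, ← hmL' l hl]
    refine lintegral_congr_ae ?_
    filter_upwards [hae] with y hy
    rw [rpow_def_of_pos hy.1]
    congr 2; ring
end P3b

section P3c
set_option linter.unusedSectionVars false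

/-- one-sided stable law -/
structure SUB (p : ℝ) (η : Measure ℝ) : Prop where
  hp : 0 < p
  hp1 : p < 1
  prob : IsProbabilityMeasure η
  supp : η (Iic 0) = 0
  lap : ∀ l : ℝ, 0 < l → ∫⁻ u, ENNReal.ofReal (exp (-(l * u))) ∂η = ENNReal.ofReal (exp (-(l ^ p)))

variable {p : ℝ} {η : Measure ℝ}

lemma SUB.pos (h : SUB p η) : ∀ᵐ u ∂η, 0 < u := by
  filter_upwards [measure_eq_zero_iff_ae_notMem.1 h.supp] with u hu using not_le.1 hu

lemma ofReal_exp_add (a b : ℝ) : ENNReal.ofReal (exp (a + b)) = ENNReal.ofReal (exp a) * ENNReal.ofReal (exp b) := by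
  rw [exp_add, ENNReal.ofReal_mul (exp_pos _).le]

lemma SUB.lap' (h : SUB p η) {l : ℝ} (hl : 0 < l) :
    ∫⁻ u, ENNReal.ofReal (u * exp (-(l * u))) ∂η = ENNReal.ofReal (p * l ^ (p - 1) * exp (-(l ^ p))) := by
  haveI := h.prob
  have hIntg : ∀ l, 0 < l → Integrable (fun u => exp (-(l * u))) η := by
    intro l hl
    refine ⟨by fun_prop, ?_⟩
    rw [hasFiniteIntegral_iff_ofReal (Eventually.of_forall fun u => (exp_pos _).le), h.lap l hl]
    exact ENNReal.ofReal_lt_top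
  have hset : Iio (0:ℝ) ⊆ ProbabilityTheory.integrableExpSet id η := by
    intro t ht
    have := hIntg (-t) (by simpa using ht)
    simpa [ProbabilityTheory.integrableExpSet] using this
  have hmem : -l ∈ interior (ProbabilityTheory.integrableExpSet id η) := by
    refine interior_mono hset ?_
    rw [interior_Iio]; simpa using hl
  have h1 := ProbabilityTheory.hasDerivAt_mgf hmem
  have h2 : HasDerivAt (fun t : ℝ => exp (-((-t) ^ p))) (p * l ^ (p - 1) * exp (-(l ^ p))) (-l) := by
    have a1 : HasDerivAt (fun t : ℝ => -t) (-1) (-l) := (hasDerivAt_id' _).fun_neg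
    have a2 := a1.rpow_const (p := p) (Or.inl (by simpa using hl.ne'))
    have a3 := (a2.fun_neg).exp
    refine a3.congr_deriv ?_
    simp; ring
  have h3 : ProbabilityTheory.mgf id η =ᶠ[nhds (-l)] fun t : ℝ => exp (-((-t) ^ p)) := by
    filter_upwards [Iio_mem_nhds (show -l < 0 by linarith)] with t ht
    have ht' : 0 < -t := by simpa using ht
    unfold ProbabilityTheory.mgf
    rw [integral_eq_lintegral_of_nonneg_ae (Eventually.of_forall fun u => (exp_pos _).le) (Measurable.aestronglyMeasurable (by fun_prop))]
    have := h.lap (-t) ht'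
    simp only [neg_mul, neg_neg] at this
    simp only [id]
    rw [this, ENNReal.toReal_ofReal (exp_pos _).le]
  have h4 := (h2.congr_of_eventuallyEq h3).unique h1
  have hpos : 0 < p * l ^ (p - 1) * exp (-(l ^ p)) := by have := h.hp; positivity
  have hi : Integrable (fun u => u * exp (-(l * u))) η := by
    by_contra hn
    have : ∫ u, id u * exp (-l * id u) ∂η = 0 := by
      simp only [id, neg_mul]
      exact integral_undef hn
    rw [this] at h4
    exact hpos.ne' h4
  rw [h4]
  simp only [id, neg_mul]
  rw [ofReal_integral_eq_lintegral_ofReal hi]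
  filter_upwards [h.pos] with u hu
  positivity

/-- size-bias identity -/
lemma SUB.size_bias (h : SUB p η) {f : ℝ → ℝ≥0∞} (hf : Measurable f) :
    ∫⁻ u, ENNReal.ofReal u * f u ∂η =
      ∫⁻ s in Ioi (0:ℝ), ENNReal.ofReal (p / Gamma (1 - p) * s ^ (-p)) * ∫⁻ u, f (s + u) ∂η := by
  haveI := h.prob
  have hp := h.hp
  have hp1 := h.hp1
  have hG := Gamma_pos_of_pos (by linarith : 0 < 1 - p)
  set κ := p / Gamma (1 - p) with hκ
  have hκ0 : 0 < κ := by positivity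
  set μ1 : Measure ℝ := η.withDensity (fun u => ENNReal.ofReal (u * exp (-u)))
  set a : Measure ℝ := (volume.restrict (Ioi 0)).withDensity (fun s => ENNReal.ofReal (κ * s ^ (-p) * exp (-s))) with ha
  set b : Measure ℝ := η.withDensity (fun u => ENNReal.ofReal (exp (-u))) with hb
  have haL : ∀ l, 0 ≤ l → ∫⁻ s, ENNReal.ofReal (exp (-(l * s))) ∂a = ENNReal.ofReal (p * (l + 1) ^ (p - 1)) := by
    intro l hl
    rw [ha, lintegral_withDensity_eq_lintegral_mul _ (by fun_prop) (by fun_prop)]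
    have e : ∀ s ∈ Ioi (0:ℝ), ((fun s => ENNReal.ofReal (κ * s ^ (-p) * exp (-s))) * fun s => ENNReal.ofReal (exp (-(l * s)))) s
        = ENNReal.ofReal κ * ENNReal.ofReal (s ^ ((1 - p) - 1) * exp (-((l + 1) * s))) := by
      intro s hs
      have hs' : (0:ℝ) < s := hs
      simp only [Pi.mul_apply]
      rw [← ENNReal.ofReal_mul (by positivity), ← ENNReal.ofReal_mul (by positivity), show -((l + 1) * s) = -s + -(l * s) by ring, exp_add,
        show (1 - p) - 1 = -p by ring]
      congr 1; ring
    rw [setLIntegral_congr_fun measurableSet_Ioi e, lintegral_const_mul _ (by fun_prop), lap_rpow (by linarith) (by linarith),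
      ← ENNReal.ofReal_mul (by positivity), one_div, inv_rpow (by positivity), ← rpow_neg (by positivity), neg_sub, hκ]
    congr 1
    field_simp
  have hbL : ∀ l, 0 ≤ l → ∫⁻ s, ENNReal.ofReal (exp (-(l * s))) ∂b = ENNReal.ofReal (exp (-(l + 1) ^ p)) := by
    intro l hl
    rw [hb, lintegral_withDensity_eq_lintegral_mul _ (by fun_prop) (by fun_prop), ← h.lap (l + 1) (by linarith)]
    refine lintegral_congr fun u => ?_
    simp only [Pi.mul_apply]
    rw [← ofReal_exp_add]; congr 2; ring
  have h1L : ∀ l, 0 ≤ l → ∫⁻ s, ENNReal.ofReal (exp (-(l * s))) ∂μ1 = ENNReal.ofReal (p * (l + 1) ^ (p - 1) * exp (-(l + 1) ^ p)) := by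
    intro l hl
    rw [lintegral_withDensity_eq_lintegral_mul _ (by fun_prop) (by fun_prop), ← h.lap' (by linarith : 0 < l + 1)]
    refine lintegral_congr fun u => ?_
    simp only [Pi.mul_apply]
    rw [← ENNReal.ofReal_mul' (exp_pos _).le, mul_assoc, ← exp_add]; congr 3; ring
  haveI : IsFiniteMeasure a := ⟨by
    have := haL 0 le_rfl
    simp only [zero_mul, neg_zero, exp_zero, ENNReal.ofReal_one, lintegral_one] at this
    rw [this]; exact ENNReal.ofReal_lt_top⟩
  haveI : IsFiniteMeasure b := ⟨by
    have := hbL 0 le_rfl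
    simp only [zero_mul, neg_zero, exp_zero, ENNReal.ofReal_one, lintegral_one] at this
    rw [this]; exact ENNReal.ofReal_lt_top⟩
  haveI : IsFiniteMeasure μ1 := ⟨by
    have := h1L 0 le_rfl
    simp only [zero_mul, neg_zero, exp_zero, ENNReal.ofReal_one, lintegral_one] at this
    rw [this]; exact ENNReal.ofReal_lt_top⟩
  have hη0 : η (Iio 0) = 0 := measure_mono_null Iio_subset_Iic_self h.supp
  have hb0 : b (Iio 0) = 0 := withDensity_absolutelyContinuous _ _ hη0
  have ha0 : a (Iio 0) = 0 := withDensity_absolutelyContinuous _ _ (by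
    rw [Measure.restrict_apply measurableSet_Iio]
    have : Iio (0:ℝ) ∩ Ioi 0 = ∅ := by ext u; simp; intro h; exact h.le
    rw [this, measure_empty])
  have key : μ1 = a.conv b := by
    refine laplace_ext (withDensity_absolutelyContinuous _ _ hη0) ?_ fun n => ?_
    · have : ∫⁻ z, (Iio (0:ℝ)).indicator 1 z ∂(a.conv b) = 0 := by
        rw [Measure.lintegral_conv (measurable_one.indicator measurableSet_Iio)]
        have hx : ∀ᵐ x ∂a, ∫⁻ y, (Iio (0:ℝ)).indicator (1 : ℝ → ℝ≥0∞) (x + y) ∂b = 0 := by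
          filter_upwards [measure_eq_zero_iff_ae_notMem.1 ha0] with x hx
          have hz : ∀ᵐ y ∂b, (Iio (0:ℝ)).indicator (1 : ℝ → ℝ≥0∞) (x + y) = 0 := by
            filter_upwards [measure_eq_zero_iff_ae_notMem.1 hb0] with y hy
            simp only [mem_Iio, not_lt] at hx hy
            rw [indicator_of_notMem]
            simp only [mem_Iio, not_lt]; linarith
          rw [lintegral_congr_ae hz, lintegral_zero]
        rw [lintegral_congr_ae hx, lintegral_zero]
      rwa [lintegral_indicator_one measurableSet_Iio] at this
    · rw [h1L n (by positivity), Measure.lintegral_conv (by fun_prop)]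
      have : ∀ x y : ℝ, ENNReal.ofReal (exp (-(n * (x + y)))) = ENNReal.ofReal (exp (-(n * x))) * ENNReal.ofReal (exp (-(n * y))) := by
        intro x y; rw [← ofReal_exp_add]; congr 2; ring
      simp_rw [this]
      simp_rw [lintegral_const_mul _ (show Measurable fun y : ℝ => ENNReal.ofReal (exp (-(n * y))) by fun_prop), hbL n (by positivity)]
      rw [lintegral_mul_const _ (by fun_prop), haL n (by positivity), ENNReal.ofReal_mul (by positivity)]
  have hfe : Measurable fun u => f u * ENNReal.ofReal (exp u) := by fun_prop
  have e1 : ∫⁻ u, ENNReal.ofReal u * f u ∂η = ∫⁻ u, f u * ENNReal.ofReal (exp u) ∂μ1 := by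
    rw [lintegral_withDensity_eq_lintegral_mul _ (by fun_prop) hfe]
    refine lintegral_congr fun u => ?_
    simp only [Pi.mul_apply]
    rw [mul_comm (f u), ← mul_assoc, ← ENNReal.ofReal_mul' (exp_pos _).le, mul_assoc, ← exp_add]
    simp
  rw [e1, key, Measure.lintegral_conv hfe]
  have hbm : ∀ x, ∫⁻ y, f (x + y) * ENNReal.ofReal (exp (x + y)) ∂b = ENNReal.ofReal (exp x) * ∫⁻ u, f (x + u) ∂η := by
    intro x
    rw [hb, lintegral_withDensity_eq_lintegral_mul _ (by fun_prop) (by fun_prop), ← lintegral_const_mul _ (by fun_prop)]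
    refine lintegral_congr fun u => ?_
    simp only [Pi.mul_apply]
    rw [mul_comm (f _), ← mul_assoc, ← ofReal_exp_add]; congr 3; ring
  simp_rw [hbm]
  have hinner : Measurable fun x => ∫⁻ u, f (x + u) ∂η := Measurable.lintegral_prod_right' (f := fun q : ℝ × ℝ => f (q.1 + q.2)) (by fun_prop)
  rw [ha, lintegral_withDensity_eq_lintegral_mul _ (by fun_prop) (by fun_prop)]
  refine setLIntegral_congr_fun measurableSet_Ioi fun s hs => ?_
  simp only [Pi.mul_apply]
  rw [← mul_assoc, ← ENNReal.ofReal_mul' (exp_pos _).le, mul_assoc, ← exp_add]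
  simp

end P3c

section P3d
set_option linter.unusedSectionVars false
variable {p : ℝ} {η : Measure ℝ}

lemma SUB.tail (h : SUB p η) {a : ℝ} (ha : 0 < a) : η (Ioi a) ≤ ENNReal.ofReal (2 * a ^ (-p)) := by
  haveI := h.prob
  have h1 : ENNReal.ofReal (1/2) * η (Ioi a) + ENNReal.ofReal (exp (-((1/a) ^ p))) ≤ 1 := by
    rw [← h.lap (1/a) (by positivity), ← lintegral_indicator_one measurableSet_Ioi, ← lintegral_const_mul _ (measurable_one.indicator measurableSet_Ioi),
      ← lintegral_add_right _ (by fun_prop)]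
    calc _ ≤ ∫⁻ u, 1 ∂η := ?_
      _ = 1 := by simp
    refine lintegral_mono_ae ?_
    filter_upwards [h.pos] with u hu
    by_cases hua : u ∈ Ioi a
    · rw [indicator_of_mem hua]
      simp only [Pi.one_apply, mul_one]
      rw [← ENNReal.ofReal_add (by norm_num) (exp_pos _).le, ENNReal.ofReal_le_one]
      have : exp (-(1 / a * u)) ≤ exp (-1) := by
        apply exp_le_exp.2
        have : 1 ≤ 1 / a * u := by rw [one_div_mul_eq_div, one_le_div ha]; exact (le_of_lt hua)
        linarith
      have := exp_neg_one_lt_half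
      linarith
    · rw [indicator_of_notMem hua, mul_zero, zero_add, ENNReal.ofReal_le_one, exp_le_one_iff]
      have : 0 < 1 / a * u := by positivity
      linarith
  have h2 : ENNReal.ofReal (1/2) * η (Ioi a) ≤ ENNReal.ofReal ((1/a)^p) := by
    have : ENNReal.ofReal (1/2) * η (Ioi a) ≤ 1 - ENNReal.ofReal (exp (-((1/a) ^ p))) := by
      rw [ENNReal.le_sub_iff_add_le_right ENNReal.ofReal_ne_top]
      · exact h1
      · rw [ENNReal.ofReal_le_one, exp_le_one_iff]; have : 0 < (1/a)^p := by positivity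
        linarith
    refine this.trans ?_
    rw [← ENNReal.ofReal_one, ← ENNReal.ofReal_sub _ (exp_pos _).le]
    apply ENNReal.ofReal_le_ofReal
    have := add_one_le_exp (-((1/a) ^ p))
    linarith
  have h3 : η (Ioi a) = ENNReal.ofReal 2 * (ENNReal.ofReal (1/2) * η (Ioi a)) := by
    rw [← mul_assoc, ← ENNReal.ofReal_mul (by norm_num)]; norm_num
  rw [h3, ENNReal.ofReal_mul (by norm_num), rpow_neg ha.le, ← inv_rpow ha.le, ← one_div]
  exact mul_le_mul_right h2 _

lemma win_int (hp : 0 < p) (hp1 : p < 1) (a : ℝ) :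
    ∫⁻ s in Ioi (0:ℝ), ENNReal.ofReal (s ^ (-p)) * (Ioc a (a + 1)).indicator 1 s ≤ ENNReal.ofReal (1 / (1 - p) + 1) := by
  have h1p : 0 ≤ 1 / (1 - p) := by
    have : 0 < 1 - p := by linarith
    positivity
  calc _ ≤ ∫⁻ s in Ioi (0:ℝ), ((Ioo (0:ℝ) 1).indicator (fun s => ENNReal.ofReal (s ^ ((1 - p) - 1))) s + (Ioc a (a + 1)).indicator 1 s) := by
        refine setLIntegral_mono' measurableSet_Ioi fun s hs => ?_
        have hs' : (0:ℝ) < s := hs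
        by_cases h1 : s < 1
        · rw [indicator_of_mem (show s ∈ Ioo (0:ℝ) 1 from ⟨hs', h1⟩), show (1 - p) - 1 = -p by ring]
          refine le_add_right ?_
          calc _ ≤ ENNReal.ofReal (s ^ (-p)) * 1 := mul_le_mul_right (indicator_le_self' (fun _ _ => zero_le) s) _
            _ = _ := mul_one _
        · refine le_add_left ?_
          calc _ ≤ 1 * (Ioc a (a + 1)).indicator (1 : ℝ → ℝ≥0∞) s := mul_le_mul_left (by
                rw [ENNReal.ofReal_le_one]; exact rpow_le_one_of_one_le_of_nonpos (not_lt.1 h1) (by linarith)) _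
            _ = _ := one_mul _
    _ ≤ _ := by
        rw [lintegral_add_right _ (measurable_one.indicator measurableSet_Ioc), ENNReal.ofReal_add h1p zero_le_one]
        refine add_le_add ?_ ?_
        · rw [setLIntegral_indicator measurableSet_Ioo]
          rw [inter_eq_left.2 (fun x hx => hx.1), lint_rpow (by linarith) one_pos]
          simp
        · refine (setLIntegral_le_lintegral _ _).trans ?_
          rw [lintegral_indicator_one measurableSet_Ioc]
          simp

lemma SUB.window (h : SUB p η) : ∃ C : ℝ, 0 < C ∧ ∀ w : ℝ, 2 ≤ w → η (Ioc (w - 1) w) ≤ ENNReal.ofReal (C * w ^ (-1 - p)) := by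
  haveI := h.prob
  have hp := h.hp
  have hp1 := h.hp1
  have hG := Gamma_pos_of_pos (by linarith : 0 < 1 - p)
  have hsb := @SUB.size_bias p η h
  set κ := p / Gamma (1 - p) with hκ
  have hκ0 : 0 < κ := by positivity
  have hp1' : 0 < 1 - p := by linarith
  set c := 1 / (1 - p) + 1 with hc
  have hc0 : 0 < c := by positivity
  refine ⟨2 * κ * (4 ^ p + c * (2 * 4 ^ p)), by positivity, fun w hw => ?_⟩
  set f : ℝ → ℝ≥0∞ := (Ioc (w - 1) w).indicator 1 with hf
  have hfm : Measurable f := measurable_one.indicator measurableSet_Ioc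
  have hL : ENNReal.ofReal (w / 2) * η (Ioc (w - 1) w) ≤ ∫⁻ u, ENNReal.ofReal u * f u ∂η := by
    rw [← lintegral_indicator_one measurableSet_Ioc, ← lintegral_const_mul _ hfm]
    refine lintegral_mono fun u => ?_
    by_cases hu : u ∈ Ioc (w - 1) w
    · refine mul_le_mul_left (ENNReal.ofReal_le_ofReal ?_) _
      have := hu.1; linarith
    · simp [indicator_of_notMem hu, hf]
  rw [hsb hfm] at hL
  have hR : ∫⁻ s in Ioi (0:ℝ), ENNReal.ofReal (κ * s ^ (-p)) * ∫⁻ u, f (s + u) ∂η ≤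
      ENNReal.ofReal κ * (ENNReal.ofReal ((w/4)^(-p)) + ENNReal.ofReal c * η (Ioi (w/4))) := by
    have hinner : Measurable fun x => ∫⁻ u, f (x + u) ∂η := Measurable.lintegral_prod_right' (f := fun q : ℝ × ℝ => f (q.1 + q.2)) (by fun_prop)
    have hinner2 : Measurable fun q : ℝ × ℝ => ENNReal.ofReal (q.1 ^ (-p)) * ((Ioi (w/4)).indicator 1 q.2 * f (q.1 + q.2)) := by
      have : Measurable ((Ioi (w/4)).indicator (1 : ℝ → ℝ≥0∞)) := measurable_one.indicator measurableSet_Ioi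
      fun_prop
    calc _ ≤ ∫⁻ s in Ioi (0:ℝ), ENNReal.ofReal κ * (ENNReal.ofReal ((w/4)^(-p)) * (∫⁻ u, f (s + u) ∂η) +
            ∫⁻ u, ENNReal.ofReal (s ^ (-p)) * ((Ioi (w/4)).indicator 1 u * f (s + u)) ∂η) := by
          refine setLIntegral_mono' measurableSet_Ioi fun s hs => ?_
          have hs' : (0:ℝ) < s := hs
          rw [ENNReal.ofReal_mul hκ0.le, mul_assoc]
          refine mul_le_mul_right ?_ _
          by_cases h1 : w / 4 < s
          · refine le_add_right (mul_le_mul_left (ENNReal.ofReal_le_ofReal ?_) _)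
            exact rpow_le_rpow_of_nonpos (by linarith) h1.le (by linarith)
          · refine le_add_left ?_
            rw [← lintegral_const_mul _ (by fun_prop)]
            refine lintegral_mono fun u => mul_le_mul_right ?_ _
            by_cases hu : s + u ∈ Ioc (w - 1) w
            · rw [indicator_of_mem (show u ∈ Ioi (w/4) by simp only [mem_Ioi]; have := hu.1; linarith)]
              simp
            · simp [hf, indicator_of_notMem hu]
      _ = ENNReal.ofReal κ * (ENNReal.ofReal ((w/4)^(-p)) * (∫⁻ s in Ioi (0:ℝ), ∫⁻ u, f (s + u) ∂η) +
            ∫⁻ u, (∫⁻ s in Ioi (0:ℝ), ENNReal.ofReal (s ^ (-p)) * ((Ioi (w/4)).indicator 1 u * f (s + u))) ∂η) := by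
          have m2 : Measurable fun s => ∫⁻ u, ENNReal.ofReal (s ^ (-p)) * ((Ioi (w/4)).indicator 1 u * f (s + u)) ∂η := hinner2.lintegral_prod_right'
          rw [lintegral_const_mul _ (by fun_prop), lintegral_add_right _ m2, lintegral_const_mul _ hinner,
            lintegral_lintegral_swap (f := fun s u => ENNReal.ofReal (s ^ (-p)) * ((Ioi (w/4)).indicator 1 u * f (s + u))) hinner2.aemeasurable]
      _ ≤ _ := by
          refine mul_le_mul_right (add_le_add ?_ ?_) _
          · rw [lintegral_lintegral_swap (by fun_prop)]
            calc _ ≤ ENNReal.ofReal ((w/4)^(-p)) * ∫⁻ u, 1 ∂η := by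
                  refine mul_le_mul_right (lintegral_mono fun u => ?_) _
                  refine (setLIntegral_le_lintegral _ _).trans ?_
                  rw [lintegral_add_right_eq_self f u, hf, lintegral_indicator_one measurableSet_Ioc]
                  simp
              _ = _ := by simp
          · rw [← lintegral_indicator_one measurableSet_Ioi, ← lintegral_const_mul _ (measurable_one.indicator measurableSet_Ioi)]
            refine lintegral_mono fun u => ?_
            calc _ = ∫⁻ s in Ioi (0:ℝ), (Ioi (w/4)).indicator 1 u * (ENNReal.ofReal (s ^ (-p)) * (Ioc (w - 1 - u) (w - 1 - u + 1)).indicator 1 s) := by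
                  refine lintegral_congr fun s => ?_
                  have : f (s + u) = (Ioc (w - 1 - u) (w - 1 - u + 1)).indicator 1 s := by
                    simp only [hf, indicator_apply, mem_Ioc, Pi.one_apply]
                    congr 1
                    refine propext (and_congr ?_ ?_) <;> constructor <;> intro _ <;> linarith
                  rw [this]; ring
              _ ≤ _ := by
                  rw [lintegral_const_mul _ (by
                    have : Measurable ((Ioc (w - 1 - u) (w - 1 - u + 1)).indicator (1 : ℝ → ℝ≥0∞)) := measurable_one.indicator measurableSet_Ioc
                    fun_prop), mul_comm]
                  exact mul_le_mul_left (win_int hp hp1 _) _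
  have h3 := (hL.trans hR).trans (mul_le_mul_right (add_le_add_right (mul_le_mul_right (h.tail (by linarith : 0 < w/4)) _) _) _)
  rw [← ENNReal.ofReal_mul hc0.le, ← ENNReal.ofReal_add (by positivity) (by positivity), ← ENNReal.ofReal_mul hκ0.le] at h3
  have hw0 : 0 < w := by linarith
  have h4 : η (Ioc (w - 1) w) = ENNReal.ofReal (2 / w) * (ENNReal.ofReal (w/2) * η (Ioc (w - 1) w)) := by
    rw [← mul_assoc, ← ENNReal.ofReal_mul (by positivity), show 2 / w * (w / 2) = 1 by field_simp]; simp
  rw [h4]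
  refine (mul_le_mul_right h3 _).trans ?_
  rw [← ENNReal.ofReal_mul (by positivity)]
  apply ENNReal.ofReal_le_ofReal
  apply le_of_eq
  have e1 : (w/4)^(-p) = 4 ^ p * w ^ (-p) := by
    rw [div_rpow hw0.le (by norm_num), rpow_neg (by norm_num : (0:ℝ) ≤ 4)]; field_simp
  have e2 : w ^ (-1 - p) = w ^ (-p) / w := by rw [← rpow_sub_one hw0.ne']; congr 1; ring
  rw [e1, e2]; field_simp

lemma SUB.upper (h : SUB p η) : ∃ C : ℝ≥0, ∀ v : ℝ, 2 ≤ v → ∀ f F : ℝ → ℝ≥0∞, Measurable F →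
    (∀ u, v < u → f u ≤ ∫⁻ w in Ico u (u + 1), F w) →
    ∫⁻ u in Ioi v, f u ∂η ≤ C * ∫⁻ w in Ioi v, ENNReal.ofReal (w ^ (-1 - p)) * F w := by
  haveI := h.prob
  obtain ⟨C, hC, hw⟩ := h.window
  refine ⟨C.toNNReal, fun v hv f F hF hfF => ?_⟩
  have hS : MeasurableSet {q : ℝ × ℝ | v < q.1 ∧ q.1 ≤ q.2 ∧ q.2 < q.1 + 1} :=
    (measurableSet_lt measurable_const measurable_fst).inter ((measurableSet_le measurable_fst measurable_snd).inter (measurableSet_lt measurable_snd (measurable_fst.add_const 1)))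
  set G : ℝ × ℝ → ℝ≥0∞ := {q : ℝ × ℝ | v < q.1 ∧ q.1 ≤ q.2 ∧ q.2 < q.1 + 1}.indicator (fun q => F q.2) with hG
  have hGm : Measurable G := (hF.comp measurable_snd).indicator hS
  calc _ ≤ ∫⁻ u, (∫⁻ w, G (u, w)) ∂η := by
        rw [← lintegral_indicator measurableSet_Ioi]
        refine lintegral_mono fun u => ?_
        by_cases hu : u ∈ Ioi v
        · rw [indicator_of_mem hu]
          refine (hfF u hu).trans ?_
          rw [← lintegral_indicator measurableSet_Ico]
          refine lintegral_mono fun w => ?_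
          by_cases hw' : w ∈ Ico u (u + 1)
          · rw [indicator_of_mem hw', hG, indicator_of_mem]; exact ⟨hu, hw'.1, hw'.2⟩
          · rw [indicator_of_notMem hw']; exact zero_le
        · rw [indicator_of_notMem hu]; exact zero_le
    _ = ∫⁻ w, (∫⁻ u, G (u, w) ∂η) := lintegral_lintegral_swap (f := fun u w => G (u, w)) hGm.aemeasurable
    _ ≤ ∫⁻ w, (Ioi v).indicator (fun w => C.toNNReal * (ENNReal.ofReal (w ^ (-1 - p)) * F w)) w := by
        refine lintegral_mono fun w => ?_
        by_cases hwv : v < w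
        · rw [indicator_of_mem (show w ∈ Ioi v from hwv)]
          calc _ ≤ ∫⁻ u, F w * (Ioc (w - 1) w).indicator 1 u ∂η := by
                refine lintegral_mono fun u => ?_
                simp only [hG, indicator_apply]
                split_ifs with h1 h2
                · simp
                · exact absurd ⟨by linarith [h1.2.2], h1.2.1⟩ h2
                · exact zero_le
                · exact zero_le
            _ = F w * η (Ioc (w - 1) w) := by
                rw [lintegral_const_mul _ (measurable_one.indicator measurableSet_Ioc), lintegral_indicator_one measurableSet_Ioc]
            _ ≤ F w * ENNReal.ofReal (C * w ^ (-1 - p)) := mul_le_mul_right (hw w (by linarith)) _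
            _ = _ := by rw [ENNReal.ofReal_mul hC.le, mul_comm, mul_assoc]; rfl
        · have : ∀ u, G (u, w) = 0 := by
            intro u
            simp only [hG]
            rw [indicator_of_notMem]
            rintro ⟨h1, h2, -⟩
            exact hwv (lt_of_lt_of_le h1 h2)
          simp [this]
    _ = _ := by rw [lintegral_indicator measurableSet_Ioi, lintegral_const_mul _ (by fun_prop)]

lemma SUB.lower (h : SUB p η) : ∃ v : ℝ, 2 ≤ v ∧ ∃ C : ℝ≥0, ∀ f : ℝ → ℝ≥0∞, Measurable f →
    ∫⁻ w in Ioi v, ENNReal.ofReal (w ^ (-1 - p)) * f w ≤ C * ∫⁻ u, f u ∂η := by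
  haveI := h.prob
  have hp := h.hp
  have hp1 := h.hp1
  have hG := Gamma_pos_of_pos (by linarith : 0 < 1 - p)
  have hsb := @SUB.size_bias p η h
  set κ := p / Gamma (1 - p) with hκ
  have hκ0 : 0 < κ := by positivity
  obtain ⟨v, hv2, hv⟩ : ∃ v : ℝ, 2 ≤ v ∧ 2 * v ^ (-p) ≤ 1/2 := by
    have : Tendsto (fun v : ℝ => 2 * v ^ (-p)) atTop (nhds (2 * 0)) := (tendsto_rpow_neg_atTop hp).const_mul 2
    rw [mul_zero] at this
    exact ((eventually_ge_atTop 2).and (this.eventually (ge_mem_nhds (by norm_num)))).exists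
  have hhalf : ENNReal.ofReal (1/2) ≤ η (Iic v) := by
    have h1 := (h.tail (by linarith : 0 < v)).trans (ENNReal.ofReal_le_ofReal hv)
    have h2 := prob_compl_eq_one_sub (μ := η) (measurableSet_Ioi (a := v))
    rw [compl_Ioi] at h2
    rw [h2]
    refine le_trans ?_ (tsub_le_tsub_left h1 1)
    rw [← ENNReal.ofReal_one, ← ENNReal.ofReal_sub _ (by norm_num)]
    norm_num
  refine ⟨v, hv2, (2 / κ).toNNReal, fun f hf => ?_⟩
  set g : ℝ → ℝ≥0∞ := fun u => ENNReal.ofReal (1 / u) * f u with hg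
  have hgm : Measurable g := by fun_prop
  have e1 : ∫⁻ u, f u ∂η = ∫⁻ u, ENNReal.ofReal u * g u ∂η := by
    refine lintegral_congr_ae ?_
    filter_upwards [h.pos] with u hu
    simp only [hg]
    rw [← mul_assoc, ← ENNReal.ofReal_mul hu.le, mul_one_div_cancel hu.ne', ENNReal.ofReal_one, one_mul]
  have hI : ∫⁻ w in Ioi v, ENNReal.ofReal (w ^ (-1 - p)) * f w = ∫⁻ w in Ioi v, ENNReal.ofReal (w ^ (-p)) * g w := by
    refine setLIntegral_congr_fun measurableSet_Ioi fun w hw => ?_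
    have hw0 : 0 < w := by simp only [mem_Ioi] at hw; linarith
    simp only [hg]
    rw [← mul_assoc, ← ENNReal.ofReal_mul (by positivity)]
    congr 2
    rw [show -1 - p = -p - 1 by ring, rpow_sub_one hw0.ne']; ring
  set I := ∫⁻ w in Ioi v, ENNReal.ofReal (w ^ (-p)) * g w with hId
  have key : ENNReal.ofReal (κ / 2) * I ≤ ∫⁻ u, f u ∂η := by
    rw [e1, hsb hgm]
    have sw : ∫⁻ s in Ioi (0:ℝ), ENNReal.ofReal (κ * s ^ (-p)) * ∫⁻ u, g (s + u) ∂η =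
        ∫⁻ u, (∫⁻ s in Ioi (0:ℝ), ENNReal.ofReal (κ * s ^ (-p)) * g (s + u)) ∂η := by
      rw [← lintegral_lintegral_swap (by fun_prop)]
      refine lintegral_congr fun s => ?_
      rw [lintegral_const_mul _ (by fun_prop)]
    rw [sw]
    calc _ = ENNReal.ofReal κ * I * ENNReal.ofReal (1/2) := by
          rw [mul_right_comm, ← ENNReal.ofReal_mul hκ0.le]; congr 2; ring
      _ ≤ ENNReal.ofReal κ * I * η (Iic v) := mul_le_mul_right hhalf _
      _ = ∫⁻ u in Iic v, ENNReal.ofReal κ * I ∂η := by rw [setLIntegral_const]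
      _ ≤ ∫⁻ u in Iic v, (∫⁻ s in Ioi (0:ℝ), ENNReal.ofReal (κ * s ^ (-p)) * g (s + u)) ∂η := by
          refine lintegral_mono_ae ((ae_restrict_iff' measurableSet_Iic).2 ?_)
          filter_upwards [h.pos] with u hu0 hu
          simp only [mem_Iic] at hu
          rw [hId, ← lintegral_const_mul _ (by fun_prop), ← lintegral_indicator measurableSet_Ioi, ← lintegral_indicator measurableSet_Ioi,
            ← lintegral_add_right_eq_self ((Ioi v).indicator _) u]
          refine lintegral_mono_ae ?_
          refine Eventually.of_forall fun s => ?_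
          simp only [indicator_apply, mem_Ioi]
          by_cases hs : v < s + u
          · have hs0 : 0 < s := by linarith
            rw [if_pos hs, if_pos hs0, ← mul_assoc, ← ENNReal.ofReal_mul hκ0.le]
            refine mul_le_mul_left (ENNReal.ofReal_le_ofReal (mul_le_mul_of_nonneg_left ?_ hκ0.le)) _
            exact rpow_le_rpow_of_nonpos hs0 (by linarith) (by linarith)
          · rw [if_neg hs]; exact zero_le
      _ ≤ _ := setLIntegral_le_lintegral _ _
  rw [hI]
  calc I = ENNReal.ofReal (2 / κ) * (ENNReal.ofReal (κ / 2) * I) := by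
        rw [← mul_assoc, ← ENNReal.ofReal_mul (by positivity), show 2 / κ * (κ / 2) = 1 by field_simp]; simp
    _ ≤ _ := mul_le_mul_right key _

lemma SUB.moment_eq (h : SUB p η) {a : ℝ} (ha : 0 < a) :
    ENNReal.ofReal (Gamma a) * ∫⁻ u, ENNReal.ofReal (u ^ (-a)) ∂η = ENNReal.ofReal ((1 / p) * Gamma (a / p)) := by
  haveI := h.prob
  have hG := Gamma_pos_of_pos ha
  rw [show a / p = (a - 1 + 1) / p by rw [sub_add_cancel]]
  rw [← lintegral_const_mul _ (by fun_prop)]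
  have : ∀ᵐ u ∂η, ENNReal.ofReal (Gamma a) * ENNReal.ofReal (u ^ (-a)) = ∫⁻ l in Ioi (0:ℝ), ENNReal.ofReal (l ^ (a - 1)) * ENNReal.ofReal (exp (-(l * u))) := by
    filter_upwards [h.pos] with u hu
    rw [← ENNReal.ofReal_mul hG.le]
    have := lap_rpow ha hu
    rw [one_div, inv_rpow hu.le, ← rpow_neg hu.le, mul_comm] at this
    rw [← this]
    refine setLIntegral_congr_fun measurableSet_Ioi fun l hl => ?_
    rw [← ENNReal.ofReal_mul' (exp_pos _).le, mul_comm u l]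
  rw [lintegral_congr_ae this, lintegral_lintegral_swap (by fun_prop)]
  have e2 : ∀ l ∈ Ioi (0:ℝ), ∫⁻ u, ENNReal.ofReal (l ^ (a - 1)) * ENNReal.ofReal (exp (-(l * u))) ∂η = ENNReal.ofReal (l ^ (a - 1) * exp (-l ^ p)) := by
    intro l hl
    rw [lintegral_const_mul _ (by fun_prop), h.lap l hl, ENNReal.ofReal_mul' (exp_pos _).le]
  rw [setLIntegral_congr_fun measurableSet_Ioi e2]
  have hp := h.hp
  refine lint_of_int measurableSet_Ioi (fun l hl => ?_) (integral_rpow_mul_exp_neg_rpow h.hp (by linarith)) ?_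
  · have : (0:ℝ) < l := hl
    positivity
  · have := Gamma_pos_of_pos (show 0 < (a - 1 + 1) / p by rw [sub_add_cancel]; positivity)
    positivity

lemma SUB.moment (h : SUB p η) {a : ℝ} (ha : 0 < a) : ∃ C : ℝ≥0, ∫⁻ u, ENNReal.ofReal (u ^ (-a)) ∂η ≤ C := by
  have hG := Gamma_pos_of_pos ha
  have h1 := h.moment_eq ha
  have hne : ∫⁻ u, ENNReal.ofReal (u ^ (-a)) ∂η ≠ ∞ := by
    intro htop
    rw [htop, ENNReal.mul_top (by simpa using hG)] at h1
    exact ENNReal.ofReal_ne_top h1.symm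
  exact ⟨(∫⁻ u, ENNReal.ofReal (u ^ (-a)) ∂η).toNNReal, by rw [ENNReal.coe_toNNReal hne]⟩
end P3d

section P4a
set_option linter.unusedSectionVars false

lemma lint_of_int' {X : Type*} [MeasurableSpace X] {μ : Measure X} {f : X → ℝ} {v : ℝ} (hf : ∀ u, 0 ≤ f u) (hv : ∫ u, f u ∂μ = v) (h0 : v ≠ 0) :
    ∫⁻ u, ENNReal.ofReal (f u) ∂μ = ENNReal.ofReal v := by
  have hi : Integrable f μ := by
    by_contra h
    rw [integral_undef h] at hv
    exact h0 hv.symm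
  rw [← hv, ofReal_integral_eq_lintegral_ofReal hi (Eventually.of_forall hf)]

lemma gauss_real {d : ℕ} {b : ℝ} (hb : 0 < b) (c : ℝ) (w : Ed d) :
    ∫ z : Ed d, exp (-b * ‖z‖ ^ 2 + c * ⟪w, z⟫) = (π / b) ^ ((d:ℝ) / 2) * exp (c ^ 2 * ‖w‖ ^ 2 / (4 * b)) := by
  have h := GaussianFourier.integral_cexp_neg_mul_sq_norm_add (V := Ed d) (b := (b:ℂ)) (by simpa using hb) (c:ℂ) w
  rw [finrank_euclideanSpace_fin] at h
  have h2 : ∀ z : Ed d, Complex.exp (-(b:ℂ) * ‖z‖ ^ 2 + c * ⟪w, z⟫) = ((exp (-b * ‖z‖ ^ 2 + c * ⟪w, z⟫) : ℝ) : ℂ) := by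
    intro z; push_cast; rfl
  simp_rw [h2] at h
  rw [integral_complex_ofReal] at h
  have h3 : ((π / b : ℂ)) ^ ((d:ℂ) / 2) = (((π / b) ^ ((d:ℝ) / 2) : ℝ) : ℂ) := by
    rw [Complex.ofReal_cpow (by positivity)]; push_cast; rfl
  rw [h3] at h
  have h4 : Complex.exp ((c:ℂ) ^ 2 * ‖w‖ ^ 2 / (4 * b)) = ((exp (c ^ 2 * ‖w‖ ^ 2 / (4 * b)) : ℝ) : ℂ) := by push_cast; rfl
  rw [h4] at h
  exact_mod_cast h

lemma gauss_cos {d : ℕ} {b : ℝ} (hb : 0 < b) (w : Ed d) :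
    ∫ z : Ed d, cos ⟪w, z⟫ * exp (-b * ‖z‖ ^ 2) = (π / b) ^ ((d:ℝ) / 2) * exp (-(‖w‖ ^ 2 / (4 * b))) := by
  have h := GaussianFourier.integral_cexp_neg_mul_sq_norm_add (V := Ed d) (b := (b:ℂ)) (by simpa using hb) Complex.I w
  have hi := GaussianFourier.integrable_cexp_neg_mul_sq_norm_add (V := Ed d) (b := (b:ℂ)) (by simpa using hb) Complex.I w
  rw [finrank_euclideanSpace_fin] at h
  have h3 : ((π / b : ℂ)) ^ ((d:ℂ) / 2) = (((π / b) ^ ((d:ℝ) / 2) : ℝ) : ℂ) := by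
    rw [Complex.ofReal_cpow (by positivity)]; push_cast; rfl
  have h4 : Complex.exp ((Complex.I:ℂ) ^ 2 * ‖w‖ ^ 2 / (4 * b)) = ((exp (-(‖w‖ ^ 2 / (4 * b))) : ℝ) : ℂ) := by
    rw [Complex.I_sq]; push_cast; congr 1; ring
  rw [h3, h4, ← Complex.ofReal_mul] at h
  have h5 := congrArg Complex.re h
  rw [Complex.ofReal_re] at h5
  rw [← h5]
  have h6 := integral_re hi
  simp only [RCLike.re_to_complex] at h6
  rw [← h6]
  refine integral_congr_ae (Eventually.of_forall fun z => ?_)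
  simp only
  rw [Complex.exp_re]
  have e1 : (-(b:ℂ) * ‖z‖ ^ 2 + Complex.I * ⟪w, z⟫).re = -b * ‖z‖ ^ 2 := by
    simp [← Complex.ofReal_pow]
  have e2 : (-(b:ℂ) * ‖z‖ ^ 2 + Complex.I * ⟪w, z⟫).im = ⟪w, z⟫ := by
    simp [← Complex.ofReal_pow]
  rw [e1, e2, mul_comm]

def gau (d : ℕ) (v r : ℝ) : ℝ := (4 * π * v) ^ (-((d:ℝ) / 2)) * exp (-(r ^ 2 / (4 * v)))

lemma gau_pos {d : ℕ} {v : ℝ} (hv : 0 < v) (r : ℝ) : 0 < gau d v r := by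
  unfold gau; positivity

@[fun_prop]
lemma gau_meas {X : Type*} [MeasurableSpace X] {d : ℕ} {f g : X → ℝ} (hf : Measurable f) (hg : Measurable g) :
    Measurable fun x => gau d (f x) (g x) := by
  unfold gau; fun_prop

lemma gau_fourier {d : ℕ} {v : ℝ} (hv : 0 < v) (w : Ed d) :
    ∫ z : Ed d, cos ⟪w, z⟫ * exp (-v * ‖z‖ ^ 2) = (2 * π) ^ (d:ℝ) * gau d v ‖w‖ := by
  rw [gauss_cos hv, gau, ← mul_assoc]
  congr 1
  rw [show (d:ℝ) = 2 * ((d:ℝ)/2) by ring, rpow_mul (by positivity), rpow_two, show 2 * ((d:ℝ)/2) / 2 = (d:ℝ)/2 by ring,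
    rpow_neg (by positivity), ← inv_rpow (by positivity), ← mul_rpow (by positivity) (by positivity)]
  congr 1
  field_simp; ring

lemma gau_mass {d : ℕ} {v : ℝ} (hv : 0 < v) (x : Ed d) :
    ∫⁻ z : Ed d, ENNReal.ofReal (gau d v ‖x - z‖) = 1 := by
  have : ∫ z : Ed d, gau d v ‖z‖ = 1 := by
    unfold gau
    rw [integral_const_mul]
    have h := gauss_real (d := d) (b := 1 / (4 * v)) (by positivity) 0 0
    simp only [zero_mul, add_zero, norm_zero] at h
    have e : ∀ z : Ed d, exp (-(‖z‖ ^ 2 / (4 * v))) = exp (-(1 / (4 * v)) * ‖z‖ ^ 2) := by intro z; congr 1; ring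
    simp_rw [e]; rw [h, rpow_neg (by positivity), show π / (1 / (4 * v)) = 4 * π * v by field_simp]
    norm_num
    exact inv_mul_cancel₀ (by positivity)
  rw [← ENNReal.ofReal_one, ← lint_of_int' (fun z => (gau_pos hv _).le) this one_ne_zero]
  exact lintegral_sub_left_eq_self (fun z : Ed d => ENNReal.ofReal (gau d v ‖z‖)) x

lemma gau_conv {d : ℕ} {s t : ℝ} (hs : 0 < s) (ht : 0 < t) (x y : Ed d) :
    ∫⁻ z : Ed d, ENNReal.ofReal (gau d s ‖x - z‖) * ENNReal.ofReal (gau d t ‖z - y‖) = ENNReal.ofReal (gau d (s + t) ‖x - y‖) := by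
  set w := x - y with hw
  have h1 : ∫ z : Ed d, gau d s ‖w - z‖ * gau d t ‖z‖ = gau d (s + t) ‖w‖ := by
    have hb : 0 < (s + t) / (4 * s * t) := by positivity
    have h := gauss_real hb (1 / (2 * s)) w
    have e : ∀ z : Ed d, gau d s ‖w - z‖ * gau d t ‖z‖ = ((4 * π * s) ^ (-((d:ℝ) / 2)) * (4 * π * t) ^ (-((d:ℝ) / 2)) * exp (-(‖w‖ ^ 2 / (4 * s)))) *
        exp (-((s + t) / (4 * s * t)) * ‖z‖ ^ 2 + (1 / (2 * s)) * ⟪w, z⟫) := by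
      intro z
      unfold gau
      have : -(‖w - z‖ ^ 2 / (4 * s)) + -(‖z‖ ^ 2 / (4 * t)) = -(‖w‖ ^ 2 / (4 * s)) + (-((s + t) / (4 * s * t)) * ‖z‖ ^ 2 + (1 / (2 * s)) * ⟪w, z⟫) := by
        rw [norm_sub_sq_real]; field_simp; ring
      calc _ = (4 * π * s) ^ (-((d:ℝ) / 2)) * (4 * π * t) ^ (-((d:ℝ) / 2)) * exp (-(‖w - z‖ ^ 2 / (4 * s)) + -(‖z‖ ^ 2 / (4 * t))) := by rw [exp_add]; ring
        _ = _ := by rw [this, exp_add]; ring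
    simp_rw [e]
    rw [integral_const_mul, h]
    unfold gau
    have e2 : (4 * π * s) ^ (-((d:ℝ) / 2)) * (4 * π * t) ^ (-((d:ℝ) / 2)) * (π / ((s + t) / (4 * s * t))) ^ ((d:ℝ) / 2) = (4 * π * (s + t)) ^ (-((d:ℝ) / 2)) := by
      have : π / ((s + t) / (4 * s * t)) = ((s + t) / (4 * s * t * π))⁻¹ := by field_simp
      rw [this, inv_rpow (by positivity), ← rpow_neg (by positivity), ← mul_rpow (by positivity) (by positivity), ← mul_rpow (by positivity) (by positivity)]
      congr 1; field_simp
    have e3 : exp (-(‖w‖ ^ 2 / (4 * s))) * exp ((1 / (2 * s)) ^ 2 * ‖w‖ ^ 2 / (4 * ((s + t) / (4 * s * t)))) = exp (-(‖w‖ ^ 2 / (4 * (s + t)))) := by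
      rw [← exp_add]; congr 1; field_simp; ring
    rw [← e2, ← e3]; ring
  have h2 := lint_of_int' (fun z => (mul_pos (gau_pos hs _) (gau_pos ht _)).le) h1 (gau_pos (by linarith) _).ne'
  rw [← h2, ← lintegral_sub_right_eq_self (fun u => ENNReal.ofReal (gau d s ‖w - u‖ * gau d t ‖u‖)) y]
  refine lintegral_congr fun z => ?_
  rw [ENNReal.ofReal_mul (gau_pos hs _).le, hw, sub_sub_sub_cancel_right]
end P4a

section P4b
set_option linter.unusedSectionVars false

def mmv (d : ℕ) (v r : ℝ) : ℝ := gau d v r * exp (-v)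

lemma mmv_pos {d : ℕ} {v : ℝ} (hv : 0 < v) (r : ℝ) : 0 < mmv d v r := mul_pos (gau_pos hv r) (exp_pos _)

@[fun_prop]
lemma mmv_meas {X : Type*} [MeasurableSpace X] {d : ℕ} {f g : X → ℝ} (hf : Measurable f) (hg : Measurable g) :
    Measurable fun x => mmv d (f x) (g x) := by
  unfold mmv; fun_prop

def PR (d : ℕ) (p : ℝ) (η : Measure ℝ) (t r : ℝ) : ℝ≥0∞ := ∫⁻ u, ENNReal.ofReal (mmv d (t ^ (1 / p) * u) r) ∂η

def KE (d : ℕ) (p : ℝ) (η : Measure ℝ) (t : ℝ) (x y : Ed d) : ℝ≥0∞ := if 0 < t then PR d p η t ‖x - y‖ else 0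

variable {d : ℕ} {p : ℝ} {η : Measure ℝ}

lemma KE_pos {t : ℝ} (ht : 0 < t) (x y : Ed d) : KE d p η t x y = PR d p η t ‖x - y‖ := if_pos ht

lemma th_pow (hp : 0 < p) {t : ℝ} (ht : 0 < t) : (t ^ (1/p)) ^ p = t := by
  rw [← rpow_mul ht.le, one_div_mul_cancel hp.ne', rpow_one]

@[fun_prop]
lemma PR_meas [SFinite η] {X : Type*} [MeasurableSpace X] {f g : X → ℝ} (hf : Measurable f) (hg : Measurable g) :
    Measurable fun x => PR d p η (f x) (g x) := by
  have h1 : Measurable fun q : X × ℝ => ENNReal.ofReal (mmv d ((f q.1) ^ (1 / p) * q.2) (g q.1)) := by fun_prop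
  unfold PR
  exact h1.lintegral_prod_right'

lemma KE_meas [SFinite η] : KMeas (KE d p η) := by
  have h2 : Measurable fun q : ℝ × Ed d × Ed d => PR d p η q.1 ‖q.2.1 - q.2.2‖ := PR_meas (by fun_prop) (by fun_prop)
  have h3 : MeasurableSet {q : ℝ × Ed d × Ed d | 0 < q.1} := measurableSet_lt measurable_const measurable_fst
  have h4 := h2.indicator h3
  have h5 : (fun q : ℝ × Ed d × Ed d => KE d p η q.1 q.2.1 q.2.2) = {q : ℝ × Ed d × Ed d | 0 < q.1}.indicator (fun q => PR d p η q.1 ‖q.2.1 - q.2.2‖) := by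
    funext q
    by_cases hq : 0 < q.1
    · rw [KE_pos hq, indicator_of_mem (show q ∈ {q : ℝ × Ed d × Ed d | 0 < q.1} from hq)]
    · rw [KE, if_neg hq, indicator_of_notMem (show q ∉ {q : ℝ × Ed d × Ed d | 0 < q.1} from hq)]
  unfold KMeas
  rw [h5]
  exact h4

lemma KE_symm (t : ℝ) (x y : Ed d) : KE d p η t x y = KE d p η t y x := by
  unfold KE; rw [norm_sub_rev]

lemma KE_zero (t : ℝ) (ht : t ≤ 0) (x y : Ed d) : KE d p η t x y = 0 := if_neg (not_lt.2 ht)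

lemma SUB.lapt (h : SUB p η) {t l : ℝ} (ht : 0 < t) (hl : 0 < l) :
    ∫⁻ u, ENNReal.ofReal (exp (-(l * (t ^ (1/p) * u)))) ∂η = ENNReal.ofReal (exp (-(t * l ^ p))) := by
  have := h.lap (l * t ^ (1/p)) (by positivity)
  rw [mul_rpow hl.le (by positivity), th_pow h.hp ht, mul_comm (l^p)] at this
  rw [← this]
  refine lintegral_congr fun u => ?_
  rw [mul_assoc]

lemma SUB.semi (h : SUB p η) {s t : ℝ} (hs : 0 < s) (ht : 0 < t) {f : ℝ → ℝ≥0∞} (hf : Measurable f) :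
    ∫⁻ u, (∫⁻ w, f (s ^ (1/p) * u + t ^ (1/p) * w) ∂η) ∂η = ∫⁻ u, f ((s + t) ^ (1/p) * u) ∂η := by
  haveI := h.prob
  have m1 : Measurable fun q : ℝ × ℝ => s ^ (1/p) * q.1 + t ^ (1/p) * q.2 := by fun_prop
  have m2 : Measurable fun u : ℝ => (s + t) ^ (1/p) * u := by fun_prop
  have key : (η.prod η).map (fun q : ℝ × ℝ => s ^ (1/p) * q.1 + t ^ (1/p) * q.2) = η.map (fun u : ℝ => (s + t) ^ (1/p) * u) := by
    haveI := Measure.isProbabilityMeasure_map (μ := η.prod η) m1.aemeasurable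
    haveI := Measure.isProbabilityMeasure_map (μ := η) m2.aemeasurable
    refine laplace_ext ?_ ?_ fun n => ?_
    · rw [Measure.map_apply m1 measurableSet_Iio, measure_eq_zero_iff_ae_notMem]
      have h1 : ∀ᵐ q ∂(η.prod η), 0 < q.1 := Measure.quasiMeasurePreserving_fst.ae h.pos
      have h2 : ∀ᵐ q ∂(η.prod η), 0 < q.2 := Measure.quasiMeasurePreserving_snd.ae h.pos
      filter_upwards [h1, h2] with q hq1 hq2
      simp only [mem_preimage, mem_Iio, not_lt]
      positivity
    · rw [Measure.map_apply m2 measurableSet_Iio, measure_eq_zero_iff_ae_notMem]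
      filter_upwards [h.pos] with u hu
      simp only [mem_preimage, mem_Iio, not_lt]
      positivity
    · rw [lintegral_map (by fun_prop) m1, lintegral_map (by fun_prop) m2]
      rcases Nat.eq_zero_or_pos n with rfl | hn
      · simp
      · have hn' : (0:ℝ) < n := by exact_mod_cast hn
        rw [h.lapt (by positivity) hn', lintegral_prod _ (by fun_prop)]
        have e : ∀ u w : ℝ, ENNReal.ofReal (exp (-(n * (s ^ (1/p) * u + t ^ (1/p) * w)))) =
            ENNReal.ofReal (exp (-(n * (s ^ (1/p) * u)))) * ENNReal.ofReal (exp (-(n * (t ^ (1/p) * w)))) := by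
          intro u w; rw [← ofReal_exp_add]; congr 2; ring
        simp_rw [e]
        have e' : ∀ u : ℝ, ∫⁻ w, ENNReal.ofReal (exp (-(n * (s ^ (1/p) * u)))) * ENNReal.ofReal (exp (-(n * (t ^ (1/p) * w)))) ∂η =
            ENNReal.ofReal (exp (-(n * (s ^ (1/p) * u)))) * ENNReal.ofReal (exp (-(t * (n:ℝ) ^ p))) := by
          intro u; rw [lintegral_const_mul _ (by fun_prop), h.lapt ht hn']
        simp_rw [e']
        rw [lintegral_mul_const _ (by fun_prop), h.lapt hs hn', ← ofReal_exp_add]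
        congr 2; ring
  rw [← lintegral_map hf m2, ← key, lintegral_map hf m1, lintegral_prod _ (by fun_prop)]

lemma mmv_conv {s t : ℝ} (hs : 0 < s) (ht : 0 < t) (x y : Ed d) :
    ∫⁻ z : Ed d, ENNReal.ofReal (mmv d s ‖x - z‖) * ENNReal.ofReal (mmv d t ‖z - y‖) = ENNReal.ofReal (mmv d (s + t) ‖x - y‖) := by
  unfold mmv
  rw [ENNReal.ofReal_mul' (exp_pos _).le, ← gau_conv hs ht, neg_add, ofReal_exp_add, ← lintegral_mul_const _ (by fun_prop)]
  refine lintegral_congr fun z => ?_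
  rw [ENNReal.ofReal_mul' (exp_pos _).le, ENNReal.ofReal_mul' (exp_pos _).le]; ring

lemma mmv_mass {s : ℝ} (hs : 0 < s) (x : Ed d) :
    ∫⁻ z : Ed d, ENNReal.ofReal (mmv d s ‖x - z‖) = ENNReal.ofReal (exp (-s)) := by
  unfold mmv
  simp_rw [ENNReal.ofReal_mul' (exp_pos (-s)).le]
  rw [lintegral_mul_const _ (by fun_prop), gau_mass hs, one_mul]

lemma KE_mass (h : SUB p η) (t : ℝ) (ht : 0 < t) (x : Ed d) : ∫⁻ z, KE d p η t x z = ENNReal.ofReal (exp (-t)) := by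
  haveI := h.prob
  simp_rw [KE_pos ht, PR]
  rw [lintegral_lintegral_swap (by fun_prop)]
  have : ∀ᵐ u ∂η, ∫⁻ z : Ed d, ENNReal.ofReal (mmv d (t ^ (1/p) * u) ‖x - z‖) = ENNReal.ofReal (exp (-(1 * (t ^ (1/p) * u)))) := by
    filter_upwards [h.pos] with u hu
    rw [mmv_mass (by positivity), one_mul]
  rw [lintegral_congr_ae this, h.lapt ht one_pos]; simp

lemma KE_ck (h : SUB p η) (s t : ℝ) (hs : 0 < s) (ht : 0 < t) (x y : Ed d) :
    ∫⁻ z, KE d p η s x z * KE d p η t z y = KE d p η (s + t) x y := by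
  haveI := h.prob
  simp_rw [KE_pos hs, KE_pos ht, KE_pos (add_pos hs ht)]
  have e1 : ∀ z : Ed d, PR d p η s ‖x - z‖ * PR d p η t ‖z - y‖ =
      ∫⁻ q : ℝ × ℝ, ENNReal.ofReal (mmv d (s ^ (1/p) * q.1) ‖x - z‖) * ENNReal.ofReal (mmv d (t ^ (1/p) * q.2) ‖z - y‖) ∂(η.prod η) := by
    intro z
    rw [lintegral_prod_mul (f := fun u => ENNReal.ofReal (mmv d (s ^ (1/p) * u) ‖x - z‖)) (g := fun u => ENNReal.ofReal (mmv d (t ^ (1/p) * u) ‖z - y‖))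
      (by fun_prop) (by fun_prop)]; rfl
  simp_rw [e1]
  rw [lintegral_lintegral_swap (by fun_prop), PR, ← h.semi hs ht (f := fun v => ENNReal.ofReal (mmv d v ‖x - y‖)) (by fun_prop),
    lintegral_prod _ (by fun_prop)]
  refine lintegral_congr_ae ?_
  filter_upwards [h.pos] with u hu
  refine lintegral_congr_ae ?_
  filter_upwards [h.pos] with w hw
  exact mmv_conv (by positivity) (by positivity) x y

lemma KE_HK (h : SUB p η) : HK (KE d p η) := by
  haveI := h.prob
  exact ⟨KE_meas, KE_zero, KE_ck h, KE_symm⟩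

/-- on-diagonal bound -/
lemma PR_le (h : SUB p η) (hd : 0 < d) : ∃ C : ℝ≥0, ∀ t, 0 < t → ∀ r, PR d p η t r ≤ C * ENNReal.ofReal ((t ^ (1/p)) ^ (-((d:ℝ)/2))) := by
  have hd' : (0:ℝ) < d := by exact_mod_cast hd
  obtain ⟨C, hC⟩ := h.moment (a := (d:ℝ)/2) (by positivity)
  refine ⟨C, fun t ht r => ?_⟩
  rw [PR]
  calc _ ≤ ∫⁻ u, ENNReal.ofReal ((t ^ (1/p)) ^ (-((d:ℝ)/2))) * ENNReal.ofReal (u ^ (-((d:ℝ)/2))) ∂η := by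
        refine lintegral_mono_ae ?_
        filter_upwards [h.pos] with u hu
        rw [← ENNReal.ofReal_mul (by positivity), ← mul_rpow (by positivity) hu.le]
        refine ENNReal.ofReal_le_ofReal ?_
        have hv : 0 < t ^ (1/p) * u := by positivity
        generalize t ^ (1/p) * u = v at hv
        unfold mmv gau
        have h1 : exp (-(r ^ 2 / (4 * v))) ≤ 1 := by rw [exp_le_one_iff]; have : 0 ≤ r ^ 2 / (4 * v) := by positivity
                                                     linarith
        have h2 : exp (-v) ≤ 1 := by rw [exp_le_one_iff]; linarith
        have h3 : (4 * π * v) ^ (-((d:ℝ)/2)) ≤ v ^ (-((d:ℝ)/2)) := by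
          refine rpow_le_rpow_of_nonpos hv ?_ (by linarith)
          have := pi_gt_three
          nlinarith
        calc _ ≤ v ^ (-((d:ℝ)/2)) * 1 * 1 := by gcongr
          _ = _ := by ring
    _ ≤ _ := by
        rw [lintegral_const_mul _ (by fun_prop), mul_comm]
        exact mul_le_mul_left hC _

lemma PR_ne_top (h : SUB p η) (hd : 0 < d) {t : ℝ} (ht : 0 < t) (r : ℝ) : PR d p η t r ≠ ∞ := by
  obtain ⟨C, hC⟩ := PR_le h hd
  exact ((hC t ht r).trans_lt (ENNReal.mul_lt_top ENNReal.coe_lt_top ENNReal.ofReal_lt_top)).ne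

lemma rel_eq {α : ℝ} (hα : 0 < α) (h : SUB (α/2) η) (hd : 0 < d) {t : ℝ} (ht : 0 < t) (x y : Ed d) :
    relKernel d α 1 t x y = (PR d (α/2) η t ‖x - y‖).toReal := by
  haveI := h.prob
  have hd' : (0:ℝ) < d := by exact_mod_cast hd
  set θ := t ^ (1/(α/2)) with hθ
  have hθ0 : 0 < θ := by positivity
  unfold relKernel
  have e1 : ∀ z : Ed d, exp (-t * (‖z‖ ^ 2 + 1 ^ (2 / α)) ^ (α / 2)) = ∫ u, exp (-((‖z‖ ^ 2 + 1) * (θ * u))) ∂η := by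
    intro z
    rw [one_rpow, integral_eq_lintegral_of_nonneg_ae (Eventually.of_forall fun u => (exp_pos _).le) (by fun_prop),
      h.lapt ht (by positivity), ENNReal.toReal_ofReal (exp_pos _).le, neg_mul]
  simp_rw [e1]
  have e0 : ∀ z : Ed d, cos ⟪y - x, z⟫ * ∫ u, exp (-((‖z‖ ^ 2 + 1) * (θ * u))) ∂η =
      ∫ u, cos ⟪y - x, z⟫ * exp (-((‖z‖ ^ 2 + 1) * (θ * u))) ∂η := fun z => (integral_const_mul _ _).symm
  simp_rw [e0]
  have hG : ∀ v : ℝ, 0 < v → ∫⁻ z : Ed d, ENNReal.ofReal (exp (-((‖z‖ ^ 2 + 1) * v))) = ENNReal.ofReal ((2 * π) ^ (d:ℝ) * mmv d v 0) := by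
    intro v hv
    refine lint_of_int' (fun z => (exp_pos _).le) ?_ (mul_pos (by positivity) (mmv_pos hv _)).ne'
    have := gau_fourier (d := d) hv 0
    simp only [inner_zero_left, cos_zero, one_mul, norm_zero] at this
    unfold mmv
    rw [← mul_assoc, ← this, ← integral_mul_const]
    refine integral_congr_ae (Eventually.of_forall fun z => ?_)
    simp only
    rw [← exp_add]; congr 1; ring
  have hIntg : Integrable (fun q : Ed d × ℝ => cos ⟪y - x, q.1⟫ * exp (-((‖q.1‖ ^ 2 + 1) * (θ * q.2)))) (volume.prod η) := by
    refine ⟨Measurable.aestronglyMeasurable (by fun_prop), ?_⟩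
    rw [hasFiniteIntegral_iff_norm]
    calc _ ≤ ∫⁻ q : Ed d × ℝ, ENNReal.ofReal (exp (-((‖q.1‖ ^ 2 + 1) * (θ * q.2)))) ∂(volume.prod η) := by
          refine lintegral_mono fun q => ENNReal.ofReal_le_ofReal ?_
          rw [norm_mul, Real.norm_eq_abs, Real.norm_eq_abs, abs_of_pos (exp_pos _)]
          exact mul_le_of_le_one_left (exp_pos _).le (abs_cos_le_one _)
      _ = ∫⁻ u, ENNReal.ofReal ((2 * π) ^ (d:ℝ) * mmv d (θ * u) 0) ∂η := by
          rw [lintegral_prod_symm _ (by fun_prop)]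
          refine lintegral_congr_ae ?_
          filter_upwards [h.pos] with u hu
          exact hG _ (by positivity)
      _ = ENNReal.ofReal ((2 * π) ^ (d:ℝ)) * PR d (α/2) η t 0 := by
          simp_rw [ENNReal.ofReal_mul (show (0:ℝ) ≤ (2 * π) ^ (d:ℝ) by positivity)]
          rw [lintegral_const_mul _ (by fun_prop)]; rfl
      _ < ∞ := ENNReal.mul_lt_top ENNReal.ofReal_lt_top (PR_ne_top h hd ht 0).lt_top
  rw [integral_integral_swap hIntg]
  have e2 : ∀ᵐ u ∂η, ∫ z : Ed d, cos ⟪y - x, z⟫ * exp (-((‖z‖ ^ 2 + 1) * (θ * u))) = (2 * π) ^ (d:ℝ) * mmv d (θ * u) ‖x - y‖ := by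
    filter_upwards [h.pos] with u hu
    unfold mmv
    rw [← mul_assoc, norm_sub_rev, ← gau_fourier (by positivity), ← integral_mul_const]
    refine integral_congr_ae (Eventually.of_forall fun z => ?_)
    simp only
    rw [mul_assoc, ← exp_add]; congr 2; ring
  rw [integral_congr_ae e2, integral_const_mul, ← mul_assoc, ← rpow_add (by positivity), neg_add_cancel, rpow_zero, one_mul,
    integral_eq_lintegral_of_nonneg_ae _ (Measurable.aestronglyMeasurable (by fun_prop))]
  · rfl
  · filter_upwards [h.pos] with u hu
    exact (mmv_pos (by positivity) _).le
end P4b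

section P4c
set_option linter.unusedSectionVars false
variable {d : ℕ} {p : ℝ} {η : Measure ℝ}

lemma rpow_exp_le {a x : ℝ} (ha : 0 < a) (hx : 0 < x) : x ^ a * exp (-x) ≤ a ^ a := by
  have h1 : x / a ≤ exp (x / a) := by linarith [add_one_le_exp (x/a)]
  have h2 := rpow_le_rpow (by positivity) h1 ha.le
  rw [← exp_mul, div_mul_cancel₀ _ ha.ne', div_rpow hx.le ha.le, div_le_iff₀ (by positivity)] at h2
  rw [exp_neg, ← div_eq_mul_inv, div_le_iff₀ (exp_pos _)]
  linarith

lemma mmv_ratio {θ v w : ℝ} (hθ : 0 < θ) (hv : 0 < v) (hw : 0 < w) (r r' : ℝ) {A B M : ℝ} (hA : (w / v) ^ ((d:ℝ)/2) * exp (-B) ≤ A) (hA0 : 0 ≤ A)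
    (hB : r' ^ 2 / (4 * (θ * w)) - r ^ 2 / (4 * (θ * v)) ≤ - B) (hM : θ * w - θ * v ≤ M) :
    mmv d (θ * v) r ≤ A * exp M * mmv d (θ * w) r' := by
  unfold mmv gau
  have e1 : (4 * π * (θ * v)) ^ (-((d:ℝ)/2)) = (w / v) ^ ((d:ℝ)/2) * (4 * π * (θ * w)) ^ (-((d:ℝ)/2)) := by
    rw [rpow_neg (by positivity), ← inv_rpow (by positivity), rpow_neg (by positivity), ← inv_rpow (by positivity),
      ← mul_rpow (by positivity) (by positivity)]
    congr 1; field_simp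
  have e2 : exp (-(r ^ 2 / (4 * (θ * v)))) ≤ exp (-B) * exp (-(r' ^ 2 / (4 * (θ * w)))) := by
    rw [← exp_add]; apply exp_le_exp.2; linarith
  have e3 : exp (-(θ * v)) ≤ exp M * exp (-(θ * w)) := by
    rw [← exp_add]; apply exp_le_exp.2; linarith
  calc _ ≤ (w / v) ^ ((d:ℝ)/2) * (4 * π * (θ * w)) ^ (-((d:ℝ)/2)) * (exp (-B) * exp (-(r' ^ 2 / (4 * (θ * w))))) * (exp M * exp (-(θ * w))) := by
        rw [e1]; gcongr
    _ = ((w / v) ^ ((d:ℝ)/2) * exp (-B)) * (exp M * ((4 * π * (θ * w)) ^ (-((d:ℝ)/2)) * exp (-(r' ^ 2 / (4 * (θ * w)))) * exp (-(θ * w)))) := by ring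
    _ ≤ A * (exp M * ((4 * π * (θ * w)) ^ (-((d:ℝ)/2)) * exp (-(r' ^ 2 / (4 * (θ * w)))) * exp (-(θ * w)))) := by gcongr
    _ = _ := by ring

lemma mmv_L1 (d : ℕ) (Θ D v1 c1 : ℝ) (hv1 : 0 < v1) (hc1 : 1 ≤ c1) : ∃ C : ℝ≥0, ∀ θ r r' δ v w : ℝ, 0 < θ → θ ≤ Θ → 0 ≤ r → 0 ≤ r' → r' ≤ r + δ → δ ^ 2 ≤ D * θ →
    v1 ≤ v → v + 1 ≤ w → w ≤ v + c1 → ENNReal.ofReal (mmv d (θ * v) r) ≤ C * ENNReal.ofReal (mmv d (θ * w) r') := by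
  refine ⟨((1 + c1 / v1) ^ ((d:ℝ)/2) * exp (D/4) * exp (c1 * Θ)).toNNReal, ?_⟩
  intro θ r r' δ v w hθ hΘ hr hr' hrr hδ hv hw1 hw2
  have hv0 : 0 < v := by linarith
  have hw0 : 0 < w := by linarith
  rw [← ENNReal.ofReal, ← ENNReal.ofReal_mul (by positivity)]
  apply ENNReal.ofReal_le_ofReal
  refine mmv_ratio hθ hv0 hw0 r r' (B := -(D/4)) ?_ (by positivity) ?_ ?_
  · rw [neg_neg]
    gcongr
    rw [div_le_iff₀ hv0, add_mul, one_mul]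
    have : c1 ≤ c1 / v1 * v := by rw [div_mul_eq_mul_div, le_div_iff₀ hv1]; gcongr
    linarith
  · rw [neg_neg, sub_le_iff_le_add]
    have h1 : r' ^ 2 ≤ (r + δ) ^ 2 := by gcongr
    have h2 : (r + δ) ^ 2 ≤ w * (r ^ 2 / v + δ ^ 2) := by
      obtain ⟨c, rfl⟩ : ∃ c, w = v + c := ⟨w - v, by ring⟩
      have hc : 1 ≤ c := by linarith
      have : (v + c) * (r ^ 2 / v + δ ^ 2) = r ^ 2 + c * r ^ 2 / v + v * δ ^ 2 + c * δ ^ 2 := by field_simp; ring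
      rw [this]
      have h3 : 2 * r * δ ≤ c * r ^ 2 / v + v * δ ^ 2 := by
        have : 2 * r * δ ≤ r ^ 2 / v + v * δ ^ 2 := by
          have e : r ^ 2 / v + v * δ ^ 2 - 2 * r * δ = (r - v * δ) ^ 2 / v := by field_simp; ring
          have : 0 ≤ (r - v * δ) ^ 2 / v := by positivity
          linarith
        have h4 : r ^ 2 / v ≤ c * r ^ 2 / v := by
          apply div_le_div_of_nonneg_right _ hv0.le
          exact le_mul_of_one_le_left (sq_nonneg r) hc
        linarith
      have h5 : δ ^ 2 ≤ c * δ ^ 2 := le_mul_of_one_le_left (sq_nonneg δ) hc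
      nlinarith
    calc r' ^ 2 / (4 * (θ * w)) ≤ (w * (r ^ 2 / v + D * θ)) / (4 * (θ * w)) := by
          apply div_le_div_of_nonneg_right _ (by positivity)
          refine (h1.trans h2).trans ?_
          gcongr
      _ = _ := by field_simp; ring
  · have : θ * w - θ * v = θ * (w - v) := by ring
    rw [this, mul_comm]
    have : 0 ≤ w - v := by linarith
    gcongr
    linarith

lemma mmv_L2 (hd : 0 < d) (Θ k v1 W : ℝ) (hk : 0 < k) (hW : 2 * v1 ≤ W) : ∃ C : ℝ≥0, ∀ θ r v w : ℝ, 0 < θ → θ ≤ Θ → k ^ 2 * θ ≤ r ^ 2 →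
    0 < v → v ≤ v1 → W ≤ w → w ≤ 2 * W → ENNReal.ofReal (mmv d (θ * v) r) ≤ C * ENNReal.ofReal (mmv d (θ * w) r) := by
  have ha : 0 < (d:ℝ)/2 := by have : (0:ℝ) < d := by exact_mod_cast hd
                              positivity
  refine ⟨((16 * |W| / k ^ 2) ^ ((d:ℝ)/2) * ((d:ℝ)/2) ^ ((d:ℝ)/2) * exp (2 * W * Θ)).toNNReal, ?_⟩
  intro θ r v w hθ hΘ hr hv hv1 hw1 hw2
  have hw0 : 0 < w := by linarith
  have hW0 : 0 < W := by linarith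
  rw [← ENNReal.ofReal, ← ENNReal.ofReal_mul (by positivity)]
  apply ENNReal.ofReal_le_ofReal
  refine mmv_ratio hθ hv hw0 r r (B := k ^ 2 / (8 * v)) ?_ (by positivity) ?_ ?_
  · have hx : 0 < k ^ 2 / (8 * v) := by positivity
    calc _ ≤ (16 * |W| / k ^ 2 * (k ^ 2 / (8 * v))) ^ ((d:ℝ)/2) * exp (-(k ^ 2 / (8 * v))) := by
          gcongr
          rw [abs_of_pos hW0, show 16 * W / k ^ 2 * (k ^ 2 / (8 * v)) = 2 * W / v by field_simp; ring]
          gcongr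
      _ = (16 * |W| / k ^ 2) ^ ((d:ℝ)/2) * ((k ^ 2 / (8 * v)) ^ ((d:ℝ)/2) * exp (-(k ^ 2 / (8 * v)))) := by
          rw [mul_rpow (by positivity) hx.le]; ring
      _ ≤ _ := by gcongr; exact rpow_exp_le ha hx
  · have h1 : r ^ 2 / (4 * (θ * w)) ≤ r ^ 2 / (4 * (θ * (2 * v))) := by
      gcongr
      linarith
    have h2 : k ^ 2 / (8 * v) ≤ r ^ 2 / (8 * θ * v) := by
      rw [div_le_div_iff₀ (by positivity) (by positivity)]
      have : 0 ≤ 8 * v := by positivity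
      nlinarith
    have h3 : r ^ 2 / (4 * (θ * v)) = 2 * (r ^ 2 / (8 * θ * v)) := by field_simp; ring
    have h4 : r ^ 2 / (4 * (θ * (2 * v))) = r ^ 2 / (8 * θ * v) := by congr 1; ring
    linarith
  · have h1 : θ * w ≤ 2 * W * Θ := by rw [mul_comm]; gcongr
    have : 0 < θ * v := by positivity
    linarith

lemma exists_nn {c : ℝ≥0∞} (hc : c ≠ 0) : ∃ C : ℝ≥0, 1 ≤ C * c := by
  rcases eq_or_ne c ∞ with rfl | h
  · exact ⟨1, by simp⟩
  · refine ⟨(c⁻¹).toNNReal, ?_⟩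
    rw [ENNReal.coe_toNNReal (ENNReal.inv_ne_top.2 hc), ENNReal.inv_mul_cancel hc h]

lemma PR_low (h : SUB p η) (D Θ : ℝ) : ∃ C : ℝ≥0, ∀ t r, 0 < t → t ^ (1/p) ≤ Θ → r ^ 2 ≤ D * t ^ (1/p) →
    ENNReal.ofReal ((t ^ (1/p)) ^ (-((d:ℝ)/2))) ≤ C * PR d p η t r := by
  haveI := h.prob
  set F : ℝ → ℝ≥0∞ := fun u => ENNReal.ofReal ((4 * π * u) ^ (-((d:ℝ)/2)) * exp (-(D / (4 * u))) * exp (-(Θ * u))) with hF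
  have hFm : Measurable F := by fun_prop
  have hc : ∫⁻ u, F u ∂η ≠ 0 := by
    intro h0
    rw [lintegral_eq_zero_iff hFm] at h0
    have : ∀ᵐ u ∂η, False := by
      filter_upwards [h0, h.pos] with u h1 h2
      simp only [hF, Pi.zero_apply, ENNReal.ofReal_eq_zero] at h1
      exact absurd h1 (not_le.2 (by positivity))
    simp at this
    have h1 := measure_univ (μ := η)
    rw [this] at h1; simp at h1
  obtain ⟨C, hC⟩ := exists_nn hc
  refine ⟨C, fun t r ht htΘ hr => ?_⟩
  set θ := t ^ (1/p) with hθ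
  have hθ0 : 0 < θ := by positivity
  calc _ = 1 * ENNReal.ofReal (θ ^ (-((d:ℝ)/2))) := (one_mul _).symm
    _ ≤ C * (∫⁻ u, F u ∂η) * ENNReal.ofReal (θ ^ (-((d:ℝ)/2))) := mul_le_mul_left hC _
    _ = C * (∫⁻ u, F u * ENNReal.ofReal (θ ^ (-((d:ℝ)/2))) ∂η) := by rw [lintegral_mul_const _ hFm, mul_assoc]
    _ ≤ _ := by
        rw [PR]
        refine mul_le_mul_right (lintegral_mono_ae ?_) _
        filter_upwards [h.pos] with u hu
        simp only [hF]
        rw [← ENNReal.ofReal_mul (by positivity)]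
        apply ENNReal.ofReal_le_ofReal
        unfold mmv gau
        rw [← hθ, show 4 * π * (θ * u) = (4 * π * u) * θ by ring, mul_rpow (by positivity) hθ0.le]
        have h1 : r ^ 2 / (4 * (θ * u)) ≤ D / (4 * u) := by
          rw [div_le_div_iff₀ (by positivity) (by positivity)]
          have : 0 ≤ 4 * u := by positivity
          nlinarith
        have h2 : θ * u ≤ Θ * u := by gcongr
        calc _ = (4 * π * u) ^ (-((d:ℝ)/2)) * θ ^ (-((d:ℝ)/2)) * exp (-(D / (4 * u))) * exp (-(Θ * u)) := by ring
          _ ≤ _ := by gcongr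

lemma PR_k4 (h : SUB p η) (hd : 0 < d) (D Θ k : ℝ) (hk : 0 < k) : ∃ C : ℝ≥0, ∀ s t r r' δ, 0 < t → 0 < s → s ≤ 2 * t → t ^ (1/p) ≤ Θ →
    0 ≤ r → 0 ≤ r' → k ^ 2 * t ^ (1/p) ≤ r ^ 2 → r' ≤ r + δ → δ ^ 2 ≤ D * t ^ (1/p) → PR d p η s r ≤ C * PR d p η t r' := by
  haveI := h.prob
  have hp := h.hp
  obtain ⟨v0, hv02, C0, hlow⟩ := h.lower
  obtain ⟨C1, hup⟩ := h.upper
  set Λ : ℝ := 2 ^ (1/p) with hΛ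
  have hΛ1 : 1 ≤ Λ := one_le_rpow (by norm_num) (by positivity)
  set v1 := Λ * v0 with hv1
  have hv10 : v0 ≤ v1 := by rw [hv1]; exact le_mul_of_one_le_left (by linarith) hΛ1
  set W := 2 * v1 with hW
  obtain ⟨A1, hA1⟩ := mmv_L1 d Θ D v1 (Λ + 1) (by linarith) (by linarith)
  obtain ⟨A2, hA2⟩ := mmv_L2 hd Θ k v1 W hk hW.ge
  obtain ⟨A3, hA3⟩ : ∃ A3 : ℝ≥0, 1 ≤ A3 * ∫⁻ w in Ioc (W + 1) (2 * W + 1), ENNReal.ofReal (w ^ (-1 - p)) := by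
    apply exists_nn
    intro h0
    rw [lintegral_eq_zero_iff (by fun_prop)] at h0
    have : ∀ᵐ w ∂(volume.restrict (Ioc (W + 1) (2 * W + 1))), False := by
      filter_upwards [h0, ae_restrict_mem measurableSet_Ioc] with w h1 h2
      have hw0 : 0 < w := by linarith [h2.1]
      simp only [Pi.zero_apply, ENNReal.ofReal_eq_zero] at h1
      exact absurd h1 (not_le.2 (by positivity))
    rw [Filter.eventually_false_iff_eq_bot, ae_eq_bot, Measure.restrict_eq_zero, Real.volume_Ioc, ENNReal.ofReal_eq_zero] at this
    linarith
  refine ⟨A3 * (A2 * A1) * C0 + C1 * (A1 * (2 ^ (1 + p) * 2 : ℝ).toNNReal) * C0, ?_⟩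
  intro s t r r' δ ht hs hst hΘ hr hr' hkr hrr hδ
  set θ := t ^ (1/p) with hθ
  have hθ0 : 0 < θ := by positivity
  set l := (s / t) ^ (1/p) with hl
  have hl0 : 0 < l := by positivity
  have hlp : l ^ p ≤ 2 := by rw [hl, th_pow hp (by positivity), div_le_iff₀ ht]; exact hst
  have hlΛ : l ≤ Λ := by
    refine rpow_le_rpow (by positivity) ?_ (by positivity)
    rw [div_le_iff₀ ht]; exact hst
  have hsl : s ^ (1/p) = θ * l := by
    rw [hθ, hl, ← mul_rpow ht.le (by positivity)]; congr 1; field_simp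
  set I := ∫⁻ w in Ioi v0, ENNReal.ofReal (w ^ (-1 - p)) * ENNReal.ofReal (mmv d (θ * w) r') with hI
  have hIle : I ≤ C0 * PR d p η t r' := hlow _ (by fun_prop)
  set Slo : Set ℝ := {u | l * u ≤ v1} with hS
  have hSm : MeasurableSet Slo := measurableSet_le (by fun_prop) (by fun_prop)
  have hlo : ∫⁻ u in Slo, ENNReal.ofReal (mmv d (s ^ (1/p) * u) r) ∂η ≤ A3 * (A2 * A1) * I := by
    calc _ ≤ ∫⁻ u in Slo, A3 * (A2 * A1) * I ∂η := by
          refine lintegral_mono_ae ((ae_restrict_iff' hSm).2 ?_)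
          filter_upwards [h.pos] with u hu huS
          rw [hsl, mul_assoc]
          have hb : ∀ w ∈ Ioc (W + 1) (2 * W + 1), ENNReal.ofReal (mmv d (θ * (l * u)) r) ≤ A2 * A1 * ENNReal.ofReal (mmv d (θ * w) r') := by
            intro w hw
            have g1 := hA2 θ r (l * u) (w - 1) hθ0 hΘ hkr (by positivity) huS (by linarith [hw.1]) (by linarith [hw.2])
            have g2 := hA1 θ r r' δ (w - 1) w hθ0 hΘ hr hr' hrr hδ (by linarith [hw.1]) (by linarith) (by linarith)
            rw [mul_assoc]
            exact g1.trans (mul_le_mul_right g2 _)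
          set X := ENNReal.ofReal (mmv d (θ * (l * u)) r) with hX
          calc X = 1 * X := (one_mul _).symm
            _ ≤ (A3 * ∫⁻ w in Ioc (W + 1) (2 * W + 1), ENNReal.ofReal (w ^ (-1 - p))) * X := mul_le_mul_left hA3 _
            _ = A3 * ∫⁻ w in Ioc (W + 1) (2 * W + 1), ENNReal.ofReal (w ^ (-1 - p)) * X := by rw [lintegral_mul_const _ (by fun_prop), mul_assoc]
            _ ≤ A3 * ∫⁻ w in Ioc (W + 1) (2 * W + 1), A2 * A1 * (ENNReal.ofReal (w ^ (-1 - p)) * ENNReal.ofReal (mmv d (θ * w) r')) := by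
                refine mul_le_mul_right (setLIntegral_mono' measurableSet_Ioc fun w hw => ?_) _
                rw [mul_left_comm]
                exact mul_le_mul_right (hb w hw) _
            _ ≤ A3 * (A2 * A1 * I) := by
                rw [lintegral_const_mul _ (by fun_prop)]
                refine mul_le_mul_right (mul_le_mul_right (lintegral_mono_set fun w hw => ?_) _) _
                simp only [mem_Ioi]
                linarith [hw.1]
            _ = _ := by ring
      _ ≤ A3 * (A2 * A1) * I := by
          rw [setLIntegral_const]
          calc _ ≤ A3 * (A2 * A1) * I * 1 := mul_le_mul_right prob_le_one _
            _ = _ := mul_one _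
  have hhi : ∫⁻ u in Sloᶜ, ENNReal.ofReal (mmv d (s ^ (1/p) * u) r) ∂η ≤ C1 * (A1 * (2 ^ (1 + p) * 2 : ℝ).toNNReal) * I := by
    set F : ℝ → ℝ≥0∞ := (Ioi (v1/l)).indicator (fun w => A1 * ENNReal.ofReal (mmv d (θ * (l * w + 1)) r')) with hF
    have hFm : Measurable F := Measurable.indicator (by fun_prop) measurableSet_Ioi
    set f : ℝ → ℝ≥0∞ := Sloᶜ.indicator (fun u => ENNReal.ofReal (mmv d (s ^ (1/p) * u) r)) with hf
    have hff : ∀ u, v0 < u → f u ≤ ∫⁻ w in Ico u (u + 1), F w := by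
      intro u hu
      by_cases huS : u ∈ Sloᶜ
      · rw [hf, indicator_of_mem huS]
        have huS' : v1 < l * u := not_le.1 huS
        calc ENNReal.ofReal (mmv d (s ^ (1/p) * u) r) = ∫⁻ w in Ico u (u + 1), ENNReal.ofReal (mmv d (s ^ (1/p) * u) r) := by
              rw [setLIntegral_const]; simp
          _ ≤ _ := by
              refine setLIntegral_mono' measurableSet_Ico fun w hw => ?_
              have hmem : w ∈ Ioi (v1 / l) := by
                simp only [mem_Ioi]
                rw [div_lt_iff₀ hl0, mul_comm]
                exact huS'.trans_le (by have := hw.1; gcongr)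
              rw [hF, indicator_of_mem hmem, hsl, mul_assoc]
              refine hA1 θ r r' δ (l * u) (l * w + 1) hθ0 hΘ hr hr' hrr hδ huS'.le ?_ ?_
              · have := mul_le_mul_of_nonneg_left hw.1 hl0.le; linarith
              · have := mul_le_mul_of_nonneg_left hw.2.le hl0.le
                linarith
      · rw [hf, indicator_of_notMem huS]; exact zero_le
    have h1 := hup v0 hv02 f F hFm hff
    have h2 : ∫⁻ u in Sloᶜ, ENNReal.ofReal (mmv d (s ^ (1/p) * u) r) ∂η ≤ ∫⁻ u in Ioi v0, f u ∂η := by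
      rw [← lintegral_indicator hSm.compl, ← lintegral_indicator measurableSet_Ioi]
      refine lintegral_mono fun u => ?_
      by_cases huS : u ∈ Sloᶜ
      · have huS' : v1 < l * u := not_le.1 huS
        have : u ∈ Ioi v0 := by
          simp only [mem_Ioi]
          by_contra hcon
          have hle : l * u ≤ Λ * v0 := by
            by_cases hu0 : 0 ≤ u
            · exact mul_le_mul hlΛ (not_lt.1 hcon) hu0 (by linarith)
            · have : l * u ≤ 0 := mul_nonpos_of_nonneg_of_nonpos hl0.le (not_le.1 hu0).le
              have : 0 ≤ Λ * v0 := mul_nonneg (by linarith) (by linarith)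
              linarith
          linarith
        rw [indicator_of_mem this]
      · rw [indicator_of_notMem huS]; exact zero_le
    refine (h2.trans h1).trans ?_
    rw [mul_assoc, mul_assoc]
    refine mul_le_mul_right ?_ _
    -- change of variables
    set Gf : ℝ → ℝ≥0∞ := fun w => (Ioi (v1 + 1)).indicator (fun w => ENNReal.ofReal (l * (2 ^ (1 + p) * 2) * w ^ (-1 - p)) * (A1 * ENNReal.ofReal (mmv d (θ * w) r'))) w with hGf
    have hGm : Measurable Gf := Measurable.indicator (by fun_prop) measurableSet_Ioi
    calc _ ≤ ∫⁻ w, Gf (l * w + 1) := by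
          refine (lintegral_mono fun w => ?_).trans (setLIntegral_le_lintegral (Ioi v0) _)
          by_cases hw : w ∈ Ioi (v1 / l)
          · have hw' : v1 < l * w := by
              simp only [mem_Ioi] at hw
              rwa [div_lt_iff₀ hl0, mul_comm] at hw
            rw [hF, indicator_of_mem hw, hGf]
            simp only
            rw [indicator_of_mem (show l * w + 1 ∈ Ioi (v1 + 1) by simp only [mem_Ioi]; linarith)]
            refine mul_le_mul_left (ENNReal.ofReal_le_ofReal ?_) _
            have hlw : 0 < l * w := by linarith
            have hw0 : 0 < w := by
              by_contra hcon
              have := mul_nonpos_of_nonneg_of_nonpos hl0.le (not_lt.1 hcon)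
              linarith
            have e1 : (l * w) ^ (-1 - p) ≤ 2 ^ (1 + p) * (l * w + 1) ^ (-1 - p) := by
              have : (2 * (l * w)) ^ (-1 - p) ≤ (l * w + 1) ^ (-1 - p) := rpow_le_rpow_of_nonpos (by linarith) (by linarith) (by linarith)
              rw [mul_rpow (by norm_num) hlw.le] at this
              have e : (2:ℝ) ^ (1 + p) * 2 ^ (-1 - p) = 1 := by rw [← rpow_add (by norm_num)]; ring_nf; simp
              calc (l * w) ^ (-1 - p) = 2 ^ (1 + p) * (2 ^ (-1 - p) * (l * w) ^ (-1 - p)) := by rw [← mul_assoc, e, one_mul]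
                _ ≤ _ := by gcongr
            have e2 : w ^ (-1 - p) = l * l ^ p * (l * w) ^ (-1 - p) := by
              rw [mul_rpow hl0.le hw0.le, ← mul_assoc]
              have : l * l ^ p * l ^ (-1 - p) = 1 := by
                rw [← rpow_one_add' hl0.le (by positivity), ← rpow_add hl0]; ring_nf; simp
              rw [this, one_mul]
            rw [e2]
            calc l * l ^ p * (l * w) ^ (-1 - p) ≤ l * 2 * (2 ^ (1 + p) * (l * w + 1) ^ (-1 - p)) := by gcongr
              _ = _ := by ring
          · rw [hF, indicator_of_notMem hw, mul_zero]; exact zero_le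
      _ = ENNReal.ofReal l⁻¹ * ∫⁻ w, Gf w := by
          have e1 : ∫⁻ w, Gf (l * w + 1) = ∫⁻ w, (fun y => Gf (y + 1)) (l * w) := rfl
          have hmap := Real.map_volume_mul_left hl0.ne'
          rw [e1, ← lintegral_map (f := fun y => Gf (y + 1)) (by fun_prop) (by fun_prop : Measurable fun w : ℝ => l * w)]
          have : Measure.map (fun w : ℝ => l * w) volume = ENNReal.ofReal |l⁻¹| • volume := hmap
          rw [this, lintegral_smul_measure, lintegral_add_right_eq_self Gf 1, abs_of_pos (by positivity), smul_eq_mul]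
      _ ≤ ENNReal.ofReal l⁻¹ * (ENNReal.ofReal l * (A1 * (2 ^ (1 + p) * 2 : ℝ).toNNReal * I)) := by
          refine mul_le_mul_right ?_ _
          rw [hGf, lintegral_indicator measurableSet_Ioi]
          calc _ = ∫⁻ w in Ioi (v1 + 1), (ENNReal.ofReal l * (A1 * (2 ^ (1 + p) * 2 : ℝ).toNNReal)) * (ENNReal.ofReal (w ^ (-1 - p)) * ENNReal.ofReal (mmv d (θ * w) r')) := by
                refine lintegral_congr fun w => ?_
                rw [ENNReal.ofReal_mul (by positivity), ENNReal.ofReal_mul hl0.le]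
                simp only [ENNReal.ofReal]
                ring
            _ ≤ _ := by
                rw [lintegral_const_mul _ (by fun_prop), mul_assoc]
                refine mul_le_mul_right (mul_le_mul_right (lintegral_mono_set fun w hw => ?_) _) _
                simp only [mem_Ioi] at hw ⊢
                linarith
      _ = _ := by
          rw [← mul_assoc, ← ENNReal.ofReal_mul (by positivity), inv_mul_cancel₀ hl0.ne', ENNReal.ofReal_one, one_mul, mul_assoc]
  rw [PR, ← lintegral_add_compl _ hSm]
  calc _ ≤ A3 * (A2 * A1) * I + C1 * (A1 * (2 ^ (1 + p) * 2 : ℝ).toNNReal) * I := add_le_add hlo hhi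
    _ ≤ A3 * (A2 * A1) * (C0 * PR d p η t r') + C1 * (A1 * (2 ^ (1 + p) * 2 : ℝ).toNNReal) * (C0 * PR d p η t r') :=
        add_le_add (mul_le_mul_right hIle _) (mul_le_mul_right hIle _)
    _ = _ := by push_cast; ring

lemma th_rd {α t : ℝ} (hα : 0 < α) (ht : 0 < t) : t ^ (1/(α/2)) = rd α t ^ 2 := by
  rw [rd, ← rpow_natCast, ← rpow_mul ht.le]; congr 1; field_simp; norm_num

lemma th_Dt {α t : ℝ} (hα : 0 < α) (ht : 0 < t) : ENNReal.ofReal ((t ^ (1/(α/2))) ^ (-((d:ℝ)/2))) = Dt d α t := by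
  have hr := rd_pos (α := α) ht
  rw [th_rd hα ht, Dt, ← rpow_natCast (rd α t) 2, ← rpow_mul hr.le, ← rpow_natCast, ← rpow_neg hr.le]
  congr 2; push_cast; ring

lemma KE_HKB {α : ℝ} (hα : 0 < α) (h : SUB (α/2) η) (hd : 0 < d) : HKB d α (KE d (α/2) η) := by
  refine ⟨KE_HK h, KE_mass h, ?_, ?_, ?_⟩
  · intro T hT
    obtain ⟨C, hC⟩ := PR_le h hd
    refine ⟨C, fun t ht htT x y => ?_⟩
    rw [KE_pos ht, ← th_Dt hα ht]
    exact hC t ht _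
  · intro T hT k hk
    obtain ⟨C, hC⟩ := PR_low (d := d) h ((2 * k) ^ 2) (T ^ (1/(α/2)))
    refine ⟨C, fun t ht htT x y hx hy => ?_⟩
    rw [KE_pos ht, ← th_Dt hα ht]
    refine hC t _ ht (rpow_le_rpow ht.le htT (by positivity)) ?_
    rw [th_rd hα ht, ← mul_pow]
    have := norm_sub_le x y
    gcongr
    linarith
  · intro T hT k hk
    obtain ⟨C, hC⟩ := PR_k4 h hd ((2 * k) ^ 2) (T ^ (1/(α/2))) k hk
    refine ⟨C, fun s t hs hst htT x y z hx hz hy => ?_⟩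
    have ht : 0 < t := by linarith
    have hr := rd_pos (α := α) ht
    rw [KE_pos ht, KE_pos hs]
    refine hC s t _ _ (2 * k * rd α t) ht hs hst (rpow_le_rpow ht.le htT (by positivity)) (norm_nonneg _) (norm_nonneg _) ?_ ?_ ?_
    · rw [th_rd hα ht, ← mul_pow]
      have := norm_sub_norm_le y z
      rw [norm_sub_rev] at this
      gcongr
      linarith
    · have h1 := norm_sub_le_norm_sub_add_norm_sub x z y
      have h2 := norm_sub_le x z
      linarith
    · rw [th_rd hα ht, ← mul_pow]
end P4c

section P4d
set_option linter.unusedSectionVars false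
variable {d : ℕ} {p : ℝ} {η : Measure ℝ}

lemma shift_int (f g : ℝ → ℝ≥0∞) (τ : ℝ) :
    ∫⁻ s in Ioi (0:ℝ), f s * g (τ + s) = ∫⁻ σ, (Ioi (0:ℝ)).indicator f (σ - τ) * g σ := by
  rw [← lintegral_add_right_eq_self (fun σ => (Ioi (0:ℝ)).indicator f (σ - τ) * g σ) τ, ← lintegral_indicator measurableSet_Ioi]
  refine lintegral_congr fun s => ?_
  rw [add_sub_cancel_right, add_comm s τ]
  by_cases hs : s ∈ Ioi (0:ℝ)
  · rw [indicator_of_mem hs, indicator_of_mem hs]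
  · rw [indicator_of_notMem hs, indicator_of_notMem hs, zero_mul]

lemma tau_int {γ t σ : ℝ} (hγ : 0 < γ) (ht : 0 < t) (hσ : 0 < σ) :
    ∫⁻ τ in Ioo (0:ℝ) t, (Ioi (0:ℝ)).indicator (fun s => ENNReal.ofReal (γ * s ^ (γ - 1))) (σ - τ) = ENNReal.ofReal (σ ^ γ - (σ - min t σ) ^ γ) := by
  have hm : 0 < min t σ := lt_min ht hσ
  have h1 : ∫⁻ τ in Ioo (0:ℝ) t, (Ioi (0:ℝ)).indicator (fun s => ENNReal.ofReal (γ * s ^ (γ - 1))) (σ - τ) =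
      ∫⁻ τ in Ioo (0:ℝ) (min t σ), ENNReal.ofReal (γ * (σ - τ) ^ (γ - 1)) := by
    rw [← lintegral_indicator measurableSet_Ioo, ← lintegral_indicator measurableSet_Ioo]
    refine lintegral_congr fun τ => ?_
    simp only [indicator_apply, mem_Ioo, mem_Ioi, lt_min_iff, sub_pos]
    by_cases h1 : 0 < τ <;> by_cases h2 : τ < t <;> by_cases h3 : τ < σ <;> simp [h1, h2, h3]
  rw [h1]
  have hpos : (σ - min t σ) ^ γ < σ ^ γ := rpow_lt_rpow (by linarith [min_le_right t σ]) (by linarith) hγ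
  refine lint_of_int measurableSet_Ioo (fun τ hτ => ?_) ?_ (by linarith)
  · have : 0 < σ - τ := by linarith [hτ.2, min_le_right t σ]
    positivity
  · rw [integral_const_mul, ← integral_Ioc_eq_integral_Ioo, ← intervalIntegral.integral_of_le hm.le,
      intervalIntegral.integral_comp_sub_left (fun s => s ^ (γ - 1)) σ, integral_rpow (Or.inl (by linarith)), sub_zero, sub_add_cancel]
    field_simp

lemma conv_ident {g : ℝ → ℝ≥0∞} (hg : Measurable g) {γ t : ℝ} (hγ : 0 < γ) (ht : 0 < t) :
    (∫⁻ s in Ioi (0:ℝ), ENNReal.ofReal (s ^ γ) * g (t + s)) +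
      (∫⁻ τ in Ioo (0:ℝ) t, ∫⁻ s in Ioi (0:ℝ), ENNReal.ofReal (γ * s ^ (γ - 1)) * g (τ + s)) =
    ∫⁻ s in Ioi (0:ℝ), ENNReal.ofReal (s ^ γ) * g s := by
  set f1 : ℝ → ℝ≥0∞ := (Ioi (0:ℝ)).indicator (fun s => ENNReal.ofReal (s ^ γ)) with hf1
  set f2 : ℝ → ℝ≥0∞ := (Ioi (0:ℝ)).indicator (fun s => ENNReal.ofReal (γ * s ^ (γ - 1))) with hf2
  have hm1 : Measurable f1 := Measurable.indicator (by fun_prop) measurableSet_Ioi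
  have hm2 : Measurable f2 := Measurable.indicator (by fun_prop) measurableSet_Ioi
  have e3 : ∫⁻ s in Ioi (0:ℝ), ENNReal.ofReal (s ^ γ) * g s = ∫⁻ σ, f1 σ * g σ := by
    have := shift_int (fun s => ENNReal.ofReal (s ^ γ)) g 0
    simpa using this
  simp_rw [shift_int (fun s => ENNReal.ofReal (γ * s ^ (γ - 1))) g]
  rw [shift_int (fun s => ENNReal.ofReal (s ^ γ)) g, e3, ← hf1, ← hf2]
  have hsw : Measurable fun q : ℝ × ℝ => f2 (q.2 - q.1) * g q.2 := by fun_prop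
  rw [lintegral_lintegral_swap (f := fun τ σ => f2 (σ - τ) * g σ) hsw.aemeasurable]
  rw [← lintegral_add_left (by fun_prop)]
  refine lintegral_congr fun σ => ?_
  have hm3 : Measurable fun τ => f2 (σ - τ) := by fun_prop
  rw [lintegral_mul_const _ hm3, ← add_mul]
  congr 1
  by_cases hσ : 0 < σ
  · rw [hf2, tau_int hγ ht hσ]
    simp only [hf1]
    rw [indicator_of_mem (show σ ∈ Ioi (0:ℝ) from hσ)]
    by_cases h1 : t < σ
    · rw [indicator_of_mem (show σ - t ∈ Ioi (0:ℝ) by simp only [mem_Ioi]; linarith), min_eq_left h1.le, ← ENNReal.ofReal_add]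
      · congr 1; ring
      · exact rpow_nonneg (by linarith) _
      · have : (σ - t) ^ γ ≤ σ ^ γ := rpow_le_rpow (by linarith) (by linarith) hγ.le
        linarith
    · rw [indicator_of_notMem (show σ - t ∉ Ioi (0:ℝ) by simp only [mem_Ioi]; linarith), min_eq_right (not_lt.1 h1), sub_self, zero_rpow hγ.ne', zero_add, sub_zero]
  · have h1 : f1 (σ - t) = 0 := indicator_of_notMem (by simp only [mem_Ioi]; linarith) _
    have h2 : f1 σ = 0 := indicator_of_notMem hσ _
    rw [h1, h2, zero_add]
    refine (setLIntegral_congr_fun measurableSet_Ioo (g := fun _ => 0) fun τ hτ => ?_).trans (by simp)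
    exact indicator_of_notMem (by simp only [mem_Ioi]; linarith [hτ.1]) _

def JJ (d : ℕ) (p : ℝ) (η : Measure ℝ) (γ r : ℝ) : ℝ≥0∞ := ∫⁻ s in Ioi (0:ℝ), ENNReal.ofReal (s ^ γ) * PR d p η s r

@[fun_prop]
lemma JJ_meas [SFinite η] {X : Type*} [MeasurableSpace X] {γ : ℝ} {g : X → ℝ} (hg : Measurable g) :
    Measurable fun x => JJ d p η γ (g x) := by
  have h1 : Measurable fun q : X × ℝ => ENNReal.ofReal (q.2 ^ γ) * PR d p η q.2 (g q.1) := by fun_prop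
  unfold JJ
  exact h1.lintegral_prod_right'

lemma act_JJ (h : SUB p η) {w : ℝ → ℝ≥0∞} (hw : Measurable w) {τ : ℝ} (hτ : 0 < τ) (x : Ed d) :
    act (KE d p η) (fun z => ∫⁻ s in Ioi (0:ℝ), w s * PR d p η s ‖z‖) τ x = ∫⁻ s in Ioi (0:ℝ), w s * PR d p η (τ + s) ‖x‖ := by
  haveI := h.prob
  unfold act
  have e1 : ∀ z : Ed d, KE d p η τ x z * ∫⁻ s in Ioi (0:ℝ), w s * PR d p η s ‖z‖ = ∫⁻ s in Ioi (0:ℝ), PR d p η τ ‖x - z‖ * (w s * PR d p η s ‖z‖) := by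
    intro z
    have hm : Measurable fun s => w s * PR d p η s ‖z‖ := by fun_prop
    rw [lintegral_const_mul _ hm, KE_pos hτ]
  simp_rw [e1]
  have hm : Measurable fun q : Ed d × ℝ => PR d p η τ ‖x - q.1‖ * (w q.2 * PR d p η q.2 ‖q.1‖) := by fun_prop
  rw [lintegral_lintegral_swap (f := fun z s => PR d p η τ ‖x - z‖ * (w s * PR d p η s ‖z‖)) hm.aemeasurable]
  refine setLIntegral_congr_fun measurableSet_Ioi fun s hs => ?_
  have hs' : (0:ℝ) < s := hs
  have hck := KE_ck h τ s hτ hs' x (0 : Ed d)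
  simp_rw [KE_pos hτ, KE_pos hs', KE_pos (add_pos hτ hs'), sub_zero] at hck
  rw [← hck]
  have hm : Measurable fun z : Ed d => PR d p η τ ‖x - z‖ * PR d p η s ‖z‖ := by fun_prop
  rw [← lintegral_const_mul _ hm]
  refine lintegral_congr fun z => ?_
  ring

lemma JJ_ident (h : SUB p η) {γ t : ℝ} (hγ : 0 < γ) (ht : 0 < t) (x : Ed d) :
    act (KE d p η) (fun z => JJ d p η γ ‖z‖) t x + pot (KE d p η) (fun z => ENNReal.ofReal γ * JJ d p η (γ - 1) ‖z‖) t x = JJ d p η γ ‖x‖ := by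
  haveI := h.prob
  have hm : Measurable fun s => PR d p η s ‖x‖ := by fun_prop
  have hw1 : Measurable fun s : ℝ => ENNReal.ofReal (s ^ γ) := by fun_prop
  have hw2 : Measurable fun s : ℝ => ENNReal.ofReal (γ * s ^ (γ - 1)) := by fun_prop
  unfold pot
  have e1 : act (KE d p η) (fun z => JJ d p η γ ‖z‖) t x = _ := act_JJ h hw1 ht x
  have e2 : ∀ z : Ed d, ENNReal.ofReal γ * JJ d p η (γ - 1) ‖z‖ = ∫⁻ s in Ioi (0:ℝ), ENNReal.ofReal (γ * s ^ (γ - 1)) * PR d p η s ‖z‖ := by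
    intro z
    have hm' : Measurable fun s : ℝ => ENNReal.ofReal (s ^ (γ - 1)) * PR d p η s ‖z‖ := by fun_prop
    unfold JJ
    rw [← lintegral_const_mul _ hm']
    refine lintegral_congr fun s => ?_
    rw [ENNReal.ofReal_mul hγ.le, mul_assoc]
  simp_rw [e2]
  rw [e1, setLIntegral_congr_fun measurableSet_Ioo fun τ hτ => act_JJ h hw2 hτ.1 x]
  exact conv_ident hm hγ ht

/-- Bessel integral -/
def BI (ν r : ℝ) : ℝ := ∫ u in Ioi (0:ℝ), u ^ (-ν - 1) * exp (-u - r ^ 2 / (4 * u))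

lemma JJ_eq (h : SUB p η) {γ : ℝ} (hγ : -1 < γ) (r : ℝ) :
    ENNReal.ofReal (Gamma (p * (γ + 1))) * JJ d p η γ r = ENNReal.ofReal (Gamma (γ + 1)) * ∫⁻ v in Ioi (0:ℝ), ENNReal.ofReal (v ^ (p * (γ + 1) - 1) * mmv d v r) := by
  haveI := h.prob
  have hp := h.hp
  set a := p * (γ + 1) with ha
  have hγ1 : 0 < γ + 1 := by linarith
  have ha0 : 0 < a := mul_pos hp hγ1
  have hmom := h.moment_eq ha0
  have hm : Measurable fun q : ℝ × ℝ => ENNReal.ofReal (q.1 ^ γ) * ENNReal.ofReal (mmv d (q.1 ^ (1/p) * q.2) r) := by fun_prop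
  have e1 : JJ d p η γ r = ∫⁻ u, (∫⁻ s in Ioi (0:ℝ), ENNReal.ofReal (s ^ γ) * ENNReal.ofReal (mmv d (s ^ (1/p) * u) r)) ∂η := by
    unfold JJ PR
    rw [← lintegral_lintegral_swap (f := fun s u => ENNReal.ofReal (s ^ γ) * ENNReal.ofReal (mmv d (s ^ (1/p) * u) r)) hm.aemeasurable]
    refine lintegral_congr fun s => ?_
    have hm' : Measurable fun u => ENNReal.ofReal (mmv d (s ^ (1/p) * u) r) := by fun_prop
    rw [lintegral_const_mul _ hm']
  set I := ∫⁻ v in Ioi (0:ℝ), ENNReal.ofReal (v ^ (a - 1) * mmv d v r) with hI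
  have e2 : ∀ᵐ u ∂η, ∫⁻ s in Ioi (0:ℝ), ENNReal.ofReal (s ^ γ) * ENNReal.ofReal (mmv d (s ^ (1/p) * u) r) = ENNReal.ofReal p * I * ENNReal.ofReal (u ^ (-a)) := by
    filter_upwards [h.pos] with u hu
    have himg : (fun v : ℝ => (v / u) ^ p) '' Ioi 0 = Ioi 0 := by
      ext s
      simp only [mem_image, mem_Ioi]
      constructor
      · rintro ⟨v, hv, rfl⟩; positivity
      · intro hs
        refine ⟨s ^ (1/p) * u, by positivity, ?_⟩
        rw [mul_div_cancel_right₀ _ hu.ne', th_pow hp hs]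
    have hinj : InjOn (fun v : ℝ => (v / u) ^ p) (Ioi 0) := by
      intro v hv w hw hvw
      simp only [mem_Ioi] at hv hw
      have := rpow_left_injOn hp.ne' (show v / u ∈ _ from by simp only [mem_setOf_eq]; positivity) (show w / u ∈ _ from by simp only [mem_setOf_eq]; positivity) hvw
      field_simp at this
      exact this
    have hder : ∀ v ∈ Ioi (0:ℝ), HasDerivWithinAt (fun v : ℝ => (v / u) ^ p) (1 / u * p * (v / u) ^ (p - 1)) (Ioi 0) v := by
      intro v hv
      simp only [mem_Ioi] at hv
      exact (((hasDerivAt_id v).div_const u).rpow_const (Or.inl (by simp only [id]; positivity))).hasDerivWithinAt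
    have := lintegral_image_eq_lintegral_abs_deriv_mul measurableSet_Ioi hder hinj (fun s => ENNReal.ofReal (s ^ γ) * ENNReal.ofReal (mmv d (s ^ (1/p) * u) r))
    rw [himg] at this
    rw [this, mul_right_comm, hI, ← ENNReal.ofReal_mul hp.le, ← lintegral_const_mul _ (by fun_prop)]
    refine setLIntegral_congr_fun measurableSet_Ioi fun v hv => ?_
    simp only [mem_Ioi] at hv
    have hvu : 0 < v / u := by positivity
    rw [← ENNReal.ofReal_mul (by positivity), ← ENNReal.ofReal_mul (by positivity), ← ENNReal.ofReal_mul (by positivity)]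
    congr 1
    have : ((v / u) ^ p) ^ (1 / p) * u = v := by
      rw [← rpow_mul hvu.le, mul_one_div_cancel hp.ne', rpow_one, div_mul_cancel₀ _ hu.ne']
    rw [this, abs_of_pos (by positivity), ← mul_assoc, ← mul_assoc]
    congr 1
    rw [← rpow_mul hvu.le]
    have e3 : (v / u) ^ (p - 1) * (v / u) ^ (p * γ) = v ^ (a - 1) * u ^ (-a) * u := by
      rw [← rpow_add hvu, show p - 1 + p * γ = a - 1 by rw [ha]; ring, div_rpow hv.le hu.le, mul_assoc, ← rpow_add_one hu.ne', div_eq_mul_inv, ← rpow_neg hu.le]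
      congr 2; ring
    calc 1 / u * p * (v / u) ^ (p - 1) * (v / u) ^ (p * γ) = 1 / u * p * ((v / u) ^ (p - 1) * (v / u) ^ (p * γ)) := by ring
      _ = _ := by rw [e3]; field_simp
  rw [e1, lintegral_congr_ae e2, lintegral_const_mul _ (by fun_prop), mul_left_comm, hmom, show a / p = γ + 1 by rw [ha]; field_simp,
    mul_right_comm, ← ENNReal.ofReal_mul hp.le]
  congr 2
  field_simp

end P4d

section P5a
set_option linter.unusedSectionVars false

def GG (ν r : ℝ) : ℝ := ∫ u in Ioi (0:ℝ), u ^ (ν - 1) * exp (-u - r ^ 2 / (4 * u))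

lemma GG_integrand_le (ν r : ℝ) {u : ℝ} (hu : 0 < u) :
    u ^ (ν - 1) * exp (-u - r ^ 2 / (4 * u)) ≤ exp (-u) * u ^ (ν - 1) := by
  have h : 0 ≤ r ^ 2 / (4 * u) := by positivity
  rw [mul_comm]
  exact mul_le_mul_of_nonneg_right (exp_le_exp.2 (by linarith)) (by positivity)

lemma GG_meas_int (ν r : ℝ) : Measurable fun u : ℝ => u ^ (ν - 1) * exp (-u - r ^ 2 / (4 * u)) := by fun_prop

lemma GG_int {ν : ℝ} (hν : 0 < ν) (r : ℝ) :
    IntegrableOn (fun u : ℝ => u ^ (ν - 1) * exp (-u - r ^ 2 / (4 * u))) (Ioi 0) := by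
  refine Integrable.mono' (Real.GammaIntegral_convergent hν) (GG_meas_int ν r).aestronglyMeasurable ?_
  filter_upwards [ae_restrict_mem measurableSet_Ioi] with u hu
  have hu' : (0:ℝ) < u := hu
  rw [norm_of_nonneg (by positivity)]
  exact GG_integrand_le ν r hu

lemma GG_le_Gamma {ν : ℝ} (hν : 0 < ν) (r : ℝ) : GG ν r ≤ Gamma ν := by
  rw [Real.Gamma_eq_integral hν]
  exact setIntegral_mono_on (GG_int hν r) (Real.GammaIntegral_convergent hν) measurableSet_Ioi
    (fun u hu => GG_integrand_le ν r hu)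

lemma GG_lower {ν r R : ℝ} (hν : 0 < ν) (hr : 0 ≤ r) (hR : r ≤ R) : 1 / 2 * exp (-2 - R ^ 2 / 4) ≤ GG ν r := by
  have h1 : ∫ u in Ioc (1:ℝ) 2, (1 / 2 * exp (-2 - R ^ 2 / 4) : ℝ) ≤ ∫ u in Ioc (1:ℝ) 2, u ^ (ν - 1) * exp (-u - r ^ 2 / (4 * u)) := by
    refine setIntegral_mono_on (integrableOn_const (by simp)) ((GG_int hν r).mono_set fun u hu => lt_trans one_pos hu.1) measurableSet_Ioc fun u hu => ?_
    have hu0 : 0 < u := lt_trans one_pos hu.1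
    refine mul_le_mul ?_ (exp_le_exp.2 ?_) (exp_pos _).le (by positivity)
    · calc (1/2:ℝ) ≤ u⁻¹ := by rw [one_div]; exact inv_anti₀ hu0 hu.2
        _ = u ^ (-1:ℝ) := (rpow_neg_one u).symm
        _ ≤ u ^ (ν - 1) := rpow_le_rpow_of_exponent_le hu.1.le (by linarith)
    · have : r ^ 2 / (4 * u) ≤ R ^ 2 / 4 := by
        refine div_le_div₀ (by positivity) (pow_le_pow_left₀ hr hR 2) (by norm_num) (by linarith [hu.1])
      linarith [hu.2]
  have h2 : ∫ u in Ioc (1:ℝ) 2, u ^ (ν - 1) * exp (-u - r ^ 2 / (4 * u)) ≤ GG ν r := by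
    refine setIntegral_mono_set (GG_int hν r) ?_ (Eventually.of_forall fun u hu => lt_trans one_pos hu.1)
    filter_upwards [ae_restrict_mem measurableSet_Ioi] with u hu
    have hu' : (0:ℝ) < u := hu
    simp only [Pi.zero_apply]
    positivity
  refine le_trans (le_of_eq ?_) (h1.trans h2)
  simp
  norm_num

lemma GG_pos {ν r : ℝ} (hν : 0 < ν) (hr : 0 ≤ r) : 0 < GG ν r :=
  lt_of_lt_of_le (by positivity) (GG_lower hν hr le_rfl)

lemma one_sub_exp_le {x e : ℝ} (hx : 0 ≤ x) (he : 0 < e) (he1 : e ≤ 1) : 1 - exp (-x) ≤ x ^ e := by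
  rcases le_total x 1 with h | h
  · have h1 : 1 - exp (-x) ≤ x := by linarith [add_one_le_exp (-x)]
    refine h1.trans ?_
    rcases hx.eq_or_lt with h0 | h0
    · rw [← h0, zero_rpow he.ne']
    · calc x = x ^ (1:ℝ) := (rpow_one x).symm
        _ ≤ x ^ e := rpow_le_rpow_of_exponent_ge h0 h he1
  · have : 1 ≤ x ^ e := one_le_rpow h he.le
    linarith [exp_pos (-x)]

lemma Gamma_sub_GG {ν r ε : ℝ} (hr : 0 < r) (hε : 0 < ε) (hε2 : ε ≤ 2) (hν : ε / 2 < ν) :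
    Gamma ν - GG ν r ≤ r ^ ε * Gamma (ν - ε / 2) := by
  have hν0 : 0 < ν := by linarith
  have hν1 : 0 < ν - ε / 2 := by linarith
  rw [Real.Gamma_eq_integral hν0, Real.Gamma_eq_integral hν1, GG, ← integral_sub (Real.GammaIntegral_convergent hν0) (GG_int hν0 r), ← integral_const_mul]
  refine setIntegral_mono_on ((Real.GammaIntegral_convergent hν0).sub (GG_int hν0 r)) ((Real.GammaIntegral_convergent hν1).const_mul _) measurableSet_Ioi fun u hu => ?_
  have hu' : (0:ℝ) < u := hu
  have h1 := one_sub_exp_le (x := r ^ 2 / (4 * u)) (e := ε / 2) (by positivity) (by linarith) (by linarith)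
  have h2 : (r ^ 2 / (4 * u)) ^ (ε / 2) ≤ r ^ ε * u ^ (-(ε / 2)) := by
    calc (r ^ 2 / (4 * u)) ^ (ε / 2) ≤ (r ^ 2 * u⁻¹) ^ (ε / 2) := by
          refine rpow_le_rpow (by positivity) ?_ (by linarith)
          rw [div_eq_mul_inv]
          exact mul_le_mul_of_nonneg_left (inv_anti₀ hu' (by linarith)) (by positivity)
      _ = r ^ ε * u ^ (-(ε / 2)) := by
          rw [mul_rpow (by positivity) (by positivity), rpow_neg hu'.le, inv_rpow hu'.le, ← rpow_natCast r 2, ← rpow_mul hr.le]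
          congr 2; push_cast; ring
  have h3 : u ^ (ν - ε / 2 - 1) = u ^ (ν - 1) * u ^ (-(ε/2)) := by
    rw [← rpow_add hu']; congr 1; ring
  have h4 : exp (-u - r ^ 2 / (4 * u)) = exp (-u) * exp (-(r ^ 2 / (4 * u))) := by rw [← exp_add]; congr 1
  rw [h3, h4]
  calc exp (-u) * u ^ (ν - 1) - u ^ (ν - 1) * (exp (-u) * exp (-(r ^ 2 / (4 * u)))) = (exp (-u) * u ^ (ν - 1)) * (1 - exp (-(r ^ 2 / (4 * u)))) := by ring
    _ ≤ (exp (-u) * u ^ (ν - 1)) * (r ^ ε * u ^ (-(ε / 2))) := mul_le_mul_of_nonneg_left (h1.trans h2) (by positivity)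
    _ = _ := by ring

lemma BI_eq {r : ℝ} (hr : 0 < r) (ν : ℝ) : BI ν r = (r / 2) ^ (-(2 * ν)) * GG ν r := by
  have hc : 0 < r ^ 2 / 4 := by positivity
  have h1 := integral_comp_rpow_Ioi (fun u : ℝ => u ^ (-ν - 1) * exp (-u - r ^ 2 / (4 * u))) (p := -1) (by norm_num)
  have h2 := integral_comp_mul_left_Ioi (fun u : ℝ => (u⁻¹) ^ (-ν - 1) * exp (-u⁻¹ - r ^ 2 / (4 * u⁻¹)) * u ^ (-2:ℝ)) 0 (b := (r ^ 2 / 4)⁻¹) (by positivity)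
  rw [BI, ← h1]
  have e1 : ∫ x in Ioi (0:ℝ), (|(-1:ℝ)| * x ^ ((-1:ℝ) - 1)) • ((x ^ (-1:ℝ)) ^ (-ν - 1) * exp (-x ^ (-1:ℝ) - r ^ 2 / (4 * x ^ (-1:ℝ)))) =
      ∫ u in Ioi (0:ℝ), (u⁻¹) ^ (-ν - 1) * exp (-u⁻¹ - r ^ 2 / (4 * u⁻¹)) * u ^ (-2:ℝ) := by
    refine setIntegral_congr_fun measurableSet_Ioi fun u hu => ?_
    simp only [smul_eq_mul, rpow_neg_one, abs_neg, abs_one]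
    norm_num
    ring
  rw [e1]
  rw [mul_zero, inv_inv, smul_eq_mul] at h2
  have h3 : ∫ u in Ioi (0:ℝ), (u⁻¹) ^ (-ν - 1) * exp (-u⁻¹ - r ^ 2 / (4 * u⁻¹)) * u ^ (-2:ℝ) =
     (r ^ 2 / 4)⁻¹ * ∫ x in Ioi (0:ℝ), ((((r ^ 2 / 4)⁻¹ * x)⁻¹) ^ (-ν - 1) * exp (-((r ^ 2 / 4)⁻¹ * x)⁻¹ - r ^ 2 / (4 * ((r ^ 2 / 4)⁻¹ * x)⁻¹)) * ((r ^ 2 / 4)⁻¹ * x) ^ (-2:ℝ)) := by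
    rw [h2, ← mul_assoc, inv_mul_cancel₀ hc.ne', one_mul]
  rw [h3, ← integral_const_mul, GG, ← integral_const_mul]
  refine setIntegral_congr_fun measurableSet_Ioi fun u hu => ?_
  have hu' : (0:ℝ) < u := hu
  have e2 : -((r ^ 2 / 4)⁻¹ * u)⁻¹ - r ^ 2 / (4 * ((r ^ 2 / 4)⁻¹ * u)⁻¹) = -u - r ^ 2 / (4 * u) := by
    field_simp; ring
  have e3 : (r / 2) ^ (-(2 * ν)) = (r ^ 2 / 4) ^ (-ν) := by
    rw [show r ^ 2 / 4 = (r / 2) ^ (2:ℝ) by rw [rpow_two]; ring, ← rpow_mul (by positivity)]; congr 1; ring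
  rw [e2, e3]
  set c := r ^ 2 / 4 with hcd
  have e4 : ((c⁻¹ * u)⁻¹) ^ (-ν - 1) = c ^ (-ν-1) * u ^ (ν + 1) := by
    rw [show (c⁻¹ * u)⁻¹ = c * u⁻¹ by field_simp, mul_rpow hc.le (by positivity), inv_rpow hu'.le, ← rpow_neg hu'.le]; congr 2; ring
  have e5 : (c⁻¹ * u) ^ (-2:ℝ) = c ^ (2:ℝ) * u ^ (-2:ℝ) := by
    rw [mul_rpow (by positivity) hu'.le, inv_rpow hc.le, ← rpow_neg hc.le]; norm_num
  have e6 : u ^ (ν - 1) = u ^ (ν + 1) * u ^ (-2:ℝ) := by rw [← rpow_add hu']; congr 1; ring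
  have e7 : c ^ (-ν) = c⁻¹ * (c ^ (-ν - 1) * c ^ (2:ℝ)) := by
    rw [← rpow_neg_one c, ← rpow_add hc, ← rpow_add hc]; congr 1; ring
  rw [e4, e5, e6, e7]; ring

lemma GG_parts {ν r : ℝ} (hν : 0 < ν) (hr : 0 ≤ r) : GG (ν + 2) r = (ν + 1) * GG (ν + 1) r + r ^ 2 / 4 * GG ν r := by
  have I2 := GG_int (show 0 < ν + 2 by linarith) r
  have I1 := GG_int (show 0 < ν + 1 by linarith) r
  have I0 := GG_int hν r
  set F : ℝ → ℝ := fun u => u ^ (ν + 1) * exp (-u - r ^ 2 / (4 * u)) with hF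
  set F' : ℝ → ℝ := fun u => (ν + 1) * (u ^ (ν + 1 - 1) * exp (-u - r ^ 2 / (4 * u))) + r ^ 2 / 4 * (u ^ (ν - 1) * exp (-u - r ^ 2 / (4 * u)))
     - u ^ (ν + 2 - 1) * exp (-u - r ^ 2 / (4 * u)) with hF'
  have hd : ∀ u ∈ Ioi (0:ℝ), HasDerivAt F (F' u) u := by
    intro u hu
    have hu' : (0:ℝ) < u := hu
    have d1 : HasDerivAt (fun u : ℝ => u ^ (ν + 1)) ((ν + 1) * u ^ (ν + 1 - 1)) u := Real.hasDerivAt_rpow_const (Or.inl hu'.ne')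
    have d2 : HasDerivAt (fun u : ℝ => -u - r ^ 2 / 4 * u⁻¹) (-1 - r ^ 2 / 4 * (-(u ^ 2)⁻¹)) u :=
      (hasDerivAt_id u).neg.sub ((hasDerivAt_inv hu'.ne').const_mul _)
    have d3 := d1.mul d2.exp
    have ef : ∀ v : ℝ, -v - r ^ 2 / 4 * v⁻¹ = -v - r ^ 2 / (4 * v) := fun v => by
      rw [div_mul_eq_div_div, div_eq_mul_inv (r^2/4) v]
    simp only [ef] at d3
    refine HasDerivAt.congr_deriv d3 ?_
    simp only [hF']
    have e1 : u ^ (ν + 2 - 1) = u ^ (ν + 1) := by congr 1; ring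
    have e2 : u ^ (ν - 1) = u ^ (ν + 1) * (u ^ 2)⁻¹ := by
      rw [← rpow_natCast u 2, ← rpow_neg hu'.le, ← rpow_add hu']; congr 1; push_cast; ring
    rw [e1, e2]; ring
  have hbd : ∀ u, 0 ≤ u → 0 ≤ F u ∧ F u ≤ u ^ (ν + 1) * exp (- 1 * u) := by
    intro u hu
    refine ⟨by positivity, ?_⟩
    have h : 0 ≤ r ^ 2 / (4 * u) := by positivity
    exact mul_le_mul_of_nonneg_left (exp_le_exp.2 (by linarith)) (by positivity)
  have h0 : ContinuousWithinAt F (Ici 0) 0 := by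
    have hF0 : F 0 = 0 := by simp only [hF]; rw [zero_rpow (by linarith), zero_mul]
    unfold ContinuousWithinAt
    rw [hF0]
    have hc : Tendsto (fun u : ℝ => u ^ (ν + 1) * exp (-1 * u)) (nhdsWithin 0 (Ici 0)) (nhds 0) := by
      have : ContinuousAt (fun u : ℝ => u ^ (ν + 1) * exp (-1 * u)) 0 :=
        (continuousAt_rpow_const 0 (ν + 1) (Or.inr (by linarith))).mul (by fun_prop)
      have h := this.tendsto
      simp only [zero_rpow (show ν + 1 ≠ 0 by linarith), zero_mul] at h
      exact h.mono_left nhdsWithin_le_nhds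
    refine squeeze_zero' ?_ ?_ hc
    · filter_upwards [self_mem_nhdsWithin] with u hu using (hbd u hu).1
    · filter_upwards [self_mem_nhdsWithin] with u hu using (hbd u hu).2
  have hinf : Tendsto F atTop (nhds 0) := by
    refine squeeze_zero' ?_ ?_ (tendsto_rpow_mul_exp_neg_mul_atTop_nhds_zero (ν + 1) 1 one_pos)
    · filter_upwards [eventually_ge_atTop 0] with u hu using (hbd u hu).1
    · filter_upwards [eventually_ge_atTop 0] with u hu using (hbd u hu).2
  have hI : IntegrableOn F' (Ioi 0) := ((I1.const_mul _).add (I0.const_mul _)).sub I2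
  have h := integral_Ioi_of_hasDerivAt_of_tendsto h0 hd hI hinf
  have hF0 : F 0 = 0 := by simp only [hF]; rw [zero_rpow (by linarith), zero_mul]
  rw [hF0, hF'] at h
  have e1 := integral_sub ((I1.const_mul (ν+1)).add (I0.const_mul (r^2/4))) I2
  have e2 := integral_add (I1.const_mul (ν+1)) (I0.const_mul (r^2/4))
  simp only [Pi.add_apply] at e1
  rw [e1, e2, integral_const_mul, integral_const_mul] at h
  unfold GG
  linarith

lemma GG_ratio {ν r a : ℝ} (hν : 0 < ν) (hr : 0 ≤ r) (ha : 0 < a) (ha1 : a ≤ 1) :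
    GG (ν + a) r ≤ (1 + (ν + 1) ^ 2) * (1 + r ^ a) * GG ν r := by
  have I2 := GG_int (show 0 < ν + 2 by linarith) r
  have I1 := GG_int (show 0 < ν + 1 by linarith) r
  have I0 := GG_int hν r
  have hG := GG_pos hν hr
  have h1 : (ν + 1) * GG (ν + 1) r ≤ 1 / 2 * GG (ν + 2) r + (ν + 1) ^ 2 / 2 * GG ν r := by
    unfold GG
    rw [← integral_const_mul, ← integral_const_mul, ← integral_const_mul, ← integral_add (I2.const_mul _) (I0.const_mul _)]
    refine setIntegral_mono_on (I1.const_mul _) ((I2.const_mul _).add (I0.const_mul _)) measurableSet_Ioi fun u hu => ?_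
    have hu' : (0:ℝ) < u := hu
    have e1 : u ^ (ν + 1 - 1) = u ^ (ν - 1) * u := by rw [← rpow_add_one hu'.ne']; congr 1; ring
    have e2 : u ^ (ν + 2 - 1) = u ^ (ν - 1) * u * u := by rw [← rpow_add_one hu'.ne', ← rpow_add_one hu'.ne']; congr 1; ring
    rw [e1, e2]
    have : 0 ≤ u ^ (ν - 1) * exp (-u - r ^ 2 / (4 * u)) * (u - (ν + 1)) ^ 2 := by positivity
    linarith
  have h2 := GG_parts hν hr
  have h3 : GG (ν + 2) r ≤ ((ν + 1) ^ 2 + r ^ 2 / 2) * GG ν r := by linarith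
  set M := 1 + r with hM
  have hM0 : 0 < M := by linarith
  have h4 : GG (ν + a) r ≤ M ^ a * (GG ν r + (M ^ 2)⁻¹ * GG (ν + 2) r) := by
    unfold GG
    rw [← integral_const_mul, ← integral_add I0 (I2.const_mul _), ← integral_const_mul]
    refine setIntegral_mono_on (GG_int (by linarith) r) ((I0.add (I2.const_mul _)).const_mul _) measurableSet_Ioi fun u hu => ?_
    have hu' : (0:ℝ) < u := hu
    have e1 : u ^ (ν + a - 1) = u ^ (ν - 1) * u ^ a := by rw [← rpow_add hu']; congr 1; ring
    have e2 : u ^ (ν + 2 - 1) = u ^ (ν - 1) * u * u := by rw [← rpow_add_one hu'.ne', ← rpow_add_one hu'.ne']; congr 1; ring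
    rw [e1, e2]
    have hx : u ^ a ≤ M ^ a * (1 + (M ^ 2)⁻¹ * (u * u)) := by
      have e3 : u ^ a = M ^ a * (u / M) ^ a := by rw [← mul_rpow hM0.le (by positivity)]; congr 1; field_simp
      have e4 : (M ^ 2)⁻¹ * (u * u) = (u / M) ^ 2 := by field_simp
      rw [e3, e4]
      refine mul_le_mul_of_nonneg_left ?_ (by positivity)
      have hw : 0 < u / M := by positivity
      rcases le_total (u / M) 1 with h | h
      · have := rpow_le_one hw.le h ha.le
        nlinarith [sq_nonneg (u/M)]
      · calc (u / M) ^ a ≤ (u/M) ^ (2:ℝ) := rpow_le_rpow_of_exponent_le h (by linarith)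
          _ = (u/M)^2 := rpow_two _
          _ ≤ _ := by linarith
    calc u ^ (ν - 1) * u ^ a * exp (-u - r ^ 2 / (4 * u)) = (u ^ (ν - 1) * exp (-u - r ^ 2 / (4 * u))) * u ^ a := by ring
      _ ≤ (u ^ (ν - 1) * exp (-u - r ^ 2 / (4 * u))) * (M ^ a * (1 + (M ^ 2)⁻¹ * (u * u))) := mul_le_mul_of_nonneg_left hx (by positivity)
      _ = _ := by ring
  have h5 : GG ν r + (M ^ 2)⁻¹ * GG (ν + 2) r ≤ (1 + (ν + 1) ^ 2) * GG ν r := by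
    have : (M ^ 2)⁻¹ * GG (ν + 2) r ≤ (ν + 1) ^ 2 * GG ν r := by
      rw [inv_mul_le_iff₀ (by positivity)]
      refine h3.trans ?_
      rw [← mul_assoc]
      refine mul_le_mul_of_nonneg_right ?_ hG.le
      have a1 : 1 ≤ (ν + 1)^2 := by nlinarith
      have a2 : (M ^ 2) = 1 + 2 * r + r ^ 2 := by rw [hM]; ring
      rw [a2]
      nlinarith [mul_nonneg (sq_nonneg r) (sub_nonneg.2 a1), mul_nonneg hr (sq_nonneg (ν+1)), sq_nonneg r]
    linarith
  have h6 : M ^ a ≤ 1 + r ^ a := by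
    have := rpow_add_le_add_rpow zero_le_one hr ha.le ha1
    rwa [one_rpow] at this
  calc GG (ν + a) r ≤ M ^ a * (GG ν r + (M ^ 2)⁻¹ * GG (ν + 2) r) := h4
    _ ≤ M ^ a * ((1 + (ν + 1) ^ 2) * GG ν r) := mul_le_mul_of_nonneg_left h5 (by positivity)
    _ ≤ (1 + r ^ a) * ((1 + (ν + 1) ^ 2) * GG ν r) := mul_le_mul_of_nonneg_right h6 (by positivity)
    _ = _ := by ring

end P5a

section P5b
set_option linter.unusedSectionVars false
variable {d : ℕ} {α : ℝ}

lemma besselK_eq {r : ℝ} (hr : 0 < r) (ν : ℝ) : besselK ν r = 1 / 2 * (r / 2) ^ (-ν) * GG ν r := by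
  have h : besselK ν r = 1 / 2 * (r / 2) ^ ν * BI ν r := rfl
  rw [h, BI_eq hr]
  have : (r / 2) ^ (-ν) = (r / 2) ^ ν * (r / 2) ^ (-(2 * ν)) := by
    rw [← rpow_add (by positivity)]; congr 1; ring
  rw [this]; ring

/-- The coefficient in `V_b`. -/
def Acf (d : ℕ) (α b : ℝ) : ℝ := 2 ^ α * Gamma (((d:ℝ) - b) / 2) / Gamma (((d:ℝ) - b - α) / 2)

lemma VProf_eq {b r : ℝ} (hb : 0 < b) (hr : 0 < r) :
    VProf d α b r = Acf d α b * (r ^ (-α) * (GG (b / 2 + α / 2) r / GG (b / 2) r)) := by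
  have hG := GG_pos (ν := b / 2) (by linarith) hr.le
  unfold VProf Acf
  rw [besselK_eq hr, besselK_eq hr]
  have e0 : (b + α) / 2 = b / 2 + α / 2 := by ring
  rw [e0]
  have e1 : (r / 2) ^ (-(b / 2 + α / 2)) = (r / 2) ^ (-(b / 2)) * ((2:ℝ) ^ (α / 2) * r ^ (-(α / 2))) := by
    have : (2:ℝ) ^ (α / 2) * r ^ (-(α / 2)) = (r / 2) ^ (-(α/2)) := by
      rw [div_rpow hr.le (by norm_num), rpow_neg (by norm_num : (0:ℝ) ≤ 2)]; field_simp
    rw [this, ← rpow_add (by positivity)]; congr 1; ring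
  have e2 : (2:ℝ) ^ α = 2 ^ (α / 2) * 2 ^ (α / 2) := by rw [← rpow_add (by norm_num)]; congr 1; ring
  have e3 : r ^ (-α) = r ^ (-(α / 2)) * r ^ (-(α / 2)) := by rw [← rpow_add hr]; congr 1; ring
  rw [e1, e2, e3]
  have h1 : (r / 2) ^ (-(b / 2)) ≠ 0 := (rpow_pos_of_pos (by positivity) _).ne'
  field_simp

lemma Acf_pos {b : ℝ} (hα : 0 < α) (hb : b < d - α) : 0 < Acf d α b := by
  have h1 := Gamma_pos_of_pos (show 0 < ((d:ℝ) - b) / 2 by linarith)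
  have h2 := Gamma_pos_of_pos (show 0 < ((d:ℝ) - b - α) / 2 by linarith)
  unfold Acf; positivity

lemma VProf_pos {b r : ℝ} (hα : 0 < α) (hb : 0 < b) (hb' : b < d - α) (hr : 0 < r) : 0 < VProf d α b r := by
  rw [VProf_eq hb hr]
  have h1 := Acf_pos hα hb'
  have h2 := GG_pos (ν := b / 2) (by linarith) hr.le
  have h3 := GG_pos (ν := b / 2 + α / 2) (by linarith) hr.le
  positivity

lemma gam_bd {lo hi : ℝ} (hlo : 0 < lo) (hh : lo ≤ hi) : ∃ c C : ℝ, 0 < c ∧ 0 < C ∧ ∀ x ∈ Icc lo hi, c ≤ Gamma x ∧ Gamma x ≤ C := by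
  have hc : ContinuousOn Gamma (Icc lo hi) := fun x hx =>
    (Real.differentiableAt_Gamma fun m => by
      have : 0 < x := lt_of_lt_of_le hlo hx.1
      have h2 : (0:ℝ) ≤ m := by positivity
      linarith).continuousAt.continuousWithinAt
  obtain ⟨x0, h0, hmin⟩ := isCompact_Icc.exists_isMinOn ⟨lo, left_mem_Icc.2 hh⟩ hc
  obtain ⟨x1, h1, hmax⟩ := isCompact_Icc.exists_isMaxOn ⟨lo, left_mem_Icc.2 hh⟩ hc
  exact ⟨Gamma x0, Gamma x1, Gamma_pos_of_pos (lt_of_lt_of_le hlo h0.1), Gamma_pos_of_pos (lt_of_lt_of_le hlo h1.1),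
    fun x hx => ⟨hmin hx, hmax hx⟩⟩

lemma Acf_bd {b₀ δ : ℝ} (hα : 0 < α) (h0 : b₀ ≤ δ) (hδ : δ < d - α) : ∃ A : ℝ, 0 < A ∧ ∀ b ∈ Icc b₀ δ, Acf d α b ≤ A := by
  obtain ⟨c1, C1, hc1, hC1, H1⟩ := gam_bd (lo := ((d:ℝ) - δ) / 2) (hi := ((d:ℝ) - b₀) / 2) (by linarith) (by linarith)
  obtain ⟨c2, C2, hc2, hC2, H2⟩ := gam_bd (lo := ((d:ℝ) - δ - α) / 2) (hi := ((d:ℝ) - b₀ - α) / 2) (by linarith) (by linarith)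
  refine ⟨2 ^ α * C1 / c2, by positivity, fun b hb => ?_⟩
  have h1 := (H1 (((d:ℝ) - b) / 2) ⟨by linarith [hb.2], by linarith [hb.1]⟩).2
  have h2 := (H2 (((d:ℝ) - b - α) / 2) ⟨by linarith [hb.2], by linarith [hb.1]⟩).1
  exact div_le_div₀ (by positivity) (mul_le_mul_of_nonneg_left h1 (by positivity)) hc2 h2

lemma V_bd {b₀ δ : ℝ} (hα : 0 < α) (hα2 : α ≤ 2) (hb₀ : 0 < b₀) (h0 : b₀ ≤ δ) (hδ : δ < d - α) :
    ∃ C : ℝ, 0 < C ∧ ∀ b ∈ Icc b₀ δ, ∀ r, 0 < r → VProf d α b r ≤ C * (r ^ (-α) + r ^ (-(α / 2))) := by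
  obtain ⟨A, hA, HA⟩ := Acf_bd hα h0 hδ
  refine ⟨A * (1 + (δ / 2 + 1) ^ 2), by positivity, fun b hb r hr => ?_⟩
  have hb0 : 0 < b := by linarith [hb.1]
  rw [VProf_eq hb0 hr, mul_assoc]
  have hG := GG_pos (ν := b / 2) (by linarith) hr.le
  have h3 := GG_pos (ν := b / 2 + α / 2) (by linarith) hr.le
  refine mul_le_mul (HA b hb) ?_ (by positivity) hA.le
  have h4 : GG (b / 2 + α / 2) r / GG (b / 2) r ≤ (1 + (b / 2 + 1) ^ 2) * (1 + r ^ (α / 2)) := by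
    rw [div_le_iff₀ hG]
    exact GG_ratio (by linarith) hr.le (by linarith) (by linarith)
  have h5 : (1 + (b / 2 + 1) ^ 2) ≤ (1 + (δ / 2 + 1) ^ 2) := by
    have := pow_le_pow_left₀ (show 0 ≤ b / 2 + 1 by linarith) (show b / 2 + 1 ≤ δ / 2 + 1 by linarith [hb.2]) 2
    linarith
  have e : r ^ (-α) + r ^ (-(α / 2)) = r ^ (-α) * (1 + r ^ (α / 2)) := by
    rw [mul_add, mul_one, ← rpow_add hr]; congr 2; ring
  rw [e]
  calc r ^ (-α) * (GG (b / 2 + α / 2) r / GG (b / 2) r) ≤ r ^ (-α) * ((1 + (δ / 2 + 1) ^ 2) * (1 + r ^ (α / 2))) :=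
        mul_le_mul_of_nonneg_left (h4.trans (mul_le_mul_of_nonneg_right h5 (by positivity))) (by positivity)
    _ = _ := by ring

lemma kappa_eq {b : ℝ} : kappa d α b = Acf d α b * (Gamma (b / 2 + α / 2) / Gamma (b / 2)) := by
  unfold kappa Acf
  rw [show (b + α) / 2 = b / 2 + α / 2 by ring]
  rw [div_mul_div_comm]; congr 1 <;> ring

lemma V_asym {b₀ δ ε : ℝ} (hα : 0 < α) (hb₀ : 0 < b₀) (h0 : b₀ ≤ δ) (hδ : δ < d - α)
    (hε : 0 < ε) (hε2 : ε ≤ 2) (hεb : ε < b₀) :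
    ∃ C : ℝ, 0 < C ∧ ∀ b ∈ Icc b₀ δ, ∀ r, 0 < r → r ≤ 1 →
      |VProf d α b r - kappa d α b * r ^ (-α)| ≤ C * r ^ (-α + ε) := by
  obtain ⟨A, hA, HA⟩ := Acf_bd hα h0 hδ
  obtain ⟨c1, C1, hc1, hC1, H1⟩ := gam_bd (lo := (b₀ - ε) / 2) (hi := δ / 2 + α / 2) (by linarith) (by linarith)
  set g : ℝ := 1 / 2 * exp (-2 - 1 ^ 2 / 4) with hg
  have hg0 : 0 < g := by positivity
  refine ⟨A * (C1 * C1 / (g * c1) + C1 / c1), by positivity, fun b hb r hr hr1 => ?_⟩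
  obtain ⟨hb1, hb2⟩ := hb
  have hb0 : 0 < b := by linarith
  rw [VProf_eq hb0 hr, kappa_eq, rpow_add hr]
  set G := GG (b / 2) r
  set G' := GG (b / 2 + α / 2) r
  set Γ := Gamma (b / 2)
  set Γ' := Gamma (b / 2 + α / 2)
  have hG : g ≤ G := GG_lower (by linarith) hr.le hr1
  have hG' : 0 < G' := GG_pos (by linarith) hr.le
  have hGΓ : G ≤ Γ := GG_le_Gamma (by linarith) r
  have hGΓ' : G' ≤ Γ' := GG_le_Gamma (by linarith) r
  have hΓ := H1 (b / 2) ⟨by linarith, by linarith⟩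
  have hΓ' := H1 (b / 2 + α / 2) ⟨by linarith, by linarith⟩
  have hs : Γ - G ≤ r ^ ε * C1 := (Gamma_sub_GG hr hε hε2 (by linarith)).trans
    (mul_le_mul_of_nonneg_left (H1 _ ⟨by linarith, by linarith⟩).2 (by positivity))
  have hs' : Γ' - G' ≤ r ^ ε * C1 := (Gamma_sub_GG hr hε hε2 (by linarith)).trans
    (mul_le_mul_of_nonneg_left (H1 _ ⟨by linarith, by linarith⟩).2 (by positivity))
  have hG0 : 0 < G := lt_of_lt_of_le hg0 hG
  have hΓ0 : 0 < Γ := lt_of_lt_of_le hG0 hGΓ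
  have hΓ0' : 0 < Γ' := lt_of_lt_of_le hG' hGΓ'
  have hre : 0 < r ^ ε := by positivity
  have key : |G' / G - Γ' / Γ| ≤ (C1 * C1 / (g * c1) + C1 / c1) * r ^ ε := by
    have p1 : 0 ≤ C1 * C1 / (g * c1) * r ^ ε := by positivity
    have p2 : 0 ≤ C1 / c1 * r ^ ε := by positivity
    rw [add_mul, abs_le]
    constructor
    · have : Γ' / Γ - G' / G ≤ C1 / c1 * r ^ ε := by
        calc Γ' / Γ - G' / G ≤ Γ' / Γ - G' / Γ := sub_le_sub_left (div_le_div_of_nonneg_left hG'.le hG0 hGΓ) _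
          _ = (Γ' - G') / Γ := by ring
          _ ≤ (r ^ ε * C1) / c1 := div_le_div₀ (by positivity) hs' hc1 hΓ.1
          _ = _ := by ring
      linarith
    · have : G' / G - Γ' / Γ ≤ C1 * C1 / (g * c1) * r ^ ε := by
        calc G' / G - Γ' / Γ ≤ Γ' / G - Γ' / Γ := sub_le_sub_right (div_le_div_of_nonneg_right hGΓ' hG0.le) _
          _ = (Γ' * (Γ - G)) / (G * Γ) := by field_simp
          _ ≤ (C1 * (r ^ ε * C1)) / (g * c1) := by
            refine div_le_div₀ (by positivity) (mul_le_mul hΓ'.2 hs (by linarith) hC1.le) (by positivity) (mul_le_mul hG hΓ.1 hc1.le hG0.le)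
          _ = _ := by ring
      linarith
  have hA0 := Acf_pos (d := d) hα (show b < d - α by linarith)
  have e : Acf d α b * (r ^ (-α) * (G' / G)) - Acf d α b * (Γ' / Γ) * r ^ (-α) = Acf d α b * r ^ (-α) * (G' / G - Γ' / Γ) := by ring
  rw [e, abs_mul, abs_of_pos (by positivity)]
  calc Acf d α b * r ^ (-α) * |G' / G - Γ' / Γ| ≤ A * r ^ (-α) * ((C1 * C1 / (g * c1) + C1 / c1) * r ^ ε) :=
        mul_le_mul (mul_le_mul_of_nonneg_right (HA b ⟨hb1, hb2⟩) (by positivity)) key (abs_nonneg _) (by positivity)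
    _ = _ := by ring

lemma kappa_symm {b : ℝ} : kappa d α ((d:ℝ) - α - b) = kappa d α b := by
  unfold kappa
  rw [show ((d:ℝ) - α - b + α) / 2 = (d - b) / 2 by ring, show ((d:ℝ) - (d - α - b)) / 2 = (b + α) / 2 by ring,
    show ((d:ℝ) - (d - α - b) - α) / 2 = b / 2 by ring, show ((d:ℝ) - α - b) / 2 = (d - b - α) / 2 by ring]
  congr 1 <;> ring

end P5b

section P5c
set_option linter.unusedSectionVars false
variable {d : ℕ} {α : ℝ}

lemma quad_le {x y s a j : ℝ} (hx : 0 < x) (hxy : x < y) (hys : y ≤ s / 2) (ha : 0 < a) (hj : 0 ≤ j) :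
    (y + a + j) * (s - y + a + j) * ((x + j) * (s - x + j)) < (x + a + j) * (s - x + a + j) * ((y + j) * (s - y + j)) := by
  have h : 0 < (a * (s + a + 2 * j)) * ((y - x) * (s - x - y)) :=
    mul_pos (mul_pos ha (by linarith)) (mul_pos (by linarith) (by linarith))
  linarith [h, show (x + a + j) * (s - x + a + j) * ((y + j) * (s - y + j)) - (y + a + j) * (s - y + a + j) * ((x + j) * (s - x + j)) = (a * (s + a + 2 * j)) * ((y - x) * (s - x - y)) by ring]

lemma gseq_mul {n : ℕ} (hn : n ≠ 0) {u v w z : ℝ} :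
    GammaSeq u n * GammaSeq v n * (GammaSeq w n * GammaSeq z n) =
     ((n:ℝ) ^ (u + v + w + z) * (n.factorial:ℝ) ^ 4) / ∏ j ∈ Finset.range (n + 1), ((u + j) * (v + j) * ((w + j) * (z + j))) := by
  have hn' : (0:ℝ) < n := by positivity
  unfold GammaSeq
  rw [Finset.prod_mul_distrib, Finset.prod_mul_distrib, Finset.prod_mul_distrib, rpow_add hn', rpow_add hn', rpow_add hn',
    div_mul_div_comm, div_mul_div_comm, div_mul_div_comm]
  congr 1
  ring

lemma gam_strict {x y s a : ℝ} (hx : 0 < x) (hxy : x < y) (hys : y ≤ s / 2) (ha : 0 < a) :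
    Gamma (x + a) * Gamma (s - x + a) * (Gamma y * Gamma (s - y)) < Gamma (y + a) * Gamma (s - y + a) * (Gamma x * Gamma (s - x)) := by
  set ρ : ℝ := ((y + a) * (s - y + a) * (x * (s - x))) / ((x + a) * (s - x + a) * (y * (s - y))) with hρ
  have hden : 0 < (x + a) * (s - x + a) * (y * (s - y)) :=
    mul_pos (mul_pos (by linarith) (by linarith)) (mul_pos (by linarith) (by linarith))
  have hnum : 0 < (y + a) * (s - y + a) * (x * (s - x)) :=
    mul_pos (mul_pos (by linarith) (by linarith)) (mul_pos (by linarith) (by linarith))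
  have hρ0 : 0 < ρ := div_pos hnum hden
  have hρ1 : ρ < 1 := by
    rw [hρ, div_lt_one hden]
    have := quad_le hx hxy hys ha le_rfl
    simpa using this
  have hle : ∀ n : ℕ, n ≠ 0 → GammaSeq (x + a) n * GammaSeq (s - x + a) n * (GammaSeq y n * GammaSeq (s - y) n) ≤
      ρ * (GammaSeq (y + a) n * GammaSeq (s - y + a) n * (GammaSeq x n * GammaSeq (s - x) n)) := by
    intro n hn
    rw [gseq_mul hn, gseq_mul hn]
    have e : x + a + (s - x + a) + y + (s - y) = y + a + (s - y + a) + x + (s - x) := by ring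
    rw [e]
    set N := (n:ℝ) ^ (y + a + (s - y + a) + x + (s - x)) * (n.factorial:ℝ) ^ 4
    have hN : 0 ≤ N := by positivity
    have hp1 : ∀ j ∈ Finset.range (n+1), 0 < (x + a + (j:ℝ)) * (s - x + a + j) * ((y + j) * (s - y + j)) := by
      intro j _
      have : (0:ℝ) ≤ j := by positivity
      exact mul_pos (mul_pos (by linarith) (by linarith)) (mul_pos (by linarith) (by linarith))
    have hp2 : ∀ j ∈ Finset.range (n+1), 0 < (y + a + (j:ℝ)) * (s - y + a + j) * ((x + j) * (s - x + j)) := by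
      intro j _
      have : (0:ℝ) ≤ j := by positivity
      exact mul_pos (mul_pos (by linarith) (by linarith)) (mul_pos (by linarith) (by linarith))
    have hP1 := Finset.prod_pos hp1
    have hP2 := Finset.prod_pos hp2
    have hm : ∏ j ∈ Finset.range (n + 1), ((y + a + (j:ℝ)) * (s - y + a + j) * ((x + j) * (s - x + j))) ≤
        ρ * ∏ j ∈ Finset.range (n + 1), ((x + a + (j:ℝ)) * (s - x + a + j) * ((y + j) * (s - y + j))) := by
      rw [Finset.prod_range_succ', Finset.prod_range_succ']
      have e1 : (y + a + ((0:ℕ):ℝ)) * (s - y + a + ((0:ℕ):ℝ)) * ((x + ((0:ℕ):ℝ)) * (s - x + ((0:ℕ):ℝ))) = ρ * ((x + a + ((0:ℕ):ℝ)) * (s - x + a + ((0:ℕ):ℝ)) * ((y + ((0:ℕ):ℝ)) * (s - y + ((0:ℕ):ℝ)))) := by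
        simp only [Nat.cast_zero, add_zero]
        rw [hρ, div_mul_cancel₀ _ hden.ne']
      rw [e1, mul_left_comm]
      refine mul_le_mul_of_nonneg_left (mul_le_mul_of_nonneg_right ?_ ?_) hρ0.le
      · refine Finset.prod_le_prod (fun j hj => ?_) fun j hj => ?_
        · exact (hp2 (j+1) (by simpa using hj)).le
        · exact (quad_le hx hxy hys ha (by positivity)).le
      · simpa using hden.le
    rw [← mul_div_assoc, div_le_div_iff₀ hP1 hP2]
    calc N * _ ≤ N * (ρ * ∏ j ∈ Finset.range (n + 1), ((x + a + (j:ℝ)) * (s - x + a + j) * ((y + j) * (s - y + j)))) := mul_le_mul_of_nonneg_left hm hN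
      _ = _ := by ring
  have hlim := le_of_tendsto_of_tendsto
    (((GammaSeq_tendsto_Gamma (x + a)).mul (GammaSeq_tendsto_Gamma (s - x + a))).mul ((GammaSeq_tendsto_Gamma y).mul (GammaSeq_tendsto_Gamma (s - y))))
    ((((GammaSeq_tendsto_Gamma (y + a)).mul (GammaSeq_tendsto_Gamma (s - y + a))).mul ((GammaSeq_tendsto_Gamma x).mul (GammaSeq_tendsto_Gamma (s - x)))).const_mul ρ)
    (by filter_upwards [eventually_ne_atTop 0] with n hn using hle n hn)
  refine lt_of_le_of_lt hlim ?_
  have : 0 < Gamma (y + a) * Gamma (s - y + a) * (Gamma x * Gamma (s - x)) :=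
    mul_pos (mul_pos (Gamma_pos_of_pos (by linarith)) (Gamma_pos_of_pos (by linarith))) (mul_pos (Gamma_pos_of_pos (by linarith)) (Gamma_pos_of_pos (by linarith)))
  calc _ < 1 * _ := mul_lt_mul_of_pos_right hρ1 this
    _ = _ := one_mul _

lemma kappa_strict {b b' : ℝ} (hα : 0 < α) (hb : 0 < b) (hbb : b < b') (hb' : b' ≤ (d - α) / 2) : kappa d α b < kappa d α b' := by
  have h := gam_strict (x := b / 2) (y := b' / 2) (s := (d - α) / 2) (a := α / 2) (by linarith) (by linarith) (by linarith) (by linarith)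
  unfold kappa
  rw [show (b + α) / 2 = b / 2 + α / 2 by ring, show (b' + α) / 2 = b' / 2 + α / 2 by ring,
    show ((d:ℝ) - b) / 2 = (d - α) / 2 - b / 2 + α / 2 by ring, show ((d:ℝ) - b') / 2 = (d - α) / 2 - b' / 2 + α / 2 by ring,
    show ((d:ℝ) - b - α) / 2 = (d - α) / 2 - b / 2 by ring, show ((d:ℝ) - b' - α) / 2 = (d - α) / 2 - b' / 2 by ring]
  rw [div_lt_div_iff₀ (mul_pos (Gamma_pos_of_pos (by linarith)) (Gamma_pos_of_pos (by linarith))) (mul_pos (Gamma_pos_of_pos (by linarith)) (Gamma_pos_of_pos (by linarith)))]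
  have h2 : (0:ℝ) < 2 ^ α := by positivity
  have := mul_lt_mul_of_pos_left h h2
  linarith

end P5c

section P5d
set_option linter.unusedSectionVars false
variable {d : ℕ} {α : ℝ} {η : Measure ℝ}

lemma BI_meas (ν : ℝ) : Measurable (BI ν) := by
  have h : Measurable fun q : ℝ × ℝ => q.2 ^ (-ν - 1) * exp (-q.2 - q.1 ^ 2 / (4 * q.2)) := by fun_prop
  exact (h.stronglyMeasurable.integral_prod_right' (ν := volume.restrict (Ioi (0:ℝ)))).measurable

lemma besselK_meas (ν : ℝ) : Measurable (besselK ν) := by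
  have h : besselK ν = fun r => 1 / 2 * (r / 2) ^ ν * BI ν r := rfl
  rw [h]
  have := BI_meas ν
  fun_prop

lemma VProf_meas (b : ℝ) : Measurable (VProf d α b) := by
  have h1 := besselK_meas ((b + α) / 2)
  have h2 := besselK_meas (b / 2)
  unfold VProf
  fun_prop

lemma BI_pos {ν r : ℝ} (hν : 0 < ν) (hr : 0 < r) : 0 < BI ν r := by
  rw [BI_eq hr]
  have := GG_pos hν hr.le
  positivity

lemma lint_BI (d : ℕ) {b r : ℝ} (hb : 0 < b) (hr : 0 < r) :
    ∫⁻ v in Ioi (0:ℝ), ENNReal.ofReal (v ^ (((d:ℝ) - b) / 2 - 1) * mmv d v r) = ENNReal.ofReal ((4 * π) ^ (-((d:ℝ)/2)) * BI (b / 2) r) := by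
  have hB := BI_pos (ν := b / 2) (by linarith) hr
  have e : ∫⁻ v in Ioi (0:ℝ), ENNReal.ofReal (v ^ (((d:ℝ) - b) / 2 - 1) * mmv d v r) =
      ∫⁻ v in Ioi (0:ℝ), ENNReal.ofReal ((4 * π) ^ (-((d:ℝ)/2)) * (v ^ (-(b/2) - 1) * exp (-v - r ^ 2 / (4 * v)))) := by
    refine setLIntegral_congr_fun measurableSet_Ioi fun v hv => ?_
    have hv' : (0:ℝ) < v := hv
    simp only [mmv, gau]
    congr 1
    have e1 : v ^ (-(b/2) - 1) = v ^ (((d:ℝ) - b) / 2 - 1) * v ^ (-((d:ℝ)/2)) := by rw [← rpow_add hv']; congr 1; ring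
    have e2 : exp (-v - r ^ 2 / (4 * v)) = exp (-(r ^ 2 / (4 * v))) * exp (-v) := by rw [← exp_add]; congr 1; ring
    rw [e1, e2, mul_rpow (by positivity) hv'.le]
    ring
  rw [e]
  refine lint_of_int measurableSet_Ioi (fun v hv => ?_) ?_ (by positivity)
  · have hv' : (0:ℝ) < v := hv
    positivity
  · rw [integral_const_mul]; rfl

/-- normalising constant for `JJ` -/
def cJ (d : ℕ) (α b : ℝ) : ℝ := Gamma (((d:ℝ) - b) / α) / Gamma (((d:ℝ) - b) / 2) * (4 * π) ^ (-((d:ℝ)/2))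

lemma cJ_pos {b : ℝ} (hα : 0 < α) (hb : b < d) : 0 < cJ d α b := by
  have h1 := Gamma_pos_of_pos (show 0 < ((d:ℝ) - b) / α from div_pos (by linarith) hα)
  have h2 := Gamma_pos_of_pos (show 0 < ((d:ℝ) - b) / 2 by linarith)
  unfold cJ; positivity

lemma JJ_BI (h : SUB (α / 2) η) {b r : ℝ} (hα : 0 < α) (hb : 0 < b) (hbd : b < d) (hr : 0 < r) :
    JJ d (α / 2) η (((d:ℝ) - α - b) / α) r = ENNReal.ofReal (cJ d α b * BI (b / 2) r) := by
  have h1 := JJ_eq (d := d) h (γ := ((d:ℝ) - α - b) / α) (by rw [lt_div_iff₀ hα]; linarith) r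
  have e1 : ((d:ℝ) - α - b) / α + 1 = (d - b) / α := by field_simp; ring
  have e2 : α / 2 * (((d:ℝ) - b) / α) = (d - b) / 2 := by field_simp
  rw [e1, e2, lint_BI d hb hr] at h1
  have g1 := Gamma_pos_of_pos (show 0 < ((d:ℝ) - b) / α from div_pos (by linarith) hα)
  have g2 := Gamma_pos_of_pos (show 0 < ((d:ℝ) - b) / 2 by linarith)
  rw [← ENNReal.ofReal_mul g1.le] at h1
  have h2 : JJ d (α / 2) η (((d:ℝ) - α - b) / α) r = (ENNReal.ofReal (Gamma (((d:ℝ) - b) / 2)))⁻¹ * ENNReal.ofReal (Gamma ((↑d - b) / α) * ((4 * π) ^ (-(↑d / 2:ℝ)) * BI (b / 2) r)) := by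
    rw [← h1, ← mul_assoc, ENNReal.inv_mul_cancel (by simpa using g2) ENNReal.ofReal_ne_top, one_mul]
  rw [h2, ← ENNReal.ofReal_inv_of_pos g2, ← ENNReal.ofReal_mul (by positivity)]
  congr 1
  unfold cJ
  field_simp

lemma V_BI {b r : ℝ} (hα : 0 < α) (hb : 0 < b) (hbd : b < d - α) (hr : 0 < r) :
    VProf d α b r * (cJ d α b * BI (b / 2) r) = ((d:ℝ) - α - b) / α * (cJ d α (b + α) * BI ((b + α) / 2) r) := by
  have hG := BI_pos (ν := b / 2) (by linarith) hr
  have hG' := BI_pos (ν := (b + α) / 2) (by linarith) hr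
  have hb1 : besselK (b / 2) r = 1 / 2 * (r / 2) ^ (b / 2) * BI (b / 2) r := rfl
  have hb2 : besselK ((b + α) / 2) r = 1 / 2 * (r / 2) ^ ((b + α) / 2) * BI ((b + α) / 2) r := rfl
  have g2 := Gamma_pos_of_pos (show 0 < ((d:ℝ) - b) / 2 by linarith)
  have g3 := Gamma_pos_of_pos (show 0 < ((d:ℝ) - b - α) / 2 by linarith)
  have hγ : 0 < ((d:ℝ) - α - b) / α := div_pos (by linarith) hα
  have hΓ := Real.Gamma_add_one hγ.ne'
  have e1 : ((d:ℝ) - α - b) / α + 1 = (d - b) / α := by field_simp; ring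
  rw [e1] at hΓ
  unfold VProf cJ
  rw [hb1, hb2, hΓ, show (d:ℝ) - (b + α) = d - b - α by ring, show (d:ℝ) - α - b = d - b - α by ring]
  have e3 : (r / 2) ^ ((b + α) / 2) = (r / 2) ^ (b / 2) * (r ^ (α / 2) / 2 ^ (α / 2)) := by
    rw [← div_rpow hr.le (by norm_num), ← rpow_add (by positivity)]; congr 1; ring
  rw [e3, rpow_neg hr.le]
  have h1 : (r / 2) ^ (b / 2) ≠ 0 := (rpow_pos_of_pos (by positivity) _).ne'
  have h2 : r ^ (α / 2) ≠ 0 := (rpow_pos_of_pos (by positivity) _).ne'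
  have h3 : (2:ℝ) ^ (α / 2) ≠ 0 := (rpow_pos_of_pos (by positivity) _).ne'
  field_simp

/-- normalised ground-state profile -/
def hP (b r : ℝ) : ℝ := 2 ^ (-b) / Gamma (b / 2) * BI (b / 2) r

lemma hP_eq {b r : ℝ} (hr : 0 < r) : hP b r = r ^ (-b) * (GG (b / 2) r / Gamma (b / 2)) := by
  unfold hP
  rw [BI_eq hr, show -(2 * (b / 2)) = -b by ring, div_rpow hr.le (by norm_num)]
  have h3 : (2:ℝ) ^ (-b) ≠ 0 := (rpow_pos_of_pos (by positivity) _).ne'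
  field_simp

lemma act_const {K : ℝ → Ed d → Ed d → ℝ≥0∞} {φ ψ : Ed d → ℝ≥0∞} {c : ℝ≥0∞} (hc : c ≠ ⊤) (h : ∀ᵐ z, φ z = c * ψ z) (t : ℝ) (x : Ed d) :
    act K φ t x = c * act K ψ t x := by
  unfold act
  rw [← lintegral_const_mul' _ _ hc]
  refine lintegral_congr_ae (h.mono fun z hz => ?_)
  simp only
  rw [hz, mul_left_comm]

lemma pot_const {K : ℝ → Ed d → Ed d → ℝ≥0∞} {φ ψ : Ed d → ℝ≥0∞} {c : ℝ≥0∞} (hc : c ≠ ⊤) (h : ∀ᵐ z, φ z = c * ψ z) (t : ℝ) (x : Ed d) :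
    pot K φ t x = c * pot K ψ t x := by
  unfold pot
  rw [← lintegral_const_mul' _ _ hc]
  exact lintegral_congr fun s => act_const hc h s x

lemma hP_ident (h : SUB (α / 2) η) (hd : 0 < d) {b t : ℝ} (hα : 0 < α) (hb : 0 < b) (hbd : b < d - α) (ht : 0 < t) {x : Ed d} (hx : x ≠ 0) :
    act (KE d (α / 2) η) (fun z => ENNReal.ofReal (hP b ‖z‖)) t x +
      pot (KE d (α / 2) η) (fun z => ENNReal.ofReal (VProf d α b ‖z‖ * hP b ‖z‖)) t x = ENNReal.ofReal (hP b ‖x‖) := by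
  have hγ : 0 < ((d:ℝ) - α - b) / α := div_pos (by linarith) hα
  have hid := JJ_ident (d := d) h hγ ht x
  have hc := cJ_pos (d := d) hα (show b < d by linarith)
  have hΓ := Gamma_pos_of_pos (show 0 < b / 2 by linarith)
  set l : ℝ := 2 ^ (-b) / Gamma (b / 2) / cJ d α b with hl
  have hl0 : 0 ≤ l := by positivity
  have e1 : ∀ z : Ed d, z ≠ 0 → ENNReal.ofReal (hP b ‖z‖) = ENNReal.ofReal l * JJ d (α / 2) η (((d:ℝ) - α - b) / α) ‖z‖ := by
    intro z hz
    rw [JJ_BI h hα hb (by linarith) (norm_pos_iff.2 hz), ← ENNReal.ofReal_mul hl0]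
    congr 1
    rw [hl, hP]; field_simp
  have e2 : ∀ z : Ed d, z ≠ 0 → ENNReal.ofReal (VProf d α b ‖z‖ * hP b ‖z‖) = ENNReal.ofReal l * (ENNReal.ofReal (((d:ℝ) - α - b) / α) * JJ d (α / 2) η (((d:ℝ) - α - b) / α - 1) ‖z‖) := by
    intro z hz
    have hz' := norm_pos_iff.2 hz
    have ee : ((d:ℝ) - α - b) / α - 1 = (d - α - (b + α)) / α := by field_simp; ring
    rw [ee, JJ_BI h hα (by linarith) (by linarith) hz', ← ENNReal.ofReal_mul hγ.le, ← V_BI hα hb hbd hz', ← ENNReal.ofReal_mul hl0]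
    congr 1
    rw [hl, hP]; field_simp
  rw [act_const ENNReal.ofReal_ne_top ((ae_ne hd).mono e1), pot_const ENNReal.ofReal_ne_top ((ae_ne hd).mono e2), ← mul_add, hid, e1 x hx]

lemma POT_inst (h : SUB (α / 2) η) (hd : 0 < d) {δ β : ℝ} (hα : 0 < α) (hα2 : α < 2) (hδ : δ < d - α)
    (hβ : 0 < β) (hβ2 : β ≤ (d - α) / 2) (hβδ : β ≤ δ) (hk : kappa d α β = kappa d α δ) :
    POT d α β (β - min α β / 4) (min α β / 2) (KE d (α / 2) η) (VProf d α δ) hP (VProf d α) := by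
  have hm0 : 0 < min α β := lt_min hα hβ
  have hm1 := min_le_left α β
  have hm2 := min_le_right α β
  set m := min α β
  have hb₀ : 0 < β - m / 4 := by linarith
  obtain ⟨CV, hCV, HV⟩ := V_bd (d := d) (b₀ := β - m / 4) (δ := δ) hα hα2.le hb₀ (by linarith) hδ
  obtain ⟨CA, hCA, HA⟩ := V_asym (d := d) (b₀ := β - m / 4) (δ := δ) (ε := m / 2) hα hb₀ (by linarith) hδ (by linarith) (by linarith) (by linarith)
  obtain ⟨g1, g2, hg1, hg2, HG⟩ := gam_bd (lo := (β - m / 4) / 2) (hi := β / 2) (by linarith) (by linarith)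
  have hδm : δ ∈ Icc (β - m / 4) δ := ⟨by linarith, le_rfl⟩
  have hmem : ∀ b ∈ Icc (β - m / 4) β, b ∈ Icc (β - m / 4) δ := fun b hb => ⟨hb.1, hb.2.trans hβδ⟩
  have hkm : ∀ b, 0 < b → b ≤ β → kappa d α b ≤ kappa d α δ := by
    intro b hb0 hb
    rcases hb.eq_or_lt with h | h
    · rw [h, hk]
    · rw [← hk]; exact (kappa_strict hα hb0 h hβ2).le
  have hdiff : ∀ b ∈ Icc (β - m / 4) β, ∀ r, 0 < r → r ≤ 1 → |(VProf d α δ r - VProf d α b r) - (kappa d α δ - kappa d α b) * r ^ (-α)| ≤ 2 * CA * r ^ (-α + m / 2) := by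
    intro b hb r hr hr1
    have h1 := abs_le.1 (HA δ hδm r hr hr1)
    have h2 := abs_le.1 (HA b (hmem b hb) r hr hr1)
    rw [abs_le]
    constructor <;> linarith [h1.1, h1.2, h2.1, h2.2]
  exact
  { hα := hα
    hb₀ := hb₀
    hbβ := by linarith
    hβd := by linarith
    hbε := by linarith
    hbα := by linarith
    hεα := by linarith
    qm := VProf_meas δ
    hm := fun b => (BI_meas (b / 2)).const_mul _
    Vm := fun b => VProf_meas b
    q0 := fun r hr => (VProf_pos hα (by linarith) hδ hr).le
    V0 := fun b hb r hr => (VProf_pos hα (by linarith [hb.1]) (by linarith [hb.2]) hr).le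
    ident := fun b hb t ht x hx => hP_ident h hd hα (by linarith [hb.1]) (by linarith [hb.2]) ht hx
    qle := ⟨CV, hCV, fun r hr => HV δ hδm r hr⟩
    Vle := by
      refine ⟨2 * CV, by positivity, fun b hb r hr => (HV b (hmem b hb) r hr).trans ?_⟩
      have : r ^ (-(α / 2)) ≤ r ^ (-α) + 1 := by
        have e : r ^ (-α) = r ^ (-(α/2)) * r ^ (-(α/2)) := by rw [← rpow_add hr]; congr 1; ring
        rw [e]
        nlinarith [sq_nonneg (r ^ (-(α/2)) - 1/2)]
      have p1 : 0 ≤ r ^ (-α) := by positivity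
      calc CV * (r ^ (-α) + r ^ (-(α / 2))) ≤ CV * (2 * (r ^ (-α) + 1)) := mul_le_mul_of_nonneg_left (by linarith) hCV.le
        _ = _ := by ring
    hpos := by
      intro b hb r hr
      have hb0 : 0 < b := by linarith [hb.1]
      have h1 := BI_pos (ν := b / 2) (by linarith) hr
      have h2 := Gamma_pos_of_pos (show 0 < b / 2 by linarith)
      unfold hP; positivity
    hle := by
      intro b hb r hr
      have hb0 : 0 < b := by linarith [hb.1]
      have h2 := Gamma_pos_of_pos (show 0 < b / 2 by linarith)
      rw [hP_eq hr]
      have : GG (b / 2) r / Gamma (b / 2) ≤ 1 := (div_le_one h2).2 (GG_le_Gamma (by linarith) r)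
      exact mul_le_of_le_one_right (by positivity) this
    hge := by
      intro R hR
      refine ⟨(1 / 2 * exp (-2 - R ^ 2 / 4)) / g2, by positivity, fun b hb r hr hrR => ?_⟩
      have hb0 : 0 < b := by linarith [hb.1]
      have h2 := Gamma_pos_of_pos (show 0 < b / 2 by linarith)
      rw [hP_eq hr, mul_comm]
      refine mul_le_mul_of_nonneg_left ?_ (by positivity)
      exact div_le_div₀ (GG_pos (by linarith) hr.le).le (GG_lower (by linarith) hr.le hrR) h2 (HG _ ⟨by linarith [hb.1], by linarith [hb.2]⟩).2
    gap := by
      intro b hb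
      have hb0 : 0 < b := by linarith [hb.1]
      have hks : 0 < kappa d α δ - kappa d α b := by
        have := kappa_strict (d := d) hα hb0 hb.2 hβ2
        rw [← hk]; linarith
      set D := kappa d α δ - kappa d α b
      have hm2' : 0 < m / 2 := by linarith
      refine ⟨D / 2, min 1 ((D / (4 * CA)) ^ (m / 2)⁻¹), by positivity, lt_min one_pos (by positivity), fun r hr hr1 => ?_⟩
      have h1 := (abs_le.1 (hdiff b ⟨hb.1, hb.2.le⟩ r hr (hr1.trans (min_le_left _ _)))).1
      have h2 : r ^ (m / 2) ≤ D / (4 * CA) := by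
        have := rpow_le_rpow hr.le (hr1.trans (min_le_right _ _)) hm2'.le
        rwa [← rpow_mul (by positivity), inv_mul_cancel₀ hm2'.ne', rpow_one] at this
      rw [le_div_iff₀ (by positivity)] at h2
      rw [rpow_add hr] at h1
      have h3 : 2 * CA * (r ^ (-α) * r ^ (m / 2)) ≤ D / 2 * r ^ (-α) := by
        have p1 : 0 ≤ r ^ (-α) := by positivity
        calc 2 * CA * (r ^ (-α) * r ^ (m / 2)) = r ^ (-α) * (r ^ (m/2) * (4 * CA) / 2) := by ring
          _ ≤ r ^ (-α) * (D / 2) := mul_le_mul_of_nonneg_left (by linarith) p1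
          _ = _ := by ring
      linarith
    near := by
      refine ⟨2 * CA, 1, by positivity, one_pos, fun r hr hr1 => ⟨?_, fun b hb => ?_⟩⟩
      · have h1 := (abs_le.1 (hdiff β ⟨by linarith, le_rfl⟩ r hr hr1)).2
        rw [hk, sub_self, zero_mul, sub_zero] at h1
        exact h1
      · have h1 := (abs_le.1 (hdiff b hb r hr hr1)).1
        have h2 := hkm b (by linarith [hb.1]) hb.2
        have p1 : 0 ≤ r ^ (-α) := by positivity
        have := mul_nonneg (sub_nonneg.2 h2) p1
        linarith }

end P5d

section P6
set_option linter.unusedSectionVars false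
variable {d : ℕ} {α : ℝ} {η : Measure ℝ}

lemma PN_succ_iter {K : ℝ → Ed d → Ed d → ℝ≥0∞} (hK : HK K) {q : Ed d → ℝ≥0∞} (hq : Measurable q) (n : ℕ) (t : ℝ) (x y : Ed d) :
    PN K q (n + 1) t x y = ∫⁻ s in Ioo (0:ℝ) t, ∫⁻ z, PN K q n s x z * q z * K (t - s) z y := by
  have hA := PN_meas hK hq n
  have hm : Measurable fun a : ℝ × Ed d => PN K q n a.1 x a.2 * q a.2 * K (t - a.1) a.2 y := by
    refine Measurable.mul (Measurable.mul ?_ (hq.comp measurable_snd)) ?_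
    · exact hA.comp measurable_fst measurable_const measurable_snd
    · exact hK.meas.comp (measurable_const.sub measurable_fst) measurable_snd measurable_const
  have h1 : PN K q (n + 1) t x y = ∫⁻ a : ℝ × Ed d, PN K q n a.1 x a.2 * q a.2 * K (t - a.1) a.2 y := rfl
  rw [h1, Measure.volume_eq_prod, lintegral_prod _ hm.aemeasurable, ← lintegral_indicator measurableSet_Ioo]
  refine lintegral_congr fun s => ?_
  by_cases hs : s ∈ Ioo (0:ℝ) t
  · rw [indicator_of_mem hs]
  · rw [indicator_of_notMem hs, ← lintegral_zero]
    refine lintegral_congr fun z => ?_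
    rw [mem_Ioo, not_and_or, not_lt, not_lt] at hs
    rcases hs with hs | hs
    · simp [PN_zero hK n s hs]
    · simp [hK.zero (t - s) (by linarith)]

lemma pertN_eq {K : ℝ → Ed d → Ed d → ℝ≥0∞} (hK : HK K) {k : ℝ → Ed d → Ed d → ℝ} {q : ℝ → ℝ} (hq : Measurable q)
    (hq0 : ∀ r, 0 < r → 0 ≤ q r) (hd : 0 < d) {T : ℝ} (hk : ∀ t, 0 < t → ∀ x y, k t x y = (K t x y).toReal)
    (hfin : ∀ n t, 0 < t → t ≤ T → ∀ x y : Ed d, x ≠ 0 → y ≠ 0 → PN K (qE d q) n t x y ≠ ⊤) (n : ℕ) :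
    ∀ t, 0 < t → t ≤ T → ∀ x y : Ed d, x ≠ 0 → y ≠ 0 → pertN d k (fun z => q ‖z‖) n t x y = (PN K (qE d q) n t x y).toReal := by
  have hqm : Measurable (qE d q) := qE_meas hq
  induction n with
  | zero => intro t ht _ x y _ _; exact hk t ht x y
  | succ n ih =>
    intro t ht htT x y hx hy
    have hA := PN_meas hK hqm n
    set F : ℝ → Ed d → ℝ≥0∞ := fun s z => PN K (qE d q) n s x z * qE d q z * K (t - s) z y with hF
    have hm : Measurable fun a : ℝ × Ed d => F a.1 a.2 := by
      refine Measurable.mul (Measurable.mul ?_ (hqm.comp measurable_snd)) ?_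
      · exact hA.comp measurable_fst measurable_const measurable_snd
      · exact hK.meas.comp (measurable_const.sub measurable_fst) measurable_snd measurable_const
    have hit := PN_succ_iter hK hqm n t x y
    have hft := hfin (n + 1) t ht htT x y hx hy
    have hI : Measurable fun s => ∫⁻ z, F s z := hm.lintegral_prod_right'
    have hlt : ∀ᵐ s ∂(volume.restrict (Ioo (0:ℝ) t)), (∫⁻ z, F s z) < ⊤ :=
      ae_lt_top hI (by rw [← hit]; exact hft)
    rw [hit, ← integral_toReal hI.aemeasurable hlt]
    show ∫ s in Ioo (0 : ℝ) t, ∫ z : Ed d, pertN d k (fun z => q ‖z‖) n s x z * q ‖z‖ * k (t - s) z y = _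
    refine integral_congr_ae ?_
    filter_upwards [hlt, ae_restrict_mem measurableSet_Ioo] with s hs hst
    have hms : Measurable fun z => F s z := hm.comp (measurable_const.prodMk measurable_id)
    rw [← integral_toReal hms.aemeasurable (ae_lt_top hms hs.ne)]
    refine integral_congr_ae ((ae_ne hd).mono fun z hz => ?_)
    simp only [hF]
    rw [ENNReal.toReal_mul, ENNReal.toReal_mul, ih s hst.1 (hst.2.le.trans htT) x z hx hz, hk (t - s) (by linarith [hst.2]) z y, qE,
      ENNReal.toReal_ofReal (hq0 _ (norm_pos_iff.2 hz))]

lemma main_beta (h : SUB (α / 2) η) (hd : 0 < d) {δ β : ℝ} (hα : 0 < α) (hα2 : α < 2) (hδ : δ < d - α)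
    (hβ : 0 < β) (hβ2 : β ≤ (d - α) / 2) (hβδ : β ≤ δ) (hk : kappa d α β = kappa d α δ) {T : ℝ} (hT : 0 < T) :
    ∃ c : ℝ, 1 ≤ c ∧ ∀ t ∈ Ioc (0 : ℝ) T, ∀ x y : Ed d, x ≠ 0 → y ≠ 0 →
      c⁻¹ * (relKernel d α 1 t x y * (1 + t ^ (β / α) * ‖x‖ ^ (-β)) * (1 + t ^ (β / α) * ‖y‖ ^ (-β))) ≤
          pert d (relKernel d α 1) (Vbeta d α δ) t x y ∧
        pert d (relKernel d α 1) (Vbeta d α δ) t x y ≤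
          c * (relKernel d α 1 t x y * (1 + t ^ (β / α) * ‖x‖ ^ (-β)) * (1 + t ^ (β / α) * ‖y‖ ^ (-β))) := by
  have hK := KE_HKB hα h hd
  have hP := POT_inst h hd hα hα2 hδ hβ hβ2 hβδ hk
  obtain ⟨C1, H1⟩ := upper_full hK hP hT
  obtain ⟨C2, H2⟩ := lower_full hK hP hT
  set K := KE d (α / 2) η
  set q := VProf d α δ
  have hKfin : ∀ t, 0 < t → ∀ x y : Ed d, K t x y ≠ ⊤ := fun t ht x y => by
    show KE d (α / 2) η t x y ≠ ⊤
    rw [KE_pos ht]; exact PR_ne_top h hd ht _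
  have hPfin : ∀ t, 0 < t → t ≤ T → ∀ x y : Ed d, x ≠ 0 → y ≠ 0 → PP K q t x y ≠ ⊤ := by
    intro t ht htT x y hx hy
    refine ((H1 t ht htT x y hx hy).trans_lt ?_).ne
    exact ENNReal.mul_lt_top ENNReal.coe_lt_top (ENNReal.mul_lt_top (ENNReal.mul_lt_top (hKfin t ht x y).lt_top ENNReal.ofReal_lt_top) ENNReal.ofReal_lt_top)
  have hNfin : ∀ n t, 0 < t → t ≤ T → ∀ x y : Ed d, x ≠ 0 → y ≠ 0 → PN K (qE d q) n t x y ≠ ⊤ := by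
    intro n t ht htT x y hx hy
    exact ((ENNReal.le_tsum n).trans_lt (hPfin t ht htT x y hx hy).lt_top).ne
  have hkk : ∀ t, 0 < t → ∀ x y, relKernel d α 1 t x y = (K t x y).toReal := by
    intro t ht x y
    rw [rel_eq hα h hd ht]
    show _ = (KE d (α / 2) η t x y).toReal
    rw [KE_pos ht]
  have hpn := pertN_eq hK.toHK hP.qm hP.q0 hd hkk hNfin
  have hpt : ∀ t, 0 < t → t ≤ T → ∀ x y : Ed d, x ≠ 0 → y ≠ 0 → pert d (relKernel d α 1) (Vbeta d α δ) t x y = (PP K q t x y).toReal := by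
    intro t ht htT x y hx hy
    have e : PP K q t x y = ∑' n, PN K (qE d q) n t x y := rfl
    rw [e, ENNReal.tsum_toReal_eq fun n => hNfin n t ht htT x y hx hy]
    exact tsum_congr fun n => hpn n t ht htT x y hx hy
  have hW : ∀ t, 0 < t → ∀ x : Ed d, x ≠ 0 → (1 + rd α t / ‖x‖) ^ β ≤ 2 ^ β * (1 + t ^ (β / α) * ‖x‖ ^ (-β)) ∧
      (1 + t ^ (β / α) * ‖x‖ ^ (-β)) ≤ 2 * (1 + rd α t / ‖x‖) ^ β := by
    intro t ht x hx
    have hx' := norm_pos_iff.2 hx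
    have hr := rd_pos (α := α) ht
    have e : t ^ (β / α) * ‖x‖ ^ (-β) = (rd α t / ‖x‖) ^ β := by
      rw [div_rpow hr.le hx'.le, rpow_neg hx'.le, rd, ← rpow_mul ht.le, one_div_mul_eq_div, div_eq_mul_inv (t ^ (β / α))]
    rw [e]
    set w := rd α t / ‖x‖
    have hw : 0 < w := div_pos hr hx'
    have p := rpow_pos_of_pos hw β
    constructor
    · rcases le_total w 1 with h | h
      · calc (1 + w) ^ β ≤ 2 ^ β := rpow_le_rpow (by linarith) (by linarith) hβ.le
          _ ≤ _ := le_mul_of_one_le_right (by positivity) (by linarith)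
      · calc (1 + w) ^ β ≤ (2 * w) ^ β := rpow_le_rpow (by linarith) (by linarith) hβ.le
          _ = 2 ^ β * w ^ β := mul_rpow (by norm_num) hw.le
          _ ≤ _ := mul_le_mul_of_nonneg_left (by linarith) (by positivity)
    · have h1 : w ^ β ≤ (1 + w) ^ β := rpow_le_rpow hw.le (by linarith) hβ.le
      have h2 : 1 ≤ (1 + w) ^ β := one_le_rpow (by linarith) hβ.le
      linarith
  set c : ℝ := max 1 (max (C1 * (2 ^ β * 2 ^ β)) (C2 * 4)) with hc
  have hc1 : 1 ≤ c := le_max_left _ _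
  have hcA : C1 * (2 ^ β * 2 ^ β) ≤ c := (le_max_left _ _).trans (le_max_right _ _)
  have hcB : C2 * 4 ≤ c := (le_max_right _ _).trans (le_max_right _ _)
  have hc0 : 0 < c := by linarith
  refine ⟨c, hc1, fun t ht x y hx hy => ?_⟩
  obtain ⟨ht0, htT⟩ := ht
  rw [hpt t ht0 htT x y hx hy, hkk t ht0 x y]
  obtain ⟨a1, a2⟩ := hW t ht0 x hx
  obtain ⟨b1, b2⟩ := hW t ht0 y hy
  have hx' := norm_pos_iff.2 hx
  have hy' := norm_pos_iff.2 hy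
  have hr := rd_pos (α := α) ht0
  have u1 := ENNReal.toReal_mono (by
    exact ENNReal.mul_ne_top ENNReal.coe_ne_top (ENNReal.mul_ne_top (ENNReal.mul_ne_top (hKfin t ht0 x y) ENNReal.ofReal_ne_top) ENNReal.ofReal_ne_top)) (H1 t ht0 htT x y hx hy)
  have u2 := ENNReal.toReal_mono (by
    exact ENNReal.mul_ne_top ENNReal.coe_ne_top (hPfin t ht0 htT x y hx hy)) (H2 t ht0 htT x y hx hy)
  have w1 : 0 ≤ (1 + rd α t / ‖x‖) ^ β := by positivity
  have w2 : 0 ≤ (1 + rd α t / ‖y‖) ^ β := by positivity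
  simp only [Wt, ENNReal.toReal_mul, ENNReal.coe_toReal, ENNReal.toReal_ofReal w1, ENNReal.toReal_ofReal w2] at u1 u2
  have hR : 0 ≤ (K t x y).toReal := ENNReal.toReal_nonneg
  have hPP : 0 ≤ (PP K q t x y).toReal := ENNReal.toReal_nonneg
  have hHx : 0 ≤ 1 + t ^ (β / α) * ‖x‖ ^ (-β) := by positivity
  have hHy : 0 ≤ 1 + t ^ (β / α) * ‖y‖ ^ (-β) := by positivity
  generalize (PP K q t x y).toReal = P at *
  generalize (K t x y).toReal = R at *
  generalize (1 + rd α t / ‖x‖) ^ β = W1 at *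
  generalize (1 + rd α t / ‖y‖) ^ β = W2 at *
  generalize 1 + t ^ (β / α) * ‖x‖ ^ (-β) = X at *
  generalize 1 + t ^ (β / α) * ‖y‖ ^ (-β) = Y at *
  have h2b : (0:ℝ) ≤ 2 ^ β := by positivity
  constructor
  · rw [inv_mul_le_iff₀ hc0]
    calc R * X * Y ≤ R * (2 * W1) * (2 * W2) :=
          mul_le_mul (mul_le_mul_of_nonneg_left a2 hR) b2 hHy (by positivity)
      _ = 4 * (R * W1 * W2) := by ring
      _ ≤ 4 * (C2 * P) := by linarith
      _ = (C2 * 4) * P := by ring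
      _ ≤ c * P := mul_le_mul_of_nonneg_right hcB hPP
  · calc P ≤ C1 * (R * W1 * W2) := u1
      _ ≤ C1 * (R * (2 ^ β * X) * (2 ^ β * Y)) := by
          refine mul_le_mul_of_nonneg_left ?_ C1.coe_nonneg
          exact mul_le_mul (mul_le_mul_of_nonneg_left a1 hR) b1 w2 (by positivity)
      _ = (C1 * (2 ^ β * 2 ^ β)) * (R * X * Y) := by ring
      _ ≤ c * (R * X * Y) := mul_le_mul_of_nonneg_right hcA (by positivity)

end P6

theorem stmt_0 (d : ℕ) (α δ : ℝ) (hα : α ∈ Ioo 0 (min 2 (d : ℝ)))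
    (hδ : δ ∈ Ioo 0 ((d : ℝ) - α)) (T : ℝ) (hT : 0 < T) :
    ∃ c : ℝ, 1 ≤ c ∧ ∀ t ∈ Ioc (0 : ℝ) T, ∀ x y : Ed d, x ≠ 0 → y ≠ 0 →
      c⁻¹ * (relKernel d α 1 t x y * Hzero d α δ t x * Hzero d α δ t y) ≤
          pert d (relKernel d α 1) (Vbeta d α δ) t x y ∧
        pert d (relKernel d α 1) (Vbeta d α δ) t x y ≤
          c * (relKernel d α 1 t x y * Hzero d α δ t x * Hzero d α δ t y) := by
  obtain ⟨hα0, hα1⟩ := hα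
  obtain ⟨hδ0, hδ1⟩ := hδ
  have hα2 : α < 2 := hα1.trans_le (min_le_left _ _)
  have hd : 0 < d := by
    have : (0:ℝ) < d := hα0.trans (hα1.trans_le (min_le_right _ _))
    exact_mod_cast this
  obtain ⟨η, e1, e2, e3⟩ := stable_exists (p := α / 2) (by linarith) (by linarith)
  have hS : SUB (α / 2) η := ⟨by linarith, by linarith, e1, e2, e3⟩
  by_cases hc : δ ≤ ((d:ℝ) - α) / 2
  · have := main_beta hS hd (δ := δ) (β := δ) hα0 hα2 hδ1 hδ0 hc le_rfl rfl hT
    simpa only [Hzero, if_pos hc] using this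
  · have := main_beta hS hd (δ := δ) (β := (d:ℝ) - α - δ) hα0 hα2 hδ1 (by linarith) (by linarith) (by linarith) kappa_symm hT
    simpa only [Hzero, if_neg hc] using this
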